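/- Interpolated L²-sup bound with L¹ tail (claim (3.8) in the proof of Lemma 3.2). Let v be a local weak solution of the homogeneous equation ∂_t v − div(𝒜(t,x,Dv)) + ℒv = 0 in Ω_T. Then for every R ∈ (0,1] and (t₀,x₀) with I_{2R}^⊖(t₀) × B_{2R}(x₀) compactly contained in I × Ω, and every δ ∈ (0,1], there exists C > 0 depending only on d, s, Λ such that ess sup_{Q_{R/2}(t₀,x₀)} |v| ≤ C δ^{−(d+2)/4} (⨍_{Q_R(t₀,x₀)} |v|² dx dt)^{1/2} + C ⨍_{I_R^⊖(t₀)} Tail(v(t); x₀, R) dt. -/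

import Mathlib

open MeasureTheory Set Filter Metric
open scoped ENNReal NNReal Topology RealInnerProductSpace

noncomputable section

/-- Euclidean space `ℝ^d`. -/
abbrev Ed (d : ℕ) : Type := EuclideanSpace ℝ (Fin d)

variable {d : ℕ}

/-- Backward time interval `I_r^⊖(t₀) = (t₀ - r², t₀)`. -/
def Iminus (t₀ r : ℝ) : Set ℝ := Set.Ioo (t₀ - r ^ 2) t₀

/-- Parabolic cylinder `Q_r(t₀,x₀) = I_r^⊖(t₀) × B_r(x₀)`. -/
def pCyl (t₀ : ℝ) (x₀ : Ed d) (r : ℝ) : Set (ℝ × Ed d) :=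
  (Iminus t₀ r) ×ˢ (Metric.ball x₀ r)

/-- Nonlocal tail `Tail(v; x₀, R) = R² ∫_{ℝ^d ∖ B_R(x₀)} |v(y)| |x₀ - y|^{-d-2s} dy`. -/
def Tail (s : ℝ) (v : Ed d → ℝ) (x₀ : Ed d) (R : ℝ) : ℝ :=
  R ^ 2 * ∫ y in (Metric.ball x₀ R)ᶜ, |v y| / ‖x₀ - y‖ ^ ((d : ℝ) + 2 * s)

/-- Caloric Riesz potential `ℐ^ν_α(t₀,x₀;R) = ∫₀^R ν(Q_ρ(t₀,x₀)) ρ^{-(d+2-α)} dρ/ρ`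
for a nonnegative measure `ν`. -/
def RieszPot (ν : Measure (ℝ × Ed d)) (α : ℝ) (t₀ : ℝ) (x₀ : Ed d) (R : ℝ) : ℝ :=
  ∫ ρ in Set.Ioo (0 : ℝ) R, (ν (pCyl t₀ x₀ ρ)).toReal / ρ ^ ((d : ℝ) + 2 - α) / ρ

/-- The structure conditions (1.2)-(1.3) on the vector field `𝒜`. -/
structure VectorFieldHyp (d : ℕ) (Λ : ℝ) (A : ℝ → Ed d → Ed d → Ed d) : Prop where
  meas : ∀ ξ : Ed d, Measurable fun p : ℝ × Ed d => A p.1 p.2 ξ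
  cont : ∀ t x, Continuous (A t x)
  growth : ∀ t x ξ, ‖A t x ξ‖ ≤ Λ * ‖ξ‖
  monotone : ∀ t x ξ η, Λ⁻¹ * ‖η - ξ‖ ^ 2 ≤ ⟪A t x η - A t x ξ, η - ξ⟫

/-- The ellipticity and symmetry conditions on the jump kernel `K`. -/
structure KernelHyp (d : ℕ) (s Λ : ℝ) (K : ℝ → Ed d → Ed d → ℝ) : Prop where
  meas : Measurable fun p : ℝ × Ed d × Ed d => K p.1 p.2.1 p.2.2
  symm : ∀ t x y, K t x y = K t y x
  lower : ∀ t x y, x ≠ y → Λ⁻¹ / ‖x - y‖ ^ ((d : ℝ) + 2 * s) ≤ K t x y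
  upper : ∀ t x y, x ≠ y → K t x y ≤ Λ / ‖x - y‖ ^ ((d : ℝ) + 2 * s)

/-- Membership of `v` (with weak spatial gradient `Dv`) in the function space
`L²_loc(J; W^{1,2}_loc(Ω)) ∩ L^∞_loc(J; L²_loc(Ω)) ∩ L²_loc(J; 𝓛¹_{2s}(ℝ^d))`. -/
structure LocalWeakReg (d : ℕ) (s : ℝ) (J : Set ℝ) (Ω : Set (Ed d))
    (v : ℝ → Ed d → ℝ) (Dv : ℝ → Ed d → Ed d) : Prop where
  meas : Measurable (Function.uncurry v)
  measD : Measurable (Function.uncurry Dv)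
  grad : ∀ t ∈ J, ∀ φ : Ed d → ℝ, ContDiff ℝ (⊤ : ℕ∞) φ → HasCompactSupport φ →
    tsupport φ ⊆ Ω → ∀ e : Ed d,
      ∫ x, v t x * (fderiv ℝ φ x) e = - ∫ x, φ x * ⟪Dv t x, e⟫
  l2w12 : ∀ t₁ t₂ : ℝ, Set.Icc t₁ t₂ ⊆ J → ∀ Kc : Set (Ed d), IsCompact Kc → Kc ⊆ Ω →
    MeasureTheory.IntegrableOn
      (fun p : ℝ × Ed d => (v p.1 p.2) ^ 2 + ‖Dv p.1 p.2‖ ^ 2) ((Set.Ioo t₁ t₂) ×ˢ Kc)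
  linfl2 : ∀ t₁ t₂ : ℝ, Set.Icc t₁ t₂ ⊆ J → ∀ Kc : Set (Ed d), IsCompact Kc → Kc ⊆ Ω →
    ∃ M : ℝ, ∀ᵐ t ∂(volume.restrict (Set.Ioo t₁ t₂)), (∫ x in Kc, (v t x) ^ 2) ≤ M
  tail_ae : ∀ᵐ t : ℝ, t ∈ J →
    MeasureTheory.Integrable fun y : Ed d => |v t y| / (1 + ‖y‖ ^ ((d : ℝ) + 2 * s))
  tail_l2 : ∀ t₁ t₂ : ℝ, Set.Icc t₁ t₂ ⊆ J →
    MeasureTheory.IntegrableOn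
      (fun t => (∫ y : Ed d, |v t y| / (1 + ‖y‖ ^ ((d : ℝ) + 2 * s))) ^ 2) (Set.Ioo t₁ t₂)

/-- Smooth test functions with compact spatial support contained in `Ω`. -/
def IsTestFunction (Ω : Set (Ed d)) (φ : ℝ → Ed d → ℝ) : Prop :=
  ContDiff ℝ (⊤ : ℕ∞) (Function.uncurry φ) ∧
    ∃ Kc : Set (Ed d), IsCompact Kc ∧ Kc ⊆ Ω ∧ ∀ t, tsupport (φ t) ⊆ Kc

/-- The left-hand side of the weak formulation of
`∂_t u - div(𝒜(t,x,Du)) + ℒu` tested against `φ` on `(t₁,t₂] × Ω`. -/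
def mixedLHS (A : ℝ → Ed d → Ed d → Ed d) (K : ℝ → Ed d → Ed d → ℝ)
    (Ω : Set (Ed d)) (u : ℝ → Ed d → ℝ) (Du : ℝ → Ed d → Ed d)
    (φ : ℝ → Ed d → ℝ) (t₁ t₂ : ℝ) : ℝ :=
  -(∫ t in Set.Ioc t₁ t₂, ∫ x in Ω, u t x * deriv (fun τ => φ τ x) t)
    + (∫ x in Ω, u t₂ x * φ t₂ x) - (∫ x in Ω, u t₁ x * φ t₁ x)
    + (∫ t in Set.Ioc t₁ t₂, ∫ x in Ω, ⟪A t x (Du t x), gradient (φ t) x⟫)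
    + ∫ t in Set.Ioc t₁ t₂, ∫ x : Ed d, ∫ y : Ed d,
        (u t x - u t y) * (φ t x - φ t y) * K t x y

/-- Integral of a function against a finite signed measure. -/
def signedIntegral (μ : MeasureTheory.SignedMeasure (ℝ × Ed d)) (f : ℝ × Ed d → ℝ) : ℝ :=
  (∫ p, f p ∂μ.toJordanDecomposition.posPart)
    - ∫ p, f p ∂μ.toJordanDecomposition.negPart

/-- Local weak solution of `∂_t u - div(𝒜(t,x,Du)) + ℒu = μ` in `J × Ω`. -/
def IsLocalWeakSolution (A : ℝ → Ed d → Ed d → Ed d) (K : ℝ → Ed d → Ed d → ℝ)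
    (J : Set ℝ) (Ω : Set (Ed d)) (μ : MeasureTheory.SignedMeasure (ℝ × Ed d))
    (u : ℝ → Ed d → ℝ) (Du : ℝ → Ed d → Ed d) : Prop :=
  ∀ t₁ t₂ : ℝ, t₁ ≤ t₂ → Set.Icc t₁ t₂ ⊆ J →
    ∀ φ : ℝ → Ed d → ℝ, IsTestFunction Ω φ →
      mixedLHS A K Ω u Du φ t₁ t₂ =
        signedIntegral μ (Set.indicator ((Set.Ioc t₁ t₂) ×ˢ Ω) fun p => φ p.1 p.2)

/-- Local weak solution of the homogeneous equation
`∂_t v - div(𝒜(t,x,Dv)) + ℒv = 0` in `J × Ω`. -/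
def IsLocalWeakSolutionHom (A : ℝ → Ed d → Ed d → Ed d) (K : ℝ → Ed d → Ed d → ℝ)
    (J : Set ℝ) (Ω : Set (Ed d))
    (v : ℝ → Ed d → ℝ) (Dv : ℝ → Ed d → Ed d) : Prop :=
  ∀ t₁ t₂ : ℝ, t₁ ≤ t₂ → Set.Icc t₁ t₂ ⊆ J →
    ∀ φ : ℝ → Ed d → ℝ, IsTestFunction Ω φ → mixedLHS A K Ω v Dv φ t₁ t₂ = 0

/-- Local weak subsolution of the homogeneous equation in `J × Ω`. -/
def IsLocalWeakSubsolutionHom (A : ℝ → Ed d → Ed d → Ed d) (K : ℝ → Ed d → Ed d → ℝ)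
    (J : Set ℝ) (Ω : Set (Ed d))
    (v : ℝ → Ed d → ℝ) (Dv : ℝ → Ed d → Ed d) : Prop :=
  ∀ t₁ t₂ : ℝ, t₁ ≤ t₂ → Set.Icc t₁ t₂ ⊆ J →
    ∀ φ : ℝ → Ed d → ℝ, IsTestFunction Ω φ → (∀ t x, 0 ≤ φ t x) →
      mixedLHS A K Ω v Dv φ t₁ t₂ ≤ 0

/-- Local weak supersolution of the homogeneous equation in `J × Ω`. -/
def IsLocalWeakSupersolutionHom (A : ℝ → Ed d → Ed d → Ed d) (K : ℝ → Ed d → Ed d → ℝ)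
    (J : Set ℝ) (Ω : Set (Ed d))
    (v : ℝ → Ed d → ℝ) (Dv : ℝ → Ed d → Ed d) : Prop :=
  ∀ t₁ t₂ : ℝ, t₁ ≤ t₂ → Set.Icc t₁ t₂ ⊆ J →
    ∀ φ : ℝ → Ed d → ℝ, IsTestFunction Ω φ → (∀ t x, φ t x ≤ 0) →
      mixedLHS A K Ω v Dv φ t₁ t₂ ≤ 0

/-- The global excess functional `E(u,t₀,x₀,R)`. -/
def Excess (s q : ℝ) (u : ℝ → Ed d → ℝ) (t₀ : ℝ) (x₀ : Ed d) (R : ℝ) : ℝ :=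
  (⨍ t in Iminus t₀ R, (⨍ x in Metric.ball x₀ R,
      |u t x - ⨍ p in pCyl t₀ x₀ R, u p.1 p.2|) ^ q) ^ (1 / q)
  + (⨍ t in Iminus t₀ R,
      (Tail s (fun y => u t y - ⨍ p in pCyl t₀ x₀ R, u p.1 p.2) x₀ R) ^ q) ^ (1 / q)

set_option linter.unusedSectionVars false
set_option linter.unusedSimpArgs false

open scoped Convolution

instance prodHaar (d : ℕ) : (volume : Measure (ℝ × Ed d)).IsAddHaarMeasure :=
  Measure.prod.instIsAddHaarMeasure volume volume

section SquareIntegrable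

variable {X : Type*} [MeasurableSpace X] {μ : Measure X}

lemma integrable_mul_of_memLp_two {f g : X → ℝ} (hf : MemLp f 2 μ) (hg : MemLp g 2 μ) :
    Integrable (fun x => f x * g x) μ := hf.integrable_mul hg

lemma abs_integral_mul_le_sqrt {f g : X → ℝ} (hf : MemLp f 2 μ) (hg : MemLp g 2 μ) :
    |∫ x, f x * g x ∂μ| ≤ √(∫ x, f x ^ 2 ∂μ) * √(∫ x, g x ^ 2 ∂μ) := by
  have h := integral_mul_le_Lp_mul_Lq_of_nonneg (μ := μ) (f := fun x => |f x|) (g := fun x => |g x|)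
    (p := 2) (q := 2) ⟨by norm_num, by norm_num, by norm_num⟩
    (ae_of_all _ fun x => abs_nonneg _) (ae_of_all _ fun x => abs_nonneg _)
    (by simpa using hf.norm) (by simpa using hg.norm)
  have h1 : |∫ x, f x * g x ∂μ| ≤ ∫ x, |f x| * |g x| ∂μ := by
    simpa [abs_mul] using abs_integral_le_integral_abs (μ := μ) (f := fun x => f x * g x)
  refine h1.trans (h.trans (le_of_eq ?_))
  simp [Real.sqrt_eq_rpow, sq_abs]

lemma integral_add_sq_le {f g : X → ℝ} (hf : MemLp f 2 μ) (hg : MemLp g 2 μ) :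
    ∫ x, (f x + g x) ^ 2 ∂μ ≤ 2 * ∫ x, f x ^ 2 ∂μ + 2 * ∫ x, g x ^ 2 ∂μ := by
  rw [← integral_const_mul, ← integral_const_mul,
    ← integral_add (hf.integrable_sq.const_mul 2) (hg.integrable_sq.const_mul 2)]
  refine integral_mono (hf.add hg).integrable_sq
    ((hf.integrable_sq.const_mul 2).add (hg.integrable_sq.const_mul 2)) fun x => ?_
  simp only
  nlinarith [sq_nonneg (f x - g x)]

/-- If `f n → f` and `g n → g` in `L²`, then `∫ f n * g n → ∫ f * g`. -/
lemma tendsto_integral_mul_of_sq {f g : ℕ → X → ℝ} {f₀ g₀ : X → ℝ}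
    (hf : ∀ n, MemLp (f n) 2 μ) (hg : ∀ n, MemLp (g n) 2 μ)
    (hf₀ : MemLp f₀ 2 μ) (hg₀ : MemLp g₀ 2 μ)
    (hfl : Tendsto (fun n => ∫ x, (f n x - f₀ x) ^ 2 ∂μ) atTop (𝓝 0))
    (hgl : Tendsto (fun n => ∫ x, (g n x - g₀ x) ^ 2 ∂μ) atTop (𝓝 0)) :
    Tendsto (fun n => ∫ x, f n x * g n x ∂μ) atTop (𝓝 (∫ x, f₀ x * g₀ x ∂μ)) := by
  rw [tendsto_iff_norm_sub_tendsto_zero]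
  have hfl' := (Real.continuous_sqrt.tendsto 0).comp hfl
  have hgl' := (Real.continuous_sqrt.tendsto 0).comp hgl
  simp only [Real.sqrt_zero] at hfl' hgl'
  have hlim : Tendsto (fun n => √(∫ x, (f n x - f₀ x) ^ 2 ∂μ) * √(∫ x, (g n x - g₀ x) ^ 2 ∂μ)
      + √(∫ x, (f n x - f₀ x) ^ 2 ∂μ) * √(∫ x, g₀ x ^ 2 ∂μ)
      + √(∫ x, f₀ x ^ 2 ∂μ) * √(∫ x, (g n x - g₀ x) ^ 2 ∂μ)) atTop (𝓝 0) := by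
    simpa using ((hfl'.mul hgl').add (hfl'.mul_const _)).add (hgl'.const_mul (√(∫ x, f₀ x ^ 2 ∂μ)))
  refine squeeze_zero (fun n => norm_nonneg _) (fun n => ?_) hlim
  have d1 : MemLp (fun x => f n x - f₀ x) 2 μ := (hf n).sub hf₀
  have d2 : MemLp (fun x => g n x - g₀ x) 2 μ := (hg n).sub hg₀
  have d3 : Integrable (fun x => (f n x - f₀ x) * (g n x - g₀ x) + (f n x - f₀ x) * g₀ x) μ :=
    (integrable_mul_of_memLp_two d1 d2).add (integrable_mul_of_memLp_two d1 hg₀)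
  have e : ∫ x, f n x * g n x ∂μ - ∫ x, f₀ x * g₀ x ∂μ
      = ∫ x, (f n x - f₀ x) * (g n x - g₀ x) ∂μ + ∫ x, (f n x - f₀ x) * g₀ x ∂μ
        + ∫ x, f₀ x * (g n x - g₀ x) ∂μ := by
    rw [← integral_sub (integrable_mul_of_memLp_two (hf n) (hg n))
      (integrable_mul_of_memLp_two hf₀ hg₀), ← integral_add
      (integrable_mul_of_memLp_two d1 d2) (integrable_mul_of_memLp_two d1 hg₀),
      ← integral_add d3 (integrable_mul_of_memLp_two hf₀ d2)]
    congr 1; ext x; ring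
  rw [e, Real.norm_eq_abs]
  exact (abs_add_le _ _).trans (add_le_add ((abs_add_le _ _).trans (add_le_add
    (abs_integral_mul_le_sqrt d1 d2) (abs_integral_mul_le_sqrt d1 hg₀)))
    (abs_integral_mul_le_sqrt hf₀ d2))

/-- Generalised dominated convergence: `0 ≤ F n ≤ G n`, `F n → 0` and `G n → G` almost everywhere,
and `∫ G n → ∫ G` imply `∫ F n → 0`. -/
lemma tendsto_integral_zero_of_dominated_tendsto {F G : ℕ → X → ℝ} {G₀ : X → ℝ}
    (hF : ∀ n, Integrable (F n) μ) (hG : ∀ n, Integrable (G n) μ) (hG₀ : Integrable G₀ μ)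
    (hF0 : ∀ n x, 0 ≤ F n x) (hFG : ∀ n x, F n x ≤ G n x)
    (hFl : ∀ᵐ x ∂μ, Tendsto (fun n => F n x) atTop (𝓝 0))
    (hGl : ∀ᵐ x ∂μ, Tendsto (fun n => G n x) atTop (𝓝 (G₀ x)))
    (hGi : Tendsto (fun n => ∫ x, G n x ∂μ) atTop (𝓝 (∫ x, G₀ x ∂μ))) :
    Tendsto (fun n => ∫ x, F n x ∂μ) atTop (𝓝 0) := by
  have hG0 : 0 ≤ᵐ[μ] G₀ := by
    filter_upwards [hGl] with x hx
    exact ge_of_tendsto' hx fun n => (hF0 n x).trans (hFG n x)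
  have key : Tendsto (fun n => ∫ x, min (G n x - F n x) (G₀ x) ∂μ) atTop (𝓝 (∫ x, G₀ x ∂μ)) := by
    refine tendsto_integral_of_dominated_convergence G₀
      (fun n => (((hG n).sub (hF n)).inf hG₀).aestronglyMeasurable) hG₀ (fun n => ?_) ?_
    · filter_upwards [hG0] with x hx
      rw [Real.norm_of_nonneg (le_min (sub_nonneg.2 (hFG n x)) hx)]
      exact min_le_right _ _
    · filter_upwards [hFl, hGl] with x h1 h2
      simpa using (h2.sub h1).min (tendsto_const_nhds (x := G₀ x))
  refine squeeze_zero (fun n => integral_nonneg (hF0 n)) (fun n => ?_)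
    (g := fun n => ∫ x, G n x ∂μ - ∫ x, min (G n x - F n x) (G₀ x) ∂μ) (by simpa using hGi.sub key)
  have hmin : Integrable (fun x => min (G n x - F n x) (G₀ x)) μ := ((hG n).sub (hF n)).inf hG₀
  rw [← integral_sub (hG n) hmin]
  refine integral_mono (hF n) ((hG n).sub hmin) fun x => ?_
  have := min_le_left (G n x - F n x) (G₀ x)
  simp only; linarith

end SquareIntegrable

section Mollify

variable {G : Type*} [NormedAddCommGroup G] [NormedSpace ℝ G] [FiniteDimensional ℝ G]
  [MeasurableSpace G] [BorelSpace G] {μ : Measure G} [μ.IsAddHaarMeasure]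

/-- A sequence of bump functions at the origin with radii tending to zero. -/
def bumpSeq (G : Type*) [NormedAddCommGroup G] [NormedSpace ℝ G] (n : ℕ) :
    ContDiffBump (0 : G) :=
  ⟨1 / ((n : ℝ) + 1), 2 / ((n : ℝ) + 1), by positivity, by gcongr; norm_num⟩

/-- The standard mollifier. -/
def molKernel (μ : Measure G) (n : ℕ) : G → ℝ := (bumpSeq G n).normed μ

/-- Mollification of `f` at scale `2 / (n + 1)`. -/
def mollify (μ : Measure G) (n : ℕ) (f : G → ℝ) : G → ℝ :=
  molKernel μ n ⋆[ContinuousLinearMap.lsmul ℝ ℝ, μ] f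

lemma mollify_apply (n : ℕ) (f : G → ℝ) (x : G) :
    mollify μ n f x = ∫ y, molKernel μ n y * f (x - y) ∂μ := by
  simp [mollify, convolution_def]

lemma molKernel_nonneg (n : ℕ) (x : G) : 0 ≤ molKernel μ n x := (bumpSeq G n).nonneg_normed x

lemma molKernel_contDiff (n : ℕ) : ContDiff ℝ (⊤ : ℕ∞) (molKernel μ n : G → ℝ) :=
  (bumpSeq G n).contDiff_normed

lemma molKernel_hasCompactSupport (n : ℕ) : HasCompactSupport (molKernel μ n : G → ℝ) :=
  (bumpSeq G n).hasCompactSupport_normed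

lemma molKernel_integral (n : ℕ) : ∫ x, molKernel μ n x ∂μ = 1 := (bumpSeq G n).integral_normed

lemma molKernel_neg (n : ℕ) (x : G) : molKernel μ n (-x) = molKernel μ n x :=
  (bumpSeq G n).normed_neg x

lemma mollify_integrand_integrable (n : ℕ) {f : G → ℝ} (hf : LocallyIntegrable f μ) (x : G) :
    Integrable (fun y => molKernel μ n y * f (x - y)) μ := by
  have := (molKernel_hasCompactSupport (μ := μ) n).convolutionExists_left
    (ContinuousLinearMap.lsmul ℝ ℝ) (molKernel_contDiff (μ := μ) n).continuous hf x
  simpa [ConvolutionExistsAt] using this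

lemma mollify_contDiff (n : ℕ) {f : G → ℝ} (hf : LocallyIntegrable f μ) :
    ContDiff ℝ (⊤ : ℕ∞) (mollify μ n f) :=
  (molKernel_hasCompactSupport n).contDiff_convolution_left _ (molKernel_contDiff n) hf

lemma mollify_ae_tendsto {f : G → ℝ} (hf : LocallyIntegrable f μ) :
    ∀ᵐ x ∂μ, Tendsto (fun n => mollify μ n f x) atTop (𝓝 (f x)) := by
  refine ContDiffBump.ae_convolution_tendsto_right_of_locallyIntegrable (K := 2)
    (φ := bumpSeq G) ?_ ?_ hf
  · simpa [bumpSeq] using (tendsto_one_div_add_atTop_nhds_zero_nat (𝕜 := ℝ)).const_mul 2 |>.congr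
      (fun n => by ring)
  · exact Eventually.of_forall fun n => by simp only [bumpSeq]; ring_nf; rfl

lemma mollify_integral (n : ℕ) {f : G → ℝ} (hf : Integrable f μ) :
    ∫ x, mollify μ n f x ∂μ = ∫ x, f x ∂μ := by
  have := integral_convolution (μ := μ) (ν := μ) (ContinuousLinearMap.lsmul ℝ ℝ)
    (bumpSeq G n).integrable_normed hf
  rw [mollify, molKernel, this, (bumpSeq G n).integral_normed]; simp

lemma mollify_integrable (n : ℕ) {f : G → ℝ} (hf : Integrable f μ) :
    Integrable (mollify μ n f) μ :=
  (bumpSeq G n).integrable_normed.integrable_convolution (ContinuousLinearMap.lsmul ℝ ℝ) hf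

lemma locallyIntegrable_of_memLp_two {f : G → ℝ} (hf : MemLp f 2 μ) : LocallyIntegrable f μ :=
  hf.locallyIntegrable (by norm_num)

lemma mollify_sq_le (n : ℕ) {f : G → ℝ} (hf : MemLp f 2 μ) (x : G) :
    mollify μ n f x ^ 2 ≤ mollify μ n (fun y => f y ^ 2) x := by
  have i1 := mollify_integrand_integrable n (locallyIntegrable_of_memLp_two hf) x
  have i2 := mollify_integrand_integrable n hf.integrable_sq.locallyIntegrable x
  have i3 : Integrable (molKernel μ n : G → ℝ) μ := (bumpSeq G n).integrable_normed
  set m := mollify μ n f x with hm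
  have h0 : 0 ≤ ∫ y, molKernel μ n y * (f (x - y) - m) ^ 2 ∂μ :=
    integral_nonneg fun y => mul_nonneg (molKernel_nonneg n y) (sq_nonneg _)
  have e : ∫ y, molKernel μ n y * (f (x - y) - m) ^ 2 ∂μ =
      mollify μ n (fun y => f y ^ 2) x - 2 * m * m + m ^ 2 := by
    have : (fun y => molKernel μ n y * (f (x - y) - m) ^ 2) = fun y =>
        (molKernel μ n y * f (x - y) ^ 2 - 2 * m * (molKernel μ n y * f (x - y)))
          + m ^ 2 * molKernel μ n y := by ext y; ring
    have i4 : Integrable (fun y => molKernel μ n y * f (x - y) ^ 2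
        - 2 * m * (molKernel μ n y * f (x - y))) μ := i2.sub (i1.const_mul _)
    rw [this, integral_add i4 (i3.const_mul _),
      integral_sub i2 (i1.const_mul _), integral_const_mul, integral_const_mul,
      molKernel_integral, ← mollify_apply, mollify_apply n (fun y => f y ^ 2), hm]
    ring
  nlinarith

lemma mollify_memLp (n : ℕ) {f : G → ℝ} (hf : MemLp f 2 μ) : MemLp (mollify μ n f) 2 μ := by
  have hm : AEStronglyMeasurable (mollify μ n f) μ :=
    (mollify_contDiff n (locallyIntegrable_of_memLp_two hf)).continuous.aestronglyMeasurable
  refine (memLp_two_iff_integrable_sq hm).2 ((mollify_integrable n hf.integrable_sq).mono'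
    (hm.pow 2) (ae_of_all _ fun x => ?_))
  rw [Real.norm_of_nonneg (sq_nonneg _)]
  exact mollify_sq_le n hf x

lemma integral_mollify_sq_le (n : ℕ) {f : G → ℝ} (hf : MemLp f 2 μ) :
    ∫ x, mollify μ n f x ^ 2 ∂μ ≤ ∫ x, f x ^ 2 ∂μ := by
  rw [← mollify_integral n hf.integrable_sq]
  exact integral_mono (mollify_memLp n hf).integrable_sq (mollify_integrable n hf.integrable_sq)
    fun x => mollify_sq_le n hf x

/-- Mollifications converge in `L²`. -/
lemma mollify_tendsto {f : G → ℝ} (hf : MemLp f 2 μ) :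
    Tendsto (fun n => ∫ x, (mollify μ n f x - f x) ^ 2 ∂μ) atTop (𝓝 0) := by
  have hs := hf.integrable_sq
  refine tendsto_integral_zero_of_dominated_tendsto
    (G := fun n x => 2 * mollify μ n (fun y => f y ^ 2) x + 2 * f x ^ 2)
    (G₀ := fun x => 2 * f x ^ 2 + 2 * f x ^ 2)
    (fun n => ((mollify_memLp n hf).sub hf).integrable_sq)
    (fun n => ((mollify_integrable n hs).const_mul 2).add (hs.const_mul 2))
    ((hs.const_mul 2).add (hs.const_mul 2)) (fun n x => sq_nonneg _) (fun n x => ?_) ?_ ?_ ?_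
  · nlinarith [mollify_sq_le n hf x, sq_nonneg (mollify μ n f x + f x)]
  · filter_upwards [mollify_ae_tendsto (locallyIntegrable_of_memLp_two hf)] with x hx
    simpa using (hx.sub_const (f x)).pow 2
  · filter_upwards [mollify_ae_tendsto hs.locallyIntegrable] with x hx
    exact (hx.const_mul 2).add_const _
  · refine tendsto_const_nhds.congr fun n => ?_
    rw [integral_add (hs.const_mul 2) (hs.const_mul 2), integral_add
      ((mollify_integrable n hs).const_mul 2) (hs.const_mul 2), integral_const_mul,
      integral_const_mul, mollify_integral n hs]

end Mollify

section MollifyMore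

variable {G : Type*} [NormedAddCommGroup G] [NormedSpace ℝ G] [FiniteDimensional ℝ G]
  [MeasurableSpace G] [BorelSpace G] {μ : Measure G} [μ.IsAddHaarMeasure]

lemma mollify_sub (n : ℕ) {f g : G → ℝ} (hf : LocallyIntegrable f μ)
    (hg : LocallyIntegrable g μ) (x : G) :
    mollify μ n (fun y => f y - g y) x = mollify μ n f x - mollify μ n g x := by
  rw [mollify_apply, mollify_apply, mollify_apply, ← integral_sub
    (mollify_integrand_integrable n hf x) (mollify_integrand_integrable n hg x)]
  congr 1; ext y; ring

lemma mollify_comp_add (n : ℕ) (f : G → ℝ) (h x : G) :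
    mollify μ n (fun y => f (y + h)) x = mollify μ n f (x + h) := by
  rw [mollify_apply, mollify_apply]
  congr 1; ext y; rw [sub_add_eq_add_sub]

lemma memLp_two_comp_add {f : G → ℝ} (hf : MemLp f 2 μ) (h : G) :
    MemLp (fun x => f (x + h)) 2 μ :=
  hf.comp_measurePreserving (measurePreserving_add_right μ h)

lemma mollify_mul_integrable_prod (n : ℕ) {f g : G → ℝ} (hf : MemLp f 2 μ) (hg : MemLp g 2 μ) :
    Integrable (fun p : G × G => molKernel μ n p.2 * f (p.1 - p.2) * g p.1) (μ.prod μ) := by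
  have hk : Integrable (molKernel μ n : G → ℝ) μ := (bumpSeq G n).integrable_normed
  have hm : AEStronglyMeasurable
      (fun p : G × G => molKernel μ n p.2 * f (p.1 - p.2) * g p.1) (μ.prod μ) := by
    refine (AEStronglyMeasurable.mul ?_ ?_).mul hg.1.comp_fst
    · exact hk.1.comp_snd
    · exact hf.1.comp_quasiMeasurePreserving (quasiMeasurePreserving_sub_of_right_invariant μ μ)
  have hc : ∀ y, MemLp (fun x => f (x - y)) 2 μ := fun y => by
    simpa [sub_eq_add_neg] using memLp_two_comp_add hf (-y)
  refine (integrable_prod_iff' hm).2 ⟨ae_of_all _ fun y => ?_, ?_⟩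
  · simpa [mul_assoc] using (integrable_mul_of_memLp_two (hc y) hg).const_mul (molKernel μ n y)
  · refine (hk.mul_const (√(∫ x, f x ^ 2 ∂μ) * √(∫ x, g x ^ 2 ∂μ))).mono'
      hm.norm.prod_swap.integral_prod_right' (ae_of_all _ fun y => ?_)
    have h1 := abs_integral_mul_le_sqrt (hc y).norm hg.norm
    have h2 : ∫ x, f (x - y) ^ 2 ∂μ = ∫ x, f x ^ 2 ∂μ := by
      simpa [sub_eq_add_neg] using integral_add_right_eq_self (μ := μ) (fun x => f x ^ 2) (-y)
    simp only [Real.norm_eq_abs, sq_abs, h2] at h1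
    simp only [norm_mul, Real.norm_eq_abs, abs_of_nonneg (molKernel_nonneg (μ := μ) n y), mul_assoc]
    rw [integral_const_mul, abs_mul, abs_of_nonneg (molKernel_nonneg (μ := μ) n y)]
    exact mul_le_mul_of_nonneg_left h1 (molKernel_nonneg n y)

/-- Mollification is symmetric in `L²`. -/
lemma integral_mollify_mul (n : ℕ) {f g : G → ℝ} (hf : MemLp f 2 μ) (hg : MemLp g 2 μ) :
    ∫ x, mollify μ n f x * g x ∂μ = ∫ x, f x * mollify μ n g x ∂μ := by
  have key : ∀ {f g : G → ℝ}, MemLp f 2 μ → MemLp g 2 μ → ∫ x, mollify μ n f x * g x ∂μ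
      = ∫ y, molKernel μ n y * ∫ x, f (x - y) * g x ∂μ ∂μ := by
    intro f g hf hg
    have h1 : ∀ x, mollify μ n f x * g x = ∫ y, molKernel μ n y * f (x - y) * g x ∂μ := fun x => by
      rw [mollify_apply, integral_mul_const]
    simp_rw [h1]
    rw [integral_integral_swap (mollify_mul_integrable_prod n hf hg)]
    refine integral_congr_ae (ae_of_all _ fun y => ?_)
    simp only [mul_assoc]
    rw [integral_const_mul]
  rw [key hf hg]
  have e : ∫ x, f x * mollify μ n g x ∂μ = ∫ x, mollify μ n g x * f x ∂μ := by
    simp_rw [mul_comm]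
  rw [e, key hg hf, ← integral_neg_eq_self]
  refine integral_congr_ae (ae_of_all _ fun y => ?_)
  simp only
  rw [molKernel_neg]
  congr 1
  rw [← integral_add_right_eq_self _ (-y)]
  refine integral_congr_ae (ae_of_all _ fun x => ?_)
  simp only
  rw [sub_neg_eq_add, neg_add_cancel_right, ← sub_eq_add_neg, mul_comm]

lemma integral_mul_fderiv_eq_neg_fderiv_mul_of_contDiff {u ψ : G → ℝ} (hu : ContDiff ℝ 1 u)
    (hψ : ContDiff ℝ 1 ψ) (hs : HasCompactSupport ψ) (e : G) :
    ∫ x, u x * fderiv ℝ ψ x e ∂μ = - ∫ x, fderiv ℝ u x e * ψ x ∂μ := by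
  have cu : Continuous fun x => fderiv ℝ u x e :=
    (hu.continuous_fderiv one_ne_zero).clm_apply continuous_const
  have cψ : Continuous fun x => fderiv ℝ ψ x e :=
    (hψ.continuous_fderiv one_ne_zero).clm_apply continuous_const
  have hs' : HasCompactSupport (fun x => fderiv ℝ ψ x e) := hs.fderiv_apply (𝕜 := ℝ) e
  refine integral_mul_fderiv_eq_neg_fderiv_mul_of_integrable ?_ ?_ ?_
    (fun x _ => hu.differentiable one_ne_zero x) (fun x _ => hψ.differentiable one_ne_zero x)
  · exact (cu.mul hψ.continuous).integrable_of_hasCompactSupport hs.mul_left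
  · exact (hu.continuous.mul cψ).integrable_of_hasCompactSupport hs'.mul_left
  · exact (hu.continuous.mul hψ.continuous).integrable_of_hasCompactSupport hs.mul_left

lemma fderiv_convolution_eq_integral {k u : G → ℝ} (hk : ContDiff ℝ 1 k) (hks : HasCompactSupport k)
    (hu : LocallyIntegrable u μ) (e x : G) :
    fderiv ℝ (k ⋆[ContinuousLinearMap.lsmul ℝ ℝ, μ] u) x e = ∫ y, fderiv ℝ k y e * u (x - y) ∂μ := by
  have hd := (hks.hasFDerivAt_convolution_left (ContinuousLinearMap.lsmul ℝ ℝ) hk hu x).fderiv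
  have hconv : ConvolutionExistsAt (fderiv ℝ k) u x (ContinuousLinearMap.precompL G
      (ContinuousLinearMap.lsmul ℝ ℝ)) μ :=
    HasCompactSupport.convolutionExists_left _ (hks.fderiv (𝕜 := ℝ))
      (hk.continuous_fderiv one_ne_zero) hu x
  rw [hd, convolution_def, ContinuousLinearMap.integral_apply hconv]
  simp only [ContinuousLinearMap.precompL_apply, ContinuousLinearMap.lsmul_apply, smul_eq_mul]

/-- Derivatives of mollifications are mollifications of weak derivatives. -/
lemma fderiv_mollify (n : ℕ) {u w : G → ℝ} (hu : LocallyIntegrable u μ) {e : G}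
    (hw : ∀ φ : G → ℝ, ContDiff ℝ (⊤ : ℕ∞) φ → HasCompactSupport φ →
      ∫ x, u x * fderiv ℝ φ x e ∂μ = - ∫ x, w x * φ x ∂μ) (x : G) :
    fderiv ℝ (mollify μ n u) x e = mollify μ n w x := by
  have hk := molKernel_contDiff (G := G) (μ := μ) n
  have hk1 : ContDiff ℝ 1 (molKernel μ n : G → ℝ) := hk.of_le (by exact_mod_cast le_top)
  have hdk : Differentiable ℝ (molKernel μ n : G → ℝ) := hk.differentiable (by simp)
  have h2 := hw (fun z => molKernel μ n (x - z)) (hk.comp (contDiff_const.sub contDiff_id))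
    ((molKernel_hasCompactSupport n).comp_homeomorph (Homeomorph.subLeft x))
  have h3 : ∀ z, fderiv ℝ (fun z => molKernel μ n (x - z)) z e
      = - fderiv ℝ (molKernel μ n) (x - z) e := fun z => by
    have h := ((hdk (x - z)).hasFDerivAt.comp z ((hasFDerivAt_id z).const_sub x)).fderiv
    have h' : fderiv ℝ (fun z => molKernel μ n (x - z)) z = _ := h
    rw [h']; simp
  have h4 : ∫ z, u z * fderiv ℝ (molKernel μ n) (x - z) e ∂μ = ∫ z, w z * molKernel μ n (x - z) ∂μ
      := by
    have h5 : ∫ z, u z * fderiv ℝ (molKernel μ n) (x - z) e ∂μ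
        = -∫ z, u z * fderiv ℝ (fun z => molKernel μ n (x - z)) z e ∂μ := by
      rw [← integral_neg]; congr 1; ext z; rw [h3]; ring
    rw [h5, h2, neg_neg]
  rw [mollify_apply, mollify,
    fderiv_convolution_eq_integral hk1 (molKernel_hasCompactSupport n) hu,
    ← integral_sub_left_eq_self (fun y => fderiv ℝ (molKernel μ n) y e * u (x - y)) μ x,
    ← integral_sub_left_eq_self (fun y => molKernel μ n y * w (x - y)) μ x]
  simp only [sub_sub_cancel]
  simp_rw [mul_comm _ (u _), h4, mul_comm]

lemma fderiv_mollify_of_contDiff (n : ℕ) {ψ : G → ℝ} (hψ : ContDiff ℝ 1 ψ) (e x : G) :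
    fderiv ℝ (mollify μ n ψ) x e = mollify μ n (fun z => fderiv ℝ ψ z e) x :=
  fderiv_mollify n hψ.continuous.locallyIntegrable (fun φ hφ hφs =>
    integral_mul_fderiv_eq_neg_fderiv_mul_of_contDiff hψ (hφ.of_le (by exact_mod_cast le_top))
      hφs e) x

lemma mollify_hasCompactSupport (n : ℕ) {ψ : G → ℝ} (hs : HasCompactSupport ψ) :
    HasCompactSupport (mollify μ n ψ) :=
  (molKernel_hasCompactSupport n).convolution _ hs

/-- The mollifications of functions supported in a fixed compact subset of an open set are
eventually supported in the open set. -/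
lemma eventually_tsupport_mollify_subset {K P : Set G} (hK : IsCompact K) (hP : IsOpen P)
    (hKP : K ⊆ P) : ∀ᶠ n in atTop, ∀ ψ : G → ℝ, tsupport ψ ⊆ K →
      tsupport (mollify μ n ψ) ⊆ P := by
  obtain ⟨δ, hδ, hδP⟩ := hK.exists_cthickening_subset_open hP hKP
  have h0 : Tendsto (fun n : ℕ => 2 / ((n : ℝ) + 1)) atTop (𝓝 0) := by
    simpa using (tendsto_one_div_add_atTop_nhds_zero_nat (𝕜 := ℝ)).const_mul 2 |>.congr
      (fun n => by ring)
  filter_upwards [h0.eventually (gt_mem_nhds hδ)] with n hn ψ hψ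
  refine (closure_minimal ?_ isClosed_cthickening).trans hδP
  refine (support_convolution_subset_swap _).trans ?_
  rintro _ ⟨b, hb, a, ha, rfl⟩
  rw [molKernel, ContDiffBump.support_normed_eq, mem_ball_zero_iff] at ha
  refine mem_cthickening_of_dist_le _ b δ K (hψ (subset_tsupport _ hb)) ?_
  simp only [dist_eq_norm, add_sub_cancel_left]
  exact (ha.trans hn).le

lemma mollify_tendsto_of_tendsto {f : ℕ → G → ℝ} {f₀ : G → ℝ} (hf : ∀ n, MemLp (f n) 2 μ)
    (hf₀ : MemLp f₀ 2 μ)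
    (h : Tendsto (fun n => ∫ x, (f n x - f₀ x) ^ 2 ∂μ) atTop (𝓝 0)) :
    Tendsto (fun n => ∫ x, (mollify μ n (f n) x - f₀ x) ^ 2 ∂μ) atTop (𝓝 0) := by
  have hlim := (h.const_mul 2).add ((mollify_tendsto hf₀).const_mul 2)
  simp only [mul_zero, add_zero] at hlim
  refine squeeze_zero (fun n => integral_nonneg fun x => sq_nonneg _) (fun n => ?_) hlim
  have d : MemLp (fun x => f n x - f₀ x) 2 μ := (hf n).sub hf₀
  have e : ∀ x, mollify μ n (f n) x - f₀ x
      = mollify μ n (fun x => f n x - f₀ x) x + (mollify μ n f₀ x - f₀ x) := fun x => by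
    rw [mollify_sub n (locallyIntegrable_of_memLp_two (hf n)) (locallyIntegrable_of_memLp_two hf₀)]
    ring
  simp_rw [e]
  refine (integral_add_sq_le (mollify_memLp n d) ((mollify_memLp n hf₀).sub hf₀)).trans ?_
  have := integral_mollify_sq_le n d
  simp only [Pi.sub_apply]
  linarith

end MollifyMore

section Difference

variable {G : Type*} [NormedAddCommGroup G] [NormedSpace ℝ G] [FiniteDimensional ℝ G]
  [MeasurableSpace G] [BorelSpace G] {μ : Measure G} [μ.IsAddHaarMeasure]

lemma memLp_two_diff {u : G → ℝ} (hu : MemLp u 2 μ) (k : G) :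
    MemLp (fun z => u (z + k) - u z) 2 μ := (memLp_two_comp_add hu k).sub hu

lemma integral_diff_sq_le_four {u : G → ℝ} (hu : MemLp u 2 μ) (k : G) :
    ∫ z, (u (z + k) - u z) ^ 2 ∂μ ≤ 4 * ∫ z, u z ^ 2 ∂μ := by
  have h := integral_add_sq_le (memLp_two_comp_add hu k) hu.neg
  have e : ∫ z, u (z + k) ^ 2 ∂μ = ∫ z, u z ^ 2 ∂μ :=
    integral_add_right_eq_self (fun z => u z ^ 2) k
  simp only [Pi.neg_apply, ← sub_eq_add_neg, neg_sq, e] at h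
  linarith

lemma sq_sub_le_integral_fderiv_sq {u : G → ℝ} (hu : ContDiff ℝ 1 u) (k z : G) :
    (u (z + k) - u z) ^ 2 ≤ ∫ t in (0 : ℝ)..1, fderiv ℝ u (z + t • k) k ^ 2 := by
  have hd : ∀ t : ℝ, HasDerivAt (fun t : ℝ => u (z + t • k)) (fderiv ℝ u (z + t • k) k) t := by
    intro t
    have h1 : HasDerivAt (fun t : ℝ => z + t • k) k t := by
      simpa using ((hasDerivAt_id t).smul_const k).const_add z
    exact ((hu.differentiable one_ne_zero) _).hasFDerivAt.comp_hasDerivAt t h1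
  have hc : Continuous fun t : ℝ => fderiv ℝ u (z + t • k) k :=
    ((hu.continuous_fderiv one_ne_zero).comp (by fun_prop)).clm_apply continuous_const
  have hi := intervalIntegral.integral_eq_sub_of_hasDerivAt (a := 0) (b := 1)
    (fun t _ => hd t) (hc.intervalIntegrable _ _)
  simp only [one_smul, zero_smul, add_zero] at hi
  set m := u (z + k) - u z with hm
  have h0 : 0 ≤ ∫ t in (0 : ℝ)..1, (fderiv ℝ u (z + t • k) k - m) ^ 2 :=
    intervalIntegral.integral_nonneg (by norm_num) fun t _ => sq_nonneg _
  have e : ∫ t in (0 : ℝ)..1, (fderiv ℝ u (z + t • k) k - m) ^ 2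
      = (∫ t in (0 : ℝ)..1, fderiv ℝ u (z + t • k) k ^ 2) - 2 * m * m + m ^ 2 := by
    have : (fun t : ℝ => (fderiv ℝ u (z + t • k) k - m) ^ 2) = fun t =>
        (fderiv ℝ u (z + t • k) k ^ 2 - 2 * m * fderiv ℝ u (z + t • k) k) + m ^ 2 := by
      ext t; ring
    rw [this, intervalIntegral.integral_add, intervalIntegral.integral_sub,
      intervalIntegral.integral_const_mul, hi]
    · simp
    · exact (hc.pow 2).intervalIntegrable _ _
    · exact (hc.const_mul _).intervalIntegrable _ _
    · exact ((hc.pow 2).sub (hc.const_mul _)).intervalIntegrable _ _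
    · exact continuous_const.intervalIntegrable _ _
  nlinarith

/-- The `L²` difference quotient bound for weakly differentiable functions. -/
lemma integral_diff_sq_le_of_weakDeriv {u w : G → ℝ} (hu : MemLp u 2 μ) (hw : MemLp w 2 μ) {k : G}
    (hd : ∀ φ : G → ℝ, ContDiff ℝ (⊤ : ℕ∞) φ → HasCompactSupport φ →
      ∫ x, u x * fderiv ℝ φ x k ∂μ = - ∫ x, w x * φ x ∂μ) :
    ∫ z, (u (z + k) - u z) ^ 2 ∂μ ≤ ∫ z, w z ^ 2 ∂μ := by
  have hul := locallyIntegrable_of_memLp_two hu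
  have hdiff : ∀ n z, mollify μ n (fun z => u (z + k) - u z) z
      = mollify μ n u (z + k) - mollify μ n u z := fun n z => by
    rw [mollify_sub n (locallyIntegrable_of_memLp_two (memLp_two_comp_add hu k)) hul,
      mollify_comp_add]
  have step : ∀ n, ∫ z, (mollify μ n (fun z => u (z + k) - u z) z) ^ 2 ∂μ ≤ ∫ z, w z ^ 2 ∂μ := by
    intro n
    have hc := mollify_contDiff n hul
    have hwn := mollify_memLp n hw
    have hwc : Continuous (mollify μ n w) :=
      (mollify_contDiff n (locallyIntegrable_of_memLp_two hw)).continuous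
    have hpt : ∀ z, (mollify μ n (fun z => u (z + k) - u z) z) ^ 2
        ≤ ∫ t in Ioc (0 : ℝ) 1, mollify μ n w (z + t • k) ^ 2 := fun z => by
      rw [hdiff, ← intervalIntegral.integral_of_le zero_le_one]
      refine (sq_sub_le_integral_fderiv_sq (hc.of_le (by exact_mod_cast le_top)) k z).trans
        (le_of_eq ?_)
      simp_rw [fderiv_mollify n hul hd]
    have hintg : Integrable (fun p : ℝ × G => mollify μ n w (p.2 + p.1 • k) ^ 2)
        ((volume.restrict (Ioc (0 : ℝ) 1)).prod μ) := by
      have hm : AEStronglyMeasurable (fun p : ℝ × G => mollify μ n w (p.2 + p.1 • k) ^ 2)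
          ((volume.restrict (Ioc (0 : ℝ) 1)).prod μ) :=
        ((hwc.comp (by fun_prop)).pow 2).aestronglyMeasurable
      refine (integrable_prod_iff hm).2 ⟨ae_of_all _ fun t =>
        (memLp_two_comp_add hwn (t • k)).integrable_sq, ?_⟩
      have : ∀ t : ℝ, ∫ z, ‖mollify μ n w (z + t • k) ^ 2‖ ∂μ = ∫ z, mollify μ n w z ^ 2 ∂μ :=
        fun t => by
          simp only [norm_pow, Real.norm_eq_abs, sq_abs]
          exact integral_add_right_eq_self (fun z => mollify μ n w z ^ 2) (t • k)
      simp only [this]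
      exact integrable_const _
    calc ∫ z, (mollify μ n (fun z => u (z + k) - u z) z) ^ 2 ∂μ
        ≤ ∫ z, (∫ t in Ioc (0 : ℝ) 1, mollify μ n w (z + t • k) ^ 2) ∂μ :=
          integral_mono (mollify_memLp n (memLp_two_diff hu k)).integrable_sq
            hintg.integral_prod_right hpt
      _ = ∫ t in Ioc (0 : ℝ) 1, (∫ z, mollify μ n w (z + t • k) ^ 2 ∂μ) :=
          (integral_integral_swap hintg).symm
      _ = ∫ z, mollify μ n w z ^ 2 ∂μ := by
          simp_rw [fun t : ℝ => integral_add_right_eq_self (μ := μ)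
            (fun z => mollify μ n w z ^ 2) (t • k)]
          simp
      _ ≤ _ := integral_mollify_sq_le n hw
  have hl := mollify_tendsto (memLp_two_diff hu k)
  have ht := tendsto_integral_mul_of_sq (fun n => mollify_memLp n (memLp_two_diff hu k))
    (fun n => mollify_memLp n (memLp_two_diff hu k)) (memLp_two_diff hu k) (memLp_two_diff hu k)
    hl hl
  simp only [← pow_two] at ht
  exact le_of_tendsto' ht step

end Difference

section Kernel

variable {d : ℕ}

lemma integrable_norm_rpow_mul_min (hd : 2 ≤ d) {s : ℝ} (hs0 : 0 < s) (hs1 : s < 1) :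
    Integrable (fun h : Ed d => ‖h‖ ^ (-((d : ℝ) + 2 * s)) * min (‖h‖ ^ 2) 1) := by
  have : Nonempty (Fin d) := ⟨⟨0, by omega⟩⟩
  rw [integrable_fun_norm_addHaar (volume : Measure (Ed d))
    (f := fun r => r ^ (-((d : ℝ) + 2 * s)) * min (r ^ 2) 1)]
  simp only [finrank_euclideanSpace, Fintype.card_fin, smul_eq_mul]
  have hpow : ∀ r : ℝ, 0 < r → r ^ (d - 1) * r ^ (-((d : ℝ) + 2 * s)) = r ^ (-1 - 2 * s) := by
    intro r hr
    rw [← Real.rpow_natCast, ← Real.rpow_add hr, Nat.cast_sub (by omega)]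
    congr 1; push_cast; ring
  rw [← Ioc_union_Ioi_eq_Ioi zero_le_one, integrableOn_union]
  constructor
  · have h1 : IntegrableOn (fun r : ℝ => r ^ (1 - 2 * s)) (Ioc 0 1) :=
      (intervalIntegrable_iff_integrableOn_Ioc_of_le zero_le_one).1
        (intervalIntegral.intervalIntegrable_rpow' (by linarith))
    refine h1.congr_fun (fun r hr => ?_) measurableSet_Ioc
    rw [← mul_assoc, hpow r hr.1, min_eq_left (pow_le_one₀ hr.1.le hr.2), ← Real.rpow_natCast,
      ← Real.rpow_add hr.1]
    simp only
    congr 1; push_cast; ring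
  · refine (integrableOn_Ioi_rpow_of_lt (a := -1 - 2 * s) (by linarith) one_pos).congr_fun
      (fun r hr => ?_) measurableSet_Ioi
    have hr1 : (1 : ℝ) < r := hr
    rw [← mul_assoc, hpow r (by linarith), min_eq_right (one_le_pow₀ hr1.le), mul_one]

/-- Difference in the spatial direction. -/
def spDiff (u : ℝ × Ed d → ℝ) (h : Ed d) (z : ℝ × Ed d) : ℝ := u (z + (0, h)) - u z

/-- The nonlocal bilinear form with kernel `κ`. -/
def nlForm (κ : ℝ × Ed d → Ed d → ℝ) (u φ : ℝ × Ed d → ℝ) : ℝ :=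
  ∫ h, ∫ z, spDiff u h z * spDiff φ h z * κ z h

/-- A jump kernel bounded by a multiple of the fractional kernel. -/
structure JumpBound (s Λ : ℝ) (κ : ℝ × Ed d → Ed d → ℝ) : Prop where
  meas : Measurable fun p : (ℝ × Ed d) × Ed d => κ p.1 p.2
  nonneg : ∀ z h, 0 ≤ κ z h
  le : ∀ z h, κ z h ≤ Λ * ‖h‖ ^ (-((d : ℝ) + 2 * s))

/-- `L²` spatial differences of `u` are controlled by `min (|h|²) 1`. -/
def DiffBound (u : ℝ × Ed d → ℝ) (M : ℝ) : Prop :=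
  ∀ h, ∫ z, spDiff u h z ^ 2 ≤ M * min (‖h‖ ^ 2) 1

variable {s Λ : ℝ} {κ : ℝ × Ed d → Ed d → ℝ}

lemma memLp_spDiff {u : ℝ × Ed d → ℝ} (hu : MemLp u 2) (h : Ed d) : MemLp (spDiff u h) 2 :=
  memLp_two_diff hu _

lemma JumpBound.measurable_left (hκ : JumpBound s Λ κ) (h : Ed d) : Measurable fun z => κ z h :=
  hκ.meas.comp (measurable_id.prodMk measurable_const)

lemma JumpBound.integrable_inner (hκ : JumpBound s Λ κ) {u φ : ℝ × Ed d → ℝ} (hu : MemLp u 2)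
    (hφ : MemLp φ 2) (h : Ed d) : Integrable fun z => spDiff u h z * spDiff φ h z * κ z h :=
  (integrable_mul_of_memLp_two (memLp_spDiff hu h) (memLp_spDiff hφ h)).mul_bdd
    (c := Λ * ‖h‖ ^ (-((d : ℝ) + 2 * s))) (hκ.measurable_left h).aestronglyMeasurable
    (ae_of_all _ fun z => by rw [Real.norm_of_nonneg (hκ.nonneg z h)]; exact hκ.le z h)

lemma JumpBound.abs_inner_le (hκ : JumpBound s Λ κ) {u φ : ℝ × Ed d → ℝ} (hu : MemLp u 2)
    (hφ : MemLp φ 2) (h : Ed d) : |∫ z, spDiff u h z * spDiff φ h z * κ z h|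
      ≤ Λ * ‖h‖ ^ (-((d : ℝ) + 2 * s))
        * (√(∫ z, spDiff u h z ^ 2) * √(∫ z, spDiff φ h z ^ 2)) := by
  have hi := integrable_mul_of_memLp_two (memLp_spDiff hu h).norm (memLp_spDiff hφ h).norm
  have hc := abs_integral_mul_le_sqrt (memLp_spDiff hu h).norm (memLp_spDiff hφ h).norm
  simp only [Real.norm_eq_abs, sq_abs] at hc hi
  have h0 : 0 ≤ Λ * ‖h‖ ^ (-((d : ℝ) + 2 * s)) := (hκ.nonneg 0 h).trans (hκ.le 0 h)
  calc |∫ z, spDiff u h z * spDiff φ h z * κ z h|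
      ≤ ∫ z, |spDiff u h z * spDiff φ h z * κ z h| := abs_integral_le_integral_abs
    _ ≤ ∫ z, Λ * ‖h‖ ^ (-((d : ℝ) + 2 * s)) * (|spDiff u h z| * |spDiff φ h z|) := by
        refine integral_mono (hκ.integrable_inner hu hφ h).abs (hi.const_mul _) fun z => ?_
        simp only
        rw [abs_mul, abs_mul, mul_comm, abs_of_nonneg (hκ.nonneg z h)]
        exact mul_le_mul_of_nonneg_right (hκ.le z h) (by positivity)
    _ = Λ * ‖h‖ ^ (-((d : ℝ) + 2 * s)) * ∫ z, |spDiff u h z| * |spDiff φ h z| :=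
        integral_const_mul _ _
    _ ≤ _ := mul_le_mul_of_nonneg_left ((le_abs_self _).trans hc) h0

lemma JumpBound.abs_inner_le_of_diffBound (hκ : JumpBound s Λ κ) {u φ : ℝ × Ed d → ℝ} {M N : ℝ}
    (hu : MemLp u 2) (hφ : MemLp φ 2) (hM : DiffBound u M) (hN : DiffBound φ N) (h : Ed d) :
    |∫ z, spDiff u h z * spDiff φ h z * κ z h|
      ≤ Λ * √M * √N * (‖h‖ ^ (-((d : ℝ) + 2 * s)) * min (‖h‖ ^ 2) 1) := by
  have h0 : 0 ≤ Λ * ‖h‖ ^ (-((d : ℝ) + 2 * s)) := (hκ.nonneg 0 h).trans (hκ.le 0 h)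
  have hm : 0 ≤ min (‖h‖ ^ 2) 1 := by positivity
  refine (hκ.abs_inner_le hu hφ h).trans ?_
  calc _ ≤ Λ * ‖h‖ ^ (-((d : ℝ) + 2 * s))
        * (√(M * min (‖h‖ ^ 2) 1) * √(N * min (‖h‖ ^ 2) 1)) := by
        gcongr
        · exact hM h
        · exact hN h
    _ = _ := by
        rw [Real.sqrt_mul' _ hm, Real.sqrt_mul' _ hm]
        linear_combination (Λ * ‖h‖ ^ (-((d : ℝ) + 2 * s)) * √M * √N) * Real.mul_self_sqrt hm

lemma measurable_spDiff_uncurry {u : ℝ × Ed d → ℝ} (hu : Measurable u) :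
    Measurable fun p : Ed d × (ℝ × Ed d) => spDiff u p.1 p.2 := by
  unfold spDiff
  exact (hu.comp (by fun_prop)).sub (hu.comp measurable_snd)

lemma JumpBound.measurable_inner (hκ : JumpBound s Λ κ) {u φ : ℝ × Ed d → ℝ} (hu : Measurable u)
    (hφ : Measurable φ) :
    AEStronglyMeasurable (fun h => ∫ z, spDiff u h z * spDiff φ h z * κ z h) := by
  refine StronglyMeasurable.aestronglyMeasurable ?_
  refine StronglyMeasurable.integral_prod_right
    (f := fun h z => spDiff u h z * spDiff φ h z * κ z h) ?_
  exact (((measurable_spDiff_uncurry hu).mul (measurable_spDiff_uncurry hφ)).mul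
    (hκ.meas.comp measurable_swap)).stronglyMeasurable

lemma JumpBound.integrable_outer (hd : 2 ≤ d) (hs0 : 0 < s) (hs1 : s < 1) (hκ : JumpBound s Λ κ)
    {u φ : ℝ × Ed d → ℝ} {M N : ℝ} (hum : Measurable u) (hφm : Measurable φ)
    (hu : MemLp u 2) (hφ : MemLp φ 2) (hM : DiffBound u M) (hN : DiffBound φ N) :
    Integrable fun h => ∫ z, spDiff u h z * spDiff φ h z * κ z h :=
  ((integrable_norm_rpow_mul_min hd hs0 hs1).const_mul (Λ * √M * √N)).mono'
    (hκ.measurable_inner hum hφm)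
    (ae_of_all _ fun h => hκ.abs_inner_le_of_diffBound hu hφ hM hN h)

/-- Continuity of the nonlocal form under `L²` convergence with uniform difference bounds. -/
lemma JumpBound.tendsto_nlForm (hd : 2 ≤ d) (hs0 : 0 < s) (hs1 : s < 1) (hκ : JumpBound s Λ κ)
    {u φ : ℝ × Ed d → ℝ} {ψ : ℕ → ℝ × Ed d → ℝ} {M N : ℝ}
    (hum : Measurable u) (hψm : ∀ n, Measurable (ψ n))
    (hu : MemLp u 2) (hφ : MemLp φ 2) (hψ : ∀ n, MemLp (ψ n) 2)
    (hM : DiffBound u M) (hN : ∀ n, DiffBound (ψ n) N)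
    (hl : Tendsto (fun n => ∫ z, (ψ n z - φ z) ^ 2) atTop (𝓝 0)) :
    Tendsto (fun n => nlForm κ u (ψ n)) atTop (𝓝 (nlForm κ u φ)) := by
  refine tendsto_integral_of_dominated_convergence _
    (fun n => hκ.measurable_inner hum (hψm n))
    ((integrable_norm_rpow_mul_min hd hs0 hs1).const_mul (Λ * √M * √N))
    (fun n => ae_of_all _ fun h => hκ.abs_inner_le_of_diffBound hu (hψ n) hM (hN n) h)
    (ae_of_all _ fun h => ?_)
  have hkm := (hκ.measurable_left h).aestronglyMeasurable (μ := volume)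
  have huk : MemLp (fun z => spDiff u h z * κ z h) 2 := by
    refine MemLp.of_le_mul (c := Λ * ‖h‖ ^ (-((d : ℝ) + 2 * s))) (memLp_spDiff hu h)
      ((memLp_spDiff hu h).1.mul hkm) (ae_of_all _ fun z => ?_)
    rw [norm_mul, mul_comm, Real.norm_of_nonneg (hκ.nonneg z h)]
    exact mul_le_mul_of_nonneg_right (hκ.le z h) (norm_nonneg _)
  have hdl : Tendsto (fun n => ∫ z, (spDiff (ψ n) h z - spDiff φ h z) ^ 2) atTop (𝓝 0) := by
    have h4 := hl.const_mul 4
    rw [mul_zero] at h4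
    refine squeeze_zero (fun n => integral_nonneg fun z => sq_nonneg _) (fun n => ?_) h4
    have := integral_diff_sq_le_four ((hψ n).sub hφ) ((0, h) : ℝ × Ed d)
    simp only [Pi.sub_apply] at this
    refine le_trans (le_of_eq ?_) this
    congr 1; ext z; simp only [spDiff]; ring
  have := tendsto_integral_mul_of_sq (fun _ : ℕ => huk) (fun n => memLp_spDiff (hψ n) h) huk
    (memLp_spDiff hφ h) (by simp) hdl
  simpa [mul_right_comm] using this

end Kernel

section Generalised

variable {X : Type*} [MeasurableSpace X] {μ : Measure X}

/-- Generalised dominated convergence with a converging sequence of dominating functions. -/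
lemma tendsto_integral_of_dominated_tendsto {F G : ℕ → X → ℝ} {F₀ G₀ : X → ℝ}
    (hF : ∀ n, AEStronglyMeasurable (F n) μ) (hF₀ : AEStronglyMeasurable F₀ μ)
    (hG : ∀ n, Integrable (G n) μ) (hG₀ : Integrable G₀ μ)
    (hFG : ∀ n x, |F n x| ≤ G n x)
    (hFl : ∀ᵐ x ∂μ, Tendsto (fun n => F n x) atTop (𝓝 (F₀ x)))
    (hGl : ∀ᵐ x ∂μ, Tendsto (fun n => G n x) atTop (𝓝 (G₀ x)))
    (hGi : Tendsto (fun n => ∫ x, G n x ∂μ) atTop (𝓝 (∫ x, G₀ x ∂μ))) :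
    Integrable F₀ μ ∧ Tendsto (fun n => ∫ x, F n x ∂μ) atTop (𝓝 (∫ x, F₀ x ∂μ)) := by
  have hFi : ∀ n, Integrable (F n) μ := fun n =>
    (hG n).mono' (hF n) (ae_of_all _ fun x => by simpa using hFG n x)
  have hF₀i : Integrable F₀ μ := by
    refine hG₀.mono' hF₀ ?_
    filter_upwards [hFl, hGl] with x h1 h2
    exact le_of_tendsto_of_tendsto' h1.norm h2 fun n => by simpa using hFG n x
  refine ⟨hF₀i, ?_⟩
  have key := tendsto_integral_zero_of_dominated_tendsto (μ := μ)
    (F := fun n x => |F n x - F₀ x|) (G := fun n x => G n x + |F₀ x|)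
    (G₀ := fun x => G₀ x + |F₀ x|) (fun n => ((hFi n).sub hF₀i).abs)
    (fun n => (hG n).add hF₀i.abs) (hG₀.add hF₀i.abs) (fun n x => abs_nonneg _)
    (fun n x => (abs_sub _ _).trans (by gcongr; exact hFG n x))
    (by filter_upwards [hFl] with x hx; simpa using (hx.sub_const (F₀ x)).abs)
    (by filter_upwards [hGl] with x hx; exact hx.add_const _)
    (by
      simp_rw [fun n => integral_add (hG n) hF₀i.abs, integral_add hG₀ hF₀i.abs]
      exact hGi.add_const _)
  rw [tendsto_iff_norm_sub_tendsto_zero]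
  refine squeeze_zero (fun n => norm_nonneg _) (fun n => ?_) key
  rw [← integral_sub (hFi n) hF₀i]
  exact abs_integral_le_integral_abs

end Generalised

/-- A `C¹` truncation `Φ` with derivative `Φ'` and primitive `Ψ`. -/
structure TruncFun (Φ Φ' Ψ : ℝ → ℝ) : Prop where
  deriv : ∀ r, HasDerivAt Φ (Φ' r) r
  cont : Continuous Φ'
  nonneg' : ∀ r, 0 ≤ Φ' r
  le_one : ∀ r, Φ' r ≤ 1
  nonneg : ∀ r, 0 ≤ Φ r
  le : ∀ r, Φ r ≤ |r|
  prim : ∀ r, HasDerivAt Ψ (Φ r) r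
  prim_le : ∀ r, |Ψ r| ≤ r ^ 2

namespace TruncFun

variable {Φ Φ' Ψ : ℝ → ℝ}

lemma contDiff (h : TruncFun Φ Φ' Ψ) : ContDiff ℝ 1 Φ := by
  rw [contDiff_one_iff_deriv]
  refine ⟨fun r => (h.deriv r).differentiableAt, ?_⟩
  rw [show _root_.deriv Φ = Φ' from funext fun r => (h.deriv r).deriv]
  exact h.cont

lemma contDiff_prim (h : TruncFun Φ Φ' Ψ) : ContDiff ℝ 1 Ψ := by
  rw [contDiff_one_iff_deriv]
  refine ⟨fun r => (h.prim r).differentiableAt, ?_⟩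
  rw [show _root_.deriv Ψ = Φ from funext fun r => (h.prim r).deriv]
  exact h.contDiff.continuous

lemma abs_sub_le (h : TruncFun Φ Φ' Ψ) (a b : ℝ) : |Φ a - Φ b| ≤ |a - b| := by
  have := Convex.norm_image_sub_le_of_norm_hasDerivWithin_le (s := univ) (C := 1)
    (fun x _ => (h.deriv x).hasDerivWithinAt) (fun x _ => by
      rw [Real.norm_of_nonneg (h.nonneg' x)]; exact h.le_one x) convex_univ
    (mem_univ b) (mem_univ a)
  simpa using this

lemma abs_le (h : TruncFun Φ Φ' Ψ) (r : ℝ) : |Φ r| ≤ |r| := by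
  rw [abs_of_nonneg (h.nonneg r)]; exact h.le r

end TruncFun

section DiffBounds

variable {d : ℕ}

lemma diffBound_of_weakGrad {u : ℝ × Ed d → ℝ} {Du : ℝ × Ed d → Ed d} (hu : MemLp u 2)
    (hDu : MemLp Du 2)
    (hg : ∀ φ : ℝ × Ed d → ℝ, ContDiff ℝ (⊤ : ℕ∞) φ → HasCompactSupport φ → ∀ e : Ed d,
      ∫ z, u z * fderiv ℝ φ z (0, e) = - ∫ z, ⟪Du z, e⟫ * φ z) :
    DiffBound u ((∫ z, ‖Du z‖ ^ 2) + 4 * ∫ z, u z ^ 2) := by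
  intro h
  have hw : MemLp (fun z => ⟪Du z, h⟫) 2 := by
    refine MemLp.of_le_mul (c := ‖h‖) hDu (hDu.1.inner aestronglyMeasurable_const)
      (ae_of_all _ fun z => ?_)
    rw [mul_comm]; exact norm_inner_le_norm _ _
  have h1 := integral_diff_sq_le_of_weakDeriv hu hw (fun φ h1 h2 => hg φ h1 h2 h)
  have h2 := integral_diff_sq_le_four hu ((0, h) : ℝ × Ed d)
  have h3 : ∫ z, ⟪Du z, h⟫ ^ 2 ≤ ‖h‖ ^ 2 * ∫ z, ‖Du z‖ ^ 2 := by
    rw [← integral_const_mul]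
    refine integral_mono hw.integrable_sq (hDu.norm.integrable_sq.const_mul _) fun z => ?_
    simp only
    rw [← mul_pow, ← sq_abs]
    gcongr
    rw [mul_comm]; exact abs_real_inner_le_norm _ _
  have hA : 0 ≤ ∫ z, ‖Du z‖ ^ 2 := integral_nonneg fun z => by positivity
  have hB : 0 ≤ ∫ z, u z ^ 2 := integral_nonneg fun z => by positivity
  change ∫ z, (u (z + (0, h)) - u z) ^ 2 ≤ _
  rcases le_total (‖h‖ ^ 2) 1 with hh | hh
  · rw [min_eq_left hh]; nlinarith [sq_nonneg ‖h‖]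
  · rw [min_eq_right hh]; linarith

lemma spDiff_sq_le_min {ζ : ℝ × Ed d → ℝ} {C L : ℝ} (hC : ∀ z, |ζ z| ≤ C)
    (hL : ∀ h z, |spDiff ζ h z| ≤ L * ‖h‖) (h : Ed d) (z : ℝ × Ed d) :
    spDiff ζ h z ^ 2 ≤ (L + 2 * C) ^ 2 * min (‖h‖ ^ 2) 1 := by
  have hC0 : 0 ≤ C := (abs_nonneg _).trans (hC 0)
  have h1 := hL h z
  have h2 : |spDiff ζ h z| ≤ 2 * C := (abs_sub _ _).trans (by linarith [hC z, hC (z + (0, h))])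
  have h0 := abs_nonneg (spDiff ζ h z)
  rw [← sq_abs]
  rcases le_total (‖h‖ ^ 2) 1 with hh | hh
  · rw [min_eq_left hh, ← mul_pow]
    gcongr
    exact h1.trans (by nlinarith [norm_nonneg h])
  · rw [min_eq_right hh, mul_one]
    rcases eq_or_lt_of_le (norm_nonneg h) with h00 | h00
    · rw [← h00] at hh; norm_num at hh
    have hL0 : 0 ≤ L := nonneg_of_mul_nonneg_left (h0.trans h1) h00
    gcongr
    linarith

lemma DiffBound.lipschitz_mul {Φ : ℝ → ℝ} (hΦc : Continuous Φ)
    (hΦl : ∀ a b, |Φ a - Φ b| ≤ |a - b|) (hΦ0 : ∀ a, |Φ a| ≤ |a|) {w ζ : ℝ × Ed d → ℝ} {M C L B : ℝ}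
    (hw : MemLp w 2) (hM : DiffBound w M) (hC : ∀ z, |ζ z| ≤ C)
    (hL : ∀ h z, |spDiff ζ h z| ≤ L * ‖h‖) (hζ : Measurable ζ)
    (hB : ∫ z, w z ^ 2 ≤ B) :
    DiffBound (fun z => Φ (w z) * ζ z) (2 * C ^ 2 * M + 2 * (L + 2 * C) ^ 2 * B) ∧
      MemLp (fun z => Φ (w z) * ζ z) 2 := by
  have hC0 : 0 ≤ C := (abs_nonneg _).trans (hC 0)
  have hψ : MemLp (fun z => Φ (w z) * ζ z) 2 := by
    refine MemLp.of_le_mul (c := C) hw ((hΦc.comp_aestronglyMeasurable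
      hw.1).mul hζ.aestronglyMeasurable) (ae_of_all _ fun z => ?_)
    rw [norm_mul, mul_comm]
    exact mul_le_mul (hC z) (hΦ0 _) (abs_nonneg _) hC0
  refine ⟨fun h => ?_, hψ⟩
  have hm0 : 0 ≤ min (‖h‖ ^ 2) 1 := by positivity
  have hζm := spDiff_sq_le_min hC hL h
  have hpt : ∀ z, spDiff (fun z => Φ (w z) * ζ z) h z ^ 2
      ≤ 2 * C ^ 2 * spDiff w h z ^ 2 + 2 * ((L + 2 * C) ^ 2 * min (‖h‖ ^ 2) 1) * w z ^ 2 := by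
    intro z
    have e : spDiff (fun z => Φ (w z) * ζ z) h z
        = (Φ (w (z + (0, h))) - Φ (w z)) * ζ (z + (0, h)) + Φ (w z) * spDiff ζ h z := by
      simp only [spDiff]; ring
    have h1 : ((Φ (w (z + (0, h))) - Φ (w z)) * ζ (z + (0, h))) ^ 2
        ≤ C ^ 2 * spDiff w h z ^ 2 := by
      rw [← mul_pow, ← sq_abs, ← sq_abs (C * _), abs_mul, abs_mul, mul_comm, abs_of_nonneg hC0]
      exact pow_le_pow_left₀ (by positivity) (mul_le_mul (hC _) (hΦl _ _)
        (abs_nonneg _) hC0) 2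
    have h2 : (Φ (w z) * spDiff ζ h z) ^ 2 ≤ ((L + 2 * C) ^ 2 * min (‖h‖ ^ 2) 1) * w z ^ 2 := by
      rw [mul_pow, mul_comm]
      exact mul_le_mul (hζm z) (sq_le_sq.2 (hΦ0 _)) (sq_nonneg _) (by positivity)
    rw [e]
    nlinarith [sq_nonneg ((Φ (w (z + (0, h))) - Φ (w z)) * ζ (z + (0, h)) - Φ (w z) * spDiff ζ h z)]
  calc ∫ z, spDiff (fun z => Φ (w z) * ζ z) h z ^ 2
      ≤ ∫ z, (2 * C ^ 2 * spDiff w h z ^ 2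
          + 2 * ((L + 2 * C) ^ 2 * min (‖h‖ ^ 2) 1) * w z ^ 2) :=
        integral_mono (memLp_spDiff hψ h).integrable_sq
          (((memLp_spDiff hw h).integrable_sq.const_mul _).add (hw.integrable_sq.const_mul _)) hpt
    _ = 2 * C ^ 2 * (∫ z, spDiff w h z ^ 2)
          + 2 * ((L + 2 * C) ^ 2 * min (‖h‖ ^ 2) 1) * ∫ z, w z ^ 2 := by
        rw [integral_add ((memLp_spDiff hw h).integrable_sq.const_mul _)
          (hw.integrable_sq.const_mul _), integral_const_mul, integral_const_mul]
    _ ≤ 2 * C ^ 2 * (M * min (‖h‖ ^ 2) 1)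
          + 2 * ((L + 2 * C) ^ 2 * min (‖h‖ ^ 2) 1) * B := by
        gcongr
        exact hM h
    _ = _ := by ring

lemma DiffBound.trunc {Φ Φ' Ψ : ℝ → ℝ} (hΦ : TruncFun Φ Φ' Ψ) {w ζ : ℝ × Ed d → ℝ} {M C L B : ℝ}
    (hw : MemLp w 2) (hM : DiffBound w M) (hC : ∀ z, |ζ z| ≤ C)
    (hL : ∀ h z, |spDiff ζ h z| ≤ L * ‖h‖) (hζ : Measurable ζ)
    (hB : ∫ z, w z ^ 2 ≤ B) :
    DiffBound (fun z => Φ (w z) * ζ z) (2 * C ^ 2 * M + 2 * (L + 2 * C) ^ 2 * B) ∧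
      MemLp (fun z => Φ (w z) * ζ z) 2 :=
  DiffBound.lipschitz_mul hΦ.contDiff.continuous hΦ.abs_sub_le hΦ.abs_le hw hM hC hL hζ hB

lemma DiffBound.mollify {u : ℝ × Ed d → ℝ} {M : ℝ} (hu : MemLp u 2) (hM : DiffBound u M) (n : ℕ) :
    DiffBound (mollify volume n u) M := by
  intro h
  have e : ∀ z, spDiff (_root_.mollify volume n u) h z = _root_.mollify volume n (spDiff u h) z := by
    intro z
    rw [show spDiff u h = fun z => u (z + (0, h)) - u z from rfl,
      mollify_sub n (locallyIntegrable_of_memLp_two (memLp_two_comp_add hu _))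
      (locallyIntegrable_of_memLp_two hu), mollify_comp_add]
    rfl
  simp_rw [e]
  exact (integral_mollify_sq_le n (memLp_spDiff hu h)).trans (hM h)

end DiffBounds

/-- A global-in-space parabolic equation `∂_t u - div a + L_κ u + f = 0` tested in `P`,
with square integrable data. -/
structure WeakEq {d : ℕ} (s Λ : ℝ) (P : Set (ℝ × Ed d)) (u f : ℝ × Ed d → ℝ)
    (Du a : ℝ × Ed d → Ed d) (κ : ℝ × Ed d → Ed d → ℝ) : Prop where
  memu : MemLp u 2
  memf : MemLp f 2
  memDu : MemLp Du 2
  mema : MemLp a 2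
  meas : Measurable u
  jump : JumpBound s Λ κ
  grad : ∀ φ : ℝ × Ed d → ℝ, ContDiff ℝ (⊤ : ℕ∞) φ → HasCompactSupport φ → ∀ e : Ed d,
    ∫ z, u z * fderiv ℝ φ z (0, e) = - ∫ z, ⟪Du z, e⟫ * φ z
  eq : ∀ φ : ℝ × Ed d → ℝ, ContDiff ℝ (⊤ : ℕ∞) φ → HasCompactSupport φ → tsupport φ ⊆ P →
    -(∫ z, u z * fderiv ℝ φ z (1, 0)) + (∫ z, fderiv ℝ φ z (0, a z)) + nlForm κ u φ
      + ∫ z, f z * φ z = 0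

section Energy

variable {d : ℕ} {s Λ : ℝ} {P : Set (ℝ × Ed d)} {u f : ℝ × Ed d → ℝ}
  {Du a : ℝ × Ed d → Ed d} {κ : ℝ × Ed d → Ed d → ℝ} {Φ Φ' Ψ : ℝ → ℝ}

/-- Spatial coordinate direction in space-time. -/
def spDir (i : Fin d) : ℝ × Ed d := (0, EuclideanSpace.single i 1)

lemma fderiv_spatial_eq_sum (φ : ℝ × Ed d → ℝ) (z : ℝ × Ed d) (b : Ed d) :
    fderiv ℝ φ z (0, b) = ∑ i, b i * fderiv ℝ φ z (spDir i) := by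
  have hb : ((0 : ℝ), b) = ∑ i, b i • (spDir i : ℝ × Ed d) := by
    refine Prod.ext ?_ ?_
    · simp [spDir, Prod.fst_sum]
    · rw [Prod.snd_sum]
      simp only [spDir, Prod.smul_snd]
      ext j
      simp [Finset.sum_apply, PiLp.single_apply, Pi.single_apply]
  rw [hb, map_sum]
  simp

lemma memLp_coord {b : ℝ × Ed d → Ed d} (hb : MemLp b 2) (i : Fin d) :
    MemLp (fun z => b z i) 2 := by
  refine MemLp.of_le hb ?_ (ae_of_all _ fun z => PiLp.norm_apply_le _ _)
  exact (EuclideanSpace.proj (𝕜 := ℝ) i).continuous.comp_aestronglyMeasurable hb.1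

lemma memLp_mul_bdd {X : Type*} [MeasurableSpace X] {μ : Measure X} {g b : X → ℝ} {C : ℝ}
    (hg : MemLp g 2 μ) (hb : AEStronglyMeasurable b μ) (hC : ∀ x, |b x| ≤ C) :
    MemLp (fun x => g x * b x) 2 μ := by
  refine MemLp.of_le_mul (c := C) hg (hg.1.mul hb) (ae_of_all _ fun x => ?_)
  rw [norm_mul, mul_comm]
  exact mul_le_mul_of_nonneg_right (hC x) (norm_nonneg _)

/-- Bounds for smooth compactly supported cutoffs. -/
lemma exists_cutoff_bounds {ζ : ℝ × Ed d → ℝ} (hζ : ContDiff ℝ 1 ζ) (hs : HasCompactSupport ζ) :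
    ∃ C L : ℝ, 0 ≤ C ∧ 0 ≤ L ∧ (∀ z, |ζ z| ≤ C) ∧ (∀ h z, |spDiff ζ h z| ≤ L * ‖h‖) ∧
      ∀ z e, |fderiv ℝ ζ z e| ≤ L * ‖e‖ := by
  obtain ⟨C, hC⟩ := hζ.continuous.bounded_above_of_compact_support hs
  obtain ⟨L, hL⟩ := ((hζ.continuous_fderiv one_ne_zero).norm).bounded_above_of_compact_support
    (hs.fderiv (𝕜 := ℝ)).norm
  simp only [norm_norm, Real.norm_eq_abs, abs_norm] at hC hL
  refine ⟨C, L, (abs_nonneg _).trans (hC 0), (norm_nonneg _).trans (hL 0), hC, fun h z => ?_,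
    fun z e => ((fderiv ℝ ζ z).le_opNorm e).trans (by gcongr; exact hL z)⟩
  have := Convex.norm_image_sub_le_of_norm_fderiv_le (𝕜 := ℝ) (s := univ) (f := ζ)
    (fun x _ => hζ.differentiable one_ne_zero x) (fun x _ => hL x) convex_univ
    (mem_univ z) (mem_univ (z + (0, h)))
  simpa [spDiff] using this

/-- The weak chain rule limit: `L²` convergence and almost everywhere convergence of mollified
products. -/
lemma tendsto_integral_bdd_mollify_mul {w v : ℝ × Ed d → ℝ} {b : ℕ → ℝ × Ed d → ℝ}
    {b₀ : ℝ × Ed d → ℝ} {C : ℝ} (hw : MemLp w 2) (hv : MemLp v 2)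
    (hb : ∀ n, AEStronglyMeasurable (b n)) (hb₀ : AEStronglyMeasurable b₀)
    (hC : ∀ n z, |b n z| ≤ C) (hl : ∀ᵐ z, Tendsto (fun n => b n z) atTop (𝓝 (b₀ z))) :
    Integrable (fun z => w z * v z * b₀ z) ∧
    Tendsto (fun n => ∫ z, mollify volume n w z * mollify volume n v z * b n z) atTop
      (𝓝 (∫ z, w z * v z * b₀ z)) := by
  have hwn := fun n => mollify_memLp (μ := volume) n hw
  have hvn := fun n => mollify_memLp (μ := volume) n hv
  have tw := mollify_tendsto hw
  have tv := mollify_tendsto hv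
  have sw := tendsto_integral_mul_of_sq hwn hwn hw hw tw tw
  have sv := tendsto_integral_mul_of_sq hvn hvn hv hv tv tv
  have aw := mollify_ae_tendsto (locallyIntegrable_of_memLp_two hw)
  have av := mollify_ae_tendsto (locallyIntegrable_of_memLp_two hv)
  have hC0 : 0 ≤ C := (abs_nonneg _).trans (hC 0 0)
  have iw := fun n => integrable_mul_of_memLp_two (hwn n) (hwn n)
  have iv := fun n => integrable_mul_of_memLp_two (hvn n) (hvn n)
  have iw0 := integrable_mul_of_memLp_two hw hw
  have iv0 := integrable_mul_of_memLp_two hv hv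
  refine tendsto_integral_of_dominated_tendsto
    (G := fun n z => C * (mollify volume n w z * mollify volume n w z)
      + C * (mollify volume n v z * mollify volume n v z))
    (G₀ := fun z => C * (w z * w z) + C * (v z * v z))
    (fun n => ((hwn n).1.mul (hvn n).1).mul (hb n)) ((hw.1.mul hv.1).mul hb₀)
    (fun n => ((iw n).const_mul C).add ((iv n).const_mul C))
    ((iw0.const_mul C).add (iv0.const_mul C)) (fun n z => ?_) ?_ ?_ ?_
  · rw [abs_mul, abs_mul]
    set p := mollify volume n w z
    set q := mollify volume n v z
    have h1 : |p| * |q| ≤ p * p + q * q := by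
      nlinarith [sq_nonneg (|p| - |q|), abs_mul_abs_self p, abs_mul_abs_self q,
        mul_self_nonneg p, mul_self_nonneg q]
    calc |p| * |q| * |b n z| ≤ (p * p + q * q) * C :=
          mul_le_mul h1 (hC n z) (abs_nonneg _) (by nlinarith)
      _ = _ := by ring
  · filter_upwards [aw, av, hl] with z h1 h2 h3
    exact (h1.mul h2).mul h3
  · filter_upwards [aw, av] with z h1 h2
    exact ((h1.mul h1).const_mul C).add ((h2.mul h2).const_mul C)
  · simp_rw [fun n => integral_add ((iw n).const_mul C) ((iv n).const_mul C),
      integral_add (iw0.const_mul C) (iv0.const_mul C), integral_const_mul]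
    exact (sw.const_mul C).add (sv.const_mul C)

/-- Energy identity for smooth truncations. -/
lemma WeakEq.energy_trunc (hd : 2 ≤ d) (hs0 : 0 < s) (hs1 : s < 1)
    (h : WeakEq s Λ P u f Du a κ) (hP : IsOpen P) (hΦ : TruncFun Φ Φ' Ψ)
    {ζ : ℝ × Ed d → ℝ} (hζ : ContDiff ℝ (⊤ : ℕ∞) ζ) (hζs : HasCompactSupport ζ)
    (hζP : tsupport ζ ⊆ P) :
    -(∫ z, Ψ (u z) * fderiv ℝ ζ z (1, 0))
      + (∑ i, ((∫ z, a z i * Du z i * (Φ' (u z) * ζ z))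
        + ∫ z, a z i * (Φ (u z) * fderiv ℝ ζ z (spDir i))))
      + nlForm κ u (fun z => Φ (u z) * ζ z) + ∫ z, f z * (Φ (u z) * ζ z) = 0 := by
  have hζ1 : ContDiff ℝ 1 ζ := hζ.of_le (by exact_mod_cast le_top)
  obtain ⟨C, L, hC0, hL0, hC, hL, hL'⟩ := exists_cutoff_bounds hζ1 hζs
  have hul := locallyIntegrable_of_memLp_two h.memu
  set un : ℕ → ℝ × Ed d → ℝ := fun n => mollify volume n u with hun
  have hunc : ∀ n, ContDiff ℝ 1 (un n) := fun n =>
    (mollify_contDiff n hul).of_le (by exact_mod_cast le_top)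
  have hunm : ∀ n, MemLp (un n) 2 := fun n => mollify_memLp n h.memu
  have hunl := mollify_tendsto h.memu
  have hae := mollify_ae_tendsto hul
  have hdζ : ∀ e, Continuous fun z => fderiv ℝ ζ z e := fun e =>
    (hζ1.continuous_fderiv one_ne_zero).clm_apply continuous_const
  set ψ : ℕ → ℝ × Ed d → ℝ := fun n z => Φ (un n z) * ζ z with hψ
  set ψ₀ : ℝ × Ed d → ℝ := fun z => Φ (u z) * ζ z with hψ₀
  have hψc : ∀ n, ContDiff ℝ 1 (ψ n) := fun n => (hΦ.contDiff.comp (hunc n)).mul hζ1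
  have hψs : ∀ n, HasCompactSupport (ψ n) := fun n => hζs.mul_left
  have hψt : ∀ n, tsupport (ψ n) ⊆ tsupport ζ := fun n => tsupport_mul_subset_right
  have M1 := diffBound_of_weakGrad h.memu h.memDu h.grad
  have T0 := M1.trunc hΦ h.memu hC hL hζ.continuous.measurable le_rfl
  have hψm : ∀ n, _ := fun n => (M1.mollify h.memu n).trunc hΦ (hunm n) hC hL
    hζ.continuous.measurable (integral_mollify_sq_le n h.memu)
  have hψl : Tendsto (fun n => ∫ z, (ψ n z - ψ₀ z) ^ 2) atTop (𝓝 0) := by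
    have h2 := hunl.const_mul (C ^ 2)
    rw [mul_zero] at h2
    refine squeeze_zero (fun n => integral_nonneg fun z => sq_nonneg _) (fun n => ?_) h2
    rw [← integral_const_mul]
    refine integral_mono ((hψm n).2.sub T0.2).integrable_sq
      (((hunm n).sub h.memu).integrable_sq.const_mul _) fun z => ?_
    simp only [Pi.sub_apply, hψ, hψ₀]
    rw [← sub_mul, ← mul_pow, ← sq_abs, ← sq_abs (C * _), abs_mul, abs_mul, mul_comm,
      abs_of_nonneg hC0]
    exact pow_le_pow_left₀ (by positivity) (mul_le_mul (hC _) (hΦ.abs_sub_le _ _)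
        (abs_nonneg _) hC0) 2
  set φ : ℕ → ℝ × Ed d → ℝ := fun n => mollify volume n (ψ n) with hφ
  have hφc : ∀ n, ContDiff ℝ (⊤ : ℕ∞) (φ n) := fun n =>
    mollify_contDiff n (hψc n).continuous.locallyIntegrable
  have hφl := mollify_tendsto_of_tendsto (fun n => (hψm n).2) T0.2 hψl
  have hφm : ∀ n, MemLp (φ n) 2 := fun n => mollify_memLp n (hψm n).2
  have hev : ∀ᶠ n in atTop, -(∫ z, u z * fderiv ℝ (φ n) z (1, 0))
      + (∫ z, fderiv ℝ (φ n) z (0, a z)) + nlForm κ u (φ n) + ∫ z, f z * φ n z = 0 := by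
    filter_upwards [eventually_tsupport_mollify_subset (μ := (volume : Measure (ℝ × Ed d)))
      hζs hP hζP] with n hn
    exact h.eq _ (hφc n) (mollify_hasCompactSupport n (hψs n)) (hn _ (hψt n))
  have hdψ : ∀ n z e, fderiv ℝ (ψ n) z e
      = Φ' (un n z) * fderiv ℝ (un n) z e * ζ z + Φ (un n z) * fderiv ℝ ζ z e := by
    intro n z e
    have h1 := (hΦ.deriv (un n z)).comp_hasFDerivAt z
      ((hunc n).differentiable one_ne_zero z).hasFDerivAt
    have h2 := (h1.mul ((hζ1.differentiable one_ne_zero z).hasFDerivAt)).fderiv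
    have h3 : fderiv ℝ (ψ n) z = _ := h2
    rw [h3]
    simp
    ring
  have hdψm : ∀ n e, MemLp (fun z => fderiv ℝ (ψ n) z e) 2 := fun n e =>
    (((hψc n).continuous_fderiv one_ne_zero).clm_apply continuous_const).memLp_of_hasCompactSupport
      ((hψs n).fderiv_apply (𝕜 := ℝ) e)
  -- the parabolic term
  have hT1 : ∀ n, ∫ z, u z * fderiv ℝ (φ n) z (1, 0) = ∫ z, Ψ (un n z) * fderiv ℝ ζ z (1, 0) := by
    intro n
    have e1 : ∫ z, u z * fderiv ℝ (φ n) z (1, 0)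
        = ∫ z, un n z * fderiv ℝ (ψ n) z (1, 0) := by
      simp_rw [hφ, fderiv_mollify_of_contDiff n (hψc n)]
      rw [← integral_mollify_mul n h.memu (hdψm n _)]
    have e2 : ∫ z, Ψ (un n z) * fderiv ℝ ζ z (1, 0)
        = -∫ z, fderiv ℝ (fun z => Ψ (un n z)) z (1, 0) * ζ z :=
      integral_mul_fderiv_eq_neg_fderiv_mul_of_contDiff (hΦ.contDiff_prim.comp (hunc n)) hζ1 hζs _
    rw [e1, integral_mul_fderiv_eq_neg_fderiv_mul_of_contDiff (hunc n) (hψc n) (hψs n), e2]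
    congr 1
    refine integral_congr_ae (ae_of_all _ fun z => ?_)
    have h1 := ((hΦ.prim (un n z)).comp_hasFDerivAt z
      ((hunc n).differentiable one_ne_zero z).hasFDerivAt).fderiv
    have h2 : fderiv ℝ (fun z => Ψ (un n z)) z = _ := h1
    simp only
    rw [h2]
    simp [hψ]
    ring
  have hL1 : Tendsto (fun n => ∫ z, Ψ (un n z) * fderiv ℝ ζ z (1, 0)) atTop
      (𝓝 (∫ z, Ψ (u z) * fderiv ℝ ζ z (1, 0))) := by
    have sw := tendsto_integral_mul_of_sq hunm hunm h.memu h.memu hunl hunl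
    simp only [← pow_two] at sw
    refine (tendsto_integral_of_dominated_tendsto
      (G := fun n z => (L * ‖((1 : ℝ), (0 : Ed d))‖) * un n z ^ 2)
      (G₀ := fun z => (L * ‖((1 : ℝ), (0 : Ed d))‖) * u z ^ 2) (fun n => ?_) ?_
      (fun n => (hunm n).integrable_sq.const_mul _) (h.memu.integrable_sq.const_mul _)
      (fun n z => ?_) ?_ ?_ ?_).2
    · exact (hΦ.contDiff_prim.continuous.comp_aestronglyMeasurable (hunm n).1).mul
        (hdζ _).aestronglyMeasurable
    · exact (hΦ.contDiff_prim.continuous.comp_aestronglyMeasurable h.memu.1).mul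
        (hdζ _).aestronglyMeasurable
    · rw [abs_mul, mul_comm]
      exact mul_le_mul (hL' z _) (hΦ.prim_le _) (abs_nonneg _) (by positivity)
    · filter_upwards [hae] with z hz
      exact ((hΦ.contDiff_prim.continuous.tendsto _).comp hz).mul_const _
    · filter_upwards [hae] with z hz
      exact (hz.pow 2).const_mul _
    · simp_rw [integral_const_mul]
      exact sw.const_mul _
  -- the diffusion term
  have hT2 : ∀ n, ∫ z, fderiv ℝ (φ n) z (0, a z) = ∑ i,
      ((∫ z, mollify volume n (fun z => a z i) z * mollify volume n (fun z => Du z i) z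
          * (Φ' (un n z) * ζ z))
        + ∫ z, mollify volume n (fun z => a z i) z * (Φ (un n z) * fderiv ℝ ζ z (spDir i))) := by
    intro n
    have hi : ∀ i, MemLp (fun z => fderiv ℝ (φ n) z (spDir i)) 2 := fun i => by
      simp_rw [hφ, fderiv_mollify_of_contDiff n (hψc n)]
      exact mollify_memLp n (hdψm n _)
    simp_rw [fderiv_spatial_eq_sum]
    rw [integral_finsetSum _ fun i _ => integrable_mul_of_memLp_two (memLp_coord h.mema i) (hi i)]
    refine Finset.sum_congr rfl fun i _ => ?_
    have e1 : ∫ z, a z i * fderiv ℝ (φ n) z (spDir i)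
        = ∫ z, mollify volume n (fun z => a z i) z * fderiv ℝ (ψ n) z (spDir i) := by
      simp_rw [hφ, fderiv_mollify_of_contDiff n (hψc n)]
      rw [integral_mollify_mul n (memLp_coord h.mema i) (hdψm n _)]
    have hmn := mollify_memLp (μ := volume) n (memLp_coord h.mema i)
    have hdn : ∀ z, fderiv ℝ (un n) z (spDir i) = mollify volume n (fun z => Du z i) z :=
      fun z => fderiv_mollify n hul (fun φ h1 h2 => by
        simpa [spDir, EuclideanSpace.inner_single_right] using
          h.grad φ h1 h2 (EuclideanSpace.single i 1)) z
    have b1 : Integrable fun z => mollify volume n (fun z => a z i) z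
        * mollify volume n (fun z => Du z i) z * (Φ' (un n z) * ζ z) :=
      (integrable_mul_of_memLp_two hmn (mollify_memLp n (memLp_coord h.memDu i))).mul_bdd (c := C)
        (((hΦ.cont.comp (hunc n).continuous).mul hζ.continuous).aestronglyMeasurable)
        (ae_of_all _ fun z => by
          rw [norm_mul, ← one_mul C]
          refine mul_le_mul ?_ (hC z) (norm_nonneg _) zero_le_one
          rw [Real.norm_of_nonneg (hΦ.nonneg' _)]
          exact hΦ.le_one _)
    have b2 : Integrable fun z => mollify volume n (fun z => a z i) z
        * (Φ (un n z) * fderiv ℝ ζ z (spDir i)) := by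
      refine integrable_mul_of_memLp_two hmn (Continuous.memLp_of_hasCompactSupport
        ((hΦ.contDiff.continuous.comp (hunc n).continuous).mul (hdζ _)) ?_)
      exact (hζs.fderiv_apply (𝕜 := ℝ) _).mul_left
    rw [e1, ← integral_add b1 b2]
    refine integral_congr_ae (ae_of_all _ fun z => ?_)
    simp only
    rw [hdψ, hdn]
    ring
  have hL2 : Tendsto (fun n => ∫ z, fderiv ℝ (φ n) z (0, a z)) atTop
      (𝓝 (∑ i, ((∫ z, a z i * Du z i * (Φ' (u z) * ζ z))
        + ∫ z, a z i * (Φ (u z) * fderiv ℝ ζ z (spDir i))))) := by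
    simp_rw [hT2]
    refine tendsto_finsetSum _ fun i _ => Tendsto.add ?_ ?_
    · refine (tendsto_integral_bdd_mollify_mul (C := C) (memLp_coord h.mema i)
        (memLp_coord h.memDu i) (fun n => ?_) ?_ (fun n z => ?_) ?_).2
      · exact ((hΦ.cont.comp (hunc n).continuous).mul hζ.continuous).aestronglyMeasurable
      · exact (hΦ.cont.comp_aestronglyMeasurable h.memu.1).mul hζ.continuous.aestronglyMeasurable
      · rw [abs_mul, ← one_mul C]
        refine mul_le_mul ?_ (hC z) (abs_nonneg _) zero_le_one
        rw [abs_of_nonneg (hΦ.nonneg' _)]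
        exact hΦ.le_one _
      · filter_upwards [hae] with z hz
        exact ((hΦ.cont.tendsto _).comp hz).mul_const _
    · have hb : ∀ z, |fderiv ℝ ζ z (spDir i)| ≤ L * ‖(spDir i : ℝ × Ed d)‖ := fun z => hL' z _
      have h1 : ∀ n, MemLp (fun z => Φ (un n z) * fderiv ℝ ζ z (spDir i)) 2 := fun n =>
        memLp_mul_bdd ((hunm n).of_le (hΦ.contDiff.continuous.comp_aestronglyMeasurable (hunm n).1)
          (ae_of_all _ fun z => hΦ.abs_le _)) (hdζ _).aestronglyMeasurable hb
      have h2 : MemLp (fun z => Φ (u z) * fderiv ℝ ζ z (spDir i)) 2 :=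
        memLp_mul_bdd (h.memu.of_le (hΦ.contDiff.continuous.comp_aestronglyMeasurable h.memu.1)
          (ae_of_all _ fun z => hΦ.abs_le _)) (hdζ _).aestronglyMeasurable hb
      refine tendsto_integral_mul_of_sq
        (fun n => mollify_memLp n (memLp_coord h.mema i)) h1 (memLp_coord h.mema i) h2
        (mollify_tendsto (memLp_coord h.mema i)) ?_
      have h3 := hunl.const_mul ((L * ‖(spDir i : ℝ × Ed d)‖) ^ 2)
      rw [mul_zero] at h3
      refine squeeze_zero (fun n => integral_nonneg fun z => sq_nonneg _) (fun n => ?_) h3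
      rw [← integral_const_mul]
      refine integral_mono ((h1 n).sub h2).integrable_sq
        (((hunm n).sub h.memu).integrable_sq.const_mul _) fun z => ?_
      simp only [Pi.sub_apply]
      rw [← sub_mul, ← mul_pow, ← sq_abs, ← sq_abs ((L * ‖(spDir i : ℝ × Ed d)‖) * _), abs_mul,
        abs_mul, mul_comm, abs_of_nonneg (by positivity : 0 ≤ L * ‖(spDir i : ℝ × Ed d)‖)]
      exact pow_le_pow_left₀ (by positivity) (mul_le_mul (hb _) (hΦ.abs_sub_le _ _)
          (abs_nonneg _) (by positivity)) 2
  -- the nonlocal and lower order terms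
  have hL3 : Tendsto (fun n => nlForm κ u (φ n)) atTop (𝓝 (nlForm κ u ψ₀)) :=
    h.jump.tendsto_nlForm hd hs0 hs1 h.meas (fun n => (hφc n).continuous.measurable) h.memu T0.2
      hφm M1 (fun n => DiffBound.mollify (hψm n).2 (hψm n).1 n) hφl
  have hL4 : Tendsto (fun n => ∫ z, f z * φ n z) atTop (𝓝 (∫ z, f z * ψ₀ z)) :=
    tendsto_integral_mul_of_sq (fun _ => h.memf) hφm h.memf T0.2 (by simp) hφl
  simp_rw [hT1] at hev
  exact tendsto_nhds_unique (((hL1.neg.add hL2).add hL3).add hL4)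
    (tendsto_const_nhds.congr' (by filter_upwards [hev] with n hn using hn.symm))

end Energy

/-- Continuous approximation of the indicator of `(ℓ, ∞)`. -/
def stepApprox (ℓ : ℝ) (k : ℕ) (r : ℝ) : ℝ := max 0 (min 1 (k * (r - ℓ)))

/-- `C¹` approximation of the positive part `(r - ℓ)₊`. -/
def posApprox (ℓ : ℝ) (k : ℕ) (r : ℝ) : ℝ := ∫ x in ℓ..r, stepApprox ℓ k x

/-- `C²` approximation of `(r - ℓ)₊² / 2`. -/
def sqApprox (ℓ : ℝ) (k : ℕ) (r : ℝ) : ℝ := ∫ x in ℓ..r, posApprox ℓ k x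

/-- Positive part above the level `ℓ`. -/
def posAbove (ℓ r : ℝ) : ℝ := max (r - ℓ) 0

section Trunc

variable {ℓ : ℝ} {k : ℕ} {r : ℝ}

lemma continuous_stepApprox : Continuous (stepApprox ℓ k) := by unfold stepApprox; fun_prop

lemma stepApprox_nonneg : 0 ≤ stepApprox ℓ k r := le_max_left _ _

lemma stepApprox_le_one : stepApprox ℓ k r ≤ 1 := max_le zero_le_one (min_le_left _ _)

lemma stepApprox_of_le (h : r ≤ ℓ) : stepApprox ℓ k r = 0 :=
  max_eq_left ((min_le_right _ _).trans (mul_nonpos_of_nonneg_of_nonpos (by positivity)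
    (by linarith)))

lemma tendsto_stepApprox (ℓ r : ℝ) :
    Tendsto (fun k => stepApprox ℓ k r) atTop (𝓝 ((Ioi ℓ).indicator 1 r)) := by
  rcases le_or_gt r ℓ with h | h
  · simp [stepApprox_of_le h, h.not_gt]
  · rw [indicator_of_mem (mem_Ioi.2 h)]
    refine tendsto_const_nhds.congr' ?_
    have : Tendsto (fun k : ℕ => (k : ℝ) * (r - ℓ)) atTop atTop :=
      tendsto_natCast_atTop_atTop.atTop_mul_const (by linarith)
    filter_upwards [this.eventually_ge_atTop 1] with k hk
    simp [stepApprox, min_eq_left hk]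

lemma hasDerivAt_posApprox (ℓ : ℝ) (k : ℕ) (r : ℝ) :
    HasDerivAt (posApprox ℓ k) (stepApprox ℓ k r) r :=
  intervalIntegral.integral_hasDerivAt_right (continuous_stepApprox.intervalIntegrable _ _)
    (continuous_stepApprox.stronglyMeasurableAtFilter _ _) continuous_stepApprox.continuousAt

lemma continuous_posApprox : Continuous (posApprox ℓ k) :=
  continuous_iff_continuousAt.2 fun r => (hasDerivAt_posApprox ℓ k r).continuousAt

lemma posApprox_of_le (h : r ≤ ℓ) : posApprox ℓ k r = 0 := by
  unfold posApprox
  rw [intervalIntegral.integral_congr (g := fun _ => 0), intervalIntegral.integral_zero]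
  intro x hx
  rw [uIcc_of_ge h] at hx
  exact stepApprox_of_le hx.2

lemma posApprox_nonneg : 0 ≤ posApprox ℓ k r := by
  rcases le_total r ℓ with h | h
  · rw [posApprox_of_le h]
  · exact intervalIntegral.integral_nonneg h fun _ _ => stepApprox_nonneg

lemma posAbove_nonneg (ℓ r : ℝ) : 0 ≤ posAbove ℓ r := le_max_right _ _

lemma posAbove_of_le (h : r ≤ ℓ) : posAbove ℓ r = 0 := max_eq_right (by linarith)

lemma posAbove_of_ge (h : ℓ ≤ r) : posAbove ℓ r = r - ℓ := max_eq_left (by linarith)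

lemma posApprox_le : posApprox ℓ k r ≤ posAbove ℓ r := by
  rcases le_total r ℓ with h | h
  · rw [posApprox_of_le h]; exact posAbove_nonneg _ _
  · rw [posAbove_of_ge h]
    calc posApprox ℓ k r ≤ ∫ x in ℓ..r, (1 : ℝ) :=
          intervalIntegral.integral_mono_on h (continuous_stepApprox.intervalIntegrable _ _)
            intervalIntegrable_const fun _ _ => stepApprox_le_one
      _ = r - ℓ := by simp

lemma posAbove_le_abs (h : 0 ≤ ℓ) : posAbove ℓ r ≤ |r| :=
  max_le (by linarith [le_abs_self r]) (abs_nonneg r)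

lemma continuous_posAbove : Continuous (posAbove ℓ) := by unfold posAbove; fun_prop

lemma abs_posAbove_sub_le (ℓ a b : ℝ) : |posAbove ℓ a - posAbove ℓ b| ≤ |a - b| := by
  refine (abs_max_sub_max_le_abs _ _ _).trans (by simp)

lemma abs_posAbove_le (h : 0 ≤ ℓ) (r : ℝ) : |posAbove ℓ r| ≤ |r| := by
  rw [abs_of_nonneg (posAbove_nonneg _ _)]; exact posAbove_le_abs h

lemma sqApprox_of_le (h : r ≤ ℓ) : sqApprox ℓ k r = 0 := by
  unfold sqApprox
  rw [intervalIntegral.integral_congr (g := fun _ => 0), intervalIntegral.integral_zero]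
  intro x hx
  rw [uIcc_of_ge h] at hx
  exact posApprox_of_le hx.2

lemma abs_sqApprox_le (hℓ : 0 ≤ ℓ) (r : ℝ) : |sqApprox ℓ k r| ≤ r ^ 2 := by
  rcases le_total r ℓ with h | h
  · rw [sqApprox_of_le h, abs_zero]; positivity
  · have h1 := intervalIntegral.norm_integral_le_of_norm_le_const (a := ℓ) (b := r) (C := r - ℓ)
      (f := posApprox ℓ k) fun x hx => by
        rw [uIoc_of_le h] at hx
        rw [Real.norm_of_nonneg posApprox_nonneg]
        exact posApprox_le.trans (by rw [posAbove_of_ge hx.1.le]; linarith [hx.2])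
    rw [abs_of_nonneg (by linarith : 0 ≤ r - ℓ)] at h1
    exact h1.trans (by nlinarith)

lemma truncFun_posApprox (hℓ : 0 ≤ ℓ) (k : ℕ) :
    TruncFun (posApprox ℓ k) (stepApprox ℓ k) (sqApprox ℓ k) where
  deriv := hasDerivAt_posApprox ℓ k
  cont := continuous_stepApprox
  nonneg' _ := stepApprox_nonneg
  le_one _ := stepApprox_le_one
  nonneg _ := posApprox_nonneg
  le _ := posApprox_le.trans (posAbove_le_abs hℓ)
  prim _ := intervalIntegral.integral_hasDerivAt_right (continuous_posApprox.intervalIntegrable _ _)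
    (continuous_posApprox.stronglyMeasurableAtFilter _ _) continuous_posApprox.continuousAt
  prim_le := abs_sqApprox_le hℓ

lemma tendsto_posApprox (ℓ r : ℝ) :
    Tendsto (fun k => posApprox ℓ k r) atTop (𝓝 (posAbove ℓ r)) := by
  rcases le_total r ℓ with h | h
  · simp [posApprox_of_le h, posAbove_of_le h]
  · have h1 := intervalIntegral.tendsto_integral_filter_of_dominated_convergence (a := ℓ) (b := r)
      (μ := volume) (F := fun k => stepApprox ℓ k) (f := fun _ => (1 : ℝ)) (l := atTop)
      (fun _ => 1) (Eventually.of_forall fun k => continuous_stepApprox.aestronglyMeasurable)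
      (Eventually.of_forall fun k => ae_of_all _ fun x _ => by
        rw [Real.norm_of_nonneg stepApprox_nonneg]; exact stepApprox_le_one)
      intervalIntegrable_const (ae_of_all _ fun x hx => by
        rw [uIoc_of_le h] at hx
        simpa [hx.1] using tendsto_stepApprox ℓ x)
    rw [posAbove_of_ge h]
    simpa [posApprox] using h1

lemma tendsto_sqApprox (ℓ r : ℝ) :
    Tendsto (fun k => sqApprox ℓ k r) atTop (𝓝 (posAbove ℓ r ^ 2 / 2)) := by
  rcases le_total r ℓ with h | h
  · simp [sqApprox_of_le h, posAbove_of_le h]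
  · have h1 := intervalIntegral.tendsto_integral_filter_of_dominated_convergence (a := ℓ) (b := r)
      (μ := volume) (F := fun k => posApprox ℓ k) (f := fun x => x - ℓ) (l := atTop)
      (fun _ => r - ℓ) (Eventually.of_forall fun k => continuous_posApprox.aestronglyMeasurable)
      (Eventually.of_forall fun k => ae_of_all _ fun x hx => by
        rw [uIoc_of_le h] at hx
        rw [Real.norm_of_nonneg posApprox_nonneg]
        exact posApprox_le.trans (by rw [posAbove_of_ge hx.1.le]; linarith [hx.2]))
      intervalIntegrable_const (ae_of_all _ fun x hx => by
        rw [uIoc_of_le h] at hx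
        simpa [posAbove_of_ge hx.1.le] using tendsto_posApprox ℓ x)
    rw [posAbove_of_ge h]
    have h2 : ∫ x in ℓ..r, (x - ℓ) = (r - ℓ) ^ 2 / 2 := by
      rw [intervalIntegral.integral_sub (by simp) (by simp)]
      simp
      ring
    rwa [h2] at h1

end Trunc

section Energy

variable {d : ℕ} {s Λ : ℝ} {P : Set (ℝ × Ed d)} {u f : ℝ × Ed d → ℝ}
  {Du a : ℝ × Ed d → Ed d} {κ : ℝ × Ed d → Ed d → ℝ}

lemma inner_eq_sum_coord (x y : Ed d) : ⟪x, y⟫ = ∑ i, x i * y i := by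
  simp [PiLp.inner_apply, mul_comm]

/-- Energy identity for truncations at a nonnegative level. -/
lemma WeakEq.energy_pos (hd : 2 ≤ d) (hs0 : 0 < s) (hs1 : s < 1)
    (h : WeakEq s Λ P u f Du a κ) (hP : IsOpen P) {ℓ : ℝ} (hℓ : 0 ≤ ℓ)
    {ζ : ℝ × Ed d → ℝ} (hζ : ContDiff ℝ (⊤ : ℕ∞) ζ) (hζs : HasCompactSupport ζ)
    (hζP : tsupport ζ ⊆ P) :
    -(∫ z, posAbove ℓ (u z) ^ 2 / 2 * fderiv ℝ ζ z (1, 0))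
      + (∫ z, (Ioi ℓ).indicator 1 (u z) * ⟪a z, Du z⟫ * ζ z)
      + (∫ z, posAbove ℓ (u z) * fderiv ℝ ζ z (0, a z))
      + nlForm κ u (fun z => posAbove ℓ (u z) * ζ z)
      + ∫ z, f z * (posAbove ℓ (u z) * ζ z) = 0 := by
  have hζ1 : ContDiff ℝ 1 ζ := hζ.of_le (by exact_mod_cast le_top)
  obtain ⟨C, L, hC0, hL0, hC, hL, hL'⟩ := exists_cutoff_bounds hζ1 hζs
  have hdζ : ∀ e, Continuous fun z => fderiv ℝ ζ z e := fun e =>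
    (hζ1.continuous_fderiv one_ne_zero).clm_apply continuous_const
  have hm := h.meas
  have hΦ := fun k => truncFun_posApprox hℓ k
  have M1 := diffBound_of_weakGrad h.memu h.memDu h.grad
  have Tk := fun k => M1.trunc (hΦ k) h.memu hC hL hζ.continuous.measurable le_rfl
  have T0 := M1.lipschitz_mul (continuous_posAbove (ℓ := ℓ)) (abs_posAbove_sub_le ℓ)
    (abs_posAbove_le hℓ) h.memu hC hL hζ.continuous.measurable le_rfl
  have hi : Measurable fun z => (Ioi ℓ).indicator (1 : ℝ → ℝ) (u z) :=
    (measurable_one.indicator measurableSet_Ioi).comp hm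
  have hadi : ∀ i, Integrable fun z => a z i * Du z i := fun i =>
    integrable_mul_of_memLp_two (memLp_coord h.mema i) (memLp_coord h.memDu i)
  have hE := fun k => h.energy_trunc hd hs0 hs1 hP (hΦ k) hζ hζs hζP
  -- the parabolic term
  have l1 : Tendsto (fun k => ∫ z, sqApprox ℓ k (u z) * fderiv ℝ ζ z (1, 0)) atTop
      (𝓝 (∫ z, posAbove ℓ (u z) ^ 2 / 2 * fderiv ℝ ζ z (1, 0))) := by
    refine tendsto_integral_of_dominated_convergence
      (fun z => (L * ‖((1 : ℝ), (0 : Ed d))‖) * u z ^ 2) (fun k => ?_)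
      (h.memu.integrable_sq.const_mul _) (fun k => ae_of_all _ fun z => ?_) (ae_of_all _ fun z => ?_)
    · exact ((hΦ k).contDiff_prim.continuous.comp_aestronglyMeasurable h.memu.1).mul
        (hdζ _).aestronglyMeasurable
    · rw [norm_mul, mul_comm]
      exact mul_le_mul (hL' z _) ((hΦ k).prim_le _) (abs_nonneg _) (by positivity)
    · exact (tendsto_sqApprox ℓ (u z)).mul_const _
  -- the diffusion terms
  have l2 : ∀ i, Tendsto (fun k => ∫ z, a z i * Du z i * (stepApprox ℓ k (u z) * ζ z)) atTop
      (𝓝 (∫ z, a z i * Du z i * ((Ioi ℓ).indicator 1 (u z) * ζ z))) := fun i => by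
    refine tendsto_integral_of_dominated_convergence
      (fun z => C * |a z i * Du z i|) (fun k => ?_)
      ((hadi i).abs.const_mul _) (fun k => ae_of_all _ fun z => ?_) (ae_of_all _ fun z => ?_)
    · exact (hadi i).1.mul (((hΦ k).cont.comp_aestronglyMeasurable h.memu.1).mul
        hζ.continuous.aestronglyMeasurable)
    · rw [norm_mul, mul_comm]
      refine mul_le_mul_of_nonneg_right ?_ (abs_nonneg _)
      rw [norm_mul, ← one_mul C, Real.norm_of_nonneg stepApprox_nonneg]
      exact mul_le_mul stepApprox_le_one (hC z) (abs_nonneg _) zero_le_one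
    · exact ((tendsto_stepApprox ℓ (u z)).mul_const _).const_mul _
  have l3 : ∀ i, Tendsto (fun k => ∫ z, a z i * (posApprox ℓ k (u z) * fderiv ℝ ζ z (spDir i)))
      atTop (𝓝 (∫ z, a z i * (posAbove ℓ (u z) * fderiv ℝ ζ z (spDir i)))) := fun i => by
    refine tendsto_integral_of_dominated_convergence
      (fun z => (L * ‖(spDir i : ℝ × Ed d)‖) * |a z i * u z|) (fun k => ?_)
      ((integrable_mul_of_memLp_two (memLp_coord h.mema i) h.memu).abs.const_mul _)
      (fun k => ae_of_all _ fun z => ?_) (ae_of_all _ fun z => ?_)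
    · exact (memLp_coord h.mema i).1.mul
        (((hΦ k).contDiff.continuous.comp_aestronglyMeasurable h.memu.1).mul
        (hdζ _).aestronglyMeasurable)
    · rw [norm_mul, norm_mul, abs_mul]
      have h1 := mul_le_mul ((hΦ k).abs_le (u z)) (hL' z (spDir i)) (abs_nonneg _) (abs_nonneg _)
      calc _ ≤ |a z i| * (|u z| * (L * ‖(spDir i : ℝ × Ed d)‖)) :=
            mul_le_mul_of_nonneg_left h1 (abs_nonneg _)
        _ = _ := by ring
    · exact ((tendsto_posApprox ℓ (u z)).mul_const _).const_mul _
  have l2' : ∑ i, ((∫ z, a z i * Du z i * ((Ioi ℓ).indicator 1 (u z) * ζ z))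
        + ∫ z, a z i * (posAbove ℓ (u z) * fderiv ℝ ζ z (spDir i)))
      = (∫ z, (Ioi ℓ).indicator 1 (u z) * ⟪a z, Du z⟫ * ζ z)
        + ∫ z, posAbove ℓ (u z) * fderiv ℝ ζ z (0, a z) := by
    have i1 : ∀ i, Integrable fun z => a z i * Du z i * ((Ioi ℓ).indicator 1 (u z) * ζ z) :=
      fun i => (hadi i).mul_bdd (c := C) (hi.aestronglyMeasurable.mul
        hζ.continuous.aestronglyMeasurable) (ae_of_all _ fun z => by
          rw [norm_mul, ← one_mul C]
          refine mul_le_mul ?_ (hC z) (norm_nonneg _) zero_le_one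
          by_cases hz : u z ∈ Ioi ℓ <;> simp [hz])
    have i2 : ∀ i, Integrable fun z => a z i * (posAbove ℓ (u z) * fderiv ℝ ζ z (spDir i)) :=
      fun i => integrable_mul_of_memLp_two (memLp_coord h.mema i)
        (memLp_mul_bdd (C := L * ‖(spDir i : ℝ × Ed d)‖) (h.memu.of_le
          (continuous_posAbove.comp_aestronglyMeasurable h.memu.1)
          (ae_of_all _ fun z => abs_posAbove_le hℓ _)) (hdζ _).aestronglyMeasurable
          fun z => hL' z _)
    rw [Finset.sum_add_distrib, ← integral_finsetSum _ fun i _ => i1 i,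
      ← integral_finsetSum _ fun i _ => i2 i]
    congr 1 <;> refine integral_congr_ae (ae_of_all _ fun z => ?_) <;> simp only
    · rw [inner_eq_sum_coord, Finset.mul_sum, Finset.sum_mul]
      exact Finset.sum_congr rfl fun i _ => by ring
    · rw [fderiv_spatial_eq_sum, Finset.mul_sum]
      exact Finset.sum_congr rfl fun i _ => by ring
  -- the nonlocal and lower order terms
  have hcl : Tendsto (fun k => ∫ z, (posApprox ℓ k (u z) * ζ z - posAbove ℓ (u z) * ζ z) ^ 2) atTop
      (𝓝 0) := by
    have : Tendsto (fun k => ∫ z, (posApprox ℓ k (u z) * ζ z - posAbove ℓ (u z) * ζ z) ^ 2) atTop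
        (𝓝 (∫ _z : ℝ × Ed d, (0 : ℝ))) := by
      refine tendsto_integral_of_dominated_convergence
        (fun z => C ^ 2 * u z ^ 2) (fun k => ?_)
        (h.memu.integrable_sq.const_mul _) (fun k => ae_of_all _ fun z => ?_)
        (ae_of_all _ fun z => ?_)
      · exact ((Tk k).2.1.sub T0.2.1).pow 2
      · have h1 : |posApprox ℓ k (u z) - posAbove ℓ (u z)| ≤ |u z| := by
          rw [abs_sub_comm, abs_of_nonneg (by linarith [posApprox_le (ℓ := ℓ) (k := k) (r := u z)])]
          linarith [posApprox_nonneg (ℓ := ℓ) (k := k) (r := u z), posAbove_le_abs (r := u z) hℓ]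
        rw [norm_pow, Real.norm_eq_abs, sq_abs, ← sub_mul, ← mul_pow, ← sq_abs, ← sq_abs (C * _),
          abs_mul, abs_mul, mul_comm, abs_of_nonneg hC0]
        exact pow_le_pow_left₀ (by positivity) (mul_le_mul (hC _) h1 (abs_nonneg _) hC0) 2
      · have h1 := ((((tendsto_posApprox ℓ (u z)).mul_const (ζ z)).sub_const
          (posAbove ℓ (u z) * ζ z)).pow 2)
        simpa using h1
    simpa using this
  have l4 := h.jump.tendsto_nlForm hd hs0 hs1 h.meas
    (fun k => ((hΦ k).contDiff.continuous.measurable.comp hm).mul hζ.continuous.measurable)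
    h.memu T0.2 (fun k => (Tk k).2) M1 (fun k => (Tk k).1) hcl
  have l5 : Tendsto (fun k => ∫ z, f z * (posApprox ℓ k (u z) * ζ z)) atTop
      (𝓝 (∫ z, f z * (posAbove ℓ (u z) * ζ z))) :=
    tendsto_integral_mul_of_sq (fun _ => h.memf) (fun k => (Tk k).2) h.memf T0.2 (by simp) hcl
  have l23 := tendsto_finsetSum Finset.univ fun i _ => (l2 i).add (l3 i)
  rw [l2'] at l23
  have := tendsto_nhds_unique ((((l1.neg.add l23).add l4).add l5)) (tendsto_const_nhds.congr
    fun k => (hE k).symm)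
  linarith

end Energy

/-- Smooth time cutoff equal to one before `τ - 2 / (n + 1)` and zero after `τ + 2 / (n + 1)`. -/
def timeCut (τ : ℝ) (n : ℕ) (t : ℝ) : ℝ := ∫ y in t..(τ + 4), molKernel volume n (τ - y)

section TimeCut

variable {τ t : ℝ} {n : ℕ}

lemma continuous_molKernel_sub (τ : ℝ) (n : ℕ) :
    Continuous fun y : ℝ => molKernel volume n (τ - y) :=
  (molKernel_contDiff n).continuous.comp (by fun_prop)

lemma molKernel_eq_zero {x : ℝ} (h : 2 / ((n : ℝ) + 1) ≤ |x|) : molKernel volume n x = 0 := by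
  have : x ∉ Function.support (molKernel (volume : Measure ℝ) n) := by
    rw [molKernel, ContDiffBump.support_normed_eq]
    simpa [bumpSeq] using h
  simpa using this

lemma hasDerivAt_timeCut (τ : ℝ) (n : ℕ) (t : ℝ) :
    HasDerivAt (timeCut τ n) (-molKernel volume n (τ - t)) t :=
  intervalIntegral.integral_hasDerivAt_left
    ((continuous_molKernel_sub τ n).intervalIntegrable _ _)
    ((continuous_molKernel_sub τ n).stronglyMeasurableAtFilter _ _)
    (continuous_molKernel_sub τ n).continuousAt

lemma contDiff_timeCut (τ : ℝ) (n : ℕ) : ContDiff ℝ (⊤ : ℕ∞) (timeCut τ n) := by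
  rw [contDiff_infty_iff_deriv]
  refine ⟨fun t => (hasDerivAt_timeCut τ n t).differentiableAt, ?_⟩
  rw [show deriv (timeCut τ n) = fun t => -molKernel volume n (τ - t) from
    funext fun t => (hasDerivAt_timeCut τ n t).deriv]
  exact ((molKernel_contDiff n).comp (contDiff_const.sub contDiff_id)).neg

lemma timeCut_eq_zero (h : τ + 2 / ((n : ℝ) + 1) ≤ t) : timeCut τ n t = 0 := by
  have h2 : 2 / ((n : ℝ) + 1) ≤ 2 := div_le_self zero_le_two (by linarith [n.cast_nonneg (α := ℝ)])
  unfold timeCut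
  rw [intervalIntegral.integral_congr (g := fun _ => 0), intervalIntegral.integral_zero]
  intro x hx
  refine molKernel_eq_zero ?_
  rw [abs_sub_comm]
  refine le_trans ?_ (le_abs_self _)
  have := hx.1
  rcases min_le_iff.1 this with h3 | h3 <;> linarith

lemma timeCut_nonneg (τ : ℝ) (n : ℕ) (t : ℝ) : 0 ≤ timeCut τ n t := by
  rcases le_total t (τ + 4) with h | h
  · exact intervalIntegral.integral_nonneg h fun _ _ => molKernel_nonneg _ _
  · have h2 : 2 / ((n : ℝ) + 1) ≤ 2 :=
      div_le_self zero_le_two (by linarith [n.cast_nonneg (α := ℝ)])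
    rw [timeCut_eq_zero (by linarith)]

lemma integrable_molKernel_sub (τ : ℝ) (n : ℕ) :
    Integrable fun y : ℝ => molKernel volume n (τ - y) :=
  ((molKernel_contDiff n).continuous.integrable_of_hasCompactSupport
    (molKernel_hasCompactSupport n)).comp_sub_left τ

lemma integral_molKernel_sub (τ : ℝ) (n : ℕ) : ∫ y : ℝ, molKernel volume n (τ - y) = 1 := by
  rw [integral_sub_left_eq_self (fun y => molKernel volume n y) volume τ, molKernel_integral]

lemma timeCut_le_one (τ : ℝ) (n : ℕ) (t : ℝ) : timeCut τ n t ≤ 1 := by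
  rcases le_total t (τ + 4) with h | h
  · rw [timeCut, intervalIntegral.integral_of_le h, ← integral_molKernel_sub τ n]
    exact setIntegral_le_integral (integrable_molKernel_sub τ n)
      (ae_of_all _ fun _ => molKernel_nonneg _ _)
  · have h2 : 2 / ((n : ℝ) + 1) ≤ 2 :=
      div_le_self zero_le_two (by linarith [n.cast_nonneg (α := ℝ)])
    rw [timeCut_eq_zero (by linarith)]
    exact zero_le_one

lemma timeCut_eq_one (h : t ≤ τ - 2 / ((n : ℝ) + 1)) : timeCut τ n t = 1 := by
  have h2 : 2 / ((n : ℝ) + 1) ≤ 2 := div_le_self zero_le_two (by linarith [n.cast_nonneg (α := ℝ)])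
  have h3 : 0 < 2 / ((n : ℝ) + 1) := by positivity
  rw [timeCut, intervalIntegral.integral_of_le (by linarith), ← integral_molKernel_sub τ n]
  refine setIntegral_eq_integral_of_forall_compl_eq_zero fun x hx => molKernel_eq_zero ?_
  rw [mem_Ioc, not_and_or, not_lt, not_le] at hx
  rcases hx with hx | hx
  · exact le_trans (by linarith) (le_abs_self _)
  · exact le_trans (by linarith) (neg_le_abs _)

end TimeCut

section Cross

variable {d : ℕ} {s Λ : ℝ} {κ : ℝ × Ed d → Ed d → ℝ}

/-- Nonlocal error produced by localising with `η`. -/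
def crossForm (κ : ℝ × Ed d → Ed d → ℝ) (p η : ℝ × Ed d → ℝ) : ℝ :=
  ∫ h, ∫ z, p (z + (0, h)) * p z * (spDiff η h z ^ 2 * κ z h)

lemma JumpBound.integrable_cross_inner (hκ : JumpBound s Λ κ) {p η : ℝ × Ed d → ℝ}
    (hp : MemLp p 2) (hη : Measurable η) {C L : ℝ} (hC : ∀ z, |η z| ≤ C)
    (hL : ∀ h z, |spDiff η h z| ≤ L * ‖h‖) (h : Ed d) :
    Integrable (fun z => p (z + (0, h)) * p z * (spDiff η h z ^ 2 * κ z h)) ∧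
      |∫ z, p (z + (0, h)) * p z * (spDiff η h z ^ 2 * κ z h)|
        ≤ (∫ z, p z ^ 2) * ((L + 2 * C) ^ 2 * Λ) * (‖h‖ ^ (-((d : ℝ) + 2 * s)) * min (‖h‖ ^ 2) 1)
        := by
  have hps := memLp_two_comp_add hp ((0, h) : ℝ × Ed d)
  have hk : ∀ z, |spDiff η h z ^ 2 * κ z h|
      ≤ (L + 2 * C) ^ 2 * min (‖h‖ ^ 2) 1 * (Λ * ‖h‖ ^ (-((d : ℝ) + 2 * s))) := fun z => by
    rw [abs_of_nonneg (mul_nonneg (sq_nonneg _) (hκ.nonneg z h))]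
    exact mul_le_mul (spDiff_sq_le_min hC hL h z) (hκ.le z h) (hκ.nonneg z h) (by positivity)
  have hi := (integrable_mul_of_memLp_two hps hp)
  have hI : Integrable (fun z => p (z + (0, h)) * p z * (spDiff η h z ^ 2 * κ z h)) :=
    hi.mul_bdd (((((measurable_spDiff_uncurry hη).comp (measurable_const.prodMk
      measurable_id)).pow_const 2).mul (hκ.measurable_left h)).aestronglyMeasurable)
      (ae_of_all _ hk)
  refine ⟨hI, ?_⟩
  have hB : 0 ≤ (L + 2 * C) ^ 2 * min (‖h‖ ^ 2) 1 * (Λ * ‖h‖ ^ (-((d : ℝ) + 2 * s))) :=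
    (abs_nonneg _).trans (hk 0)
  set B := (L + 2 * C) ^ 2 * min (‖h‖ ^ 2) 1 * (Λ * ‖h‖ ^ (-((d : ℝ) + 2 * s))) with hBd
  have hs1 := hps.integrable_sq
  have hs2 := hp.integrable_sq
  calc |∫ z, p (z + (0, h)) * p z * (spDiff η h z ^ 2 * κ z h)|
      ≤ ∫ z, |p (z + (0, h)) * p z * (spDiff η h z ^ 2 * κ z h)| := abs_integral_le_integral_abs
    _ ≤ ∫ z, (B / 2 * p (z + (0, h)) ^ 2 + B / 2 * p z ^ 2) := by
        refine integral_mono hI.abs ((hs1.const_mul _).add (hs2.const_mul _)) fun z => ?_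
        simp only
        rw [abs_mul]
        have h1 : |p (z + (0, h)) * p z| ≤ (p (z + (0, h)) ^ 2 + p z ^ 2) / 2 := by
          rw [abs_le]
          constructor <;>
            nlinarith [sq_nonneg (p (z + (0, h)) - p z), sq_nonneg (p (z + (0, h)) + p z)]
        calc _ ≤ (p (z + (0, h)) ^ 2 + p z ^ 2) / 2 * B :=
              mul_le_mul h1 (hk z) (abs_nonneg _) (by positivity)
          _ = _ := by ring
    _ = B * ∫ z, p z ^ 2 := by
        rw [integral_add (hs1.const_mul _) (hs2.const_mul _), integral_const_mul,
          integral_const_mul, integral_add_right_eq_self (fun z => p z ^ 2)]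
        ring
    _ = _ := by rw [hBd]; ring

lemma JumpBound.integrable_cross_outer (hd : 2 ≤ d) (hs0 : 0 < s) (hs1 : s < 1)
    (hκ : JumpBound s Λ κ) {p η : ℝ × Ed d → ℝ} (hpm : Measurable p)
    (hp : MemLp p 2) (hη : Measurable η) {C L : ℝ} (hC : ∀ z, |η z| ≤ C)
    (hL : ∀ h z, |spDiff η h z| ≤ L * ‖h‖) :
    Integrable fun h => ∫ z, p (z + (0, h)) * p z * (spDiff η h z ^ 2 * κ z h) := by
  refine ((integrable_norm_rpow_mul_min hd hs0 hs1).const_mul _).mono' ?_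
    (ae_of_all _ fun h => (hκ.integrable_cross_inner hp hη hC hL h).2)
  refine StronglyMeasurable.aestronglyMeasurable ?_
  refine StronglyMeasurable.integral_prod_right
    (f := fun h z => p (z + (0, h)) * p z * (spDiff η h z ^ 2 * κ z h)) ?_
  exact (((hpm.comp (by fun_prop)).mul (hpm.comp measurable_snd)).mul
    (((measurable_spDiff_uncurry hη).pow_const 2).mul
    (hκ.meas.comp measurable_swap))).stronglyMeasurable

lemma neg_posAbove_mul_le (ℓ α β x y : ℝ) :
    -(posAbove ℓ α * posAbove ℓ β * (x - y) ^ 2)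
      ≤ (α - β) * (posAbove ℓ α * x ^ 2 - posAbove ℓ β * y ^ 2) := by
  rcases le_total α ℓ with ha | ha <;> rcases le_total β ℓ with hb | hb <;>
    simp only [posAbove_of_le, posAbove_of_ge, ha, hb]
  · simp
  · nlinarith [mul_nonneg (mul_nonneg (sub_nonneg.2 (ha.trans hb)) (sub_nonneg.2 hb)) (sq_nonneg y)]
  · nlinarith [mul_nonneg (mul_nonneg (sub_nonneg.2 (hb.trans ha)) (sub_nonneg.2 ha)) (sq_nonneg x)]
  · nlinarith [sq_nonneg ((α - ℓ) * x - (β - ℓ) * y)]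

end Cross

section Caccioppoli

variable {d : ℕ} {s Λ : ℝ} {P S : Set (ℝ × Ed d)} {u f η : ℝ × Ed d → ℝ}
  {Du a : ℝ × Ed d → Ed d} {κ : ℝ × Ed d → Ed d → ℝ} {t₀ D₁ D₂ : ℝ}

/-- Ellipticity and sign conditions making `u` a subsolution where it is positive. -/
structure Elliptic (Λ : ℝ) (P : Set (ℝ × Ed d)) (u f : ℝ × Ed d → ℝ)
    (Du a : ℝ × Ed d → Ed d) : Prop where
  lower : ∀ᵐ z, z ∈ P → Λ⁻¹ * ‖Du z‖ ^ 2 ≤ ⟪a z, Du z⟫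
  growth : ∀ᵐ z, z ∈ P → ‖a z‖ ≤ Λ * ‖Du z‖
  sign : ∀ᵐ z, z ∈ P → 0 < u z → 0 ≤ f z

/-- A space-time cutoff with quantitative derivative bounds. -/
structure Cutoff (P S : Set (ℝ × Ed d)) (t₀ D₁ D₂ : ℝ) (η : ℝ × Ed d → ℝ) : Prop where
  smooth : ContDiff ℝ (⊤ : ℕ∞) η
  compact : HasCompactSupport η
  nonneg : ∀ z, 0 ≤ η z
  le_one : ∀ z, η z ≤ 1
  supp : tsupport η ⊆ S
  mem : ∀ z ∈ tsupport η, z.1 < t₀ → z ∈ P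
  meas : MeasurableSet S
  time : ∀ z, |fderiv ℝ η z (1, 0)| ≤ D₁
  space : ∀ z e, |fderiv ℝ η z (0, e)| ≤ D₂ * ‖e‖

/-- The right-hand side of the Caccioppoli inequality. -/
def caccBound (Λ : ℝ) (S : Set (ℝ × Ed d)) (κ : ℝ × Ed d → Ed d → ℝ) (η p : ℝ × Ed d → ℝ)
    (D₁ D₂ : ℝ) : ℝ :=
  (D₁ + 2 * Λ ^ 3 * D₂ ^ 2) * (∫ z in S, p z ^ 2) + crossForm κ p η

lemma neg_crossForm_le (hd : 2 ≤ d) (hs0 : 0 < s) (hs1 : s < 1)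
    (h : WeakEq s Λ P u f Du a κ) {ℓ : ℝ} (hℓ : 0 ≤ ℓ) (hη : Cutoff P S t₀ D₁ D₂ η)
    {θ : ℝ → ℝ} (hθ : ContDiff ℝ (⊤ : ℕ∞) θ) (hθ0 : ∀ t, 0 ≤ θ t) (hθ1 : ∀ t, θ t ≤ 1) :
    -crossForm κ (fun z => posAbove ℓ (u z)) η
      ≤ nlForm κ u (fun z => posAbove ℓ (u z) * (η z ^ 2 * θ z.1)) := by
  set ζ : ℝ × Ed d → ℝ := fun z => η z ^ 2 * θ z.1 with hζd
  have hη1 : ContDiff ℝ 1 η := hη.smooth.of_le (by exact_mod_cast le_top)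
  have hζ1 : ContDiff ℝ 1 ζ :=
    (hη1.pow 2).mul ((hθ.of_le (by exact_mod_cast le_top)).comp contDiff_fst)
  have hζs : HasCompactSupport ζ := by
    have : HasCompactSupport fun z => η z * (η z * θ z.1) := hη.compact.mul_right
    convert this using 2 with z
    simp only [hζd]; ring
  obtain ⟨C, L, hC0, hL0, hC, hL, -⟩ := exists_cutoff_bounds hζ1 hζs
  obtain ⟨C', L', hC0', hL0', hC', hL', -⟩ := exists_cutoff_bounds hη1 hη.compact
  have M1 := diffBound_of_weakGrad h.memu h.memDu h.grad
  have T0 := M1.lipschitz_mul (continuous_posAbove (ℓ := ℓ)) (abs_posAbove_sub_le ℓ)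
    (abs_posAbove_le hℓ) h.memu hC hL hζ1.continuous.measurable le_rfl
  have hpm : Measurable fun z => posAbove ℓ (u z) := continuous_posAbove.measurable.comp h.meas
  have hp : MemLp (fun z => posAbove ℓ (u z)) 2 :=
    h.memu.of_le hpm.aestronglyMeasurable (ae_of_all _ fun z => abs_posAbove_le hℓ _)
  unfold crossForm nlForm
  rw [← integral_neg]
  refine integral_mono
    (h.jump.integrable_cross_outer hd hs0 hs1 hpm hp hη1.continuous.measurable hC' hL').neg
    (h.jump.integrable_outer hd hs0 hs1 h.meas (hpm.mul hζ1.continuous.measurable) h.memu T0.2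
      M1 T0.1) fun x => ?_
  simp only
  rw [← integral_neg]
  refine integral_mono
    (h.jump.integrable_cross_inner hp hη1.continuous.measurable hC' hL' x).1.neg
    (h.jump.integrable_inner h.memu T0.2 x) fun z => ?_
  simp only [Pi.neg_apply, spDiff, hζd]
  have h1 := neg_posAbove_mul_le ℓ (u (z + (0, x))) (u z) (η (z + (0, x))) (η z)
  have h2 := posAbove_nonneg ℓ (u (z + (0, x)))
  have h3 := posAbove_nonneg ℓ (u z)
  have h4 := hθ0 z.1
  have h5 := hθ1 z.1
  have e1 : (z + ((0 : ℝ), x)).1 = z.1 := by simp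
  rw [e1]
  set α := posAbove ℓ (u (z + (0, x)))
  set β := posAbove ℓ (u z)
  have h6 : 0 ≤ α * β * (η (z + (0, x)) - η z) ^ 2 := by positivity
  have h7 : -(α * β * (η (z + (0, x)) - η z) ^ 2)
      ≤ (u (z + (0, x)) - u z) * (α * η (z + (0, x)) ^ 2 - β * η z ^ 2) * θ z.1 := by
    nlinarith [mul_le_mul_of_nonneg_right h1 h4]
  calc _ = -(α * β * (η (z + (0, x)) - η z) ^ 2) * κ z x := by ring
    _ ≤ _ := mul_le_mul_of_nonneg_right h7 (h.jump.nonneg z x)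
    _ = _ := by ring

lemma integral_add_four {α : Type*} [MeasurableSpace α] {μ : Measure α} {f₁ f₂ f₃ f₄ : α → ℝ}
    (h₁ : Integrable f₁ μ) (h₂ : Integrable f₂ μ) (h₃ : Integrable f₃ μ) (h₄ : Integrable f₄ μ) :
    ∫ z, (f₁ z + f₂ z + f₃ z + f₄ z) ∂μ
      = (∫ z, f₁ z ∂μ) + (∫ z, f₂ z ∂μ) + (∫ z, f₃ z ∂μ) + ∫ z, f₄ z ∂μ := by
  have h₁₂ : Integrable (fun z => f₁ z + f₂ z) μ := h₁.add h₂
  have h₁₂₃ : Integrable (fun z => f₁ z + f₂ z + f₃ z) μ := h₁₂.add h₃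
  rw [integral_add h₁₂₃ h₄, integral_add h₁₂ h₃, integral_add h₁ h₂]

lemma caccioppoli_test (hd : 2 ≤ d) (hs0 : 0 < s) (hs1 : s < 1) (hΛ : 0 < Λ)
    (h : WeakEq s Λ P u f Du a κ) (he : Elliptic Λ P u f Du a) (hP : IsOpen P) {ℓ : ℝ}
    (hℓ : 0 ≤ ℓ) (hη : Cutoff P S t₀ D₁ D₂ η)
    {θ θ' : ℝ → ℝ} (hθ : ContDiff ℝ (⊤ : ℕ∞) θ) (hθd : ∀ t, HasDerivAt θ (θ' t) t)
    (hθ0 : ∀ t, 0 ≤ θ t) (hθ1 : ∀ t, θ t ≤ 1) (hθs : tsupport θ ⊆ Iio t₀) :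
    Integrable (fun z => posAbove ℓ (u z) ^ 2 * η z ^ 2 * -θ' z.1) ∧
    Integrable (fun z => (Ioi ℓ).indicator 1 (u z) * ‖Du z‖ ^ 2 * η z ^ 2 * θ z.1) ∧
    1 / 2 * (∫ z, posAbove ℓ (u z) ^ 2 * η z ^ 2 * -θ' z.1)
      + (2 * Λ)⁻¹ * (∫ z, (Ioi ℓ).indicator 1 (u z) * ‖Du z‖ ^ 2 * η z ^ 2 * θ z.1)
      ≤ caccBound Λ S κ η (fun z => posAbove ℓ (u z)) D₁ D₂ := by
  set ζ : ℝ × Ed d → ℝ := fun z => η z ^ 2 * θ z.1 with hζd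
  set p : ℝ × Ed d → ℝ := fun z => posAbove ℓ (u z) with hpd
  have hη1 : ContDiff ℝ 1 η := hη.smooth.of_le (by exact_mod_cast le_top)
  have hζ : ContDiff ℝ (⊤ : ℕ∞) ζ := (hη.smooth.pow 2).mul (hθ.comp contDiff_fst)
  have hζ1 : ContDiff ℝ 1 ζ := hζ.of_le (by exact_mod_cast le_top)
  have hζe : ζ = fun z => η z * (η z * θ z.1) := by ext z; simp only [hζd]; ring
  have hζs : HasCompactSupport ζ := by
    rw [hζe]; exact hη.compact.mul_right
  have hζP : tsupport ζ ⊆ P := by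
    intro z hz
    have h1 : z ∈ tsupport η := by
      rw [hζe] at hz; exact tsupport_mul_subset_left hz
    have h2 : z ∈ tsupport fun z : ℝ × Ed d => θ z.1 := tsupport_mul_subset_right hz
    have h3 : z.1 ∈ tsupport θ := tsupport_comp_subset_preimage θ continuous_fst h2
    exact hη.mem z h1 (hθs h3)
  obtain ⟨C, L, hC0, hL0, hC, hL, hL'⟩ := exists_cutoff_bounds hζ1 hζs
  have hdζ : ∀ e, Continuous fun z => fderiv ℝ ζ z e := fun e =>
    (hζ1.continuous_fderiv one_ne_zero).clm_apply continuous_const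
  have hpm : Measurable p := continuous_posAbove.measurable.comp h.meas
  have hp : MemLp p 2 :=
    h.memu.of_le hpm.aestronglyMeasurable (ae_of_all _ fun z => abs_posAbove_le hℓ _)
  have hi : Measurable fun z => (Ioi ℓ).indicator (1 : ℝ → ℝ) (u z) :=
    (measurable_one.indicator measurableSet_Ioi).comp h.meas
  have hi1 : ∀ r, |(Ioi ℓ).indicator (1 : ℝ → ℝ) r| ≤ 1 := fun r => by
    by_cases hz : r ∈ Ioi ℓ <;> simp [hz]
  have hE := h.energy_pos hd hs0 hs1 hP hℓ hζ hζs hζP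
  have hN := neg_crossForm_le hd hs0 hs1 h hℓ hη hθ hθ0 hθ1
  have hθ'c : Continuous θ' := by
    have : deriv θ = θ' := funext fun t => (hθd t).deriv
    rw [← this]
    exact hθ.continuous_deriv (by exact_mod_cast le_top)
  have hfd : ∀ z e, fderiv ℝ ζ z e
      = 2 * η z * fderiv ℝ η z e * θ z.1 + η z ^ 2 * (θ' z.1 * e.1) := by
    intro z e
    have h1 := ((hη1.differentiable one_ne_zero z).hasFDerivAt).pow 2
    have h2 : HasFDerivAt (fun z : ℝ × Ed d => θ z.1)
        (θ' z.1 • ContinuousLinearMap.fst ℝ ℝ (Ed d)) z :=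
      (hθd z.1).comp_hasFDerivAt z hasFDerivAt_fst
    have h3 := (h1.mul h2).fderiv
    have h4 : fderiv ℝ ζ z = _ := h3
    rw [h4]
    simp
    ring
  -- integrability
  have iA : Integrable fun z => p z ^ 2 / 2 * fderiv ℝ ζ z (1, 0) :=
    (hp.integrable_sq.div_const 2).mul_bdd (hdζ _).aestronglyMeasurable
      (ae_of_all _ fun z => hL' z _)
  have iB : Integrable fun z => (Ioi ℓ).indicator 1 (u z) * ⟪a z, Du z⟫ * ζ z := by
    have h1 : Integrable fun z => ⟪a z, Du z⟫ := by
      simp_rw [inner_eq_sum_coord]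
      exact integrable_finsetSum _ fun i _ =>
        integrable_mul_of_memLp_two (memLp_coord h.mema i) (memLp_coord h.memDu i)
    exact (h1.bdd_mul hi.aestronglyMeasurable (ae_of_all _ fun z => hi1 _)).mul_bdd
      hζ1.continuous.aestronglyMeasurable (ae_of_all _ hC)
  have iC : Integrable fun z => p z * fderiv ℝ ζ z (0, a z) := by
    simp_rw [fderiv_spatial_eq_sum, Finset.mul_sum]
    refine integrable_finsetSum _ fun i _ => integrable_mul_of_memLp_two hp
      (memLp_mul_bdd (memLp_coord h.mema i) (hdζ _).aestronglyMeasurable fun z => hL' z _)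
  have iD : Integrable fun z => f z * (p z * ζ z) :=
    integrable_mul_of_memLp_two h.memf (memLp_mul_bdd hp hζ1.continuous.aestronglyMeasurable hC)
  have bη : ∀ z, |η z ^ 2| ≤ 1 := fun z => by
    rw [abs_of_nonneg (by positivity)]
    exact pow_le_one₀ (hη.nonneg z) (hη.le_one z)
  have iF : Integrable fun z => (Ioi ℓ).indicator 1 (u z) * ‖Du z‖ ^ 2 * η z ^ 2 * θ z.1 := by
    refine ((h.memDu.norm.integrable_sq.bdd_mul hi.aestronglyMeasurable
      (ae_of_all _ fun z => hi1 _)).mul_bdd (hη1.continuous.pow 2).aestronglyMeasurable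
      (ae_of_all _ bη)).mul_bdd (c := 1)
      (hθ.continuous.comp continuous_fst).aestronglyMeasurable (ae_of_all _ fun z => ?_)
    change ‖θ z.1‖ ≤ 1
    rw [Real.norm_of_nonneg (hθ0 _)]
    exact hθ1 _
  have iE : Integrable fun z => p z ^ 2 * η z ^ 2 * -θ' z.1 := by
    have hc : HasCompactSupport fun z : ℝ × Ed d => η z * (η z * -θ' z.1) := hη.compact.mul_right
    obtain ⟨B, hB⟩ := (hη1.continuous.mul (hη1.continuous.mul
      (hθ'c.comp continuous_fst).neg)).bounded_above_of_compact_support hc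
    refine (hp.integrable_sq.mul_bdd (hη1.continuous.mul (hη1.continuous.mul
      (hθ'c.comp continuous_fst).neg)).aestronglyMeasurable (ae_of_all _ hB)).congr
      (ae_of_all _ fun z => ?_)
    simp
    ring
  have iG : Integrable fun z => S.indicator (fun z => p z ^ 2) z :=
    hp.integrable_sq.indicator hη.meas
  refine ⟨iE, iF, ?_⟩
  have hpt : ∀ᵐ z, 1 / 2 * (p z ^ 2 * η z ^ 2 * -θ' z.1)
      + (2 * Λ)⁻¹ * ((Ioi ℓ).indicator 1 (u z) * ‖Du z‖ ^ 2 * η z ^ 2 * θ z.1)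
      ≤ (D₁ + 2 * Λ ^ 3 * D₂ ^ 2) * S.indicator (fun z => p z ^ 2) z
        + (-(p z ^ 2 / 2 * fderiv ℝ ζ z (1, 0)) + (Ioi ℓ).indicator 1 (u z) * ⟪a z, Du z⟫ * ζ z
          + p z * fderiv ℝ ζ z (0, a z) + f z * (p z * ζ z)) := by
    filter_upwards [he.lower, he.growth, he.sign] with z h1 h2 h3
    have hD1 : 0 ≤ D₁ := (abs_nonneg _).trans (hη.time z)
    have hS0 : 0 ≤ (D₁ + 2 * Λ ^ 3 * D₂ ^ 2) * S.indicator (fun z => p z ^ 2) z :=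
      mul_nonneg (by positivity) (indicator_nonneg (fun _ _ => sq_nonneg _) _)
    by_cases hzη : z ∈ tsupport η
    swap
    · have e1 : η z = 0 := image_eq_zero_of_notMem_tsupport hzη
      have e2 : ζ z = 0 := by simp [hζd, e1]
      rw [hfd, hfd, e1, e2]
      simpa using hS0
    rcases le_or_gt t₀ z.1 with ht | ht
    · have h5 : z.1 ∉ tsupport θ := fun h => (hθs h).not_ge ht
      have e1 : θ z.1 = 0 := image_eq_zero_of_notMem_tsupport h5
      have e2 : θ' z.1 = 0 := by
        rw [← (hθd z.1).deriv]
        exact image_eq_zero_of_notMem_tsupport fun h => h5 (tsupport_deriv_subset h)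
      have e3 : ζ z = 0 := by simp [hζd, e1]
      rw [hfd, hfd, e1, e2, e3]
      simpa using hS0
    have hzP := hη.mem z hzη ht
    rw [indicator_of_mem (hη.supp hzη)]
    rcases le_or_gt (u z) ℓ with hu | hu
    · have e1 : p z = 0 := posAbove_of_le hu
      have e2 : (Ioi ℓ).indicator (1 : ℝ → ℝ) (u z) = 0 :=
        indicator_of_notMem (fun h => hu.not_gt h) _
      simp [e1, e2]
    have e2 : (Ioi ℓ).indicator (1 : ℝ → ℝ) (u z) = 1 := by
      rw [indicator_of_mem (mem_Ioi.2 hu)]; rfl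
    have hp0 : 0 ≤ p z := posAbove_nonneg _ _
    have hf := h3 hzP (hℓ.trans_lt hu)
    have hl := h1 hzP
    have hg := h2 hzP
    have hθz := hθ0 z.1
    have hθz1 := hθ1 z.1
    have hη0 := hη.nonneg z
    have hηz1 := hη.le_one z
    rw [e2, hfd, hfd]
    simp only [hζd, mul_zero, add_zero, mul_one, one_mul]
    have b1 : |η z * fderiv ℝ η z (1, 0)| ≤ D₁ := by
      rw [abs_mul, abs_of_nonneg hη0]
      exact (mul_le_of_le_one_left (abs_nonneg _) hηz1).trans (hη.time z)
    have hD2 : 0 ≤ D₂ * ‖a z‖ := (abs_nonneg _).trans (hη.space z (a z))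
    have b2 : |fderiv ℝ η z (0, a z)| ≤ D₂ * ‖a z‖ := hη.space z _
    have b3 : p z ^ 2 * (η z * fderiv ℝ η z (1, 0)) * θ z.1 ≤ D₁ * p z ^ 2 := by
      have := (abs_le.1 b1).2
      calc p z ^ 2 * (η z * fderiv ℝ η z (1, 0)) * θ z.1
          ≤ p z ^ 2 * D₁ * θ z.1 := by gcongr
        _ ≤ p z ^ 2 * D₁ * 1 := by gcongr
        _ = _ := by ring
    have b4 : -(fderiv ℝ η z (0, a z) * (2 * η z * p z))
        ≤ Λ⁻¹ * (‖Du z‖ ^ 2 * η z ^ 2) / 2 + 2 * Λ ^ 3 * D₂ ^ 2 * p z ^ 2 := by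
      have c1 : -(fderiv ℝ η z (0, a z) * (2 * η z * p z)) ≤ D₂ * ‖a z‖ * (2 * η z * p z) := by
        rw [← neg_mul]
        exact mul_le_mul_of_nonneg_right ((neg_le_abs _).trans b2) (by positivity)
      have c2 : D₂ * ‖a z‖ ≤ |D₂| * (Λ * ‖Du z‖) :=
        mul_le_mul (le_abs_self _) hg (norm_nonneg _) (abs_nonneg _)
      have c3 : D₂ * ‖a z‖ * (2 * η z * p z) ≤ |D₂| * (Λ * ‖Du z‖) * (2 * η z * p z) :=
        mul_le_mul_of_nonneg_right c2 (by positivity)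
      have c4 : |D₂| * (Λ * ‖Du z‖) * (2 * η z * p z)
          ≤ Λ⁻¹ * (‖Du z‖ ^ 2 * η z ^ 2) / 2 + 2 * Λ ^ 3 * |D₂| ^ 2 * p z ^ 2 := by
        have : Λ⁻¹ * (‖Du z‖ ^ 2 * η z ^ 2) / 2 + 2 * Λ ^ 3 * |D₂| ^ 2 * p z ^ 2
            - |D₂| * (Λ * ‖Du z‖) * (2 * η z * p z)
            = Λ⁻¹ / 2 * (‖Du z‖ * η z - 2 * Λ ^ 2 * |D₂| * p z) ^ 2 := by
          field_simp
          ring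
        have h0 : 0 ≤ Λ⁻¹ / 2 * (‖Du z‖ * η z - 2 * Λ ^ 2 * |D₂| * p z) ^ 2 := by positivity
        linarith
      rw [sq_abs] at c4
      linarith
    have b5 : 2 * Λ ^ 3 * D₂ ^ 2 * p z ^ 2 * θ z.1 ≤ 2 * Λ ^ 3 * D₂ ^ 2 * p z ^ 2 :=
      mul_le_of_le_one_right (by positivity) hθz1
    have b6 := mul_le_mul_of_nonneg_right b4 hθz
    have b7 : Λ⁻¹ * ‖Du z‖ ^ 2 * (η z ^ 2 * θ z.1) ≤ ⟪a z, Du z⟫ * (η z ^ 2 * θ z.1) :=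
      mul_le_mul_of_nonneg_right hl (by positivity)
    have b8 : 0 ≤ f z * (p z * (η z ^ 2 * θ z.1)) := by positivity
    have e3 : (2 * Λ)⁻¹ = Λ⁻¹ / 2 := by rw [mul_inv]; ring
    rw [e3]
    linarith
  have iSum : Integrable fun z => -(p z ^ 2 / 2 * fderiv ℝ ζ z (1, 0))
      + (Ioi ℓ).indicator 1 (u z) * ⟪a z, Du z⟫ * ζ z
          + p z * fderiv ℝ ζ z (0, a z) + f z * (p z * ζ z) := ((iA.neg.add iB).add iC).add iD
  have e5 : ∫ z, (-(p z ^ 2 / 2 * fderiv ℝ ζ z (1, 0))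
      + (Ioi ℓ).indicator 1 (u z) * ⟪a z, Du z⟫ * ζ z
          + p z * fderiv ℝ ζ z (0, a z) + f z * (p z * ζ z))
      = -(∫ z, p z ^ 2 / 2 * fderiv ℝ ζ z (1, 0))
      + (∫ z, (Ioi ℓ).indicator 1 (u z) * ⟪a z, Du z⟫ * ζ z)
      + (∫ z, p z * fderiv ℝ ζ z (0, a z)) + ∫ z, f z * (p z * ζ z) := by
    have := integral_add_four iA.neg iB iC iD
    simp only [Pi.neg_apply] at this
    rw [this, integral_neg]
  have key := integral_mono_ae ((iE.const_mul (1 / 2)).add (iF.const_mul (2 * Λ)⁻¹))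
    ((iG.const_mul (D₁ + 2 * Λ ^ 3 * D₂ ^ 2)).add iSum) hpt
  simp only [Pi.add_apply] at key
  rw [integral_add (iE.const_mul _) (iF.const_mul _), integral_const_mul, integral_const_mul,
    integral_add (iG.const_mul _) iSum, integral_const_mul, integral_indicator hη.meas, e5] at key
  unfold caccBound
  linarith

end Caccioppoli

section CaccioppoliLimits

variable {d : ℕ} {s Λ : ℝ} {P S : Set (ℝ × Ed d)} {u f η : ℝ × Ed d → ℝ}
  {Du a : ℝ × Ed d → Ed d} {κ : ℝ × Ed d → Ed d → ℝ} {t₀ D₁ D₂ : ℝ}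

lemma tsupport_timeCut_subset_Iio {τ : ℝ} {n : ℕ} (h : τ + 2 / ((n : ℝ) + 1) < t₀) :
    tsupport (timeCut τ n) ⊆ Iio t₀ := by
  have : tsupport (timeCut τ n) ⊆ Iic (τ + 2 / ((n : ℝ) + 1)) := by
    refine closure_minimal (fun t ht => ?_) isClosed_Iic
    by_contra h2
    exact ht (timeCut_eq_zero (not_le.1 h2).le)
  exact this.trans fun t ht => lt_of_le_of_lt ht h

lemma caccioppoli_grad (hd : 2 ≤ d) (hs0 : 0 < s) (hs1 : s < 1) (hΛ : 0 < Λ)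
    (h : WeakEq s Λ P u f Du a κ) (he : Elliptic Λ P u f Du a) (hP : IsOpen P) {ℓ : ℝ}
    (hℓ : 0 ≤ ℓ) (hη : Cutoff P S t₀ D₁ D₂ η) (hD : ∀ z, t₀ ≤ z.1 → Du z = 0) :
    ∫ z, (Ioi ℓ).indicator 1 (u z) * ‖Du z‖ ^ 2 * η z ^ 2
      ≤ 2 * Λ * caccBound Λ S κ η (fun z => posAbove ℓ (u z)) D₁ D₂ := by
  set F := caccBound Λ S κ η (fun z => posAbove ℓ (u z)) D₁ D₂
  have hη1 : Continuous η := hη.smooth.continuous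
  have hi : Measurable fun z => (Ioi ℓ).indicator (1 : ℝ → ℝ) (u z) :=
    (measurable_one.indicator measurableSet_Ioi).comp h.meas
  have hi1 : ∀ r, |(Ioi ℓ).indicator (1 : ℝ → ℝ) r| ≤ 1 := fun r => by
    by_cases hz : r ∈ Ioi ℓ <;> simp [hz]
  have bη : ∀ z, |η z ^ 2| ≤ 1 := fun z => by
    rw [abs_of_nonneg (by positivity)]
    exact pow_le_one₀ (hη.nonneg z) (hη.le_one z)
  have iF : Integrable fun z => (Ioi ℓ).indicator 1 (u z) * ‖Du z‖ ^ 2 * η z ^ 2 :=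
    (h.memDu.norm.integrable_sq.bdd_mul hi.aestronglyMeasurable
      (ae_of_all _ fun z => hi1 _)).mul_bdd (hη1.pow 2).aestronglyMeasurable
      (ae_of_all _ bη)
  let τ : ℕ → ℝ := fun n => t₀ - 4 / ((n : ℝ) + 1)
  have hτ : ∀ n : ℕ, τ n + 2 / ((n : ℝ) + 1) < t₀ := fun n => by
    have h1 : 0 < 2 / ((n : ℝ) + 1) := by positivity
    have h2 : 4 / ((n : ℝ) + 1) = 2 / ((n : ℝ) + 1) + 2 / ((n : ℝ) + 1) := by ring
    simp only [τ]
    linarith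
  have hlim : Tendsto (fun n : ℕ => ∫ z, (Ioi ℓ).indicator 1 (u z) * ‖Du z‖ ^ 2 * η z ^ 2
      * timeCut (τ n) n z.1) atTop
      (𝓝 (∫ z, (Ioi ℓ).indicator 1 (u z) * ‖Du z‖ ^ 2 * η z ^ 2)) := by
    refine tendsto_integral_of_dominated_convergence _ (fun n => ?_) iF.norm (fun n => ?_) ?_
    · exact iF.1.mul ((contDiff_timeCut _ _).continuous.comp continuous_fst).aestronglyMeasurable
    · refine ae_of_all _ fun z => ?_
      rw [norm_mul]
      refine mul_le_of_le_one_right (norm_nonneg _) ?_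
      rw [Real.norm_of_nonneg (timeCut_nonneg _ _ _)]
      exact timeCut_le_one _ _ _
    · refine ae_of_all _ fun z => ?_
      rcases le_or_gt t₀ z.1 with ht | ht
      · simp [hD z ht]
      · have h0 : Tendsto (fun n : ℕ => 6 * (1 / ((n : ℝ) + 1))) atTop (𝓝 (6 * 0)) :=
          tendsto_one_div_add_atTop_nhds_zero_nat.const_mul 6
        rw [mul_zero] at h0
        refine tendsto_const_nhds.congr' ?_
        filter_upwards [h0.eventually_le_const (sub_pos.2 ht)] with n hn
        rw [timeCut_eq_one, mul_one]
        have h2 : 6 * (1 / ((n : ℝ) + 1)) = 4 / ((n : ℝ) + 1) + 2 / ((n : ℝ) + 1) := by ring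
        simp only [τ]
        linarith
  refine le_of_tendsto' hlim fun n => ?_
  obtain ⟨-, -, h3⟩ := caccioppoli_test hd hs0 hs1 hΛ h he hP hℓ hη (contDiff_timeCut (τ n) n)
    (hasDerivAt_timeCut (τ n) n) (timeCut_nonneg _ _) (timeCut_le_one _ _)
    (tsupport_timeCut_subset_Iio (hτ n))
  have h4 : 0 ≤ ∫ z, posAbove ℓ (u z) ^ 2 * η z ^ 2 * - -molKernel volume n (τ n - z.1) :=
    integral_nonneg fun z => mul_nonneg (by positivity) (by
      rw [neg_neg]; exact molKernel_nonneg _ _)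
  have h5 : (2 * Λ)⁻¹ * (∫ z, (Ioi ℓ).indicator 1 (u z) * ‖Du z‖ ^ 2 * η z ^ 2
      * timeCut (τ n) n z.1) ≤ F := by linarith
  rwa [inv_mul_le_iff₀ (by positivity)] at h5

lemma caccBound_nonneg (hd : 2 ≤ d) (hs0 : 0 < s) (hs1 : s < 1) (hΛ : 0 < Λ)
    (h : WeakEq s Λ P u f Du a κ) (he : Elliptic Λ P u f Du a) (hP : IsOpen P) {ℓ : ℝ}
    (hℓ : 0 ≤ ℓ) (hη : Cutoff P S t₀ D₁ D₂ η) (hD : ∀ z, t₀ ≤ z.1 → Du z = 0) :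
    0 ≤ caccBound Λ S κ η (fun z => posAbove ℓ (u z)) D₁ D₂ := by
  have h1 := caccioppoli_grad hd hs0 hs1 hΛ h he hP hℓ hη hD
  have h2 : 0 ≤ ∫ z, (Ioi ℓ).indicator 1 (u z) * ‖Du z‖ ^ 2 * η z ^ 2 :=
    integral_nonneg fun z => mul_nonneg (mul_nonneg
      (indicator_nonneg (fun _ _ => zero_le_one) _) (sq_nonneg _)) (sq_nonneg _)
  exact nonneg_of_mul_nonneg_right (h2.trans h1) (by positivity)

lemma caccioppoli_sup (hd : 2 ≤ d) (hs0 : 0 < s) (hs1 : s < 1) (hΛ : 0 < Λ)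
    (h : WeakEq s Λ P u f Du a κ) (he : Elliptic Λ P u f Du a) (hP : IsOpen P) {ℓ : ℝ}
    (hℓ : 0 ≤ ℓ) (hη : Cutoff P S t₀ D₁ D₂ η) (hD : ∀ z, t₀ ≤ z.1 → Du z = 0)
    (hu : ∀ z, t₀ ≤ z.1 → u z = 0) :
    ∀ᵐ t : ℝ, ∫ x, posAbove ℓ (u (t, x)) ^ 2 * η (t, x) ^ 2
      ≤ 2 * caccBound Λ S κ η (fun z => posAbove ℓ (u z)) D₁ D₂ := by
  set F := caccBound Λ S κ η (fun z => posAbove ℓ (u z)) D₁ D₂ with hF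
  have hF0 : 0 ≤ F := caccBound_nonneg hd hs0 hs1 hΛ h he hP hℓ hη hD
  set G : ℝ → ℝ := fun t => ∫ x, posAbove ℓ (u (t, x)) ^ 2 * η (t, x) ^ 2 with hG
  have hη1 : Continuous η := hη.smooth.continuous
  have hpm : Measurable fun z => posAbove ℓ (u z) := continuous_posAbove.measurable.comp h.meas
  have hp : MemLp (fun z => posAbove ℓ (u z)) 2 :=
    h.memu.of_le hpm.aestronglyMeasurable (ae_of_all _ fun z => abs_posAbove_le hℓ _)
  have bη : ∀ z, |η z ^ 2| ≤ 1 := fun z => by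
    rw [abs_of_nonneg (by positivity)]
    exact pow_le_one₀ (hη.nonneg z) (hη.le_one z)
  have ip : Integrable fun z => posAbove ℓ (u z) ^ 2 * η z ^ 2 :=
    hp.integrable_sq.mul_bdd (hη1.pow 2).aestronglyMeasurable (ae_of_all _ bη)
  have iG : Integrable G := by
    rw [Measure.volume_eq_prod] at ip
    exact ip.integral_prod_left
  filter_upwards [mollify_ae_tendsto (μ := volume) iG.locallyIntegrable] with τ hτ
  rcases le_or_gt t₀ τ with ht | ht
  · have : ∀ x, posAbove ℓ (u (τ, x)) = 0 := fun x => by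
      rw [hu _ ht]; exact posAbove_of_le hℓ
    simp only [this]
    simpa using hF0
  refine le_of_tendsto hτ ?_
  have h0 : Tendsto (fun n : ℕ => 2 * (1 / ((n : ℝ) + 1))) atTop (𝓝 (2 * 0)) :=
    tendsto_one_div_add_atTop_nhds_zero_nat.const_mul 2
  rw [mul_zero] at h0
  filter_upwards [h0.eventually_lt_const (sub_pos.2 ht)] with n hn
  have hn' : τ + 2 / ((n : ℝ) + 1) < t₀ := by
    have : 2 * (1 / ((n : ℝ) + 1)) = 2 / ((n : ℝ) + 1) := by ring
    linarith
  obtain ⟨h1, -, h3⟩ := caccioppoli_test hd hs0 hs1 hΛ h he hP hℓ hη (contDiff_timeCut τ n)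
    (hasDerivAt_timeCut τ n) (timeCut_nonneg _ _) (timeCut_le_one _ _)
    (tsupport_timeCut_subset_Iio hn')
  have h4 : 0 ≤ ∫ z, (Ioi ℓ).indicator 1 (u z) * ‖Du z‖ ^ 2 * η z ^ 2 * timeCut τ n z.1 :=
    integral_nonneg fun z => mul_nonneg (mul_nonneg (mul_nonneg
      (indicator_nonneg (fun _ _ => zero_le_one) _) (sq_nonneg _)) (sq_nonneg _))
      (timeCut_nonneg _ _ _)
  have h5 : mollify volume n G τ
      = ∫ z, posAbove ℓ (u z) ^ 2 * η z ^ 2 * - -molKernel volume n (τ - z.1) := by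
    rw [Measure.volume_eq_prod] at h1 ⊢
    rw [integral_prod _ h1, mollify_apply,
      ← integral_sub_left_eq_self (fun y => molKernel volume n y * G (τ - y)) volume τ]
    refine integral_congr_ae (ae_of_all _ fun t => ?_)
    simp only [neg_neg, sub_sub_cancel]
    rw [integral_mul_const, mul_comm]
  rw [h5]
  have h6 : 0 ≤ (2 * Λ)⁻¹ * ∫ z, (Ioi ℓ).indicator 1 (u z) * ‖Du z‖ ^ 2 * η z ^ 2
      * timeCut τ n z.1 := mul_nonneg (by positivity) h4
  linarith

end CaccioppoliLimits

section FaberKrahn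

variable {d : ℕ}

lemma exists_setLIntegral_le_fderiv (hd : 2 ≤ d) : ∃ C : ℝ≥0, ∀ g : Ed d → ℝ, ContDiff ℝ 1 g →
    HasCompactSupport g → ∀ A : Set (Ed d),
      ∫⁻ x in A, ‖g x‖ₑ ≤ C * volume A ^ (1 / (d : ℝ)) * ∫⁻ x, ‖fderiv ℝ g x‖ₑ := by
  have hd1 : (1 : ℝ) < d := by exact_mod_cast hd
  set q : ℝ≥0 := NNReal.conjExponent d with hq
  have hc : NNReal.HolderConjugate (Module.finrank ℝ (Ed d)) q := by
    rw [finrank_euclideanSpace_fin]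
    exact NNReal.HolderConjugate.conjExponent (by exact_mod_cast hd1)
  refine ⟨eLpNormLESNormFDerivOneConst (volume : Measure (Ed d)) q, fun g hg hgs A => ?_⟩
  have h1 := eLpNorm_le_eLpNorm_fderiv_one volume hg hgs hc
  have h2 := eLpNorm_le_eLpNorm_mul_rpow_measure_univ (μ := volume.restrict A) (f := g) (p := 1)
    (q := q) (by exact_mod_cast hc.symm.lt.le) hg.continuous.aestronglyMeasurable
  have e : 1 / (1 : ℝ≥0∞).toReal - 1 / (q : ℝ≥0∞).toReal = 1 / (d : ℝ) := by
    have := hc.coe.inv_add_inv_eq_one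
    rw [finrank_euclideanSpace_fin] at this
    simp only [ENNReal.toReal_one, ENNReal.coe_toReal]
    push_cast at this
    simp only [one_div]
    linarith
  rw [e, Measure.restrict_apply_univ] at h2
  rw [eLpNorm_one_eq_lintegral_enorm] at h2
  rw [eLpNorm_one_eq_lintegral_enorm] at h1
  calc _ ≤ _ := h2
    _ ≤ (eLpNormLESNormFDerivOneConst (volume : Measure (Ed d)) q * ∫⁻ x, ‖fderiv ℝ g x‖ₑ)
        * volume A ^ (1 / (d : ℝ)) := by
      gcongr
      exact (eLpNorm_mono_measure _ Measure.restrict_le_self).trans h1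
    _ = _ := by ring

lemma enorm_fderiv_slice_le {g : ℝ × Ed d → ℝ} (hg : ContDiff ℝ 1 g) (t : ℝ) (x : Ed d) :
    ‖fderiv ℝ (fun x => g (t, x)) x‖ₑ ≤ ENNReal.ofReal (∑ i, |fderiv ℝ g (t, x) (spDir i)|) := by
  rw [← ofReal_norm]
  refine ENNReal.ofReal_le_ofReal ?_
  have h1 : HasFDerivAt (fun x => g (t, x))
      ((fderiv ℝ g (t, x)).comp (ContinuousLinearMap.inr ℝ ℝ (Ed d))) x :=
    (hg.differentiable one_ne_zero (t, x)).hasFDerivAt.comp x (hasFDerivAt_prodMk_right t x)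
  rw [h1.fderiv]
  refine ContinuousLinearMap.opNorm_le_bound _ (Finset.sum_nonneg fun _ _ => abs_nonneg _) fun e => ?_
  simp only [ContinuousLinearMap.comp_apply, ContinuousLinearMap.inr_apply]
  rw [fderiv_spatial_eq_sum, Finset.sum_mul, Real.norm_eq_abs]
  refine (Finset.abs_sum_le_sum_abs _ _).trans (Finset.sum_le_sum fun i _ => ?_)
  rw [abs_mul, mul_comm]
  exact mul_le_mul_of_nonneg_left (by
    simpa using PiLp.norm_apply_le e i) (abs_nonneg _)

lemma exists_setIntegral_le_sum_fderiv (hd : 2 ≤ d) : ∃ C : ℝ, 0 ≤ C ∧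
    ∀ g : ℝ × Ed d → ℝ, ContDiff ℝ 1 g → HasCompactSupport g → ∀ A : Set (ℝ × Ed d),
      MeasurableSet A → ∀ m : ℝ, 0 ≤ m →
      (∀ᵐ t : ℝ, volume (Prod.mk t ⁻¹' A) ≤ ENNReal.ofReal m) →
      ∫ z in A, |g z| ≤ C * m ^ (1 / (d : ℝ)) * ∑ i, ∫ z, |fderiv ℝ g z (spDir i)| := by
  obtain ⟨C, hC⟩ := exists_setLIntegral_le_fderiv hd
  refine ⟨C, C.coe_nonneg, fun g hg hgs A hA m hm hAm => ?_⟩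
  have hdg : ∀ e, Continuous fun z => fderiv ℝ g z e := fun e =>
    (hg.continuous_fderiv one_ne_zero).clm_apply continuous_const
  have i1 : ∀ i, Integrable fun z => |fderiv ℝ g z (spDir i)| := fun i =>
    ((hdg (spDir i)).integrable_of_hasCompactSupport (hgs.fderiv_apply ℝ (spDir i))).abs
  have i2 : Integrable fun z => |g z| := (hg.continuous.integrable_of_hasCompactSupport hgs).abs
  have key : ∫⁻ z in A, ‖g z‖ₑ ≤ C * ENNReal.ofReal m ^ (1 / (d : ℝ))
      * ∫⁻ z, ENNReal.ofReal (∑ i, |fderiv ℝ g z (spDir i)|) := by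
    have hdm : Measurable fun z => ENNReal.ofReal (∑ i, |fderiv ℝ g z (spDir i)|) :=
      (continuous_finsetSum _ fun i _ => (hdg (spDir i)).abs).measurable.ennreal_ofReal
    rw [← lintegral_indicator hA, Measure.volume_eq_prod,
      lintegral_prod _ ((hg.continuous.enorm.measurable.indicator hA).aemeasurable),
      lintegral_prod _ hdm.aemeasurable, ← lintegral_const_mul _ hdm.lintegral_prod_right']
    refine lintegral_mono_ae ?_
    filter_upwards [hAm] with t ht
    have h1 : ∀ x, A.indicator (fun z => ‖g z‖ₑ) (t, x)
        = (Prod.mk t ⁻¹' A).indicator (fun x => ‖g (t, x)‖ₑ) x := fun x => rfl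
    simp only [h1]
    rw [lintegral_indicator (measurable_prodMk_left hA)]
    have h2 : ContDiff ℝ 1 fun x => g (t, x) := hg.comp (contDiff_prodMk_right t)
    have h3 : HasCompactSupport fun x => g (t, x) := by
      refine HasCompactSupport.intro (hgs.isCompact.image continuous_snd) fun x hx => ?_
      by_contra h
      exact hx ⟨(t, x), subset_tsupport _ h, rfl⟩
    calc _ ≤ _ := hC _ h2 h3 _
      _ ≤ _ := by
        gcongr with x
        exact enorm_fderiv_slice_le hg t x
  rw [← ofReal_integral_eq_lintegral_ofReal (integrable_finsetSum _ fun i _ => i1 i)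
    (ae_of_all _ fun z => Finset.sum_nonneg fun _ _ => abs_nonneg _),
    integral_finsetSum _ fun i _ => i1 i] at key
  have e1 : ∫⁻ z in A, ‖g z‖ₑ = ENNReal.ofReal (∫ z in A, |g z|) := by
    rw [ofReal_integral_eq_lintegral_ofReal i2.integrableOn (ae_of_all _ fun z => abs_nonneg _)]
    refine lintegral_congr fun z => ?_
    rw [← ofReal_norm, Real.norm_eq_abs]
  have hS : 0 ≤ ∑ i, ∫ z, |fderiv ℝ g z (spDir i)| :=
    Finset.sum_nonneg fun i _ => integral_nonneg fun _ => abs_nonneg _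
  rw [e1, ENNReal.ofReal_rpow_of_nonneg hm (by positivity), ← ENNReal.ofReal_coe_nnreal,
    ← ENNReal.ofReal_mul C.coe_nonneg, ← ENNReal.ofReal_mul (by positivity)] at key
  exact (ENNReal.ofReal_le_ofReal_iff (by positivity)).1 key

end FaberKrahn

lemma sqApprox_nonneg {ℓ r : ℝ} {k : ℕ} : 0 ≤ sqApprox ℓ k r := by
  rcases le_total r ℓ with h | h
  · rw [sqApprox_of_le h]
  · exact intervalIntegral.integral_nonneg h fun _ _ => posApprox_nonneg

lemma sqApprox_le {ℓ r : ℝ} {k : ℕ} : sqApprox ℓ k r ≤ posAbove ℓ r ^ 2 := by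
  rcases le_total r ℓ with h | h
  · rw [sqApprox_of_le h]; positivity
  · have h1 := intervalIntegral.norm_integral_le_of_norm_le_const (a := ℓ) (b := r) (C := r - ℓ)
      (f := posApprox ℓ k) fun x hx => by
        rw [uIoc_of_le h] at hx
        rw [Real.norm_of_nonneg posApprox_nonneg]
        refine posApprox_le.trans ?_
        rw [posAbove_of_ge hx.1.le]
        linarith [hx.2]
    rw [posAbove_of_ge h]
    rw [abs_of_nonneg (sub_nonneg.2 h)] at h1
    calc sqApprox ℓ k r ≤ ‖sqApprox ℓ k r‖ := Real.le_norm_self _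
      _ ≤ _ := h1
      _ = _ := by ring

section FaberKrahn

variable {d : ℕ} {s Λ : ℝ} {P S : Set (ℝ × Ed d)} {u f η : ℝ × Ed d → ℝ}
  {Du a : ℝ × Ed d → Ed d} {κ : ℝ × Ed d → Ed d → ℝ} {t₀ D₁ D₂ : ℝ}

/-- `C` is a constant for the slicewise Gagliardo-Nirenberg inequality. -/
def SliceSobolev (d : ℕ) (C : ℝ) : Prop :=
  0 ≤ C ∧ ∀ g : ℝ × Ed d → ℝ, ContDiff ℝ 1 g → HasCompactSupport g → ∀ A : Set (ℝ × Ed d),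
      MeasurableSet A → ∀ m : ℝ, 0 ≤ m →
      (∀ᵐ t : ℝ, volume (Prod.mk t ⁻¹' A) ≤ ENNReal.ofReal m) →
      ∫ z in A, |g z| ≤ C * m ^ (1 / (d : ℝ)) * ∑ i, ∫ z, |fderiv ℝ g z (spDir i)|

lemma integral_lipschitz_sq_le {X : Type*} [MeasurableSpace X] {μ : Measure X} {Φ : ℝ → ℝ}
    (hΦ : ∀ a b, |Φ a - Φ b| ≤ |a - b|) {b : X → ℝ} {B : ℝ} (hb : ∀ x, |b x| ≤ B)
    {f g : X → ℝ} (hf : MemLp f 2 μ) (hg : MemLp g 2 μ) :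
    ∫ x, (Φ (f x) * b x - Φ (g x) * b x) ^ 2 ∂μ ≤ B ^ 2 * ∫ x, (f x - g x) ^ 2 ∂μ := by
  rw [← integral_const_mul]
  refine integral_mono_of_nonneg (ae_of_all _ fun x => sq_nonneg _)
    ((hf.sub hg).integrable_sq.const_mul _) (ae_of_all _ fun x => ?_)
  have h1 : (Φ (f x) - Φ (g x)) ^ 2 ≤ (f x - g x) ^ 2 := sq_le_sq.2 (hΦ _ _)
  have h2 : b x ^ 2 ≤ B ^ 2 := sq_le_sq.2 ((hb x).trans (le_abs_self B))
  calc (Φ (f x) * b x - Φ (g x) * b x) ^ 2 = b x ^ 2 * (Φ (f x) - Φ (g x)) ^ 2 := by ring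
    _ ≤ B ^ 2 * (f x - g x) ^ 2 := by gcongr

lemma tendsto_lipschitz_mollify {X : Type*} [MeasurableSpace X] {μ : Measure X} {Φ : ℝ → ℝ}
    (hΦ : ∀ a b, |Φ a - Φ b| ≤ |a - b|) {b : X → ℝ} {B : ℝ} (hb : ∀ x, |b x| ≤ B)
    {f : ℕ → X → ℝ} {g : X → ℝ} (hf : ∀ n, MemLp (f n) 2 μ) (hg : MemLp g 2 μ)
    (h : Tendsto (fun n => ∫ x, (f n x - g x) ^ 2 ∂μ) atTop (𝓝 0)) :
    Tendsto (fun n => ∫ x, (Φ (f n x) * b x - Φ (g x) * b x) ^ 2 ∂μ) atTop (𝓝 0) := by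
  have := h.const_mul (B ^ 2)
  rw [mul_zero] at this
  exact squeeze_zero (fun n => integral_nonneg fun x => sq_nonneg _)
    (fun n => integral_lipschitz_sq_le hΦ hb (hf n) hg) this

lemma WeakEq.setIntegral_sqApprox_le {C : ℝ} (hC : SliceSobolev d C)
    (h : WeakEq s Λ P u f Du a κ) {ℓ : ℝ} (hℓ : 0 ≤ ℓ) (hη : ContDiff ℝ 1 η)
    (hηs : HasCompactSupport η) (hη0 : ∀ z, 0 ≤ η z) (k : ℕ)
    {A : Set (ℝ × Ed d)} (hA : MeasurableSet A) {m : ℝ} (hm : 0 ≤ m)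
    (hAm : ∀ᵐ t : ℝ, volume (Prod.mk t ⁻¹' A) ≤ ENNReal.ofReal m) :
    ∫ z in A, sqApprox ℓ k (u z) * η z ^ 2 ≤ C * m ^ (1 / (d : ℝ)) * ∑ i,
      ((∫ z, posApprox ℓ k (u z) * η z * (|Du z i| * η z))
        + ∫ z, posAbove ℓ (u z) * η z * (posAbove ℓ (u z) * (2 * |fderiv ℝ η z (spDir i)|))) := by
  obtain ⟨B, L, hB0, hL0, hB, -, hL⟩ := exists_cutoff_bounds hη hηs
  have hdη : ∀ e, Continuous fun z => fderiv ℝ η z e := fun e =>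
    (hη.continuous_fderiv one_ne_zero).clm_apply continuous_const
  have hΦ := truncFun_posApprox hℓ k
  set un : ℕ → ℝ × Ed d → ℝ := fun n => mollify volume n u with hun
  set wn : Fin d → ℕ → ℝ × Ed d → ℝ := fun i n => mollify volume n fun z => Du z i with hwn
  have hul := locallyIntegrable_of_memLp_two h.memu
  have hu1 : ∀ n, ContDiff ℝ 1 (un n) := fun n =>
    (mollify_contDiff n hul).of_le (by exact_mod_cast le_top)
  have hdu : ∀ n z i, fderiv ℝ (un n) z (spDir i) = wn i n z := fun n z i => by
    refine fderiv_mollify n hul (fun φ hφ hφs => ?_) z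
    have := h.grad φ hφ hφs (EuclideanSpace.single i 1)
    simpa [EuclideanSpace.inner_single_right, spDir] using this
  have hDi := fun i => memLp_coord h.memDu i
  set g : ℕ → ℝ × Ed d → ℝ := fun n z => sqApprox ℓ k (un n z) * η z ^ 2 with hg
  have hg1 : ∀ n, ContDiff ℝ 1 (g n) := fun n => (hΦ.contDiff_prim.comp (hu1 n)).mul (hη.pow 2)
  have hgs : ∀ n, HasCompactSupport (g n) := fun n => by
    have : HasCompactSupport fun z => η z * (η z * sqApprox ℓ k (un n z)) := hηs.mul_right
    convert this using 2 with z
    simp only [hg]; ring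
  have hdg : ∀ n z i, fderiv ℝ (g n) z (spDir i) = posApprox ℓ k (un n z) * wn i n z * η z ^ 2
      + sqApprox ℓ k (un n z) * (2 * η z * fderiv ℝ η z (spDir i)) := by
    intro n z i
    have h1 := (hΦ.prim (un n z)).comp_hasFDerivAt z
      ((hu1 n).differentiable one_ne_zero z).hasFDerivAt
    have h2 := ((hη.differentiable one_ne_zero z).hasFDerivAt).pow 2
    have h3 : fderiv ℝ (g n) z = _ := (h1.mul h2).fderiv
    rw [h3]
    simp [hdu]
    ring
  have iprod : ∀ n i, Integrable fun z => posApprox ℓ k (un n z) * η z * (|wn i n z| * η z) :=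
    fun n i => integrable_mul_of_memLp_two
      (memLp_mul_bdd ((mollify_memLp n h.memu).of_le
        (continuous_posApprox.comp (hu1 n).continuous).aestronglyMeasurable
        (ae_of_all _ fun z => hΦ.abs_le _)) hη.continuous.aestronglyMeasurable hB)
      (memLp_mul_bdd (mollify_memLp n (hDi i)).norm hη.continuous.aestronglyMeasurable hB)
  have mpos : ∀ n, MemLp (fun z => posAbove ℓ (un n z)) 2 := fun n =>
    (mollify_memLp n h.memu).of_le
        (continuous_posAbove.comp (hu1 n).continuous).aestronglyMeasurable
        (ae_of_all _ fun z => abs_posAbove_le hℓ _)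
  have hdB : ∀ i z, |(2 * |fderiv ℝ η z (spDir i)|)| ≤ 2 * (L * ‖(spDir i : ℝ × Ed d)‖) := by
    intro i z
    rw [abs_of_nonneg (by positivity)]
    exact mul_le_mul_of_nonneg_left (hL z _) zero_le_two
  have hdm : ∀ i, AEStronglyMeasurable (fun z => 2 * |fderiv ℝ η z (spDir i)|)
      (volume : Measure (ℝ × Ed d)) :=
    fun i => (continuous_const.mul (hdη _).abs).aestronglyMeasurable
  have iprod2 : ∀ n i, Integrable fun z => posAbove ℓ (un n z) * η z
      * (posAbove ℓ (un n z) * (2 * |fderiv ℝ η z (spDir i)|)) :=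
    fun n i => integrable_mul_of_memLp_two
      (memLp_mul_bdd (mpos n) hη.continuous.aestronglyMeasurable hB)
      (memLp_mul_bdd (mpos n) (hdm i) (hdB i))
  have hmain : ∀ n, ∫ z in A, g n z ≤ C * m ^ (1 / (d : ℝ)) * ∑ i,
      ((∫ z, posApprox ℓ k (un n z) * η z * (|wn i n z| * η z))
        + ∫ z, posAbove ℓ (un n z) * η z
          * (posAbove ℓ (un n z) * (2 * |fderiv ℝ η z (spDir i)|))) := by
    intro n
    have h1 := hC.2 (g n) (hg1 n) (hgs n) A hA m hm hAm
    have e1 : ∀ z, |g n z| = g n z := fun z =>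
      abs_of_nonneg (mul_nonneg sqApprox_nonneg (sq_nonneg _))
    simp only [e1] at h1
    refine h1.trans (mul_le_mul_of_nonneg_left (Finset.sum_le_sum fun i _ => ?_)
      (mul_nonneg hC.1 (by positivity)))
    rw [← integral_add (iprod n i) (iprod2 n i)]
    refine integral_mono_of_nonneg (ae_of_all _ fun z => abs_nonneg _)
      ((iprod n i).add (iprod2 n i)) (ae_of_all _ fun z => ?_)
    simp only
    rw [hdg]
    refine (abs_add_le _ _).trans (add_le_add (le_of_eq ?_) ?_)
    · rw [abs_mul, abs_mul, abs_of_nonneg posApprox_nonneg, abs_of_nonneg (sq_nonneg (η z))]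
      ring
    · rw [abs_mul, abs_mul, abs_of_nonneg sqApprox_nonneg,
        abs_of_nonneg (by have := hη0 z; positivity : 0 ≤ 2 * η z)]
      have := sqApprox_le (ℓ := ℓ) (r := un n z) (k := k)
      have h0 := hη0 z
      calc sqApprox ℓ k (un n z) * (2 * η z * |fderiv ℝ η z (spDir i)|)
          ≤ posAbove ℓ (un n z) ^ 2 * (2 * η z * |fderiv ℝ η z (spDir i)|) := by gcongr
        _ = _ := by ring
  have habs : ∀ a b : ℝ, |(|a| - |b|)| ≤ |a - b| := abs_abs_sub_abs_le
  have l1 : ∀ i, Tendsto (fun n => ∫ z, posApprox ℓ k (un n z) * η z * (|wn i n z| * η z)) atTop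
      (𝓝 (∫ z, posApprox ℓ k (u z) * η z * (|Du z i| * η z))) := fun i =>
    tendsto_integral_mul_of_sq
      (fun n => memLp_mul_bdd ((mollify_memLp n h.memu).of_le
        (continuous_posApprox.comp (hu1 n).continuous).aestronglyMeasurable
        (ae_of_all _ fun z => hΦ.abs_le _)) hη.continuous.aestronglyMeasurable hB)
      (fun n => memLp_mul_bdd (mollify_memLp n (hDi i)).norm hη.continuous.aestronglyMeasurable hB)
      (memLp_mul_bdd (h.memu.of_le (continuous_posApprox.comp_aestronglyMeasurable h.memu.1)
        (ae_of_all _ fun z => hΦ.abs_le _)) hη.continuous.aestronglyMeasurable hB)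
      (memLp_mul_bdd (hDi i).norm hη.continuous.aestronglyMeasurable hB)
      (tendsto_lipschitz_mollify hΦ.abs_sub_le hB (fun n => mollify_memLp n h.memu) h.memu
        (mollify_tendsto h.memu))
      (tendsto_lipschitz_mollify habs hB (fun n => mollify_memLp n (hDi i)) (hDi i)
        (mollify_tendsto (hDi i)))
  have mpos0 : MemLp (fun z => posAbove ℓ (u z)) 2 :=
    h.memu.of_le (continuous_posAbove.comp_aestronglyMeasurable h.memu.1)
        (ae_of_all _ fun z => abs_posAbove_le hℓ _)
  have l2 : ∀ i, Tendsto (fun n => ∫ z, posAbove ℓ (un n z) * η z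
          * (posAbove ℓ (un n z) * (2 * |fderiv ℝ η z (spDir i)|))) atTop
      (𝓝 (∫ z, posAbove ℓ (u z) * η z * (posAbove ℓ (u z) * (2 * |fderiv ℝ η z (spDir i)|)))) :=
    fun i => tendsto_integral_mul_of_sq
      (fun n => memLp_mul_bdd (mpos n) hη.continuous.aestronglyMeasurable hB)
      (fun n => memLp_mul_bdd (mpos n) (hdm i) (hdB i))
      (memLp_mul_bdd mpos0 hη.continuous.aestronglyMeasurable hB)
      (memLp_mul_bdd mpos0 (hdm i) (hdB i))
      (tendsto_lipschitz_mollify (abs_posAbove_sub_le ℓ) hB (fun n => mollify_memLp n h.memu) h.memu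
        (mollify_tendsto h.memu))
      (tendsto_lipschitz_mollify (abs_posAbove_sub_le ℓ) (hdB i) (fun n => mollify_memLp n h.memu)
        h.memu (mollify_tendsto h.memu))
  have l0 : Tendsto (fun n => ∫ z in A, g n z) atTop
      (𝓝 (∫ z in A, sqApprox ℓ k (u z) * η z ^ 2)) := by
    have hη2 : ∀ z, |η z ^ 2| ≤ B ^ 2 := fun z => by
      rw [abs_pow]; exact pow_le_pow_left₀ (abs_nonneg _) (hB z) 2
    simp only [← integral_indicator hA]
    have hul2 := h.memu.integrable_sq
    have hG : ∀ n, ∫ z, mollify volume n (fun y => u y ^ 2) z * B ^ 2 = ∫ z, u z ^ 2 * B ^ 2 :=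
      fun n => by
        rw [integral_mul_const, integral_mul_const, mollify_integral n hul2]
    refine (tendsto_integral_of_dominated_tendsto
      (G := fun n z => mollify volume n (fun y => u y ^ 2) z * B ^ 2)
      (G₀ := fun z => u z ^ 2 * B ^ 2)
      (fun n => (hg1 n).continuous.aestronglyMeasurable.indicator hA)
      (((hΦ.contDiff_prim.continuous.measurable.comp h.meas).mul
        (hη.continuous.pow 2).measurable).indicator hA).aestronglyMeasurable
      (fun n => (mollify_integrable n hul2).mul_const _)
      (hul2.mul_const _) (fun n z => ?_) ?_ ?_ ?_).2
    · have h0 : |g n z| ≤ mollify volume n (fun y => u y ^ 2) z * B ^ 2 := by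
        simp only [hg]
        rw [abs_mul]
        exact mul_le_mul ((hΦ.prim_le _).trans (mollify_sq_le n h.memu z)) (hη2 z) (abs_nonneg _)
          ((sq_nonneg _).trans (mollify_sq_le n h.memu z))
      by_cases hz : z ∈ A
      · rwa [indicator_of_mem hz]
      · rw [indicator_of_notMem hz, abs_zero]
        exact (abs_nonneg _).trans h0
    · filter_upwards [mollify_ae_tendsto hul] with z hz
      by_cases hzA : z ∈ A
      · simp only [indicator_of_mem hzA]
        exact ((hΦ.contDiff_prim.continuous.tendsto _).comp hz).mul_const _
      · simp only [indicator_of_notMem hzA]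
        exact tendsto_const_nhds
    · filter_upwards [mollify_ae_tendsto hul2.locallyIntegrable] with z hz
      exact hz.mul_const _
    · simp only [hG]
      exact tendsto_const_nhds
  refine le_of_tendsto_of_tendsto' l0 ?_ hmain
  exact (tendsto_finsetSum _ fun i _ => (l1 i).add (l2 i)).const_mul _

end FaberKrahn

section FaberKrahn

variable {d : ℕ} {s Λ : ℝ} {P S : Set (ℝ × Ed d)} {u f η : ℝ × Ed d → ℝ}
  {Du a : ℝ × Ed d → Ed d} {κ : ℝ × Ed d → Ed d → ℝ} {t₀ D₁ D₂ : ℝ}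

lemma WeakEq.setIntegral_sq_le_sum {C : ℝ} (hC : SliceSobolev d C)
    (h : WeakEq s Λ P u f Du a κ) {ℓ : ℝ} (hℓ : 0 ≤ ℓ) (hη : Cutoff P S t₀ D₁ D₂ η)
    {A : Set (ℝ × Ed d)} (hA : MeasurableSet A) {m : ℝ} (hm : 0 ≤ m)
    (hAm : ∀ᵐ t : ℝ, volume (Prod.mk t ⁻¹' A) ≤ ENNReal.ofReal m) :
    ∫ z in A, posAbove ℓ (u z) ^ 2 * η z ^ 2
      ≤ 2 * C * d * m ^ (1 / (d : ℝ)) * (√(∫ z in S, posAbove ℓ (u z) ^ 2) *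
        (√(∫ z, (Ioi ℓ).indicator 1 (u z) * ‖Du z‖ ^ 2 * η z ^ 2)
          + 2 * D₂ * √(∫ z in S, posAbove ℓ (u z) ^ 2))) := by
  have hη1 : ContDiff ℝ 1 η := hη.smooth.of_le (by exact_mod_cast le_top)
  obtain ⟨B, L, hB0, hL0, hB, -, hL⟩ := exists_cutoff_bounds hη1 hη.compact
  set p : ℝ × Ed d → ℝ := fun z => posAbove ℓ (u z) with hp
  set Y := ∫ z in S, p z ^ 2 with hY
  set G := ∫ z, (Ioi ℓ).indicator 1 (u z) * ‖Du z‖ ^ 2 * η z ^ 2 with hG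
  have hpm : Measurable p := continuous_posAbove.measurable.comp h.meas
  have mp : MemLp p 2 :=
    h.memu.of_le hpm.aestronglyMeasurable (ae_of_all _ fun z => abs_posAbove_le hℓ _)
  have hi : Measurable fun z => (Ioi ℓ).indicator (1 : ℝ → ℝ) (u z) :=
    (measurable_one.indicator measurableSet_Ioi).comp h.meas
  have hi1 : ∀ r, |(Ioi ℓ).indicator (1 : ℝ → ℝ) r| ≤ 1 := fun r => by
    by_cases hz : r ∈ Ioi ℓ <;> simp [hz]
  have hisq : ∀ r, (Ioi ℓ).indicator (1 : ℝ → ℝ) r ^ 2 = (Ioi ℓ).indicator (1 : ℝ → ℝ) r :=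
    fun r => by by_cases hz : r ∈ Ioi ℓ <;> simp [hz]
  have bη : ∀ z, |η z ^ 2| ≤ 1 := fun z => by
    rw [abs_of_nonneg (by positivity)]
    exact pow_le_one₀ (hη.nonneg z) (hη.le_one z)
  have mpη : MemLp (fun z => p z * η z) 2 :=
    memLp_mul_bdd mp hη1.continuous.aestronglyMeasurable hB
  have hD2 : ∀ i z, |fderiv ℝ η z (spDir i)| ≤ D₂ := fun i z => by
    have := hη.space z (EuclideanSpace.single i 1)
    simpa [spDir] using this
  have hdη : ∀ e, Continuous fun z => fderiv ℝ η z e := fun e =>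
    (hη1.continuous_fderiv one_ne_zero).clm_apply continuous_const
  have iS : Integrable fun z => S.indicator (fun z => p z ^ 2) z :=
    mp.integrable_sq.indicator hη.meas
  have hY1 : ∫ z, (p z * η z) ^ 2 ≤ Y := by
    rw [hY, ← integral_indicator hη.meas]
    refine integral_mono mpη.integrable_sq iS fun z => ?_
    by_cases hz : z ∈ S
    · rw [indicator_of_mem hz]
      simp only [mul_pow]
      exact mul_le_of_le_one_right (sq_nonneg _) ((le_abs_self _).trans (bη z))
    · rw [indicator_of_notMem hz]
      have : η z = 0 := image_eq_zero_of_notMem_tsupport fun h => hz (hη.supp h)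
      simp [this]
  have mD : ∀ i, MemLp (fun z => (Ioi ℓ).indicator 1 (u z) * |Du z i| * η z) 2 := fun i => by
    refine memLp_mul_bdd ?_ hη1.continuous.aestronglyMeasurable hB
    simp_rw [mul_comm ((Ioi ℓ).indicator 1 (u _)) _]
    exact memLp_mul_bdd (memLp_coord h.memDu i).norm hi.aestronglyMeasurable fun z => hi1 _
  have iF : Integrable fun z => (Ioi ℓ).indicator 1 (u z) * ‖Du z‖ ^ 2 * η z ^ 2 :=
    (h.memDu.norm.integrable_sq.bdd_mul hi.aestronglyMeasurable
      (ae_of_all _ fun z => hi1 _)).mul_bdd (hη1.continuous.pow 2).aestronglyMeasurable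
      (ae_of_all _ bη)
  have hG1 : ∀ i, ∫ z, ((Ioi ℓ).indicator 1 (u z) * |Du z i| * η z) ^ 2 ≤ G := fun i => by
    refine integral_mono (mD i).integrable_sq iF fun z => ?_
    simp only [mul_pow, hisq, sq_abs]
    have h1 : 0 ≤ (Ioi ℓ).indicator (1 : ℝ → ℝ) (u z) :=
      indicator_nonneg (fun _ _ => zero_le_one) _
    have h2 : Du z i ^ 2 ≤ ‖Du z‖ ^ 2 := by
      rw [← sq_abs (Du z i)]
      exact pow_le_pow_left₀ (abs_nonneg _) (PiLp.norm_apply_le (Du z) i) 2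
    gcongr
  have mE : ∀ i, MemLp (fun z => p z * (2 * |fderiv ℝ η z (spDir i)|)) 2 := fun i =>
    memLp_mul_bdd (C := 2 * D₂) mp (continuous_const.mul (hdη _).abs).aestronglyMeasurable
      fun z => by
        rw [abs_of_nonneg (by positivity)]
        exact mul_le_mul_of_nonneg_left (hD2 i z) zero_le_two
  have hE1 : ∀ i : Fin d, ∫ z, (p z * (2 * |fderiv ℝ η z (spDir i)|)) ^ 2 ≤ (2 * D₂) ^ 2 * Y := by
    intro i
    rw [hY, ← integral_indicator hη.meas, ← integral_const_mul]
    refine integral_mono (mE i).integrable_sq (iS.const_mul _) fun z => ?_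
    by_cases hz : z ∈ S
    · simp only [indicator_of_mem hz, mul_pow]
      have : |fderiv ℝ η z (spDir i)| ^ 2 ≤ D₂ ^ 2 :=
        pow_le_pow_left₀ (abs_nonneg _) (hD2 i z) 2
      calc p z ^ 2 * (2 ^ 2 * |fderiv ℝ η z (spDir i)| ^ 2) ≤ p z ^ 2 * (2 ^ 2 * D₂ ^ 2) := by gcongr
        _ = _ := by ring
    · simp only [indicator_of_notMem hz]
      have h1 : z ∉ tsupport (fderiv ℝ η) := fun h =>
        hz (hη.supp (tsupport_fderiv_subset ℝ h))
      have : fderiv ℝ η z = 0 := image_eq_zero_of_notMem_tsupport h1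
      simp [this]
  have hS2 : ∀ k, ∀ i : Fin d, (∫ z, posApprox ℓ k (u z) * η z * (|Du z i| * η z))
      + (∫ z, p z * η z * (p z * (2 * |fderiv ℝ η z (spDir i)|)))
      ≤ √Y * (√G + 2 * D₂ * √Y) := by
    intro k i
    have hD20 : 0 ≤ D₂ := (abs_nonneg _).trans (hD2 i 0)
    have c1 : ∫ z, posApprox ℓ k (u z) * η z * (|Du z i| * η z)
        ≤ ∫ z, p z * η z * ((Ioi ℓ).indicator 1 (u z) * |Du z i| * η z) := by
      refine integral_mono_of_nonneg (ae_of_all _ fun z => ?_)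
        (integrable_mul_of_memLp_two mpη (mD i)) (ae_of_all _ fun z => ?_)
      · have := hη.nonneg z
        have := posApprox_nonneg (ℓ := ℓ) (k := k) (r := u z)
        simp only [Pi.zero_apply]
        positivity
      · have h0 := hη.nonneg z
        have h1 := posApprox_nonneg (ℓ := ℓ) (k := k) (r := u z)
        simp only
        rcases le_or_gt (u z) ℓ with hz | hz
        · rw [posApprox_of_le hz]
          simp [hz.not_gt]
        · have h2 : posApprox ℓ k (u z) ≤ p z := posApprox_le
          simp only [indicator_of_mem (mem_Ioi.2 hz), Pi.one_apply, one_mul]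
          gcongr
    have c2 := (le_abs_self _).trans (abs_integral_mul_le_sqrt mpη (mD i))
    have c3 := (le_abs_self _).trans (abs_integral_mul_le_sqrt mpη (mE i))
    have c4 : √(∫ z, (p z * η z) ^ 2) ≤ √Y := Real.sqrt_le_sqrt hY1
    have c5 := Real.sqrt_le_sqrt (hG1 i)
    have c6 : √(∫ z, (p z * (2 * |fderiv ℝ η z (spDir i)|)) ^ 2) ≤ 2 * D₂ * √Y := by
      refine (Real.sqrt_le_sqrt (hE1 i)).trans ?_
      rw [Real.sqrt_mul (sq_nonneg _), Real.sqrt_sq (by positivity)]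
    have c7 := mul_le_mul c4 c5 (Real.sqrt_nonneg _) (Real.sqrt_nonneg _)
    have c8 := mul_le_mul c4 c6 (Real.sqrt_nonneg _) (Real.sqrt_nonneg _)
    rw [mul_add]
    linarith
  have hk : ∀ k, ∫ z in A, sqApprox ℓ k (u z) * η z ^ 2
      ≤ C * m ^ (1 / (d : ℝ)) * (d * (√Y * (√G + 2 * D₂ * √Y))) := fun k => by
    refine (h.setIntegral_sqApprox_le hC hℓ hη1 hη.compact hη.nonneg k hA hm hAm).trans
      (mul_le_mul_of_nonneg_left ?_ (mul_nonneg hC.1 (by positivity)))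
    refine (Finset.sum_le_sum fun i _ => hS2 k i).trans ?_
    simp
  have hlim : Tendsto (fun k => ∫ z in A, sqApprox ℓ k (u z) * η z ^ 2) atTop
      (𝓝 (∫ z in A, posAbove ℓ (u z) ^ 2 / 2 * η z ^ 2)) := by
    refine tendsto_integral_of_dominated_convergence (fun z => u z ^ 2) (fun k => ?_)
      h.memu.integrable_sq.integrableOn (fun k => ae_of_all _ fun z => ?_)
      (ae_of_all _ fun z => (tendsto_sqApprox ℓ (u z)).mul_const _)
    · exact (((truncFun_posApprox hℓ k).contDiff_prim.continuous.measurable.comp h.meas).mul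
        (hη1.continuous.pow 2).measurable).aestronglyMeasurable
    · rw [norm_mul]
      calc _ ≤ u z ^ 2 * 1 := mul_le_mul (abs_sqApprox_le hℓ _) (bη z) (abs_nonneg _) (sq_nonneg _)
        _ = _ := mul_one _
  have hfin := le_of_tendsto' hlim hk
  have e : ∫ z in A, posAbove ℓ (u z) ^ 2 / 2 * η z ^ 2 = (∫ z in A, p z ^ 2 * η z ^ 2) / 2 := by
    rw [← integral_div]
    congr 1; ext z; simp only [hp]; ring
  rw [e] at hfin
  linarith

end FaberKrahn

/-- Fast geometric convergence: a superlinear recursive inequality with small starting value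
forces the sequence to vanish in the limit. -/
theorem tendsto_zero_of_superlinear {n : ℕ} (hn : 0 < n) {Y : ℕ → ℝ} {M b : ℝ} (hM : 0 ≤ M)
    (hb : 1 < b) (hY : ∀ j, 0 ≤ Y j)
    (hrec : ∀ j, Y (j + 1) ≤ M * b ^ j * (Y j * Y j ^ (1 / (n : ℝ))))
    (h0 : M * Y 0 ^ (1 / (n : ℝ)) * b ^ n ≤ 1) : Tendsto Y atTop (𝓝 0) := by
  have hb0 : 0 < b := by linarith
  have hn' : (n : ℝ) ≠ 0 := by positivity
  have key : ∀ j, Y j ≤ Y 0 * ((b ^ n)⁻¹) ^ j := by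
    intro j
    induction j with
    | zero => simp
    | succ j ih =>
      have h1 : Y j ^ (1 / (n : ℝ)) ≤ Y 0 ^ (1 / (n : ℝ)) * (b⁻¹) ^ j := by
        refine (Real.rpow_le_rpow (hY j) ih (by positivity)).trans ?_
        rw [Real.mul_rpow (hY 0) (by positivity)]
        have : (((b ^ n)⁻¹) ^ j) ^ (1 / (n : ℝ)) = (b⁻¹) ^ j := by
          rw [← inv_pow, ← pow_mul, mul_comm, pow_mul, one_div]
          exact Real.pow_rpow_inv_natCast (by positivity) hn.ne'
        rw [this]
      have h2 : Y j * Y j ^ (1 / (n : ℝ))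
          ≤ (Y 0 * ((b ^ n)⁻¹) ^ j) * (Y 0 ^ (1 / (n : ℝ)) * (b⁻¹) ^ j) :=
        mul_le_mul ih h1 (Real.rpow_nonneg (hY j) _) ((hY j).trans ih)
      calc Y (j + 1) ≤ M * b ^ j * (Y j * Y j ^ (1 / (n : ℝ))) := hrec j
        _ ≤ M * b ^ j * ((Y 0 * ((b ^ n)⁻¹) ^ j) * (Y 0 ^ (1 / (n : ℝ)) * (b⁻¹) ^ j)) := by
            gcongr
        _ = (M * Y 0 ^ (1 / (n : ℝ)) * b ^ n) * (Y 0 * ((b ^ n)⁻¹) ^ (j + 1))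
              * (b ^ j * (b⁻¹) ^ j) := by
            rw [pow_succ]; field_simp
        _ ≤ 1 * (Y 0 * ((b ^ n)⁻¹) ^ (j + 1)) * (b ^ j * (b⁻¹) ^ j) := by
            have := hY 0
            gcongr
        _ = Y 0 * ((b ^ n)⁻¹) ^ (j + 1) := by
            rw [← mul_pow, mul_inv_cancel₀ hb0.ne']; simp
  refine squeeze_zero hY key ?_
  have := (tendsto_pow_atTop_nhds_zero_of_lt_one (r := (b ^ n)⁻¹) (by positivity)
    (inv_lt_one_of_one_lt₀ (one_lt_pow₀ hb hn.ne'))).const_mul (Y 0)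
  simpa using this

/-- The part of the tail outside `B_ρ(x₀)`, without the scaling factor. -/
def farTail {d : ℕ} (s : ℝ) (v : ℝ → Ed d → ℝ) (x₀ : Ed d) (ρ : ℝ) (t : ℝ) : ℝ :=
  ∫ y in (ball x₀ ρ)ᶜ, |v t y| / ‖x₀ - y‖ ^ ((d : ℝ) + 2 * s)

section Far

variable {d : ℕ} {s Λ ρ : ℝ} {x₀ : Ed d} {J : Set ℝ} {Ω : Set (Ed d)}
  {v : ℝ → Ed d → ℝ} {Dv : ℝ → Ed d → Ed d} {K : ℝ → Ed d → Ed d → ℝ}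

lemma farTail_nonneg (t : ℝ) : 0 ≤ farTail s v x₀ ρ t :=
  setIntegral_nonneg isOpen_ball.measurableSet.compl fun y _ => by positivity

lemma measurable_farTail (hv : Measurable (Function.uncurry v)) :
    Measurable (farTail s v x₀ ρ) := by
  have h : StronglyMeasurable fun p : ℝ × Ed d =>
      |v p.1 p.2| / ‖x₀ - p.2‖ ^ ((d : ℝ) + 2 * s) := by
    refine Measurable.stronglyMeasurable ?_
    have h1 : Measurable fun p : ℝ × Ed d => v p.1 p.2 := hv
    exact (measurable_norm.comp h1).div
      (((measurable_const.sub measurable_snd).norm).pow_const _)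
  exact (h.integral_prod_right' (ν := volume.restrict (ball x₀ ρ)ᶜ)).measurable

lemma inv_norm_sub_rpow_le (hs : 0 < s) (hρ : 0 < ρ) {y : Ed d} (hy : y ∉ ball x₀ ρ) :
    1 / ‖x₀ - y‖ ^ ((d : ℝ) + 2 * s) ≤
      ((ρ⁻¹) ^ ((d : ℝ) + 2 * s) + (‖x₀‖ / ρ + 1) ^ ((d : ℝ) + 2 * s))
        * (1 / (1 + ‖y‖ ^ ((d : ℝ) + 2 * s))) := by
  set p := (d : ℝ) + 2 * s with hp
  have hp0 : 0 < p := by positivity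
  have hr : ρ ≤ ‖x₀ - y‖ := by
    rw [mem_ball, not_lt, dist_comm, dist_eq_norm] at hy; exact hy
  have hr0 : 0 < ‖x₀ - y‖ := by linarith
  have h1 : (1 : ℝ) ≤ (ρ⁻¹) ^ p * ‖x₀ - y‖ ^ p := by
    rw [← Real.mul_rpow (by positivity) (by positivity)]
    refine Real.one_le_rpow ?_ hp0.le
    rw [inv_mul_eq_div, one_le_div hρ]; exact hr
  have h2 : ‖y‖ ^ p ≤ (‖x₀‖ / ρ + 1) ^ p * ‖x₀ - y‖ ^ p := by
    rw [← Real.mul_rpow (by positivity) (by positivity)]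
    refine Real.rpow_le_rpow (norm_nonneg _) ?_ hp0.le
    have h3 : ‖y‖ ≤ ‖x₀‖ + ‖x₀ - y‖ := by
      have := norm_sub_le x₀ (x₀ - y)
      simpa using this
    have h4 : ‖x₀‖ ≤ ‖x₀‖ / ρ * ‖x₀ - y‖ := by
      rw [div_mul_eq_mul_div, le_div_iff₀ hρ]
      exact mul_le_mul_of_nonneg_left hr (norm_nonneg _)
    linarith
  rw [mul_one_div, div_le_div_iff₀ (by positivity) (by positivity)]
  linarith

lemma farTail_integrand_le (hs : 0 < s) (hρ : 0 < ρ) {y : Ed d} (hy : y ∉ ball x₀ ρ) (t : ℝ) :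
    |v t y| / ‖x₀ - y‖ ^ ((d : ℝ) + 2 * s) ≤
      ((ρ⁻¹) ^ ((d : ℝ) + 2 * s) + (‖x₀‖ / ρ + 1) ^ ((d : ℝ) + 2 * s))
        * (|v t y| / (1 + ‖y‖ ^ ((d : ℝ) + 2 * s))) := by
  have := mul_le_mul_of_nonneg_left (inv_norm_sub_rpow_le (x₀ := x₀) hs hρ hy) (abs_nonneg (v t y))
  calc _ = |v t y| * (1 / ‖x₀ - y‖ ^ ((d : ℝ) + 2 * s)) := by ring
    _ ≤ _ := this
    _ = _ := by ring

lemma ae_integrableOn_farTail (hs : 0 < s) (hρ : 0 < ρ) (h : LocalWeakReg d s J Ω v Dv) :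
    ∀ᵐ t : ℝ, t ∈ J →
      IntegrableOn (fun y => |v t y| / ‖x₀ - y‖ ^ ((d : ℝ) + 2 * s)) (ball x₀ ρ)ᶜ := by
  filter_upwards [h.tail_ae] with t ht htJ
  refine Integrable.mono' ((ht htJ).const_mul
      ((ρ⁻¹) ^ ((d : ℝ) + 2 * s) + (‖x₀‖ / ρ + 1) ^ ((d : ℝ) + 2 * s))).integrableOn ?_
    ((ae_restrict_iff' isOpen_ball.measurableSet.compl).2
      (Eventually.of_forall fun y hy => ?_))
  · have h1 : Measurable (v t) := h.meas.comp measurable_prodMk_left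
    exact ((measurable_norm.comp h1).div
      (((measurable_const.sub measurable_id).norm).pow_const _)).aestronglyMeasurable
  · rw [Real.norm_of_nonneg (by positivity)]
    exact farTail_integrand_le hs hρ hy t

lemma memLp_farTail (hs : 0 < s) (hρ : 0 < ρ) (h : LocalWeakReg d s J Ω v Dv) {t₁ t₂ : ℝ}
    (hJ : Icc t₁ t₂ ⊆ J) :
    MemLp ((Ioo t₁ t₂).indicator (farTail s v x₀ ρ)) 2 := by
  have hm := measurable_farTail (s := s) (x₀ := x₀) (ρ := ρ) h.meas
  rw [memLp_indicator_iff_restrict measurableSet_Ioo,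
    memLp_two_iff_integrable_sq hm.aestronglyMeasurable]
  set c := ((ρ⁻¹) ^ ((d : ℝ) + 2 * s) + (‖x₀‖ / ρ + 1) ^ ((d : ℝ) + 2 * s)) with hc
  have hc0 : 0 ≤ c := by positivity
  refine Integrable.mono' ((h.tail_l2 t₁ t₂ hJ).const_mul (c ^ 2))
    (hm.pow_const 2).aestronglyMeasurable ?_
  refine (ae_restrict_iff' measurableSet_Ioo).2 ?_
  filter_upwards [h.tail_ae, ae_integrableOn_farTail (x₀ := x₀) hs hρ h] with t ht ht2 htI
  have htJ := hJ (Ioo_subset_Icc_self htI)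
  rw [Real.norm_of_nonneg (sq_nonneg _), ← mul_pow]
  refine pow_le_pow_left₀ (farTail_nonneg t) ?_ 2
  rw [← integral_const_mul, farTail]
  refine (setIntegral_mono_on (ht2 htJ) ((ht htJ).const_mul c).integrableOn
    isOpen_ball.measurableSet.compl fun y hy => farTail_integrand_le hs hρ hy t).trans ?_
  exact setIntegral_le_integral ((ht htJ).const_mul c)
    (Eventually.of_forall fun y => by positivity)

lemma kernel_far_le (hs : s ∈ Ioo (0 : ℝ) 1) (hΛ : 0 ≤ Λ) (hρ : 0 < ρ) (hK : KernelHyp d s Λ K)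
    (t : ℝ) {x y : Ed d} (hx : x ∈ ball x₀ (7 / 8 * ρ)) (hy : y ∉ ball x₀ ρ) :
    K t x y ≤ Λ * 8 ^ (d + 2) * (1 / ‖x₀ - y‖ ^ ((d : ℝ) + 2 * s)) := by
  set p := (d : ℝ) + 2 * s with hp
  have hp0 : 0 < p := by have := hs.1; positivity
  have hr : ρ ≤ ‖x₀ - y‖ := by
    rw [mem_ball, not_lt, dist_comm, dist_eq_norm] at hy; exact hy
  have hx' : ‖x₀ - x‖ < 7 / 8 * ρ := by
    rw [mem_ball, dist_comm, dist_eq_norm] at hx; exact hx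
  have h1 : ‖x₀ - y‖ ≤ ‖x₀ - x‖ + ‖x - y‖ := by
    simpa using norm_add_le (x₀ - x) (x - y)
  have h2 : ‖x₀ - y‖ ≤ 8 * ‖x - y‖ := by linarith
  have hxy : x ≠ y := by
    rintro rfl
    rw [sub_self, norm_zero, mul_zero] at h2
    linarith
  have hxy0 : 0 < ‖x - y‖ := norm_pos_iff.2 (sub_ne_zero.2 hxy)
  have hr0 : 0 < ‖x₀ - y‖ := by linarith
  refine (hK.upper t x y hxy).trans ?_
  rw [mul_one_div, div_le_div_iff₀ (by positivity) (by positivity), mul_assoc]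
  refine mul_le_mul_of_nonneg_left ?_ hΛ
  calc ‖x₀ - y‖ ^ p ≤ (8 * ‖x - y‖) ^ p := Real.rpow_le_rpow hr0.le h2 hp0.le
    _ = 8 ^ p * ‖x - y‖ ^ p := Real.mul_rpow (by norm_num) hxy0.le
    _ ≤ 8 ^ (d + 2) * ‖x - y‖ ^ p := by
        gcongr
        rw [← Real.rpow_natCast]
        refine Real.rpow_le_rpow_of_exponent_le (by norm_num) ?_
        push_cast; have := hs.2; linarith

lemma kernel_nonneg (hΛ : 0 < Λ) (hK : KernelHyp d s Λ K) (t : ℝ) {x y : Ed d} (h : x ≠ y) :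
    0 ≤ K t x y :=
  le_trans (by positivity) (hK.lower t x y h)

end Far

/-- A local weak solution together with a time interval and a ball compactly contained in the
domain. -/
structure LocalSol (d : ℕ) (s Λ : ℝ) (A : ℝ → Ed d → Ed d → Ed d) (K : ℝ → Ed d → Ed d → ℝ)
    (J : Set ℝ) (Ω : Set (Ed d)) (v : ℝ → Ed d → ℝ) (Dv : ℝ → Ed d → Ed d)
    (t₁ t₂ : ℝ) (x₀ : Ed d) (R : ℝ) : Prop where
  hd : 2 ≤ d
  hs : s ∈ Ioo (0 : ℝ) 1
  hΛ : 1 ≤ Λ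
  hA : VectorFieldHyp d Λ A
  hK : KernelHyp d s Λ K
  reg : LocalWeakReg d s J Ω v Dv
  sol : IsLocalWeakSolutionHom A K J Ω v Dv
  lt : t₁ < t₂
  hJ : Icc t₁ t₂ ⊆ J
  hR : 0 < R
  hΩ : closedBall x₀ (2 * R) ⊆ Ω

/-- The constant in front of the tail in the corrector. -/
def tailConst (d : ℕ) (Λ : ℝ) : ℝ := 2 * (Λ * 8 ^ (d + 2))

/-- The time-dependent corrector absorbing the tail. -/
def corr {d : ℕ} (s Λ : ℝ) (v : ℝ → Ed d → ℝ) (t₁ t₂ : ℝ) (x₀ : Ed d) (ρ t : ℝ) : ℝ :=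
  tailConst d Λ * ∫ τ in t₁..t, (Ioo t₁ t₂).indicator (farTail s v x₀ ρ) τ

/-- Smooth cutoff, equal to one on `closedBall x₀ R` and supported in `closedBall x₀ (2 * R)`. -/
def spCut {d : ℕ} (x₀ : Ed d) (R : ℝ) (x : Ed d) : ℝ :=
  if h : 0 < R then (⟨R, 3 / 2 * R, h, by linarith⟩ : ContDiffBump x₀) x else 0

section Cut

variable {d : ℕ} {x₀ : Ed d} {R : ℝ}

lemma spCut_contDiff : ContDiff ℝ (⊤ : ℕ∞) (spCut x₀ R) := by
  unfold spCut
  by_cases h : 0 < R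
  · simp only [h, dite_true]; exact ContDiffBump.contDiff _
  · simp only [h, dite_false]; exact contDiff_const

lemma spCut_nonneg (x : Ed d) : 0 ≤ spCut x₀ R x := by
  unfold spCut; split_ifs
  · exact ContDiffBump.nonneg _
  · rfl

lemma spCut_le_one (x : Ed d) : spCut x₀ R x ≤ 1 := by
  unfold spCut; split_ifs
  · exact ContDiffBump.le_one _
  · exact zero_le_one

lemma spCut_one (hR : 0 < R) {x : Ed d} (hx : x ∈ closedBall x₀ R) : spCut x₀ R x = 1 := by
  unfold spCut; rw [dif_pos hR]
  exact ContDiffBump.one_of_mem_closedBall _ hx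

lemma spCut_tsupport (hR : 0 < R) : tsupport (spCut x₀ R) ⊆ closedBall x₀ (2 * R) := by
  have : spCut x₀ R = (⟨R, 3 / 2 * R, hR, by linarith⟩ : ContDiffBump x₀) := by
    ext x; unfold spCut; rw [dif_pos hR]
  rw [this, ContDiffBump.tsupport_eq]
  exact closedBall_subset_closedBall (by simp only; linarith)

lemma gradient_spCut_eq_zero (hR : 0 < R) {x : Ed d} (hx : x ∉ closedBall x₀ (2 * R)) :
    gradient (spCut x₀ R) x = 0 := by
  have : fderiv ℝ (spCut x₀ R) x = 0 :=
    image_eq_zero_of_notMem_tsupport fun h => hx (spCut_tsupport hR (tsupport_fderiv_subset ℝ h))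
  simp [gradient, this]

lemma gradient_spCut_eq_zero_of_ball (hR : 0 < R) {x : Ed d} (hx : x ∈ ball x₀ R) :
    gradient (spCut x₀ R) x = 0 := by
  have h1 : spCut x₀ R =ᶠ[𝓝 x] fun _ => (1 : ℝ) := by
    filter_upwards [isOpen_ball.mem_nhds hx] with y hy
    exact spCut_one hR (ball_subset_closedBall hy)
  have : fderiv ℝ (spCut x₀ R) x = 0 := by rw [h1.fderiv_eq]; simp
  simp [gradient, this]

lemma continuous_gradient_spCut : Continuous (gradient (spCut x₀ R)) := by
  unfold gradient
  exact (LinearIsometryEquiv.continuous _).comp (spCut_contDiff.continuous_fderiv (by simp))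

lemma exists_norm_gradient_spCut_le (hR : 0 < R) :
    ∃ C, 0 ≤ C ∧ ∀ x, ‖gradient (spCut x₀ R) x‖ ≤ C := by
  have hc : HasCompactSupport (gradient (spCut x₀ R)) :=
    HasCompactSupport.of_support_subset_isCompact (isCompact_closedBall x₀ (2 * R)) fun x hx => by
      by_contra h
      exact hx (gradient_spCut_eq_zero hR h)
  obtain ⟨C, hC⟩ := continuous_gradient_spCut.bounded_above_of_compact_support hc
  exact ⟨C, (norm_nonneg _).trans (hC x₀), hC⟩

end Cut

/-- The corrected, localized solution. -/
def redU {d : ℕ} (s Λ : ℝ) (v : ℝ → Ed d → ℝ) (t₁ t₂ : ℝ) (x₀ : Ed d) (R ρ : ℝ) :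
    ℝ × Ed d → ℝ :=
  (Ioo t₁ t₂ ×ˢ closedBall x₀ (2 * R)).indicator
    fun z => spCut x₀ R z.2 * (v z.1 z.2 - corr s Λ v t₁ t₂ x₀ ρ z.1)

/-- The spatial gradient of `redU`. -/
def redDu {d : ℕ} (s Λ : ℝ) (v : ℝ → Ed d → ℝ) (Dv : ℝ → Ed d → Ed d) (t₁ t₂ : ℝ) (x₀ : Ed d)
    (R ρ : ℝ) : ℝ × Ed d → Ed d :=
  (Ioo t₁ t₂ ×ˢ closedBall x₀ (2 * R)).indicator
    fun z => spCut x₀ R z.2 • Dv z.1 z.2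
      + (v z.1 z.2 - corr s Λ v t₁ t₂ x₀ ρ z.1) • gradient (spCut x₀ R) z.2

/-- The localized flux. -/
def redA {d : ℕ} (A : ℝ → Ed d → Ed d → Ed d) (Dv : ℝ → Ed d → Ed d) (t₁ t₂ : ℝ) (x₀ : Ed d)
    (R : ℝ) : ℝ × Ed d → Ed d :=
  (Ioo t₁ t₂ ×ˢ closedBall x₀ (2 * R)).indicator fun z => A z.1 z.2 (Dv z.1 z.2)

section Reg

variable {d : ℕ} {s Λ : ℝ} {A : ℝ → Ed d → Ed d → Ed d} {K : ℝ → Ed d → Ed d → ℝ}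
    {J : Set ℝ} {Ω : Set (Ed d)} {v : ℝ → Ed d → ℝ} {Dv : ℝ → Ed d → Ed d}
    {t₁ t₂ : ℝ} {x₀ : Ed d} {R ρ : ℝ}

lemma LocalSol.integrable_farTail (h : LocalSol d s Λ A K J Ω v Dv t₁ t₂ x₀ R) (hρ : 0 < ρ) :
    Integrable ((Ioo t₁ t₂).indicator (farTail s v x₀ ρ)) := by
  have := memLp_farTail (x₀ := x₀) h.hs.1 hρ h.reg h.hJ
  rw [memLp_indicator_iff_restrict measurableSet_Ioo] at this
  rw [integrable_indicator_iff measurableSet_Ioo]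
  exact this.integrable (by norm_num)

lemma tailConst_pos (hΛ : 1 ≤ Λ) : 0 < tailConst d Λ := by unfold tailConst; positivity

lemma LocalSol.continuous_corr (h : LocalSol d s Λ A K J Ω v Dv t₁ t₂ x₀ R) (hρ : 0 < ρ) :
    Continuous (corr s Λ v t₁ t₂ x₀ ρ) :=
  (intervalIntegral.continuous_primitive
    (fun _ _ => (h.integrable_farTail hρ).intervalIntegrable) t₁).const_mul _

lemma LocalSol.corr_nonneg (h : LocalSol d s Λ A K J Ω v Dv t₁ t₂ x₀ R) {t : ℝ}
    (ht : t₁ ≤ t) : 0 ≤ corr s Λ v t₁ t₂ x₀ ρ t :=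
  mul_nonneg (tailConst_pos h.hΛ).le (intervalIntegral.integral_nonneg_of_forall ht fun _ =>
    indicator_nonneg (fun _ _ => farTail_nonneg _) _)

lemma LocalSol.corr_le (h : LocalSol d s Λ A K J Ω v Dv t₁ t₂ x₀ R) (hρ : 0 < ρ) {t : ℝ}
    (ht : t₁ ≤ t) : corr s Λ v t₁ t₂ x₀ ρ t ≤
      tailConst d Λ * ∫ τ in Ioo t₁ t₂, farTail s v x₀ ρ τ := by
  refine mul_le_mul_of_nonneg_left ?_ (tailConst_pos h.hΛ).le
  rw [intervalIntegral.integral_of_le ht, ← integral_indicator measurableSet_Ioo]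
  exact setIntegral_le_integral (h.integrable_farTail hρ)
    (Eventually.of_forall fun _ => indicator_nonneg (fun _ _ => farTail_nonneg _) _)

lemma LocalSol.abs_corr_le (h : LocalSol d s Λ A K J Ω v Dv t₁ t₂ x₀ R) (hρ : 0 < ρ) {t : ℝ}
    (ht : t₁ ≤ t) : |corr s Λ v t₁ t₂ x₀ ρ t| ≤
      tailConst d Λ * ∫ τ in Ioo t₁ t₂, farTail s v x₀ ρ τ := by
  rw [abs_of_nonneg (h.corr_nonneg ht)]; exact h.corr_le hρ ht

lemma measurableSet_box : MeasurableSet (Ioo t₁ t₂ ×ˢ closedBall x₀ (2 * R)) :=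
  measurableSet_Ioo.prod isClosed_closedBall.measurableSet

lemma volume_box_lt_top : volume (Ioo t₁ t₂ ×ˢ closedBall x₀ (2 * R)) < ⊤ := by
  rw [Measure.volume_eq_prod, Measure.prod_prod]
  exact ENNReal.mul_lt_top (by simp) measure_closedBall_lt_top

lemma LocalSol.memLp_v (h : LocalSol d s Λ A K J Ω v Dv t₁ t₂ x₀ R) :
    MemLp ((Ioo t₁ t₂ ×ˢ closedBall x₀ (2 * R)).indicator fun z => v z.1 z.2) 2 := by
  have hm : Measurable fun z : ℝ × Ed d => v z.1 z.2 := h.reg.meas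
  rw [memLp_indicator_iff_restrict measurableSet_box,
    memLp_two_iff_integrable_sq hm.aestronglyMeasurable]
  refine Integrable.mono' (h.reg.l2w12 t₁ t₂ h.hJ _ (isCompact_closedBall _ _) h.hΩ)
    (hm.pow_const 2).aestronglyMeasurable (ae_of_all _ fun z => ?_)
  rw [Real.norm_of_nonneg (sq_nonneg _)]
  exact le_add_of_nonneg_right (sq_nonneg _)

lemma LocalSol.memLp_Dv (h : LocalSol d s Λ A K J Ω v Dv t₁ t₂ x₀ R) :
    MemLp ((Ioo t₁ t₂ ×ˢ closedBall x₀ (2 * R)).indicator fun z => Dv z.1 z.2) 2 := by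
  have hm : Measurable fun z : ℝ × Ed d => Dv z.1 z.2 := h.reg.measD
  rw [memLp_indicator_iff_restrict measurableSet_box,
    memLp_two_iff_integrable_sq_norm hm.aestronglyMeasurable]
  refine Integrable.mono' (h.reg.l2w12 t₁ t₂ h.hJ _ (isCompact_closedBall _ _) h.hΩ)
    (hm.norm.pow_const 2).aestronglyMeasurable (ae_of_all _ fun z => ?_)
  rw [Real.norm_of_nonneg (sq_nonneg _)]
  exact le_add_of_nonneg_left (sq_nonneg _)

lemma LocalSol.memLp_corr (h : LocalSol d s Λ A K J Ω v Dv t₁ t₂ x₀ R) (hρ : 0 < ρ) :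
    MemLp ((Ioo t₁ t₂ ×ˢ closedBall x₀ (2 * R)).indicator
      fun z : ℝ × Ed d => corr s Λ v t₁ t₂ x₀ ρ z.1) 2 := by
  rw [memLp_indicator_iff_restrict measurableSet_box]
  have : IsFiniteMeasure ((volume : Measure (ℝ × Ed d)).restrict
      (Ioo t₁ t₂ ×ˢ closedBall x₀ (2 * R))) :=
    ⟨by rw [Measure.restrict_apply_univ]; exact volume_box_lt_top⟩
  refine MemLp.of_bound ((h.continuous_corr hρ).comp continuous_fst).aestronglyMeasurable
    (tailConst d Λ * ∫ τ in Ioo t₁ t₂, farTail s v x₀ ρ τ)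
    ((ae_restrict_iff' measurableSet_box).2 (ae_of_all _ fun z hz => ?_))
  exact h.abs_corr_le hρ hz.1.1.le

lemma LocalSol.memLp_sub_corr (h : LocalSol d s Λ A K J Ω v Dv t₁ t₂ x₀ R) (hρ : 0 < ρ) :
    MemLp ((Ioo t₁ t₂ ×ˢ closedBall x₀ (2 * R)).indicator
      fun z : ℝ × Ed d => v z.1 z.2 - corr s Λ v t₁ t₂ x₀ ρ z.1) 2 := by
  convert h.memLp_v.sub (h.memLp_corr hρ) using 1
  exact indicator_sub' _ _ _

lemma LocalSol.measurable_redU (h : LocalSol d s Λ A K J Ω v Dv t₁ t₂ x₀ R) (hρ : 0 < ρ) :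
    Measurable (redU s Λ v t₁ t₂ x₀ R ρ) := by
  have hm : Measurable fun z : ℝ × Ed d => v z.1 z.2 := h.reg.meas
  exact (((spCut_contDiff.continuous.measurable).comp measurable_snd).mul
    (hm.sub ((h.continuous_corr hρ).measurable.comp measurable_fst))).indicator measurableSet_box

lemma LocalSol.memLp_redU (h : LocalSol d s Λ A K J Ω v Dv t₁ t₂ x₀ R) (hρ : 0 < ρ) :
    MemLp (redU s Λ v t₁ t₂ x₀ R ρ) 2 := by
  refine (h.memLp_sub_corr hρ).of_le (h.measurable_redU hρ).aestronglyMeasurable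
    (ae_of_all _ fun z => ?_)
  unfold redU
  by_cases hz : z ∈ Ioo t₁ t₂ ×ˢ closedBall x₀ (2 * R)
  · rw [indicator_of_mem hz, indicator_of_mem hz, norm_mul, Real.norm_of_nonneg (spCut_nonneg _)]
    exact mul_le_of_le_one_left (norm_nonneg _) (spCut_le_one _)
  · rw [indicator_of_notMem hz, indicator_of_notMem hz]

lemma LocalSol.memLp_redDu (h : LocalSol d s Λ A K J Ω v Dv t₁ t₂ x₀ R) (hρ : 0 < ρ) :
    MemLp (redDu s Λ v Dv t₁ t₂ x₀ R ρ) 2 := by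
  obtain ⟨C, hC0, hC⟩ := exists_norm_gradient_spCut_le (x₀ := x₀) h.hR
  have hcut : Measurable fun z : ℝ × Ed d => spCut x₀ R z.2 :=
    spCut_contDiff.continuous.measurable.comp measurable_snd
  have hg : Measurable fun z : ℝ × Ed d => gradient (spCut x₀ R) z.2 :=
    continuous_gradient_spCut.measurable.comp measurable_snd
  have h1 : MemLp (fun z => spCut x₀ R z.2 •
      (Ioo t₁ t₂ ×ˢ closedBall x₀ (2 * R)).indicator (fun z => Dv z.1 z.2) z) 2 := by
    refine h.memLp_Dv.of_le (hcut.aestronglyMeasurable.smul h.memLp_Dv.1) (ae_of_all _ fun z => ?_)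
    rw [norm_smul, Real.norm_of_nonneg (spCut_nonneg _)]
    exact mul_le_of_le_one_left (norm_nonneg _) (spCut_le_one _)
  have h2 : MemLp (fun z => (Ioo t₁ t₂ ×ˢ closedBall x₀ (2 * R)).indicator
      (fun z => v z.1 z.2 - corr s Λ v t₁ t₂ x₀ ρ z.1) z • gradient (spCut x₀ R) z.2) 2 := by
    refine MemLp.of_le_mul (c := C) (h.memLp_sub_corr hρ)
      ((h.memLp_sub_corr hρ).1.smul hg.aestronglyMeasurable) (ae_of_all _ fun z => ?_)
    rw [norm_smul, mul_comm]
    exact mul_le_mul_of_nonneg_right (hC _) (norm_nonneg _)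
  convert h1.add h2 using 1
  ext1 z
  simp only [redDu, Pi.add_apply]
  by_cases hz : z ∈ Ioo t₁ t₂ ×ˢ closedBall x₀ (2 * R)
  · simp only [indicator_of_mem hz]
  · simp only [indicator_of_notMem hz, smul_zero, zero_smul, add_zero]

lemma LocalSol.memLp_redA (h : LocalSol d s Λ A K J Ω v Dv t₁ t₂ x₀ R) :
    MemLp (redA A Dv t₁ t₂ x₀ R) 2 := by
  have hm : Measurable fun z : ℝ × Ed d => A z.1 z.2 (Dv z.1 z.2) := by
    have h1 : Measurable (Function.uncurry fun (ξ : Ed d) (z : ℝ × Ed d) => A z.1 z.2 ξ) :=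
      measurable_uncurry_of_continuous_of_measurable (fun z => h.hA.cont z.1 z.2)
        (fun ξ => h.hA.meas ξ)
    have h2 : Measurable fun z : ℝ × Ed d => Dv z.1 z.2 := h.reg.measD
    exact h1.comp (h2.prodMk measurable_id)
  refine MemLp.of_le_mul (c := Λ) h.memLp_Dv (hm.indicator measurableSet_box).aestronglyMeasurable
    (ae_of_all _ fun z => ?_)
  unfold redA
  by_cases hz : z ∈ Ioo t₁ t₂ ×ˢ closedBall x₀ (2 * R)
  · rw [indicator_of_mem hz, indicator_of_mem hz]; exact h.hA.growth _ _ _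
  · rw [indicator_of_notMem hz, indicator_of_notMem hz]; simp

end Reg

section Slice

variable {d : ℕ} {φ : ℝ × Ed d → ℝ}

lemma contDiff_slice (hφ : ContDiff ℝ (⊤ : ℕ∞) φ) (t : ℝ) :
    ContDiff ℝ (⊤ : ℕ∞) fun x => φ (t, x) :=
  hφ.comp (contDiff_prodMk_right t)

lemma tsupport_slice_subset (φ : ℝ × Ed d → ℝ) (hc : HasCompactSupport φ) (t : ℝ) :
    tsupport (fun x => φ (t, x)) ⊆ Set.image Prod.snd (tsupport φ) := by
  refine closure_minimal (fun x hx => ⟨(t, x), subset_tsupport φ hx, rfl⟩) ?_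
  exact (IsCompact.image hc continuous_snd).isClosed

lemma hasCompactSupport_slice (hc : HasCompactSupport φ) (t : ℝ) :
    HasCompactSupport fun x => φ (t, x) :=
  (IsCompact.image hc continuous_snd).of_isClosed_subset (isClosed_tsupport _)
    (tsupport_slice_subset φ hc t)

lemma fderiv_slice (hφ : ContDiff ℝ (⊤ : ℕ∞) φ) (t : ℝ) (x e : Ed d) :
    fderiv ℝ (fun x => φ (t, x)) x e = fderiv ℝ φ (t, x) (0, e) := by
  have h1 : HasFDerivAt φ (fderiv ℝ φ (t, x)) (t, x) :=
    (hφ.differentiable (by simp) _).hasFDerivAt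
  have h2 := h1.comp x (hasFDerivAt_prodMk_right t x)
  have h3 : fderiv ℝ (fun x => φ (t, x)) x = _ := h2.fderiv
  rw [h3]; simp

lemma hasDerivAt_slice (hφ : ContDiff ℝ (⊤ : ℕ∞) φ) (t : ℝ) (x : Ed d) :
    HasDerivAt (fun τ => φ (τ, x)) (fderiv ℝ φ (t, x) (1, 0)) t := by
  have h1 : HasFDerivAt φ (fderiv ℝ φ (t, x)) (t, x) :=
    (hφ.differentiable (by simp) _).hasFDerivAt
  have h2 := (h1.comp t (hasFDerivAt_prodMk_left t x)).hasDerivAt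
  simp only [ContinuousLinearMap.comp_apply, ContinuousLinearMap.inl_apply] at h2
  exact h2

lemma memLp_dirDeriv (hφ : ContDiff ℝ (⊤ : ℕ∞) φ) (hc : HasCompactSupport φ) (e : ℝ × Ed d) :
    MemLp (fun z => fderiv ℝ φ z e) 2 :=
  ((hφ.continuous_fderiv (by simp)).clm_apply continuous_const).memLp_of_hasCompactSupport
    (hc.fderiv_apply (𝕜 := ℝ) e)

lemma integral_slice_fderiv (hφ : ContDiff ℝ (⊤ : ℕ∞) φ) (hc : HasCompactSupport φ)
    (t : ℝ) (e : Ed d) : ∫ x, fderiv ℝ φ (t, x) (0, e) = 0 := by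
  have h1 := contDiff_slice hφ t
  have hc1 := hasCompactSupport_slice hc t
  have := integral_mul_fderiv_eq_neg_fderiv_mul_of_integrable (μ := (volume : Measure (Ed d)))
    (f := fun _ => (1 : ℝ)) (g := fun x => φ (t, x)) (v := e) (by simp)
    (by simpa using ((h1.continuous_fderiv (by simp)).clm_apply
      continuous_const).integrable_of_hasCompactSupport (hc1.fderiv_apply (𝕜 := ℝ) e))
    (by simpa using h1.continuous.integrable_of_hasCompactSupport hc1)
    (by fun_prop) (fun x _ => h1.differentiable (by simp) x)
  simpa [fderiv_slice hφ] using this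

end Slice

section Grad

variable {d : ℕ} {s Λ : ℝ} {A : ℝ → Ed d → Ed d → Ed d} {K : ℝ → Ed d → Ed d → ℝ}
    {J : Set ℝ} {Ω : Set (Ed d)} {v : ℝ → Ed d → ℝ} {Dv : ℝ → Ed d → Ed d}
    {t₁ t₂ : ℝ} {x₀ : Ed d} {R ρ : ℝ}

lemma LocalSol.integral_v_mul_fderiv (h : LocalSol d s Λ A K J Ω v Dv t₁ t₂ x₀ R)
    {ψ : ℝ × Ed d → ℝ} (hψ : ContDiff ℝ (⊤ : ℕ∞) ψ) (hc : HasCompactSupport ψ)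
    (hs : ∀ t, tsupport (fun x => ψ (t, x)) ⊆ closedBall x₀ (2 * R)) (e : Ed d) :
    ∫ z, (Ioo t₁ t₂ ×ˢ closedBall x₀ (2 * R)).indicator (fun z => v z.1 z.2) z
        * fderiv ℝ ψ z (0, e)
      = -∫ z, ψ z * ⟪(Ioo t₁ t₂ ×ˢ closedBall x₀ (2 * R)).indicator
          (fun z => Dv z.1 z.2) z, e⟫ := by
  have h0 : ∀ t x, x ∉ closedBall x₀ (2 * R) → ψ (t, x) = 0 := fun t x hx =>
    image_eq_zero_of_notMem_tsupport (f := fun x => ψ (t, x)) fun hx' => hx (hs t hx')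
  have h0' : ∀ t x, x ∉ closedBall x₀ (2 * R) → fderiv ℝ ψ (t, x) (0, e) = 0 := fun t x hx => by
    rw [← fderiv_slice hψ]
    have : fderiv ℝ (fun x => ψ (t, x)) x = 0 := image_eq_zero_of_notMem_tsupport
      fun hx' => hx (hs t (tsupport_fderiv_subset ℝ hx'))
    simp [this]
  have hi1 := integrable_mul_of_memLp_two h.memLp_v (memLp_dirDeriv hψ hc (0, e))
  have hi2 : Integrable fun z => ψ z * ⟪(Ioo t₁ t₂ ×ˢ closedBall x₀ (2 * R)).indicator
          (fun z => Dv z.1 z.2) z, e⟫ := by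
    refine integrable_mul_of_memLp_two (hψ.continuous.memLp_of_hasCompactSupport hc) ?_
    refine MemLp.of_le_mul (c := ‖e‖) h.memLp_Dv (h.memLp_Dv.1.inner aestronglyMeasurable_const)
      (ae_of_all _ fun z => ?_)
    exact (norm_inner_le_norm (𝕜 := ℝ) (E := Ed d) _ _).trans_eq (mul_comm _ _)
  rw [Measure.volume_eq_prod] at hi1 hi2 ⊢
  rw [integral_prod _ hi1, integral_prod _ hi2, ← integral_neg]
  congr 1
  ext1 t
  by_cases ht : t ∈ Ioo t₁ t₂
  · have hg := h.reg.grad t (h.hJ (Ioo_subset_Icc_self ht)) _ (contDiff_slice hψ t)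
      (hasCompactSupport_slice hc t) ((hs t).trans h.hΩ) e
    refine Eq.trans ?_ (hg.trans (congrArg Neg.neg ?_))
    · congr 1
      ext1 x
      rw [fderiv_slice hψ]
      by_cases hx : x ∈ closedBall x₀ (2 * R)
      · rw [indicator_of_mem (show (t, x) ∈ Ioo t₁ t₂ ×ˢ closedBall x₀ (2 * R) from ⟨ht, hx⟩)]
      · rw [h0' t x hx, mul_zero, mul_zero]
    · congr 1
      ext1 x
      by_cases hx : x ∈ closedBall x₀ (2 * R)
      · rw [indicator_of_mem (show (t, x) ∈ Ioo t₁ t₂ ×ˢ closedBall x₀ (2 * R) from ⟨ht, hx⟩)]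
      · rw [h0 t x hx, zero_mul, zero_mul]
  · have hn : ∀ x, (t, x) ∉ Ioo t₁ t₂ ×ˢ closedBall x₀ (2 * R) := fun x hx => ht hx.1
    simp [indicator_of_notMem (hn _)]

lemma LocalSol.integral_corr_mul_fderiv (h : LocalSol d s Λ A K J Ω v Dv t₁ t₂ x₀ R) (hρ : 0 < ρ)
    {ψ : ℝ × Ed d → ℝ} (hψ : ContDiff ℝ (⊤ : ℕ∞) ψ) (hc : HasCompactSupport ψ)
    (hs : ∀ t, tsupport (fun x => ψ (t, x)) ⊆ closedBall x₀ (2 * R)) (e : Ed d) :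
    ∫ z, (Ioo t₁ t₂ ×ˢ closedBall x₀ (2 * R)).indicator
      (fun z : ℝ × Ed d => corr s Λ v t₁ t₂ x₀ ρ z.1) z * fderiv ℝ ψ z (0, e) = 0 := by
  have h0' : ∀ t x, x ∉ closedBall x₀ (2 * R) → fderiv ℝ ψ (t, x) (0, e) = 0 := fun t x hx => by
    rw [← fderiv_slice hψ]
    have : fderiv ℝ (fun x => ψ (t, x)) x = 0 := image_eq_zero_of_notMem_tsupport
      fun hx' => hx (hs t (tsupport_fderiv_subset ℝ hx'))
    simp [this]
  have hi1 := integrable_mul_of_memLp_two (h.memLp_corr hρ) (memLp_dirDeriv hψ hc (0, e))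
  rw [Measure.volume_eq_prod] at hi1 ⊢
  rw [integral_prod _ hi1]
  refine integral_eq_zero_of_ae (ae_of_all _ fun t => ?_)
  by_cases ht : t ∈ Ioo t₁ t₂
  · have : ∀ x, (Ioo t₁ t₂ ×ˢ closedBall x₀ (2 * R)).indicator
        (fun z : ℝ × Ed d => corr s Λ v t₁ t₂ x₀ ρ z.1) (t, x) * fderiv ℝ ψ (t, x) (0, e)
        = corr s Λ v t₁ t₂ x₀ ρ t * fderiv ℝ ψ (t, x) (0, e) := fun x => by
      by_cases hx : x ∈ closedBall x₀ (2 * R)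
      · rw [indicator_of_mem (show (t, x) ∈ Ioo t₁ t₂ ×ˢ closedBall x₀ (2 * R) from ⟨ht, hx⟩)]
      · rw [h0' t x hx, mul_zero, mul_zero]
    simp only [this, integral_const_mul, integral_slice_fderiv hψ hc, mul_zero, Pi.zero_apply]
  · have hn : ∀ x, (t, x) ∉ Ioo t₁ t₂ ×ˢ closedBall x₀ (2 * R) := fun x hx => ht hx.1
    simp [indicator_of_notMem (hn _)]

lemma LocalSol.weakGrad_redU (h : LocalSol d s Λ A K J Ω v Dv t₁ t₂ x₀ R) (hρ : 0 < ρ)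
    {φ : ℝ × Ed d → ℝ} (hφ : ContDiff ℝ (⊤ : ℕ∞) φ) (hc : HasCompactSupport φ) (e : Ed d) :
    ∫ z, redU s Λ v t₁ t₂ x₀ R ρ z * fderiv ℝ φ z (0, e)
      = -∫ z, ⟪redDu s Λ v Dv t₁ t₂ x₀ R ρ z, e⟫ * φ z := by
  set B := Ioo t₁ t₂ ×ˢ closedBall x₀ (2 * R) with hB
  set w := B.indicator fun z : ℝ × Ed d => v z.1 z.2 - corr s Λ v t₁ t₂ x₀ ρ z.1 with hw
  have hχ : ContDiff ℝ (⊤ : ℕ∞) fun z : ℝ × Ed d => spCut x₀ R z.2 :=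
    spCut_contDiff.comp contDiff_snd
  set ψ : ℝ × Ed d → ℝ := fun z => spCut x₀ R z.2 * φ z with hψd
  have hψ : ContDiff ℝ (⊤ : ℕ∞) ψ := hχ.mul hφ
  have hψc : HasCompactSupport ψ := hc.mul_left
  have hs : ∀ t, tsupport (fun x => ψ (t, x)) ⊆ closedBall x₀ (2 * R) := fun t =>
    (tsupport_mul_subset_left (f := spCut x₀ R) (g := fun x => φ (t, x))).trans
      (spCut_tsupport h.hR)
  have hder : ∀ z : ℝ × Ed d, fderiv ℝ ψ z (0, e)
      = spCut x₀ R z.2 * fderiv ℝ φ z (0, e) + φ z * ⟪gradient (spCut x₀ R) z.2, e⟫ := fun z => by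
    rw [hψd, fderiv_fun_mul (hχ.differentiable (by simp) _) (hφ.differentiable (by simp) _)]
    have h1 : fderiv ℝ (fun z : ℝ × Ed d => spCut x₀ R z.2) z (0, e)
        = fderiv ℝ (spCut x₀ R) z.2 e := by
      have := ((spCut_contDiff (x₀ := x₀) (R := R)).differentiable (by simp) z.2).hasFDerivAt.comp z
        hasFDerivAt_snd
      have h3 : fderiv ℝ (fun z : ℝ × Ed d => spCut x₀ R z.2) z = _ := this.fderiv
      rw [h3]; simp
    have h2 : ⟪gradient (spCut x₀ R) z.2, e⟫ = fderiv ℝ (spCut x₀ R) z.2 e := by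
      simp [gradient]
    simp [h1, h2]
  have hv := h.integral_v_mul_fderiv hψ hψc hs e
  have hg := h.integral_corr_mul_fderiv hρ hψ hψc hs e
  have hD := memLp_dirDeriv hψ hψc (0, e)
  have hwi : ∫ z, w z * fderiv ℝ ψ z (0, e)
      = -∫ z, ψ z * ⟪B.indicator (fun z => Dv z.1 z.2) z, e⟫ := by
    have hsplit := integral_sub (integrable_mul_of_memLp_two h.memLp_v hD)
      (integrable_mul_of_memLp_two (h.memLp_corr hρ) hD)
    rw [hv, hg, sub_zero] at hsplit
    rw [← hsplit]
    congr 1; ext1 z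
    by_cases hz : z ∈ B
    · simp only [hw, ← hB, indicator_of_mem hz]; ring
    · simp only [hw, ← hB, indicator_of_notMem hz]; ring
  obtain ⟨C, hC0, hC⟩ := exists_norm_gradient_spCut_le (x₀ := x₀) h.hR
  have hφp : MemLp (fun z => φ z * ⟪gradient (spCut x₀ R) z.2, e⟫) 2 := by
    refine Continuous.memLp_of_hasCompactSupport ?_ hc.mul_right
    exact hφ.continuous.mul ((continuous_gradient_spCut.comp continuous_snd).inner
      continuous_const)
  have hi1 := integrable_mul_of_memLp_two (h.memLp_sub_corr hρ) hD
  have hi2 := integrable_mul_of_memLp_two (h.memLp_sub_corr hρ) hφp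
  have hi3 : Integrable fun z => ψ z * ⟪B.indicator (fun z => Dv z.1 z.2) z, e⟫ := by
    refine integrable_mul_of_memLp_two (hψ.continuous.memLp_of_hasCompactSupport hψc) ?_
    refine MemLp.of_le_mul (c := ‖e‖) h.memLp_Dv (h.memLp_Dv.1.inner aestronglyMeasurable_const)
      (ae_of_all _ fun z => ?_)
    exact (norm_inner_le_norm (𝕜 := ℝ) (E := Ed d) _ _).trans_eq (mul_comm _ _)
  calc _ = ∫ z, (w z * fderiv ℝ ψ z (0, e)
          - w z * (φ z * ⟪gradient (spCut x₀ R) z.2, e⟫)) := by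
        congr 1; ext1 z
        rw [hder, redU, hw, ← hB]
        by_cases hz : z ∈ B
        · simp only [indicator_of_mem hz]; ring
        · simp only [indicator_of_notMem hz]; ring
    _ = (-∫ z, ψ z * ⟪B.indicator (fun z => Dv z.1 z.2) z, e⟫)
          - ∫ z, w z * (φ z * ⟪gradient (spCut x₀ R) z.2, e⟫) := by
        rw [integral_sub hi1 hi2, hwi]
    _ = -∫ z, (ψ z * ⟪B.indicator (fun z => Dv z.1 z.2) z, e⟫
          + w z * (φ z * ⟪gradient (spCut x₀ R) z.2, e⟫)) := by
        rw [integral_add hi3 hi2]; ring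
    _ = _ := by
        congr 2; ext1 z
        rw [redDu, hw, ← hB]
        by_cases hz : z ∈ B
        · simp only [indicator_of_mem hz, inner_add_left, real_inner_smul_left, hψd]; ring
        · simp only [indicator_of_notMem hz, inner_zero_left]; ring

end Grad

/-- The jump kernel restricted to jumps inside `B_ρ(x₀)`. -/
def nearK {d : ℕ} (K : ℝ → Ed d → Ed d → ℝ) (t₁ t₂ : ℝ) (x₀ : Ed d) (ρ : ℝ)
    (z : ℝ × Ed d) (h : Ed d) : ℝ :=
  {p : (ℝ × Ed d) × Ed d | (p.2 ≠ 0 ∧ p.1.1 ∈ Ioo t₁ t₂) ∧ p.1.2 ∈ ball x₀ ρ ∧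
    p.1.2 + p.2 ∈ ball x₀ ρ}.indicator (fun p => K p.1.1 p.1.2 (p.1.2 + p.2)) (z, h)

/-- The nonlocal interaction of a point with the exterior of `B_ρ(x₀)`. -/
def farB {d : ℕ} (K : ℝ → Ed d → Ed d → ℝ) (v : ℝ → Ed d → ℝ) (x₀ : Ed d) (ρ : ℝ)
    (z : ℝ × Ed d) : ℝ :=
  ∫ y in (ball x₀ ρ)ᶜ, (v z.1 z.2 - v z.1 y) * K z.1 z.2 y

/-- The zeroth-order term produced by the far jumps and the corrector. -/
def redF {d : ℕ} (s Λ : ℝ) (K : ℝ → Ed d → Ed d → ℝ) (v : ℝ → Ed d → ℝ) (t₁ t₂ : ℝ) (x₀ : Ed d)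
    (ρ : ℝ) : ℝ × Ed d → ℝ :=
  (Ioo t₁ t₂ ×ˢ ball x₀ (7 / 8 * ρ)).indicator fun z =>
    2 * farB K v x₀ ρ z + tailConst d Λ * farTail s v x₀ ρ z.1

section Far

variable {d : ℕ} {s Λ : ℝ} {A : ℝ → Ed d → Ed d → Ed d} {K : ℝ → Ed d → Ed d → ℝ}
    {J : Set ℝ} {Ω : Set (Ed d)} {v : ℝ → Ed d → ℝ} {Dv : ℝ → Ed d → Ed d}
    {t₁ t₂ : ℝ} {x₀ : Ed d} {R ρ : ℝ}

lemma jumpBound_nearK (hΛ : 0 < Λ) (hK : KernelHyp d s Λ K) :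
    JumpBound s Λ (nearK K t₁ t₂ x₀ ρ) where
  meas := by
    unfold nearK
    refine Measurable.indicator ?_ ?_
    · exact hK.meas.comp (f := fun p : (ℝ × Ed d) × Ed d => (p.1.1, p.1.2, p.1.2 + p.2))
        (by fun_prop)
    · refine MeasurableSet.inter (MeasurableSet.inter ?_ ?_) (MeasurableSet.inter ?_ ?_)
      · exact (measurableSet_singleton (0 : Ed d)).compl.preimage measurable_snd
      · exact measurableSet_Ioo.preimage (measurable_fst.comp measurable_fst)
      · exact isOpen_ball.measurableSet.preimage (measurable_snd.comp measurable_fst)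
      · exact isOpen_ball.measurableSet.preimage
          (by fun_prop : Measurable fun p : (ℝ × Ed d) × Ed d => p.1.2 + p.2)
  nonneg z h := by
    unfold nearK
    refine indicator_apply_nonneg fun hp => ?_
    exact kernel_nonneg hΛ hK _ (by simpa using hp.1.1)
  le z h := by
    unfold nearK
    have h0 : 0 ≤ Λ * ‖h‖ ^ (-((d : ℝ) + 2 * s)) := by positivity
    refine indicator_apply_le' (fun hp => ?_) fun _ => h0
    have := hK.upper z.1 z.2 (z.2 + h) (by simpa using hp.1.1)
    refine this.trans_eq ?_
    simp only [sub_add_cancel_left, norm_neg]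
    rw [Real.rpow_neg (norm_nonneg _), div_eq_mul_inv]

lemma integrableOn_far_kernel (hd : 2 ≤ d) (hs : s ∈ Ioo (0 : ℝ) 1) (hρ : 0 < ρ) :
    IntegrableOn (fun y => 1 / ‖x₀ - y‖ ^ ((d : ℝ) + 2 * s)) (ball x₀ ρ)ᶜ := by
  have h1 : Integrable fun y : Ed d => ‖x₀ - y‖ ^ (-((d : ℝ) + 2 * s)) * min (‖x₀ - y‖ ^ 2) 1 :=
    (integrable_norm_rpow_mul_min hd hs.1 hs.2).comp_sub_left x₀
  have hm : 0 < min (ρ ^ 2) 1 := by positivity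
  refine Integrable.mono' (h1.const_mul (min (ρ ^ 2) 1)⁻¹).integrableOn ?_
    ((ae_restrict_iff' isOpen_ball.measurableSet.compl).2 (ae_of_all _ fun y hy => ?_))
  · exact (measurable_const.div
      (((measurable_const.sub measurable_id).norm).pow_const _)).aestronglyMeasurable
  · have hr : ρ ≤ ‖x₀ - y‖ := by
      rw [mem_compl_iff, mem_ball, not_lt, dist_comm, dist_eq_norm] at hy; exact hy
    rw [Real.norm_of_nonneg (by positivity), Real.rpow_neg (norm_nonneg _), one_div]
    have h2 : min (ρ ^ 2) 1 ≤ min (‖x₀ - y‖ ^ 2) 1 := by gcongr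
    have h3 : 1 ≤ (min (ρ ^ 2) 1)⁻¹ * min (‖x₀ - y‖ ^ 2) 1 := by
      rw [inv_mul_eq_div, one_le_div hm]; exact h2
    have h4 : 0 ≤ (‖x₀ - y‖ ^ ((d : ℝ) + 2 * s))⁻¹ := by positivity
    nlinarith

lemma measurable_farB (hv : Measurable (Function.uncurry v)) (hK : KernelHyp d s Λ K) :
    Measurable (farB K v x₀ ρ) := by
  have h : StronglyMeasurable fun p : (ℝ × Ed d) × Ed d =>
      (v p.1.1 p.1.2 - v p.1.1 p.2) * K p.1.1 p.1.2 p.2 := by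
    refine Measurable.stronglyMeasurable ?_
    refine ((hv.comp measurable_fst).sub
      (hv.comp (f := fun p : (ℝ × Ed d) × Ed d => (p.1.1, p.2)) (by fun_prop))).mul ?_
    exact hK.meas.comp (f := fun p : (ℝ × Ed d) × Ed d => (p.1.1, p.1.2, p.2)) (by fun_prop)
  exact (h.integral_prod_right' (ν := volume.restrict (ball x₀ ρ)ᶜ)).measurable

lemma LocalSol.far_abs_kernel_le (h : LocalSol d s Λ A K J Ω v Dv t₁ t₂ x₀ R) (hρ : 0 < ρ)
    (t : ℝ) {x y : Ed d} (hx : x ∈ ball x₀ (7 / 8 * ρ)) (hy : y ∉ ball x₀ ρ) :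
    |K t x y| ≤ Λ * 8 ^ (d + 2) * (1 / ‖x₀ - y‖ ^ ((d : ℝ) + 2 * s)) := by
  have hΛ0 : 0 < Λ := by linarith [h.hΛ]
  have hxy : x ≠ y := by
    rintro rfl
    exact hy (ball_subset_ball (by linarith) hx)
  rw [abs_of_nonneg (kernel_nonneg hΛ0 h.hK t hxy)]
  exact kernel_far_le h.hs hΛ0.le hρ h.hK t hx hy

lemma LocalSol.abs_farB_le (h : LocalSol d s Λ A K J Ω v Dv t₁ t₂ x₀ R) (hρ : 0 < ρ) :
    ∀ᵐ z : ℝ × Ed d, z ∈ Ioo t₁ t₂ ×ˢ ball x₀ (7 / 8 * ρ) →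
      |farB K v x₀ ρ z| ≤ Λ * 8 ^ (d + 2) *
        (|v z.1 z.2| * (∫ y in (ball x₀ ρ)ᶜ, 1 / ‖x₀ - y‖ ^ ((d : ℝ) + 2 * s))
          + farTail s v x₀ ρ z.1) := by
  have h1 := Measure.quasiMeasurePreserving_fst (μ := (volume : Measure ℝ))
    (ν := (volume : Measure (Ed d))) |>.ae (ae_integrableOn_farTail (x₀ := x₀) h.hs.1 hρ h.reg)
  filter_upwards [h1] with z hz hzP
  have hi := hz (h.hJ (Ioo_subset_Icc_self hzP.1))
  have hi2 := integrableOn_far_kernel (x₀ := x₀) h.hd h.hs hρ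
  have hi3 := ((hi2.const_mul |v z.1 z.2|).add hi).const_mul (Λ * 8 ^ (d + 2))
  have := norm_integral_le_of_norm_le hi3 (f := fun y => (v z.1 z.2 - v z.1 y) * K z.1 z.2 y)
    ((ae_restrict_iff' isOpen_ball.measurableSet.compl).2 (ae_of_all _ fun y hy => ?_))
  · rw [integral_const_mul, integral_add' (hi2.const_mul _) hi, integral_const_mul] at this
    exact this
  · have hk := h.far_abs_kernel_le hρ z.1 hzP.2 hy
    have h3 : |v z.1 z.2 - v z.1 y| ≤ |v z.1 z.2| + |v z.1 y| := abs_sub _ _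
    rw [norm_mul, Real.norm_eq_abs, Real.norm_eq_abs]
    calc _ ≤ (|v z.1 z.2| + |v z.1 y|)
          * (Λ * 8 ^ (d + 2) * (1 / ‖x₀ - y‖ ^ ((d : ℝ) + 2 * s))) := by gcongr
      _ = _ := by simp only [Pi.add_apply]; ring

lemma LocalSol.memLp_farTail_box (h : LocalSol d s Λ A K J Ω v Dv t₁ t₂ x₀ R) (hρ : 0 < ρ) :
    MemLp ((Ioo t₁ t₂ ×ˢ closedBall x₀ (2 * R)).indicator
      fun z : ℝ × Ed d => farTail s v x₀ ρ z.1) 2 := by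
  have hm : Measurable fun z : ℝ × Ed d => farTail s v x₀ ρ z.1 :=
    (measurable_farTail h.reg.meas).comp measurable_fst
  rw [memLp_indicator_iff_restrict measurableSet_box,
    memLp_two_iff_integrable_sq hm.aestronglyMeasurable]
  have h1 := memLp_farTail (x₀ := x₀) h.hs.1 hρ h.reg h.hJ
  rw [memLp_indicator_iff_restrict measurableSet_Ioo, memLp_two_iff_integrable_sq
    (measurable_farTail h.reg.meas).aestronglyMeasurable] at h1
  rw [Measure.volume_eq_prod, ← Measure.prod_restrict]
  have : IsFiniteMeasure ((volume : Measure (Ed d)).restrict (closedBall x₀ (2 * R))) :=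
    ⟨by rw [Measure.restrict_apply_univ]; exact measure_closedBall_lt_top⟩
  exact h1.comp_fst _

lemma LocalSol.memLp_redF (h : LocalSol d s Λ A K J Ω v Dv t₁ t₂ x₀ R) (hρ : 0 < ρ)
    (hρR : ρ ≤ R) : MemLp (redF s Λ K v t₁ t₂ x₀ ρ) 2 := by
  have hP : MeasurableSet (Ioo t₁ t₂ ×ˢ ball x₀ (7 / 8 * ρ)) :=
    measurableSet_Ioo.prod isOpen_ball.measurableSet
  set B := Ioo t₁ t₂ ×ˢ closedBall x₀ (2 * R) with hB
  have hPB : Ioo t₁ t₂ ×ˢ ball x₀ (7 / 8 * ρ) ⊆ B := prod_mono le_rfl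
    (ball_subset_closedBall.trans (closedBall_subset_closedBall (by linarith)))
  have hH := h.memLp_farTail_box hρ
  rw [← hB] at hH
  set c := ∫ y in (ball x₀ ρ)ᶜ, 1 / ‖x₀ - y‖ ^ ((d : ℝ) + 2 * s) with hc
  have hc0 : 0 ≤ c := setIntegral_nonneg isOpen_ball.measurableSet.compl fun y _ => by positivity
  have hbig : MemLp (fun z => 2 * (Λ * 8 ^ (d + 2)) * c * ‖B.indicator (fun z => v z.1 z.2) z‖
      + (2 * (Λ * 8 ^ (d + 2)) + tailConst d Λ)
        * ‖B.indicator (fun z : ℝ × Ed d => farTail s v x₀ ρ z.1) z‖) 2 :=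
    (h.memLp_v.norm.const_mul _).add (hH.norm.const_mul _)
  have hΛ0 : 0 < Λ := by linarith [h.hΛ]
  refine hbig.mono' (Measurable.indicator ?_ hP).aestronglyMeasurable ?_
  · exact ((measurable_farB h.reg.meas h.hK).const_mul 2).add
      (((measurable_farTail h.reg.meas).comp measurable_fst).const_mul _)
  · filter_upwards [h.abs_farB_le hρ] with z hz
    unfold redF
    have hT := (tailConst_pos (d := d) h.hΛ).le
    by_cases hzP : z ∈ Ioo t₁ t₂ ×ˢ ball x₀ (7 / 8 * ρ)
    · rw [indicator_of_mem hzP, indicator_of_mem (hPB hzP), indicator_of_mem (hPB hzP)]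
      have h1 := hz hzP
      have h2 : 0 ≤ farTail s v x₀ ρ z.1 := farTail_nonneg _
      simp only [Real.norm_eq_abs]
      rw [abs_of_nonneg h2]
      have h3 := abs_add_le (2 * farB K v x₀ ρ z) (tailConst d Λ * farTail s v x₀ ρ z.1)
      rw [abs_mul, abs_two, abs_of_nonneg (mul_nonneg hT h2)] at h3
      refine h3.trans ?_
      nlinarith
    · rw [indicator_of_notMem hzP, norm_zero]
      positivity

lemma LocalSol.redF_nonneg (h : LocalSol d s Λ A K J Ω v Dv t₁ t₂ x₀ R) (hρ : 0 < ρ)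
    (hρR : ρ ≤ R) : ∀ᵐ z : ℝ × Ed d, z ∈ Ioo t₁ t₂ ×ˢ ball x₀ (7 / 8 * ρ) →
      0 < redU s Λ v t₁ t₂ x₀ R ρ z → 0 ≤ redF s Λ K v t₁ t₂ x₀ ρ z := by
  have hΛ0 : 0 < Λ := by linarith [h.hΛ]
  have h1 := Measure.quasiMeasurePreserving_fst (μ := (volume : Measure ℝ))
    (ν := (volume : Measure (Ed d))) |>.ae (ae_integrableOn_farTail (x₀ := x₀) h.hs.1 hρ h.reg)
  filter_upwards [h1] with z hz hzP hu
  have hi := hz (h.hJ (Ioo_subset_Icc_self hzP.1))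
  have hzB : z ∈ Ioo t₁ t₂ ×ˢ closedBall x₀ (2 * R) := ⟨hzP.1,
    ball_subset_closedBall (ball_subset_ball (by linarith) hzP.2)⟩
  have hv0 : 0 ≤ v z.1 z.2 := by
    rw [redU, indicator_of_mem hzB] at hu
    have := pos_of_mul_pos_right hu (spCut_nonneg _)
    have := h.corr_nonneg (ρ := ρ) hzP.1.1.le
    linarith
  have hT : 0 ≤ farTail s v x₀ ρ z.1 := farTail_nonneg _
  rw [redF, indicator_of_mem hzP, tailConst]
  have key : -(Λ * 8 ^ (d + 2) * farTail s v x₀ ρ z.1) ≤ farB K v x₀ ρ z := by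
    unfold farB
    by_cases hintg : IntegrableOn (fun y => (v z.1 z.2 - v z.1 y) * K z.1 z.2 y) (ball x₀ ρ)ᶜ
    · rw [farTail, ← integral_const_mul, ← integral_neg]
      refine setIntegral_mono_on (hi.const_mul _).neg hintg isOpen_ball.measurableSet.compl
        fun y hy => ?_
      have hk := h.far_abs_kernel_le hρ z.1 hzP.2 hy
      have hxy : z.2 ≠ y := by
        intro hxy
        exact hy (hxy ▸ ball_subset_ball (by linarith) hzP.2)
      have hk0 := kernel_nonneg hΛ0 h.hK z.1 hxy
      rw [abs_of_nonneg hk0] at hk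
      have h5 : -|v z.1 y| ≤ v z.1 z.2 - v z.1 y := by linarith [le_abs_self (v z.1 y)]
      calc -(Λ * 8 ^ (d + 2) * (|v z.1 y| / ‖x₀ - y‖ ^ ((d : ℝ) + 2 * s)))
          = -|v z.1 y| * (Λ * 8 ^ (d + 2) * (1 / ‖x₀ - y‖ ^ ((d : ℝ) + 2 * s))) := by ring
        _ ≤ -|v z.1 y| * K z.1 z.2 y :=
            mul_le_mul_of_nonpos_left hk (neg_nonpos.2 (abs_nonneg _))
        _ ≤ _ := mul_le_mul_of_nonneg_right h5 hk0
    · rw [integral_undef hintg]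
      have : 0 ≤ Λ * 8 ^ (d + 2) * farTail s v x₀ ρ z.1 := by positivity
      linarith
  linarith

lemma LocalSol.elliptic (h : LocalSol d s Λ A K J Ω v Dv t₁ t₂ x₀ R) (hρ : 0 < ρ)
    (hρR : ρ ≤ R) : Elliptic Λ (Ioo t₁ t₂ ×ˢ ball x₀ (7 / 8 * ρ)) (redU s Λ v t₁ t₂ x₀ R ρ)
      (redF s Λ K v t₁ t₂ x₀ ρ) (redDu s Λ v Dv t₁ t₂ x₀ R ρ) (redA A Dv t₁ t₂ x₀ R) := by
  have key : ∀ z ∈ Ioo t₁ t₂ ×ˢ ball x₀ (7 / 8 * ρ),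
      redDu s Λ v Dv t₁ t₂ x₀ R ρ z = Dv z.1 z.2 ∧
        redA A Dv t₁ t₂ x₀ R z = A z.1 z.2 (Dv z.1 z.2) := fun z hz => by
    have hR := h.hR
    have hzb : z.2 ∈ ball x₀ R := ball_subset_ball (by linarith) hz.2
    have hzB : z ∈ Ioo t₁ t₂ ×ˢ closedBall x₀ (2 * R) := ⟨hz.1,
      ball_subset_closedBall (ball_subset_ball (by linarith) hz.2)⟩
    rw [redDu, redA, indicator_of_mem hzB, indicator_of_mem hzB,
      spCut_one hR (ball_subset_closedBall hzb), gradient_spCut_eq_zero_of_ball hR hzb]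
    simp
  refine ⟨ae_of_all _ fun z hz => ?_, ae_of_all _ fun z hz => ?_, h.redF_nonneg hρ hρR⟩
  · rw [(key z hz).1, (key z hz).2]
    have h0 : A z.1 z.2 0 = 0 := by
      have := h.hA.growth z.1 z.2 0
      simpa using this
    have := h.hA.monotone z.1 z.2 0 (Dv z.1 z.2)
    simpa [h0] using this
  · rw [(key z hz).1, (key z hz).2]
    exact h.hA.growth _ _ _

end Far

section Pairs

variable {d : ℕ}

lemma measurePreserving_increment :
    MeasurePreserving (fun p : (ℝ × Ed d) × Ed d => (p.2 - p.1.2, p.1)) := by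
  have h1 : MeasurePreserving (fun p : (ℝ × Ed d) × Ed d => (p.1, p.2 - p.1.2)) :=
    (MeasurePreserving.id (volume : Measure (ℝ × Ed d))).skew_product
      (g := fun z y => y - z.2) (by fun_prop)
      (ae_of_all _ fun z => (measurePreserving_sub_right volume z.2).map_eq)
  exact Measure.measurePreserving_swap.comp h1

lemma measurePreserving_exchange :
    MeasurePreserving (fun p : (ℝ × Ed d) × Ed d => (((p.1.1, p.2), p.1.2) : (ℝ × Ed d) × Ed d)) := by
  have h1 : MeasurePreserving (Prod.map id Prod.swap : ℝ × (Ed d × Ed d) → ℝ × (Ed d × Ed d)) :=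
    (MeasurePreserving.id (volume : Measure ℝ)).prod Measure.measurePreserving_swap
  have h2 := measurePreserving_prodAssoc (volume : Measure ℝ) (volume : Measure (Ed d))
    (volume : Measure (Ed d))
  exact (h2.symm.comp h1).comp h2

variable {s Λ : ℝ} {κ : ℝ × Ed d → Ed d → ℝ}

lemma JumpBound.integrable_prod (hd : 2 ≤ d) (hs0 : 0 < s) (hs1 : s < 1) (hκ : JumpBound s Λ κ)
    {u φ : ℝ × Ed d → ℝ} {M N : ℝ} (hum : Measurable u) (hφm : Measurable φ)
    (hu : MemLp u 2) (hφ : MemLp φ 2) (hM : DiffBound u M) (hN : DiffBound φ N) :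
    Integrable fun p : Ed d × (ℝ × Ed d) =>
      spDiff u p.1 p.2 * spDiff φ p.1 p.2 * κ p.2 p.1 := by
  have hk : Measurable fun p : Ed d × (ℝ × Ed d) => κ p.2 p.1 := hκ.meas.comp measurable_swap
  have key : ∀ {w : ℝ × Ed d → ℝ} {M : ℝ}, Measurable w → MemLp w 2 → DiffBound w M →
      Integrable fun p : Ed d × (ℝ × Ed d) =>
        spDiff w p.1 p.2 * spDiff w p.1 p.2 * κ p.2 p.1 := by
    intro w M hwm hw hM
    have hm := ((measurable_spDiff_uncurry hwm).mul (measurable_spDiff_uncurry hwm)).mul hk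
    have hm' : AEStronglyMeasurable (fun p : Ed d × (ℝ × Ed d) =>
      spDiff w p.1 p.2 * spDiff w p.1 p.2 * κ p.2 p.1)
      ((volume : Measure (Ed d)).prod (volume : Measure (ℝ × Ed d))) := hm.aestronglyMeasurable
    rw [Measure.volume_eq_prod, integrable_prod_iff hm']
    refine ⟨ae_of_all _ fun h => hκ.integrable_inner hw hw h, ?_⟩
    refine (hκ.integrable_outer hd hs0 hs1 hwm hwm hw hw hM hM).congr (ae_of_all _ fun h => ?_)
    refine integral_congr_ae (ae_of_all _ fun z => (Real.norm_of_nonneg ?_).symm)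
    exact mul_nonneg (mul_self_nonneg _) (hκ.nonneg z h)
  refine (((key hum hu hM).add (key hφm hφ hN)).const_mul (1 / 2)).mono'
    (((measurable_spDiff_uncurry hum).mul
      (measurable_spDiff_uncurry hφm)).mul hk).aestronglyMeasurable (ae_of_all _ fun p => ?_)
  have h0 := hκ.nonneg p.2 p.1
  rw [norm_mul, norm_mul, Real.norm_of_nonneg h0]
  simp only [Pi.add_apply, Real.norm_eq_abs]
  have h1 := two_mul_le_add_sq |spDiff u p.1 p.2| |spDiff φ p.1 p.2|
  rw [sq_abs, sq_abs] at h1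
  nlinarith [mul_le_mul_of_nonneg_right h1 h0]

lemma JumpBound.nlForm_eq_integral_pairs (hd : 2 ≤ d) (hs0 : 0 < s) (hs1 : s < 1)
    (hκ : JumpBound s Λ κ)
    {u φ : ℝ × Ed d → ℝ} {M N : ℝ} (hum : Measurable u) (hφm : Measurable φ)
    (hu : MemLp u 2) (hφ : MemLp φ 2) (hM : DiffBound u M) (hN : DiffBound φ N) :
    Integrable (fun p : (ℝ × Ed d) × Ed d => (u (p.1.1, p.2) - u p.1)
      * (φ (p.1.1, p.2) - φ p.1) * κ p.1 (p.2 - p.1.2)) ∧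
    ∫ p : (ℝ × Ed d) × Ed d, (u (p.1.1, p.2) - u p.1)
      * (φ (p.1.1, p.2) - φ p.1) * κ p.1 (p.2 - p.1.2) = nlForm κ u φ := by
  have hi := hκ.integrable_prod hd hs0 hs1 hum hφm hu hφ hM hN
  have he : (fun p : (ℝ × Ed d) × Ed d => (u (p.1.1, p.2) - u p.1)
      * (φ (p.1.1, p.2) - φ p.1) * κ p.1 (p.2 - p.1.2))
      = (fun p : Ed d × (ℝ × Ed d) => spDiff u p.1 p.2 * spDiff φ p.1 p.2 * κ p.2 p.1)
        ∘ (fun p : (ℝ × Ed d) × Ed d => (p.2 - p.1.2, p.1)) := by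
    ext p
    have : p.1 + (0, p.2 - p.1.2) = (p.1.1, p.2) := by ext1 <;> simp
    simp only [Function.comp_apply, spDiff, this]
  rw [he]
  refine ⟨measurePreserving_increment.integrable_comp_of_integrable hi, ?_⟩
  simp only [Function.comp_def]
  rw [← integral_map (φ := fun p : (ℝ × Ed d) × Ed d => (p.2 - p.1.2, p.1))
      (f := fun p : Ed d × (ℝ × Ed d) => spDiff u p.1 p.2 * spDiff φ p.1 p.2 * κ p.2 p.1)
    measurePreserving_increment.measurable.aemeasurable
    (by rw [measurePreserving_increment.map_eq]; exact hi.1),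
    measurePreserving_increment.map_eq]
  rw [Measure.volume_eq_prod] at hi ⊢
  rw [integral_prod _ hi]
  rfl

lemma exists_diffBound_of_contDiff {φ : ℝ × Ed d → ℝ} (hφ : ContDiff ℝ (⊤ : ℕ∞) φ)
    (hc : HasCompactSupport φ) : ∃ N, DiffBound φ N := by
  set D : ℝ × Ed d → Ed d := fun z => (InnerProductSpace.toDual ℝ (Ed d)).symm
    ((fderiv ℝ φ z).comp (ContinuousLinearMap.inr ℝ ℝ (Ed d))) with hD
  have hDe : ∀ z e, ⟪D z, e⟫ = fderiv ℝ φ z (0, e) := fun z e => by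
    simp [hD, InnerProductSpace.toDual_symm_apply]
  have hDc : Continuous D := (LinearIsometryEquiv.continuous _).comp
    ((hφ.continuous_fderiv (by simp)).clm_comp continuous_const)
  have hDs : HasCompactSupport D := by
    refine (hc.fderiv (𝕜 := ℝ)).mono fun z hz => ?_
    contrapose! hz
    have : fderiv ℝ φ z = 0 := by simpa using hz
    simp [hD, this]
  refine ⟨_, diffBound_of_weakGrad (hφ.continuous.memLp_of_hasCompactSupport hc)
    (hDc.memLp_of_hasCompactSupport hDs) fun ψ hψ hψc e => ?_⟩
  simp only [hDe]
  exact integral_mul_fderiv_eq_neg_fderiv_mul_of_contDiff (μ := volume)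
    (hφ.of_le (by exact_mod_cast le_top)) (hψ.of_le (by exact_mod_cast le_top)) hψc (0, e)

end Pairs

section Split

variable {d : ℕ} {s Λ : ℝ} {A : ℝ → Ed d → Ed d → Ed d} {K : ℝ → Ed d → Ed d → ℝ}
    {J : Set ℝ} {Ω : Set (Ed d)} {v : ℝ → Ed d → ℝ} {Dv : ℝ → Ed d → Ed d}
    {t₁ t₂ : ℝ} {x₀ : Ed d} {R ρ : ℝ} {φ : ℝ × Ed d → ℝ}

/-- The integrand of the nonlocal form. -/
def pairG (K : ℝ → Ed d → Ed d → ℝ) (v : ℝ → Ed d → ℝ) (φ : ℝ × Ed d → ℝ)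
    (p : (ℝ × Ed d) × Ed d) : ℝ :=
  (v p.1.1 p.1.2 - v p.1.1 p.2) * (φ p.1 - φ (p.1.1, p.2)) * K p.1.1 p.1.2 p.2

/-- The part of the nonlocal integrand with second point outside `B_ρ(x₀)`. -/
def pairFar (K : ℝ → Ed d → Ed d → ℝ) (v : ℝ → Ed d → ℝ) (φ : ℝ × Ed d → ℝ) (x₀ : Ed d) (ρ : ℝ)
    (p : (ℝ × Ed d) × Ed d) : ℝ :=
  φ p.1 * ((ball x₀ ρ)ᶜ.indicator (fun y => (v p.1.1 p.1.2 - v p.1.1 y) * K p.1.1 p.1.2 y) p.2)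

lemma LocalSol.pairG_eq (h : LocalSol d s Λ A K J Ω v Dv t₁ t₂ x₀ R) (hρ : 0 < ρ) (hρR : ρ ≤ R)
    (hs : tsupport φ ⊆ Ioo t₁ t₂ ×ˢ ball x₀ (7 / 8 * ρ)) (p : (ℝ × Ed d) × Ed d) :
    pairG K v φ p
      = (redU s Λ v t₁ t₂ x₀ R ρ (p.1.1, p.2) - redU s Λ v t₁ t₂ x₀ R ρ p.1)
          * (φ (p.1.1, p.2) - φ p.1) * nearK K t₁ t₂ x₀ ρ p.1 (p.2 - p.1.2)
        + pairFar K v φ x₀ ρ p + pairFar K v φ x₀ ρ ((p.1.1, p.2), p.1.2) := by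
  obtain ⟨⟨t, x⟩, y⟩ := p
  have hφ0 : ∀ z : ℝ × Ed d, z ∉ Ioo t₁ t₂ ×ˢ ball x₀ (7 / 8 * ρ) → φ z = 0 := fun z hz =>
    image_eq_zero_of_notMem_tsupport fun hz' => hz (hs hz')
  have hφb : ∀ x, x ∉ ball x₀ ρ → φ (t, x) = 0 := fun x hx =>
    hφ0 _ fun hz => hx (ball_subset_ball (by linarith) hz.2)
  simp only [pairG, pairFar]
  by_cases ht : t ∈ Ioo t₁ t₂
  swap
  · rw [hφ0 (t, x) fun hz => ht hz.1, hφ0 (t, y) fun hz => ht hz.1]; simp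
  by_cases hx : x ∈ ball x₀ ρ <;> by_cases hy : y ∈ ball x₀ ρ
  · rw [indicator_of_notMem (by simpa using hy), indicator_of_notMem (by simpa using hx)]
    have hu : ∀ x ∈ ball x₀ ρ,
        redU s Λ v t₁ t₂ x₀ R ρ (t, x) = v t x - corr s Λ v t₁ t₂ x₀ ρ t := fun x hx => by
      have hR := h.hR
      rw [redU, indicator_of_mem (show (t, x) ∈ Ioo t₁ t₂ ×ˢ closedBall x₀ (2 * R) from
        ⟨ht, ball_subset_closedBall (ball_subset_ball (by linarith) hx)⟩), spCut_one hR
        (ball_subset_closedBall (ball_subset_ball hρR hx)), one_mul]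
    rw [hu x hx, hu y hy]
    by_cases hxy : x = y
    · subst hxy; simp
    · have hn : nearK K t₁ t₂ x₀ ρ (t, x) (y - x) = K t x (x + (y - x)) := by
        unfold nearK
        refine indicator_of_mem ?_ _
        exact ⟨⟨by simpa [sub_eq_zero] using Ne.symm hxy, ht⟩, hx, by simpa using hy⟩
      rw [hn, add_sub_cancel]
      ring
  · have hn : nearK K t₁ t₂ x₀ ρ (t, x) (y - x) = 0 :=
      indicator_of_notMem (fun hp => hy (by simpa using hp.2.2)) _
    rw [hn, indicator_of_mem (by simpa using hy), hφb y hy]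
    ring
  · have hn : nearK K t₁ t₂ x₀ ρ (t, x) (y - x) = 0 :=
      indicator_of_notMem (fun hp => hx hp.2.1) _
    rw [hn, indicator_of_mem (show x ∈ (ball x₀ ρ)ᶜ from hx), hφb x hx, h.hK.symm t y x]
    ring
  · rw [hφb x hx, hφb y hy]; simp

lemma LocalSol.integrable_pairFar (h : LocalSol d s Λ A K J Ω v Dv t₁ t₂ x₀ R) (hρ : 0 < ρ)
    (hρR : ρ ≤ R) (hφ : ContDiff ℝ (⊤ : ℕ∞) φ) (hc : HasCompactSupport φ)
    (hs : tsupport φ ⊆ Ioo t₁ t₂ ×ˢ ball x₀ (7 / 8 * ρ)) :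
    Integrable (pairFar K v φ x₀ ρ) := by
  have hR := h.hR
  have hΛ0 : 0 < Λ := by linarith [h.hΛ]
  have hφL : MemLp φ 2 := hφ.continuous.memLp_of_hasCompactSupport hc
  have hφ0 : ∀ z : ℝ × Ed d, φ z ≠ 0 → z ∈ Ioo t₁ t₂ ×ˢ ball x₀ (7 / 8 * ρ) := fun z hz =>
    hs (subset_tsupport φ hz)
  have hPB : Ioo t₁ t₂ ×ˢ ball x₀ (7 / 8 * ρ) ⊆ Ioo t₁ t₂ ×ˢ closedBall x₀ (2 * R) :=
    prod_mono le_rfl (ball_subset_closedBall.trans (closedBall_subset_closedBall (by linarith)))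
  set k : Ed d → ℝ := (ball x₀ ρ)ᶜ.indicator fun y => 1 / ‖x₀ - y‖ ^ ((d : ℝ) + 2 * s) with hk
  have hki : Integrable k :=
    (integrableOn_far_kernel h.hd h.hs hρ).integrable_indicator isOpen_ball.measurableSet.compl
  have hkn : ∀ y, 0 ≤ k y := fun y => indicator_nonneg (fun _ _ => by positivity) _
  have hvφ : Integrable fun z => |v z.1 z.2 * φ z| := by
    refine ((integrable_mul_of_memLp_two h.memLp_v hφL).congr (ae_of_all _ fun z => ?_)).abs
    by_cases hz : φ z = 0
    · simp [hz]
    · simp only [indicator_of_mem (hPB (hφ0 z hz))]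
  have h1 : Integrable fun p : (ℝ × Ed d) × Ed d => |v p.1.1 p.1.2 * φ p.1| * k p.2 :=
    hvφ.mul_prod hki
  have hvm : Measurable fun p : (ℝ × Ed d) × Ed d => v p.1.1 p.2 :=
    h.reg.meas.comp (f := fun p : (ℝ × Ed d) × Ed d => (p.1.1, p.2)) (by fun_prop)
  have hkm : Measurable k := (measurable_const.div
      (((measurable_const.sub measurable_id).norm).pow_const _)).indicator
      isOpen_ball.measurableSet.compl
  have h2 : Integrable fun p : (ℝ × Ed d) × Ed d => |φ p.1| * (|v p.1.1 p.2| * k p.2) := by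
    have hm : AEStronglyMeasurable (fun p : (ℝ × Ed d) × Ed d => |φ p.1| * (|v p.1.1 p.2| * k p.2))
        ((volume : Measure (ℝ × Ed d)).prod (volume : Measure (Ed d))) := by
      refine Measurable.aestronglyMeasurable ?_
      exact (hφ.continuous.measurable.comp measurable_fst).abs.mul
        (hvm.abs.mul (hkm.comp measurable_snd))
    have he : ∀ t y, |v t y| * k y
        = (ball x₀ ρ)ᶜ.indicator (fun y => |v t y| / ‖x₀ - y‖ ^ ((d : ℝ) + 2 * s)) y := by
      intro t y
      by_cases hy : y ∈ (ball x₀ ρ)ᶜ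
      · rw [hk, indicator_of_mem hy, indicator_of_mem hy]; ring
      · rw [hk, indicator_of_notMem hy, indicator_of_notMem hy]; ring
    rw [Measure.volume_eq_prod, integrable_prod_iff hm]
    constructor
    · have h3 := Measure.quasiMeasurePreserving_fst (μ := (volume : Measure ℝ))
        (ν := (volume : Measure (Ed d))) |>.ae
          (ae_integrableOn_farTail (x₀ := x₀) h.hs.1 hρ h.reg)
      filter_upwards [h3] with z hz
      by_cases hz0 : φ z = 0
      · simp [hz0]
      · have h4 := (hz (h.hJ (Ioo_subset_Icc_self (hφ0 z hz0).1))).integrable_indicator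
          isOpen_ball.measurableSet.compl
        simp only [he]
        exact h4.const_mul _
    · refine (integrable_mul_of_memLp_two hφL.norm (h.memLp_farTail_box hρ)).congr
        (ae_of_all _ fun z => ?_)
      simp only [norm_mul, Real.norm_eq_abs, abs_abs, integral_const_mul]
      by_cases hz : φ z = 0
      · simp [hz]
      · rw [indicator_of_mem (hPB (hφ0 z hz)), farTail,
          ← integral_indicator isOpen_ball.measurableSet.compl]
        congr 2
        ext1 y
        rw [abs_of_nonneg (hkn y), he]
  refine ((h1.add h2).const_mul (Λ * 8 ^ (d + 2))).mono' ?_ (ae_of_all _ fun p => ?_)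
  · refine Measurable.aestronglyMeasurable ?_
    have hKm : Measurable fun p : (ℝ × Ed d) × Ed d => K p.1.1 p.1.2 p.2 :=
      h.hK.meas.comp (f := fun p : (ℝ × Ed d) × Ed d => (p.1.1, p.1.2, p.2)) (by fun_prop)
    have hv1 : Measurable fun p : (ℝ × Ed d) × Ed d => v p.1.1 p.1.2 :=
      h.reg.meas.comp measurable_fst
    have := ((hv1.sub hvm).mul hKm).indicator
      (isOpen_ball.measurableSet.compl.preimage measurable_snd :
        MeasurableSet ((Prod.snd : (ℝ × Ed d) × Ed d → Ed d) ⁻¹' (ball x₀ ρ)ᶜ))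
    exact (hφ.continuous.measurable.comp measurable_fst).mul this
  · simp only [pairFar, Pi.add_apply]
    by_cases hz : φ p.1 = 0
    · simp [hz]
    by_cases hy : p.2 ∈ (ball x₀ ρ)ᶜ
    · have hK := h.far_abs_kernel_le hρ p.1.1 (hφ0 _ hz).2 hy
      rw [hk, indicator_of_mem hy, indicator_of_mem hy]
      simp only [norm_mul, Real.norm_eq_abs, abs_mul]
      have h3 : |v p.1.1 p.1.2 - v p.1.1 p.2| ≤ |v p.1.1 p.1.2| + |v p.1.1 p.2| := abs_sub _ _
      calc |φ p.1| * (|v p.1.1 p.1.2 - v p.1.1 p.2| * |K p.1.1 p.1.2 p.2|)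
          ≤ |φ p.1| * ((|v p.1.1 p.1.2| + |v p.1.1 p.2|)
            * (Λ * 8 ^ (d + 2) * (1 / ‖x₀ - p.2‖ ^ ((d : ℝ) + 2 * s)))) := by gcongr
        _ = _ := by ring
    · rw [indicator_of_notMem hy, mul_zero, norm_zero]
      have := hkn p.2
      positivity

lemma LocalSol.nonlocal_eq (h : LocalSol d s Λ A K J Ω v Dv t₁ t₂ x₀ R) (hρ : 0 < ρ)
    (hρR : ρ ≤ R) (hφ : ContDiff ℝ (⊤ : ℕ∞) φ) (hc : HasCompactSupport φ)
    (hs : tsupport φ ⊆ Ioo t₁ t₂ ×ˢ ball x₀ (7 / 8 * ρ)) :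
    ∫ t in Ioc t₁ t₂, ∫ x, ∫ y, (v t x - v t y) * (φ (t, x) - φ (t, y)) * K t x y
      = nlForm (nearK K t₁ t₂ x₀ ρ) (redU s Λ v t₁ t₂ x₀ R ρ) φ
        + 2 * ∫ z, φ z * farB K v x₀ ρ z := by
  have hΛ0 : 0 < Λ := by linarith [h.hΛ]
  obtain ⟨N, hN⟩ := exists_diffBound_of_contDiff hφ hc
  have hM := diffBound_of_weakGrad (h.memLp_redU hρ) (h.memLp_redDu hρ)
    fun ψ hψ hψc e => h.weakGrad_redU hρ hψ hψc e
  obtain ⟨i1, e1⟩ := (jumpBound_nearK (t₁ := t₁) (t₂ := t₂) (x₀ := x₀) (ρ := ρ) hΛ0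
    h.hK).nlForm_eq_integral_pairs h.hd h.hs.1 h.hs.2 (h.measurable_redU hρ)
    hφ.continuous.measurable (h.memLp_redU hρ) (hφ.continuous.memLp_of_hasCompactSupport hc) hM hN
  have i2 := h.integrable_pairFar hρ hρR hφ hc hs
  have i3 : Integrable fun p : (ℝ × Ed d) × Ed d =>
      pairFar K v φ x₀ ρ ((p.1.1, p.2), p.1.2) :=
    measurePreserving_exchange.integrable_comp_of_integrable i2
  have e3 : ∫ p : (ℝ × Ed d) × Ed d, pairFar K v φ x₀ ρ ((p.1.1, p.2), p.1.2)
      = ∫ p, pairFar K v φ x₀ ρ p := by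
    rw [← integral_map (φ := fun p : (ℝ × Ed d) × Ed d => ((p.1.1, p.2), p.1.2))
      (f := pairFar K v φ x₀ ρ) measurePreserving_exchange.measurable.aemeasurable
      (by rw [measurePreserving_exchange.map_eq]; exact i2.1), measurePreserving_exchange.map_eq]
  have e2 : ∫ p, pairFar K v φ x₀ ρ p = ∫ z, φ z * farB K v x₀ ρ z := by
    rw [Measure.volume_eq_prod] at i2 ⊢
    rw [integral_prod _ i2]
    congr 1
    ext1 z
    simp only [pairFar, integral_const_mul, farB]
    rw [integral_indicator isOpen_ball.measurableSet.compl]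
  have hG := h.pairG_eq hρ hρR hs
  have iG : Integrable (pairG K v φ) := by
    rw [funext hG]; exact (i1.add i2).add i3
  have eG : ∫ p, pairG K v φ p = nlForm (nearK K t₁ t₂ x₀ ρ) (redU s Λ v t₁ t₂ x₀ R ρ) φ
        + 2 * ∫ z, φ z * farB K v x₀ ρ z := by
    simp only [hG]
    have i12 := i1.add i2
    simp only [Pi.add_def] at i12
    rw [integral_add i12 i3, integral_add i1 i2, e1, e2, e3, e2]
    ring
  rw [← eG]
  have hφ0 : ∀ t, t ∉ Ioc t₁ t₂ → ∀ x, φ (t, x) = 0 := fun t ht x =>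
    image_eq_zero_of_notMem_tsupport fun hz => ht (Ioo_subset_Ioc_self (hs hz).1)
  rw [setIntegral_eq_integral_of_forall_compl_eq_zero fun t ht => by simp [hφ0 t ht]]
  rw [Measure.volume_eq_prod] at iG ⊢
  have i4 := iG.integral_prod_left
  rw [integral_prod _ iG]
  rw [Measure.volume_eq_prod] at i4 ⊢
  rw [integral_prod _ i4]
  rfl

end Split

lemma integral_primitive_mul_deriv {H ψ : ℝ → ℝ} (hH : Integrable H) (hψ : ContDiff ℝ 1 ψ)
    (hc : HasCompactSupport ψ) :
    ∫ t, (∫ τ in Iic t, H τ) * deriv ψ t = -∫ τ, H τ * ψ τ := by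
  have hd : Integrable (deriv ψ) :=
    (hψ.continuous_deriv le_rfl).integrable_of_hasCompactSupport hc.deriv
  have hm : MeasurableSet {p : ℝ × ℝ | p.2 ≤ p.1} := measurableSet_le measurable_snd measurable_fst
  have hF : Integrable (fun p : ℝ × ℝ =>
      {p : ℝ × ℝ | p.2 ≤ p.1}.indicator (fun p => deriv ψ p.1 * H p.2) p) :=
    (hd.mul_prod hH).indicator hm
  have h1 : ∀ t, (∫ τ in Iic t, H τ) * deriv ψ t
      = ∫ τ, {p : ℝ × ℝ | p.2 ≤ p.1}.indicator (fun p => deriv ψ p.1 * H p.2) (t, τ) := fun t => by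
    rw [mul_comm, ← integral_const_mul, ← integral_indicator measurableSet_Iic]
    rfl
  have h2 : ∀ τ, ∫ t, {p : ℝ × ℝ | p.2 ≤ p.1}.indicator (fun p => deriv ψ p.1 * H p.2) (t, τ)
      = -(H τ * ψ τ) := fun τ => by
    have : ∫ t in Ioi τ, deriv ψ t = -ψ τ := hc.integral_Ioi_deriv_eq hψ τ
    rw [← mul_neg, ← this, ← integral_Ici_eq_integral_Ioi, ← integral_const_mul,
      ← integral_indicator measurableSet_Ici]
    congr 1
    ext1 t
    by_cases ht : τ ≤ t
    · rw [indicator_of_mem (show (t, τ) ∈ {p : ℝ × ℝ | p.2 ≤ p.1} from ht),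
        indicator_of_mem (show t ∈ Ici τ from ht), mul_comm]
    · rw [indicator_of_notMem (show (t, τ) ∉ {p : ℝ × ℝ | p.2 ≤ p.1} from ht),
        indicator_of_notMem (show t ∉ Ici τ from ht)]
  simp only [h1]
  rw [Measure.volume_eq_prod] at hF
  rw [integral_integral_swap hF, ← integral_neg]
  simp only [h2]

lemma setIntegral_setIntegral_eq_integral {d : ℕ} {F : ℝ × Ed d → ℝ} {t₁ t₂ : ℝ}
    {Ω : Set (Ed d)} (hF : Integrable F) (h0 : ∀ t x, F (t, x) ≠ 0 → t ∈ Ioo t₁ t₂ ∧ x ∈ Ω) :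
    ∫ t in Ioc t₁ t₂, ∫ x in Ω, F (t, x) = ∫ z, F z := by
  have h1 : ∀ t, ∫ x in Ω, F (t, x) = ∫ x, F (t, x) := fun t =>
    setIntegral_eq_integral_of_forall_compl_eq_zero fun x hx => by
      by_contra h; exact hx (h0 t x h).2
  simp only [h1]
  rw [setIntegral_eq_integral_of_forall_compl_eq_zero]
  · rw [Measure.volume_eq_prod] at hF ⊢
    rw [integral_prod _ hF]
  · intro t ht
    refine integral_eq_zero_of_ae (ae_of_all _ fun x => ?_)
    by_contra h
    exact ht (Ioo_subset_Ioc_self (h0 t x h).1)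

section Equation

variable {d : ℕ} {s Λ : ℝ} {A : ℝ → Ed d → Ed d → Ed d} {K : ℝ → Ed d → Ed d → ℝ}
    {J : Set ℝ} {Ω : Set (Ed d)} {v : ℝ → Ed d → ℝ} {Dv : ℝ → Ed d → Ed d}
    {t₁ t₂ : ℝ} {x₀ : Ed d} {R ρ : ℝ} {φ : ℝ × Ed d → ℝ}

lemma LocalSol.corr_eq (h : LocalSol d s Λ A K J Ω v Dv t₁ t₂ x₀ R) (hρ : 0 < ρ) {t : ℝ}
    : corr s Λ v t₁ t₂ x₀ ρ t
      = ∫ τ in Iic t, tailConst d Λ * (Ioo t₁ t₂).indicator (farTail s v x₀ ρ) τ := by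
  rw [integral_const_mul, corr]
  have hi := h.integrable_farTail hρ
  have h1 := intervalIntegral.integral_Iic_sub_Iic (hi.integrableOn (s := Iic t₁))
    (hi.integrableOn (s := Iic t))
  rw [← h1, sub_eq_self.2]
  refine setIntegral_eq_zero_of_forall_eq_zero fun τ hτ => indicator_of_notMem (fun hm => ?_) _
  exact absurd hm.1 (not_lt.2 hτ)

lemma LocalSol.integral_corr_mul_dt (h : LocalSol d s Λ A K J Ω v Dv t₁ t₂ x₀ R) (hρ : 0 < ρ)
    (hρR : ρ ≤ R) (hφ : ContDiff ℝ (⊤ : ℕ∞) φ) (hc : HasCompactSupport φ)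
    (hs : tsupport φ ⊆ Ioo t₁ t₂ ×ˢ ball x₀ (7 / 8 * ρ)) :
    ∫ z, (Ioo t₁ t₂ ×ˢ closedBall x₀ (2 * R)).indicator
        (fun z : ℝ × Ed d => corr s Λ v t₁ t₂ x₀ ρ z.1) z * fderiv ℝ φ z (1, 0)
      = -(tailConst d Λ * ∫ z, (Ioo t₁ t₂ ×ˢ closedBall x₀ (2 * R)).indicator
        (fun z : ℝ × Ed d => farTail s v x₀ ρ z.1) z * φ z) := by
  have hR := h.hR
  set H : ℝ → ℝ := fun τ => tailConst d Λ * (Ioo t₁ t₂).indicator (farTail s v x₀ ρ) τ with hH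
  have hHi : Integrable H := (h.integrable_farTail hρ).const_mul _
  have hPB : Ioo t₁ t₂ ×ˢ ball x₀ (7 / 8 * ρ) ⊆ Ioo t₁ t₂ ×ˢ closedBall x₀ (2 * R) :=
    prod_mono le_rfl (ball_subset_closedBall.trans (closedBall_subset_closedBall (by linarith)))
  have hφ1 : ∀ z : ℝ × Ed d, z ∉ Ioo t₁ t₂ ×ˢ closedBall x₀ (2 * R) → φ z = 0 := fun z hz =>
    image_eq_zero_of_notMem_tsupport fun hz' => hz (hPB (hs hz'))
  have hφ2 : ∀ z : ℝ × Ed d, z ∉ Ioo t₁ t₂ ×ˢ closedBall x₀ (2 * R) →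
      fderiv ℝ φ z (1, 0) = 0 := fun z hz => by
    rw [image_eq_zero_of_notMem_tsupport (f := fderiv ℝ φ)
      fun hz' => hz (hPB (hs (tsupport_fderiv_subset ℝ hz')))]
    rfl
  have i1 := integrable_mul_of_memLp_two (h.memLp_corr hρ) (memLp_dirDeriv hφ hc (1, 0))
  have i2 := (integrable_mul_of_memLp_two (h.memLp_farTail_box hρ)
    (hφ.continuous.memLp_of_hasCompactSupport hc)).const_mul (tailConst d Λ)
  rw [← integral_const_mul, ← integral_neg]
  have e1 : ∀ z : ℝ × Ed d, (Ioo t₁ t₂ ×ˢ closedBall x₀ (2 * R)).indicator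
        (fun z : ℝ × Ed d => corr s Λ v t₁ t₂ x₀ ρ z.1) z * fderiv ℝ φ z (1, 0)
      = (∫ τ in Iic z.1, H τ) * deriv (fun τ => φ (τ, z.2)) z.1 := fun z => by
    rw [(hasDerivAt_slice hφ z.1 z.2).deriv]
    by_cases hz : z ∈ Ioo t₁ t₂ ×ˢ closedBall x₀ (2 * R)
    · rw [indicator_of_mem hz, h.corr_eq hρ]
    · rw [hφ2 z hz]; simp
  have e2 : ∀ z : ℝ × Ed d, tailConst d Λ * ((Ioo t₁ t₂ ×ˢ closedBall x₀ (2 * R)).indicator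
        (fun z : ℝ × Ed d => farTail s v x₀ ρ z.1) z * φ z) = H z.1 * φ z := fun z => by
    by_cases hz : z ∈ Ioo t₁ t₂ ×ˢ closedBall x₀ (2 * R)
    · rw [indicator_of_mem hz, hH]
      simp only
      rw [indicator_of_mem hz.1, mul_assoc]
    · rw [hφ1 z hz]; simp
  simp only [e1] at i1 ⊢
  simp only [e2] at i2 ⊢
  rw [Measure.volume_eq_prod] at i1 i2 ⊢
  have i2n := i2.neg
  simp only [Pi.neg_def] at i2n
  rw [integral_prod_symm _ i1, integral_prod_symm _ i2n]
  congr 1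
  ext1 x
  have hx : HasCompactSupport fun τ => φ (τ, x) :=
    (IsCompact.image hc continuous_fst).of_isClosed_subset (isClosed_tsupport _)
      (closure_minimal (fun t ht => ⟨(t, x), subset_tsupport φ ht, rfl⟩)
        (IsCompact.image hc continuous_fst).isClosed)
  have := integral_primitive_mul_deriv hHi (ψ := fun τ => φ (τ, x))
    ((hφ.comp (contDiff_prodMk_left x)).of_le (by exact_mod_cast le_top)) hx
  simp only [integral_neg]
  exact this

lemma LocalSol.weakEq (h : LocalSol d s Λ A K J Ω v Dv t₁ t₂ x₀ R) (hρ : 0 < ρ) (hρR : ρ ≤ R) :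
    WeakEq s Λ (Ioo t₁ t₂ ×ˢ ball x₀ (7 / 8 * ρ)) (redU s Λ v t₁ t₂ x₀ R ρ)
      (redF s Λ K v t₁ t₂ x₀ ρ) (redDu s Λ v Dv t₁ t₂ x₀ R ρ) (redA A Dv t₁ t₂ x₀ R)
      (nearK K t₁ t₂ x₀ ρ) where
  memu := h.memLp_redU hρ
  memf := h.memLp_redF hρ hρR
  memDu := h.memLp_redDu hρ
  mema := h.memLp_redA
  meas := h.measurable_redU hρ
  jump := jumpBound_nearK (by linarith [h.hΛ]) h.hK
  grad φ hφ hc e := h.weakGrad_redU hρ hφ hc e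
  eq φ hφ hc hs := by
    have hR := h.hR
    set B := Ioo t₁ t₂ ×ˢ closedBall x₀ (2 * R) with hB
    have hbB : ball x₀ (7 / 8 * ρ) ⊆ closedBall x₀ (2 * R) :=
      ball_subset_closedBall.trans (closedBall_subset_closedBall (by linarith))
    have hPB : Ioo t₁ t₂ ×ˢ ball x₀ (7 / 8 * ρ) ⊆ B := prod_mono le_rfl hbB
    have hφ1 : ∀ z : ℝ × Ed d, φ z ≠ 0 → z ∈ Ioo t₁ t₂ ×ˢ ball x₀ (7 / 8 * ρ) := fun z hz =>
      hs (subset_tsupport φ hz)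
    have hφ2 : ∀ (z e : ℝ × Ed d), fderiv ℝ φ z e ≠ 0 →
        z ∈ Ioo t₁ t₂ ×ˢ ball x₀ (7 / 8 * ρ) := fun z e hz => by
      refine hs (tsupport_fderiv_subset ℝ (subset_tsupport _ fun h0 => hz ?_))
      rw [h0]; rfl
    have hφL : MemLp φ 2 := hφ.continuous.memLp_of_hasCompactSupport hc
    have hdL := memLp_dirDeriv hφ hc (1, 0)
    have htest : IsTestFunction Ω fun t x => φ (t, x) := by
      refine ⟨hφ, Set.image Prod.snd (tsupport φ), IsCompact.image hc continuous_snd, ?_,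
        fun t => tsupport_slice_subset φ hc t⟩
      rintro _ ⟨z, hz, rfl⟩
      exact h.hΩ (hbB (hs hz).2)
    have hsol := h.sol t₁ t₂ h.lt.le h.hJ _ htest
    simp only [mixedLHS] at hsol
    have hb : ∀ t, t ∉ Ioo t₁ t₂ → ∀ x, φ (t, x) = 0 := fun t ht x => by
      by_contra h0; exact ht (hφ1 _ h0).1
    rw [h.nonlocal_eq hρ hρR hφ hc hs] at hsol
    simp only [hb t₁ (by simp), hb t₂ (by simp), mul_zero, integral_zero, add_zero,
      sub_zero] at hsol
    have iv := integrable_mul_of_memLp_two h.memLp_v hdL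
    have iu := integrable_mul_of_memLp_two (h.memLp_redU hρ) hdL
    have ic := integrable_mul_of_memLp_two (h.memLp_corr hρ) hdL
    have ih := integrable_mul_of_memLp_two (h.memLp_farTail_box hρ) hφL
    have iF := integrable_mul_of_memLp_two (h.memLp_redF hρ hρR) hφL
    rw [← hB] at iv ic ih
    have etime : ∫ t in Ioc t₁ t₂, ∫ x in Ω, v t x * deriv (fun τ => φ (τ, x)) t
        = (∫ z, redU s Λ v t₁ t₂ x₀ R ρ z * fderiv ℝ φ z (1, 0))
          - tailConst d Λ * ∫ z, B.indicator
            (fun z : ℝ × Ed d => farTail s v x₀ ρ z.1) z * φ z := by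
      have e1 : ∀ t x, v t x * deriv (fun τ => φ (τ, x)) t
          = (B.indicator (fun z => v z.1 z.2) (t, x)) * fderiv ℝ φ (t, x) (1, 0) := fun t x => by
        rw [(hasDerivAt_slice hφ t x).deriv]
        by_cases h0 : fderiv ℝ φ (t, x) (1, 0) = 0
        · rw [h0]; simp
        · rw [indicator_of_mem (hPB (hφ2 _ _ h0))]
      simp only [e1]
      rw [setIntegral_setIntegral_eq_integral iv fun t x h0 => ?_]
      swap
      · have := hφ2 _ _ (right_ne_zero_of_mul h0)
        exact ⟨this.1, h.hΩ (hbB this.2)⟩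
      have e2 := h.integral_corr_mul_dt hρ hρR hφ hc hs
      rw [← hB] at e2
      rw [sub_eq_add_neg, ← e2, ← integral_add iu ic]
      congr 1
      ext1 z
      by_cases h0 : fderiv ℝ φ z (1, 0) = 0
      · rw [h0]; simp
      · have hz := hφ2 _ _ h0
        rw [redU, ← hB, indicator_of_mem (hPB hz), indicator_of_mem (hPB hz),
          indicator_of_mem (hPB hz), spCut_one hR (closedBall_subset_closedBall (by linarith)
            (ball_subset_closedBall hz.2))]
        ring
    have eflux : ∫ t in Ioc t₁ t₂, ∫ x in Ω,
        ⟪A t x (Dv t x), gradient (fun x => φ (t, x)) x⟫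
        = ∫ z, fderiv ℝ φ z (0, redA A Dv t₁ t₂ x₀ R z) := by
      have e1 : ∀ t x, ⟪A t x (Dv t x), gradient (fun x => φ (t, x)) x⟫
          = fderiv ℝ φ (t, x) (0, redA A Dv t₁ t₂ x₀ R (t, x)) := fun t x => by
        rw [real_inner_comm, gradient, InnerProductSpace.toDual_symm_apply, fderiv_slice hφ]
        by_cases h0 : fderiv ℝ φ (t, x) = 0
        · rw [h0]; simp
        · have hz := hs (tsupport_fderiv_subset ℝ (subset_tsupport _ h0))
          rw [redA, ← hB, indicator_of_mem (hPB hz)]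
      simp only [e1]
      refine setIntegral_setIntegral_eq_integral
        (F := fun z => fderiv ℝ φ z (0, redA A Dv t₁ t₂ x₀ R z)) ?_ fun t x h0 => ?_
      · simp only [fderiv_spatial_eq_sum]
        refine integrable_finsetSum _ fun i _ => ?_
        refine integrable_mul_of_memLp_two ?_ (memLp_dirDeriv hφ hc _)
        exact h.memLp_redA.of_le
          (((EuclideanSpace.proj (𝕜 := ℝ) i).continuous).comp_aestronglyMeasurable h.memLp_redA.1)
          (ae_of_all _ fun z => PiLp.norm_apply_le _ i)
      · have := hφ2 _ _ h0
        exact ⟨this.1, h.hΩ (hbB this.2)⟩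
    rw [etime, eflux] at hsol
    have eF : ∫ z, redF s Λ K v t₁ t₂ x₀ ρ z * φ z
        = 2 * (∫ z, φ z * farB K v x₀ ρ z) + tailConst d Λ * ∫ z, B.indicator
            (fun z : ℝ × Ed d => farTail s v x₀ ρ z.1) z * φ z := by
      have e1 : ∀ z, φ z * farB K v x₀ ρ z = 1 / 2 * (redF s Λ K v t₁ t₂ x₀ ρ z * φ z
          - tailConst d Λ * (B.indicator
            (fun z : ℝ × Ed d => farTail s v x₀ ρ z.1) z * φ z)) := fun z => by
        by_cases h0 : φ z = 0
        · rw [h0]; simp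
        · have hz := hφ1 z h0
          rw [redF, indicator_of_mem hz, indicator_of_mem (hPB hz)]
          ring
      simp only [e1]
      rw [integral_const_mul, integral_sub iF (ih.const_mul _), integral_const_mul]
      ring
    rw [eF]
    linarith

end Equation

lemma exists_deriv_smoothTransition_le : ∃ L : ℝ, 0 ≤ L ∧
    (∀ x, |deriv Real.smoothTransition x| ≤ L) ∧
    ∀ x < 0, deriv Real.smoothTransition x = 0 := by
  have hc : ContDiff ℝ 1 Real.smoothTransition := Real.smoothTransition.contDiff
  have h0 : ∀ x < 0, deriv Real.smoothTransition x = 0 := fun x hx => by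
    have : Real.smoothTransition =ᶠ[𝓝 x] fun _ => (0 : ℝ) := by
      filter_upwards [Iio_mem_nhds hx] with y hy
      exact Real.smoothTransition.zero_of_nonpos (le_of_lt hy)
    rw [this.deriv_eq, deriv_const]
  have h1 : ∀ x > 1, deriv Real.smoothTransition x = 0 := fun x hx => by
    have : Real.smoothTransition =ᶠ[𝓝 x] fun _ => (1 : ℝ) := by
      filter_upwards [Ioi_mem_nhds hx] with y hy
      exact Real.smoothTransition.one_of_one_le (le_of_lt hy)
    rw [this.deriv_eq, deriv_const]
  obtain ⟨L, hL⟩ := isCompact_Icc.exists_bound_of_continuousOn (s := Icc (0 : ℝ) 1)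
    (hc.continuous_deriv le_rfl).continuousOn
  refine ⟨L, (norm_nonneg _).trans (hL 0 (by simp)), fun x => ?_, h0⟩
  have hL0 := (norm_nonneg _).trans (hL 0 (by simp))
  rcases lt_or_ge x 0 with hx | hx
  · rw [h0 x hx]; simpa using hL0
  · rcases lt_or_ge 1 x with hx1 | hx1
    · rw [h1 x hx1]; simpa using hL0
    · exact hL x ⟨hx, hx1⟩

/-- Smooth cutoffs of parabolic cylinders with the natural derivative bounds. -/
lemma exists_cylinder_cutoff (d : ℕ) : ∃ L : ℝ, 1 ≤ L ∧ ∀ (x₀ : Ed d) (t₀ a g r ε : ℝ), 0 < g →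
    0 < ε → 0 ≤ r → ∃ η : ℝ × Ed d → ℝ, ContDiff ℝ (⊤ : ℕ∞) η ∧ HasCompactSupport η ∧
      (∀ z, 0 ≤ η z) ∧ (∀ z, η z ≤ 1) ∧ tsupport η ⊆ Ici a ×ˢ closedBall x₀ (r + ε) ∧
      (∀ z : ℝ × Ed d, a + g ≤ z.1 → z.1 < t₀ → z.2 ∈ closedBall x₀ r → η z = 1) ∧
      (∀ z, |fderiv ℝ η z (1, 0)| ≤ L / g) ∧ ∀ z e, |fderiv ℝ η z (0, e)| ≤ L / ε * ‖e‖ := by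
  obtain ⟨L, hL0, hL, hz⟩ := exists_deriv_smoothTransition_le
  refine ⟨2 * L + 1, by linarith, fun x₀ t₀ a g r ε hg hε hr => ?_⟩
  set θ := Real.smoothTransition with hθ
  have hθc : ∀ x, HasDerivAt θ (deriv θ x) x := fun x =>
    ((Real.smoothTransition.contDiff (n := 1)).differentiable one_ne_zero x).hasDerivAt
  have hθ0 : ∀ x, 0 ≤ θ x := Real.smoothTransition.nonneg
  have hθ1 : ∀ x, θ x ≤ 1 := Real.smoothTransition.le_one
  set c : ℝ := (r + ε) ^ 2 - r ^ 2 with hc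
  have hc0 : 0 < c := by rw [hc]; nlinarith [mul_nonneg hr hε.le, mul_pos hε hε]
  set q : Ed d → ℝ := fun x => ((r + ε) ^ 2 - ‖x - x₀‖ ^ 2) / c with hq
  set η : ℝ × Ed d → ℝ := fun z => θ ((z.1 - a) / g) * θ ((t₀ + g - z.1) / g) * θ (q z.2) with hη
  have hqc : ContDiff ℝ (⊤ : ℕ∞) q :=
    (contDiff_const.sub ((contDiff_id.sub contDiff_const).norm_sq ℝ)).div_const c
  have hsm : ContDiff ℝ (⊤ : ℕ∞) η := by
    have h1 : ContDiff ℝ (⊤ : ℕ∞) θ := Real.smoothTransition.contDiff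
    exact ((h1.comp ((contDiff_fst.sub contDiff_const).div_const g)).mul
      (h1.comp ((contDiff_const.sub contDiff_fst).div_const g))).mul
      (h1.comp (hqc.comp contDiff_snd))
  have hsup : tsupport η ⊆ Icc a (t₀ + g) ×ˢ closedBall x₀ (r + ε) := by
    refine closure_minimal (fun z hz => ?_) (isClosed_Icc.prod isClosed_closedBall)
    by_contra hn
    refine hz ?_
    simp only [mem_prod, mem_Icc, mem_closedBall, not_and_or, not_le, dist_eq_norm] at hn
    rcases hn with (hn | hn) | hn
    · have : θ ((z.1 - a) / g) = 0 := Real.smoothTransition.zero_of_nonpos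
        (div_nonpos_of_nonpos_of_nonneg (by linarith) hg.le)
      simp [hη, this]
    · have : θ ((t₀ + g - z.1) / g) = 0 := Real.smoothTransition.zero_of_nonpos
        (div_nonpos_of_nonpos_of_nonneg (by linarith) hg.le)
      simp [hη, this]
    · have : θ (q z.2) = 0 := Real.smoothTransition.zero_of_nonpos
        (div_nonpos_of_nonpos_of_nonneg (by nlinarith) hc0.le)
      simp [hη, this]
  have hdf : Differentiable ℝ η := hsm.differentiable (by simp)
  refine ⟨η, hsm, (isCompact_Icc.prod (isCompact_closedBall x₀ (r + ε))).of_isClosed_subset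
    (isClosed_tsupport _) hsup, fun z => mul_nonneg (mul_nonneg (hθ0 _) (hθ0 _)) (hθ0 _),
    fun z => mul_le_one₀ (mul_le_one₀ (hθ1 _) (hθ0 _) (hθ1 _)) (hθ0 _) (hθ1 _),
    hsup.trans (prod_mono Icc_subset_Ici_self le_rfl), fun z h1 h2 h3 => ?_, fun z => ?_,
    fun z e => ?_⟩
  · have e1 : θ ((z.1 - a) / g) = 1 := Real.smoothTransition.one_of_one_le
      ((one_le_div hg).2 (by linarith))
    have e2 : θ ((t₀ + g - z.1) / g) = 1 := Real.smoothTransition.one_of_one_le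
      ((one_le_div hg).2 (by linarith))
    have e3 : θ (q z.2) = 1 := Real.smoothTransition.one_of_one_le
      ((one_le_div hc0).2 (by
        rw [mem_closedBall, dist_eq_norm] at h3
        rw [hc]; nlinarith [norm_nonneg (z.2 - x₀)]))
    simp [hη, e1, e2, e3]
  · have k1 : HasDerivAt (fun τ : ℝ => η (z + τ • ((1, 0) : ℝ × Ed d)))
        (fderiv ℝ η z (1, 0)) 0 := by
      have := (hdf z).hasFDerivAt.hasLineDerivAt ((1, 0) : ℝ × Ed d)
      exact this
    have a1 : HasDerivAt (fun τ : ℝ => (z.1 + τ - a) / g) (1 / g) 0 :=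
      (((hasDerivAt_id' (0 : ℝ)).const_add z.1).sub_const a).div_const g
    have a2 : HasDerivAt (fun τ : ℝ => (t₀ + g - (z.1 + τ)) / g) (-1 / g) 0 :=
      ((((hasDerivAt_id' (0 : ℝ)).const_add z.1).const_sub (t₀ + g))).div_const g
    have k2 := ((((hθc _).comp (0 : ℝ) a1).mul ((hθc _).comp (0 : ℝ) a2))).mul_const (θ (q z.2))
    have k3 : (fun τ : ℝ => η (z + τ • ((1, 0) : ℝ × Ed d)))
        = fun τ => θ ((z.1 + τ - a) / g) * θ ((t₀ + g - (z.1 + τ)) / g) * θ (q z.2) := by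
      ext τ; simp [hη]
    rw [k3] at k1
    rw [k1.unique k2]
    have p1 := hθ1 (q z.2)
    have p0 := hθ0 (q z.2)
    simp only [Function.comp_apply]
    rw [abs_mul, abs_of_nonneg p0]
    refine (mul_le_of_le_one_right (abs_nonneg _) p1).trans ((abs_add_le _ _).trans ?_)
    have q1 : ∀ x y, |deriv θ x * (1 / g) * θ y| ≤ L / g := fun x y => by
      rw [abs_mul, abs_mul, abs_of_nonneg (hθ0 y), abs_of_pos (one_div_pos.2 hg)]
      calc _ ≤ L * (1 / g) * 1 := by
            have := hL x; have := hθ1 y; have := hθ0 y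
            gcongr
        _ = _ := by ring
    have q2 : ∀ x y, |θ y * (deriv θ x * (-1 / g))| ≤ L / g := fun x y => by
      rw [show θ y * (deriv θ x * (-1 / g)) = -(deriv θ x * (1 / g) * θ y) by ring, abs_neg]
      exact q1 x y
    refine (add_le_add (q1 _ _) (q2 _ _)).trans ?_
    rw [← add_div]
    exact div_le_div_of_nonneg_right (by linarith) hg.le
  · have k1 : HasDerivAt (fun τ : ℝ => η (z + τ • ((0, e) : ℝ × Ed d)))
        (fderiv ℝ η z (0, e)) 0 := (hdf z).hasFDerivAt.hasLineDerivAt ((0, e) : ℝ × Ed d)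
    have a0 : HasDerivAt (fun τ : ℝ => z.2 + τ • e - x₀) e 0 := by
      have := (((hasDerivAt_id' (0 : ℝ)).smul_const e).const_add z.2).sub_const x₀
      simpa using this
    have a1 := (a0.norm_sq.const_sub ((r + ε) ^ 2)).div_const c
    have a2 : HasDerivAt (fun τ : ℝ => q (z.2 + τ • e)) (-(2 * ⟪z.2 - x₀, e⟫) / c) 0 := by
      simpa using a1
    have k2 := ((hθc _).comp (0 : ℝ) a2).const_mul (θ ((z.1 - a) / g) * θ ((t₀ + g - z.1) / g))
    have k3 : (fun τ : ℝ => η (z + τ • ((0, e) : ℝ × Ed d)))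
        = fun τ => θ ((z.1 - a) / g) * θ ((t₀ + g - z.1) / g) * θ (q (z.2 + τ • e)) := by
      ext τ; simp [hη]
    rw [k3] at k1
    rw [k1.unique k2, abs_mul, abs_of_nonneg (mul_nonneg (hθ0 _) (hθ0 _))]
    refine (mul_le_of_le_one_left (abs_nonneg _)
      (mul_le_one₀ (hθ1 _) (hθ0 _) (hθ1 _))).trans ?_
    simp only [zero_smul, add_zero]
    by_cases hx : ‖z.2 - x₀‖ ≤ r + ε
    · rw [abs_mul, abs_div, abs_neg, abs_mul, abs_two, abs_of_pos hc0]
      have i1 : |⟪z.2 - x₀, e⟫| ≤ (r + ε) * ‖e‖ :=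
        (abs_real_inner_le_norm _ _).trans (by gcongr)
      have i2 : 2 * (r + ε) / c ≤ 2 / ε := by
        rw [div_le_div_iff₀ hc0 hε, hc]
        nlinarith [mul_nonneg hr hε.le]
      calc _ ≤ L * (2 * ((r + ε) * ‖e‖) / c) := by
            have := hL (q z.2)
            gcongr
        _ = L * (2 * (r + ε) / c) * ‖e‖ := by ring
        _ ≤ L * (2 / ε) * ‖e‖ := by gcongr
        _ = 2 * L / ε * ‖e‖ := by ring
        _ ≤ _ := by
            have : 2 * L / ε ≤ (2 * L + 1) / ε := div_le_div_of_nonneg_right (by linarith) hε.le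
            gcongr
    · rw [hz (q z.2) (div_neg_of_neg_of_pos (by nlinarith) hc0)]
      simp only [zero_mul, abs_zero]
      positivity

section CrossBound

variable {d : ℕ} {s Λ : ℝ} {κ : ℝ × Ed d → Ed d → ℝ}

lemma ae_slice_of_ae_fst {Q : ℝ → Prop} (h : ∀ᵐ t : ℝ, Q t) : ∀ᵐ z : ℝ × Ed d, Q z.1 := by
  rw [Measure.volume_eq_prod]
  exact Measure.quasiMeasurePreserving_fst.ae h

lemma integrable_integral_mul_shift {q v : ℝ × Ed d → ℝ} (hq : Integrable q) (hv : Integrable v)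
    (hqm : Measurable q) (hvm : Measurable v) (hq0 : ∀ z, 0 ≤ q z) (hv0 : ∀ z, 0 ≤ v z) {M : ℝ}
    (hM : ∀ᵐ t : ℝ, ∫ x, v (t, x) ≤ M) :
    Integrable (fun h : Ed d => ∫ z, q z * v (z + (0, h))) ∧
      ∫ h : Ed d, ∫ z, q z * v (z + (0, h)) ≤ M * ∫ z, q z := by
  have hsl : ∀ᵐ t : ℝ, Integrable fun x => v (t, x) := by
    rw [Measure.volume_eq_prod] at hv
    exact hv.prod_right_ae
  have e1 : ∀ (z : ℝ × Ed d) h, z + (0, h) = (z.1, z.2 + h) := fun z h => by ext <;> simp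
  have e2 : ∀ z : ℝ × Ed d, ∫ h : Ed d, q z * v (z + (0, h)) = q z * ∫ x, v (z.1, x) := fun z => by
    rw [integral_const_mul]
    congr 1
    simp only [e1]
    exact integral_add_left_eq_self (fun x => v (z.1, x)) z.2
  have hle : ∀ᵐ z : ℝ × Ed d, q z * ∫ x, v (z.1, x) ≤ M * q z := by
    filter_upwards [ae_slice_of_ae_fst (d := d) hM] with z hz
    rw [mul_comm M]
    exact mul_le_mul_of_nonneg_left hz (hq0 z)
  have hmeas : Measurable fun w : (ℝ × Ed d) × Ed d => q w.1 * v (w.1 + (0, w.2)) :=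
    (hqm.comp measurable_fst).mul (hvm.comp (by fun_prop))
  have hmz : Measurable fun z : ℝ × Ed d => q z * ∫ x, v (z.1, x) := by
    refine hqm.mul ?_
    have : StronglyMeasurable fun t => ∫ x, v (t, x) :=
      StronglyMeasurable.integral_prod_right (f := fun t x => v (t, x)) hvm.stronglyMeasurable
    exact this.measurable.comp measurable_fst
  have hintg : Integrable fun z : ℝ × Ed d => q z * ∫ x, v (z.1, x) := by
    refine (hq.const_mul M).mono' hmz.aestronglyMeasurable ?_
    filter_upwards [hle] with z hz
    rwa [Real.norm_of_nonneg (mul_nonneg (hq0 z) (integral_nonneg fun x => hv0 _))]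
  have hprod : Integrable (fun w : (ℝ × Ed d) × Ed d => q w.1 * v (w.1 + (0, w.2)))
      (volume.prod volume) := by
    rw [integrable_prod_iff hmeas.aestronglyMeasurable]
    refine ⟨?_, ?_⟩
    · filter_upwards [ae_slice_of_ae_fst (d := d) hsl] with z hz
      simp only [e1]
      exact (hz.comp_add_left z.2).const_mul _
    · refine hintg.congr (ae_of_all _ fun z => ?_)
      simp only
      rw [← e2]
      refine integral_congr_ae (ae_of_all _ fun h => ?_)
      simp only
      rw [Real.norm_of_nonneg (mul_nonneg (hq0 _) (hv0 _))]
  refine ⟨hprod.integral_prod_right, ?_⟩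
  have hsw := integral_integral_swap (f := fun (z : ℝ × Ed d) (h : Ed d) => q z * v (z + (0, h)))
    hprod
  rw [← hsw]
  simp only [e2]
  rw [← integral_const_mul]
  exact integral_mono_ae hintg (hq.const_mul M) hle

variable {P S W V : Set (ℝ × Ed d)} {t₀ D₁ D₂ G M : ℝ} {η p : ℝ × Ed d → ℝ}

lemma Cutoff.abs_spDiff_le (hη : Cutoff P S t₀ D₁ D₂ η) (h : Ed d) (z : ℝ × Ed d) :
    |spDiff η h z| ≤ D₂ * ‖h‖ := by
  have h1 : ∀ τ ∈ Icc (0 : ℝ) 1, HasDerivWithinAt (fun τ : ℝ => η (z + τ • ((0, h) : ℝ × Ed d)))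
      (fderiv ℝ η (z + τ • ((0, h) : ℝ × Ed d)) (0, h)) (Icc 0 1) τ := fun τ _ => by
    have a : HasDerivAt (fun τ : ℝ => z + τ • ((0, h) : ℝ × Ed d)) ((0, h) : ℝ × Ed d) τ := by
      simpa using ((hasDerivAt_id' τ).smul_const ((0, h) : ℝ × Ed d)).const_add z
    exact ((hη.smooth.differentiable (by simp) _).hasFDerivAt.comp_hasDerivAt τ a).hasDerivWithinAt
  have := norm_image_sub_le_of_norm_deriv_le_segment_01' h1 (fun τ _ => hη.space _ h)
  simpa [spDiff] using this

lemma Cutoff.spDiff_sq_le (hη : Cutoff P S t₀ D₁ D₂ η) (hD : 1 ≤ D₂) (h : Ed d) (z : ℝ × Ed d) :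
    spDiff η h z ^ 2 ≤ D₂ ^ 2 * min (‖h‖ ^ 2) 1 ∧ spDiff η h z ^ 2 ≤ 1 := by
  have h1 : |spDiff η h z| ≤ 1 := by
    rw [abs_le, spDiff]
    constructor <;> linarith [hη.nonneg z, hη.nonneg (z + (0, h)), hη.le_one z,
      hη.le_one (z + (0, h))]
  have h2 : spDiff η h z ^ 2 ≤ 1 := by rw [← sq_abs]; exact pow_le_one₀ (abs_nonneg _) h1
  refine ⟨?_, h2⟩
  rw [mul_min_of_nonneg _ _ (sq_nonneg D₂), le_min_iff]
  constructor
  · rw [← mul_pow, ← sq_abs]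
    exact pow_le_pow_left₀ (abs_nonneg _) (hη.abs_spDiff_le h z) 2
  · nlinarith

/-- The nonlocal cross term is controlled by a near part and a far part. -/
lemma crossForm_le (hd : 2 ≤ d) (hs0 : 0 < s) (hs1 : s < 1) (hΛ : 0 ≤ Λ) (hκ : JumpBound s Λ κ)
    (hη : Cutoff P S t₀ D₁ D₂ η) (hD : 1 ≤ D₂) (hpm : Measurable p) (hp : MemLp p 2)
    (hpi : Integrable p) (hp0 : ∀ z, 0 ≤ p z) (hW : MeasurableSet W) (hV : MeasurableSet V)
    (hSW : S ⊆ W) (hG : 0 ≤ G)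
    (hfar : ∀ z h, κ z h ≠ 0 → (z ∈ S → z + (0, h) ∉ W → z + (0, h) ∈ V ∧ κ z h ≤ G) ∧
      (z + (0, h) ∈ S → z ∉ W → z ∈ V ∧ κ z h ≤ G))
    (hM : ∀ᵐ t : ℝ, ∫ x, V.indicator p (t, x) ≤ M) :
    crossForm κ p η ≤ Λ * D₂ ^ 2
        * (∫ h : Ed d, ‖h‖ ^ (-((d : ℝ) + 2 * s)) * min (‖h‖ ^ 2) 1) * (∫ z in W, p z ^ 2)
      + 2 * (G * (M * ∫ z in S, p z)) := by
  set w := W.indicator p with hw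
  set q := S.indicator p with hq
  set r := V.indicator p with hr
  have w0 : ∀ z, 0 ≤ w z := fun z => indicator_nonneg (fun z _ => hp0 z) z
  have q0 : ∀ z, 0 ≤ q z := fun z => indicator_nonneg (fun z _ => hp0 z) z
  have r0 : ∀ z, 0 ≤ r z := fun z => indicator_nonneg (fun z _ => hp0 z) z
  have wm : MemLp w 2 := hp.indicator hW
  have qm : MemLp q 2 := hp.indicator hη.meas
  have rm : MemLp r 2 := hp.indicator hV
  obtain ⟨J1, J2⟩ := integrable_integral_mul_shift (hpi.indicator hη.meas) (hpi.indicator hV)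
    (hpm.indicator hη.meas) (hpm.indicator hV) q0 r0 hM
  set g : Ed d → ℝ := fun h => Λ * D₂ ^ 2 * (‖h‖ ^ (-((d : ℝ) + 2 * s)) * min (‖h‖ ^ 2) 1) with hg
  have g0 : ∀ h, 0 ≤ g h := fun h => by positivity
  have hkle : ∀ z h, spDiff η h z ^ 2 * κ z h ≤ g h := fun z h => by
    calc _ ≤ (D₂ ^ 2 * min (‖h‖ ^ 2) 1) * (Λ * ‖h‖ ^ (-((d : ℝ) + 2 * s))) :=
          mul_le_mul (hη.spDiff_sq_le hD h z).1 (hκ.le z h) (hκ.nonneg z h) (by positivity)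
      _ = _ := by rw [hg]; ring
  have hpt : ∀ h z, p (z + (0, h)) * p z * (spDiff η h z ^ 2 * κ z h)
      ≤ (g h / 2 * w z ^ 2 + g h / 2 * w (z + (0, h)) ^ 2)
        + (G * (q z * r (z + (0, h))) + G * (r z * q (z + (0, h)))) := fun h z => by
    have n1 : 0 ≤ g h / 2 * w z ^ 2 + g h / 2 * w (z + (0, h)) ^ 2 := by
      have := g0 h; positivity
    have n2 : 0 ≤ G * (q z * r (z + (0, h))) := mul_nonneg hG (mul_nonneg (q0 _) (r0 _))
    have n3 : 0 ≤ G * (r z * q (z + (0, h))) := mul_nonneg hG (mul_nonneg (r0 _) (q0 _))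
    by_cases hk : κ z h = 0
    · rw [hk, mul_zero, mul_zero]; linarith
    by_cases hS : z ∈ S ∨ z + (0, h) ∈ S
    swap
    · have e1 : η z = 0 := image_eq_zero_of_notMem_tsupport fun h => hS (Or.inl (hη.supp h))
      have e2 : η (z + (0, h)) = 0 :=
        image_eq_zero_of_notMem_tsupport fun h => hS (Or.inr (hη.supp h))
      rw [spDiff, e1, e2]
      simp only [sub_zero, ne_eq, OfNat.ofNat_ne_zero, not_false_eq_true, zero_pow, zero_mul,
        mul_zero]
      linarith
    have hpp : 0 ≤ p (z + (0, h)) * p z := mul_nonneg (hp0 _) (hp0 _)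
    have far : κ z h ≤ G → p (z + (0, h)) * p z * (spDiff η h z ^ 2 * κ z h)
        ≤ G * (p (z + (0, h)) * p z) := fun hle => by
      rw [mul_comm G]
      refine mul_le_mul_of_nonneg_left ?_ hpp
      exact (mul_le_of_le_one_left (hκ.nonneg z h) (hη.spDiff_sq_le hD h z).2).trans hle
    by_cases h1 : z ∈ W
    · by_cases h2 : z + (0, h) ∈ W
      · have e1 : w z = p z := indicator_of_mem h1 _
        have e2 : w (z + (0, h)) = p (z + (0, h)) := indicator_of_mem h2 _
        rw [e1, e2]
        have := mul_le_mul_of_nonneg_left (hkle z h) hpp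
        nlinarith [mul_nonneg (g0 h) (sq_nonneg (p z - p (z + (0, h))))]
      · have h3 : z ∈ S := hS.resolve_right fun h' => h2 (hSW h')
        obtain ⟨h4, h5⟩ := (hfar z h hk).1 h3 h2
        have e1 : q z = p z := indicator_of_mem h3 _
        have e2 : r (z + (0, h)) = p (z + (0, h)) := indicator_of_mem h4 _
        have := far h5
        rw [e1, e2] at n2 ⊢
        linarith [mul_comm (p z) (p (z + (0, h)))]
    · have h3 : z + (0, h) ∈ S := hS.resolve_left fun h' => h1 (hSW h')
      obtain ⟨h4, h5⟩ := (hfar z h hk).2 h3 h1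
      have e1 : r z = p z := indicator_of_mem h4 _
      have e2 : q (z + (0, h)) = p (z + (0, h)) := indicator_of_mem h3 _
      have := far h5
      rw [e1, e2] at n3 ⊢
      linarith [mul_comm (p z) (p (z + (0, h)))]
  have hC : ∀ z, |η z| ≤ 1 := fun z => by rw [abs_of_nonneg (hη.nonneg z)]; exact hη.le_one z
  have ηm : Measurable η := hη.smooth.continuous.measurable
  have hflip : ∀ h : Ed d, ∫ z, r z * q (z + (0, h)) = ∫ z, q z * r (z + (0, -h)) := fun h => by
    rw [← integral_add_right_eq_self (fun z => q z * r (z + (0, -h))) ((0, h) : ℝ × Ed d)]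
    refine integral_congr_ae (ae_of_all _ fun z => ?_)
    simp only
    rw [add_assoc, show ((0, h) : ℝ × Ed d) + (0, -h) = 0 by ext <;> simp, add_zero, mul_comm]
  have hw2 : ∫ z, w z ^ 2 = ∫ z in W, p z ^ 2 := by
    rw [← integral_indicator hW]
    refine integral_congr_ae (ae_of_all _ fun z => ?_)
    by_cases hz : z ∈ W <;> simp [hw, hz]
  have hq1 : ∫ z, q z = ∫ z in S, p z := integral_indicator hη.meas
  have hinner : ∀ h, ∫ z, p (z + (0, h)) * p z * (spDiff η h z ^ 2 * κ z h)
      ≤ g h * (∫ z in W, p z ^ 2) + (G * (∫ z, q z * r (z + (0, h)))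
        + G * ∫ z, q z * r (z + (0, -h))) := fun h => by
    have wsq := wm.integrable_sq
    have a1 := wsq.const_mul (g h / 2)
    have a2 := ((memLp_two_comp_add wm ((0, h) : ℝ × Ed d)).integrable_sq).const_mul (g h / 2)
    have a3 := (integrable_mul_of_memLp_two qm
      (memLp_two_comp_add rm ((0, h) : ℝ × Ed d))).const_mul G
    have a4 := (integrable_mul_of_memLp_two rm
      (memLp_two_comp_add qm ((0, h) : ℝ × Ed d))).const_mul G
    have a12 := a1.add a2
    have a34 := a3.add a4
    have a := a12.add a34
    simp only [Pi.add_def] at a12 a34 a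
    refine (integral_mono (hκ.integrable_cross_inner hp ηm hC hη.abs_spDiff_le h).1 a
      (hpt h)).trans_eq ?_
    rw [integral_add a12 a34, integral_add a1 a2, integral_add a3 a4, integral_const_mul,
      integral_const_mul, integral_const_mul, integral_const_mul,
      integral_add_right_eq_self (fun z => w z ^ 2), hflip, hw2]
    ring
  have b1 := ((integrable_norm_rpow_mul_min hd hs0 hs1).const_mul (Λ * D₂ ^ 2)).mul_const
    (∫ z in W, p z ^ 2)
  have b2 := J1.const_mul G
  have b3 := (J1.comp_neg).const_mul G
  have b23 := b2.add b3
  have b := b1.add b23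
  simp only [Pi.add_def] at b23 b
  unfold crossForm
  refine (integral_mono (hκ.integrable_cross_outer hd hs0 hs1 hpm hp ηm hC hη.abs_spDiff_le) b
    hinner).trans ?_
  rw [integral_add b1 b23, integral_add b2 b3, integral_mul_const, integral_const_mul,
    integral_const_mul, integral_const_mul,
    integral_neg_eq_self (fun h : Ed d => ∫ z, q z * r (z + (0, h)))]
  have := mul_le_mul_of_nonneg_left J2 hG
  rw [hq1] at this
  linarith

end CrossBound

/-- A solution of the localised equation in a cylinder of radius `7 / 8 * ρ`, with jumps confined
to the ball of radius `ρ`. -/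
structure LocalisedEq {d : ℕ} (s Λ t₁ t₂ ρ : ℝ) (x₀ : Ed d) (u f : ℝ × Ed d → ℝ)
    (Du a : ℝ × Ed d → Ed d) (κ : ℝ × Ed d → Ed d → ℝ) : Prop where
  hd : 2 ≤ d
  hs : s ∈ Ioo (0 : ℝ) 1
  hΛ : 1 ≤ Λ
  hρ : 0 < ρ
  eq : WeakEq s Λ (Ioo t₁ t₂ ×ˢ ball x₀ (7 / 8 * ρ)) u f Du a κ
  ell : Elliptic Λ (Ioo t₁ t₂ ×ˢ ball x₀ (7 / 8 * ρ)) u f Du a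
  int : Integrable u
  late : ∀ z, t₂ ≤ z.1 → u z = 0
  late_grad : ∀ z, t₂ ≤ z.1 → Du z = 0
  near : ∀ z h, κ z h ≠ 0 → z.2 ∈ ball x₀ ρ ∧ z.2 + h ∈ ball x₀ ρ

section Levels

variable {ℓ₀ ℓ r : ℝ}

lemma posAbove_anti (h : ℓ₀ ≤ ℓ) : posAbove ℓ r ≤ posAbove ℓ₀ r :=
  max_le_max (by linarith) le_rfl

lemma posAbove_sq_anti (h : ℓ₀ ≤ ℓ) : posAbove ℓ r ^ 2 ≤ posAbove ℓ₀ r ^ 2 :=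
  pow_le_pow_left₀ (posAbove_nonneg _ _) (posAbove_anti h) 2

lemma sub_mul_posAbove_le (h : ℓ₀ ≤ ℓ) : (ℓ - ℓ₀) * posAbove ℓ r ≤ posAbove ℓ₀ r ^ 2 := by
  rcases le_total r ℓ with h1 | h1
  · rw [posAbove_of_le h1, mul_zero]; positivity
  · rw [posAbove_of_ge h1, posAbove_of_ge (h.trans h1)]
    nlinarith

end Levels

section Step

variable {d : ℕ} {s Λ t₁ t₂ ρ : ℝ} {x₀ : Ed d} {u f : ℝ × Ed d → ℝ} {Du a : ℝ × Ed d → Ed d}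
    {κ : ℝ × Ed d → Ed d → ℝ} {S : Set (ℝ × Ed d)} {D₁ D₂ ℓ₀ ℓ ℓ₁ : ℝ} {η : ℝ × Ed d → ℝ}

lemma LocalisedEq.measurable_pos (h : LocalisedEq s Λ t₁ t₂ ρ x₀ u f Du a κ) (ℓ : ℝ) :
    Measurable fun z => posAbove ℓ (u z) := continuous_posAbove.measurable.comp h.eq.meas

lemma LocalisedEq.memLp_pos (h : LocalisedEq s Λ t₁ t₂ ρ x₀ u f Du a κ) (hℓ : 0 ≤ ℓ) :
    MemLp (fun z => posAbove ℓ (u z)) 2 :=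
  h.eq.memu.of_le (h.measurable_pos ℓ).aestronglyMeasurable
    (ae_of_all _ fun _ => abs_posAbove_le hℓ _)

lemma LocalisedEq.integrable_pos (h : LocalisedEq s Λ t₁ t₂ ρ x₀ u f Du a κ) (hℓ : 0 ≤ ℓ) :
    Integrable fun z => posAbove ℓ (u z) :=
  h.int.mono (h.measurable_pos ℓ).aestronglyMeasurable
    (ae_of_all _ fun _ => abs_posAbove_le hℓ _)

lemma LocalisedEq.late_pos (h : LocalisedEq s Λ t₁ t₂ ρ x₀ u f Du a κ) (hℓ : 0 ≤ ℓ)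
    {z : ℝ × Ed d} (hz : t₂ ≤ z.1) : posAbove ℓ (u z) = 0 := by
  rw [h.late z hz, posAbove_of_le hℓ]

lemma LocalisedEq.isOpen : IsOpen (Ioo t₁ t₂ ×ˢ ball x₀ (7 / 8 * ρ)) := isOpen_Ioo.prod isOpen_ball

/-- The measure of superlevel slices is controlled by the energy at a lower level. -/
lemma LocalisedEq.volume_slice_le (h : LocalisedEq s Λ t₁ t₂ ρ x₀ u f Du a κ) (hℓ : 0 ≤ ℓ)
    (hℓ₁ : ℓ < ℓ₁) (hη : Cutoff (Ioo t₁ t₂ ×ˢ ball x₀ (7 / 8 * ρ)) S t₂ D₁ D₂ η) {F : ℝ}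
    (hF : caccBound Λ S κ η (fun z => posAbove ℓ (u z)) D₁ D₂ ≤ F) {A : Set (ℝ × Ed d)}
    (hA : MeasurableSet A) (hA1 : ∀ z ∈ A, η z = 1 ∧ ℓ₁ < u z) :
    ∀ᵐ t : ℝ, volume (Prod.mk t ⁻¹' A) ≤ ENNReal.ofReal (2 * F / (ℓ₁ - ℓ) ^ 2) := by
  have hintg : Integrable fun z => posAbove ℓ (u z) ^ 2 * η z ^ 2 :=
    (h.memLp_pos hℓ).integrable_sq.mul_bdd (c := 1)
      (hη.smooth.continuous.pow 2).aestronglyMeasurable (ae_of_all _ fun z => by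
        rw [Real.norm_of_nonneg (sq_nonneg _)]
        exact pow_le_one₀ (hη.nonneg z) (hη.le_one z))
  rw [Measure.volume_eq_prod] at hintg
  filter_upwards [caccioppoli_sup h.hd h.hs.1 h.hs.2 (by linarith [h.hΛ]) h.eq h.ell
    LocalisedEq.isOpen hℓ hη h.late_grad h.late, hintg.prod_right_ae] with t ht hi
  have hc : 0 < (ℓ₁ - ℓ) ^ 2 := by have := sub_pos.2 hℓ₁; positivity
  have h1 : ∫⁻ x, ENNReal.ofReal (posAbove ℓ (u (t, x)) ^ 2 * η (t, x) ^ 2)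
      ≤ ENNReal.ofReal (2 * F) := by
    rw [← ofReal_integral_eq_lintegral_ofReal hi (ae_of_all _ fun x => by positivity)]
    exact ENNReal.ofReal_le_ofReal (ht.trans (by linarith))
  have h2 : ENNReal.ofReal ((ℓ₁ - ℓ) ^ 2) * volume (Prod.mk t ⁻¹' A)
      ≤ ∫⁻ x, ENNReal.ofReal (posAbove ℓ (u (t, x)) ^ 2 * η (t, x) ^ 2) := by
    rw [← setLIntegral_const]
    refine (setLIntegral_mono' (measurable_prodMk_left hA) fun x hx => ?_).trans
      (setLIntegral_le_lintegral _ _)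
    obtain ⟨e1, e2⟩ := hA1 _ hx
    rw [e1, one_pow, mul_one, posAbove_of_ge (hℓ₁.trans e2).le]
    exact ENNReal.ofReal_le_ofReal (pow_le_pow_left₀ (sub_pos.2 hℓ₁).le (by linarith) 2)
  rw [ENNReal.ofReal_div_of_pos hc,
    ENNReal.le_div_iff_mul_le (Or.inl (by simpa using (sub_pos.2 hℓ₁).ne'))
    (Or.inl ENNReal.ofReal_ne_top), mul_comm]
  exact h2.trans h1

/-- One step of the De Giorgi iteration, with the energy bound as a parameter. -/
lemma LocalisedEq.setIntegral_pos_sq_le {C : ℝ} (hC : SliceSobolev d C)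
    (h : LocalisedEq s Λ t₁ t₂ ρ x₀ u f Du a κ) (hℓ : 0 ≤ ℓ)
    (hℓ₁ : ℓ < ℓ₁) (hη : Cutoff (Ioo t₁ t₂ ×ˢ ball x₀ (7 / 8 * ρ)) S t₂ D₁ D₂ η) (hD : 0 ≤ D₂)
    {F Y : ℝ} (hF : caccBound Λ S κ η (fun z => posAbove ℓ (u z)) D₁ D₂ ≤ F)
    (hY : ∫ z in S, posAbove ℓ (u z) ^ 2 ≤ Y) {W : Set (ℝ × Ed d)} (hW : MeasurableSet W)
    (hηW : ∀ z ∈ W, z.1 < t₂ → η z = 1) :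
    ∫ z in W, posAbove ℓ₁ (u z) ^ 2 ≤ 2 * C * d * (2 * F / (ℓ₁ - ℓ) ^ 2) ^ (1 / (d : ℝ)) *
      (√Y * (√(2 * Λ * F) + 2 * D₂ * √Y)) := by
  have hΛ : 0 < Λ := by linarith [h.hΛ]
  have hC0 := hC.1
  set A : Set (ℝ × Ed d) := W ∩ {z | z.1 < t₂ ∧ ℓ₁ < u z} with hAd
  have hA : MeasurableSet A := hW.inter ((measurableSet_lt measurable_fst measurable_const).inter
    (measurableSet_lt measurable_const h.eq.meas))
  have hA1 : ∀ z ∈ A, η z = 1 ∧ ℓ₁ < u z := fun z hz => ⟨hηW z hz.1 hz.2.1, hz.2.2⟩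
  have hF0 : 0 ≤ F := (caccBound_nonneg h.hd h.hs.1 h.hs.2 hΛ h.eq h.ell LocalisedEq.isOpen hℓ hη
    h.late_grad).trans hF
  have hG := (caccioppoli_grad h.hd h.hs.1 h.hs.2 hΛ h.eq h.ell LocalisedEq.isOpen hℓ hη
    h.late_grad).trans (mul_le_mul_of_nonneg_left hF (by positivity))
  have hm : 0 ≤ 2 * F / (ℓ₁ - ℓ) ^ 2 := by positivity
  have key := h.eq.setIntegral_sq_le_sum hC hℓ hη hA hm (h.volume_slice_le hℓ hℓ₁ hη hF hA hA1)
  have i1 := (h.memLp_pos hℓ).integrable_sq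
  have i2 := (h.memLp_pos (hℓ.trans hℓ₁.le)).integrable_sq
  have e1 : ∫ z in W, posAbove ℓ₁ (u z) ^ 2 = ∫ z in A, posAbove ℓ₁ (u z) ^ 2 := by
    refine setIntegral_eq_of_subset_of_forall_sdiff_eq_zero hW inter_subset_left fun z hz => ?_
    by_cases h1 : z.1 < t₂
    · have : u z ≤ ℓ₁ := by
        by_contra h2
        exact hz.2 ⟨hz.1, h1, not_le.1 h2⟩
      rw [posAbove_of_le this]; simp
    · rw [h.late_pos (hℓ.trans hℓ₁.le) (not_lt.1 h1)]; simp
  have e2 : ∫ z in A, posAbove ℓ₁ (u z) ^ 2 ≤ ∫ z in A, posAbove ℓ (u z) ^ 2 * η z ^ 2 := by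
    have : ∫ z in A, posAbove ℓ (u z) ^ 2 * η z ^ 2 = ∫ z in A, posAbove ℓ (u z) ^ 2 :=
      setIntegral_congr_fun hA fun z hz => by simp only [(hA1 z hz).1, one_pow, mul_one]
    rw [this]
    exact integral_mono i2.integrableOn i1.integrableOn fun z => posAbove_sq_anti hℓ₁.le
  rw [e1]
  refine e2.trans (key.trans ?_)
  refine mul_le_mul_of_nonneg_left ?_ (by positivity)
  gcongr

/-- Energy bound in terms of the truncation at a lower level on a larger cylinder. -/
lemma LocalisedEq.caccBound_le (h : LocalisedEq s Λ t₁ t₂ ρ x₀ u f Du a κ) (hℓ₀ : 0 ≤ ℓ₀)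
    (hℓ : ℓ₀ < ℓ) {τ r σ L M : ℝ} (hσ : 0 < σ) (hσ1 : σ ≤ 1) (hL : 1 ≤ L) (hM0 : 0 ≤ M)
    (hη : Cutoff (Ioo t₁ t₂ ×ˢ ball x₀ (7 / 8 * ρ)) (Ici τ ×ˢ closedBall x₀ r) t₂
      (L / σ ^ 2) (L / σ) η)
    (hM : ∀ᵐ t : ℝ, ∫ x, (Ici τ ×ˢ ball x₀ ρ).indicator (fun z => posAbove 0 (u z)) (t, x) ≤ M) :
    caccBound Λ (Ici τ ×ˢ closedBall x₀ r) κ η (fun z => posAbove ℓ (u z)) (L / σ ^ 2) (L / σ)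
      ≤ ((L + 2 * Λ ^ 3 * L ^ 2 + Λ * L ^ 2 *
            (∫ h : Ed d, ‖h‖ ^ (-((d : ℝ) + 2 * s)) * min (‖h‖ ^ 2) 1)) / σ ^ 2
          + 2 * Λ / σ ^ (d + 2) * (M / (ℓ - ℓ₀)))
        * ∫ z in Ici τ ×ˢ closedBall x₀ (r + σ), posAbove ℓ₀ (u z) ^ 2 := by
  have hΛ := h.hΛ
  have hℓ' := hℓ₀.trans hℓ.le
  set S : Set (ℝ × Ed d) := Ici τ ×ˢ closedBall x₀ r with hS
  set W : Set (ℝ × Ed d) := Ici τ ×ˢ closedBall x₀ (r + σ) with hW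
  set V : Set (ℝ × Ed d) := Ici τ ×ˢ ball x₀ ρ with hV
  set Y := ∫ z in W, posAbove ℓ₀ (u z) ^ 2 with hY
  have hWm : MeasurableSet W := measurableSet_Ici.prod measurableSet_closedBall
  have hVm : MeasurableSet V := measurableSet_Ici.prod measurableSet_ball
  have hSW : S ⊆ W := prod_mono le_rfl (closedBall_subset_closedBall (by linarith))
  have i0 := (h.memLp_pos hℓ₀).integrable_sq
  have i1 := (h.memLp_pos hℓ').integrable_sq
  have hY0 : 0 ≤ Y := integral_nonneg fun z => sq_nonneg _
  have hWY : ∫ z in W, posAbove ℓ (u z) ^ 2 ≤ Y :=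
    integral_mono i1.integrableOn i0.integrableOn fun z => posAbove_sq_anti hℓ.le
  have hSY : ∫ z in S, posAbove ℓ (u z) ^ 2 ≤ Y :=
    (setIntegral_mono_set i1.integrableOn (ae_of_all _ fun z => sq_nonneg _)
      hSW.eventuallyLE).trans hWY
  have hS1 : ∫ z in S, posAbove ℓ (u z) ≤ Y / (ℓ - ℓ₀) := by
    rw [le_div_iff₀ (sub_pos.2 hℓ), mul_comm, ← integral_const_mul]
    refine (integral_mono ((h.integrable_pos hℓ').integrableOn.const_mul _) i0.integrableOn
      fun z => sub_mul_posAbove_le hℓ.le).trans ?_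
    exact setIntegral_mono_set i0.integrableOn (ae_of_all _ fun z => sq_nonneg _)
      hSW.eventuallyLE
  have hkG : ∀ z h', σ < ‖h'‖ → κ z h' ≤ Λ / σ ^ (d + 2) := fun z h' hh => by
    refine (h.eq.jump.le z h').trans ?_
    rw [div_eq_mul_inv]
    refine mul_le_mul_of_nonneg_left ?_ (by linarith)
    have h1 : ‖h'‖ ^ (-((d : ℝ) + 2 * s)) ≤ σ ^ (-((d : ℝ) + 2 * s)) :=
      Real.rpow_le_rpow_of_nonpos hσ hh.le (by have := h.hs.1; linarith [(d.cast_nonneg (α := ℝ))])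
    refine h1.trans ?_
    rw [← Real.rpow_natCast, ← Real.rpow_neg hσ.le]
    refine Real.rpow_le_rpow_of_exponent_ge hσ hσ1 ?_
    push_cast
    linarith [h.hs.2]
  have hcross := crossForm_le h.hd h.hs.1 h.hs.2 (by linarith) h.eq.jump hη
    ((one_le_div hσ).2 (by linarith)) (h.measurable_pos ℓ) (h.memLp_pos hℓ')
    (h.integrable_pos hℓ') (fun z => posAbove_nonneg _ _) hWm hVm hSW
    (G := Λ / σ ^ (d + 2)) (by positivity) (M := M) (fun z h' hk => ?_) ?_
  rotate_left
  · obtain ⟨n1, n2⟩ := h.near z h' hk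
    refine ⟨fun h1 h2 => ?_, fun h1 h2 => ?_⟩
    · refine ⟨⟨by simpa using h1.1, by simpa using n2⟩, hkG z h' ?_⟩
      by_contra hc
      refine h2 ⟨by simpa using h1.1, ?_⟩
      have h3 := h1.2
      simp only [mem_closedBall, dist_eq_norm, Prod.snd_add] at h3 ⊢
      calc ‖z.2 + h' - x₀‖ = ‖(z.2 - x₀) + h'‖ := by congr 1; abel
        _ ≤ ‖z.2 - x₀‖ + ‖h'‖ := norm_add_le _ _
        _ ≤ r + σ := by linarith [not_lt.1 hc]
    · have ht : z.1 ∈ Ici τ := by simpa using h1.1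
      refine ⟨⟨ht, n1⟩, hkG z h' ?_⟩
      by_contra hc
      refine h2 ⟨ht, ?_⟩
      have h3 := h1.2
      simp only [mem_closedBall, dist_eq_norm, Prod.snd_add] at h3 ⊢
      calc ‖z.2 - x₀‖ = ‖(z.2 + h' - x₀) - h'‖ := by congr 1; abel
        _ ≤ ‖z.2 + h' - x₀‖ + ‖h'‖ := norm_sub_le _ _
        _ ≤ r + σ := by linarith [not_lt.1 hc]
  · have hi := (h.integrable_pos (le_refl (0 : ℝ))).indicator hVm
    have hi' := (h.integrable_pos hℓ').indicator hVm
    rw [Measure.volume_eq_prod] at hi hi'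
    filter_upwards [hM, hi.prod_right_ae, hi'.prod_right_ae] with t ht h1 h2
    refine (integral_mono h2 h1 fun x => ?_).trans ht
    exact indicator_le_indicator (posAbove_anti hℓ')
  unfold caccBound
  set I := ∫ h : Ed d, ‖h‖ ^ (-((d : ℝ) + 2 * s)) * min (‖h‖ ^ 2) 1 with hI
  have hI0 : 0 ≤ I := integral_nonneg fun h => by positivity
  have c1 : (L / σ ^ 2 + 2 * Λ ^ 3 * (L / σ) ^ 2) * (∫ z in S, posAbove ℓ (u z) ^ 2)
      ≤ (L / σ ^ 2 + 2 * Λ ^ 3 * (L / σ) ^ 2) * Y := by gcongr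
  have c2 : Λ * (L / σ) ^ 2 * I * (∫ z in W, posAbove ℓ (u z) ^ 2) ≤ Λ * (L / σ) ^ 2 * I * Y := by
    gcongr
  have c3 : 2 * (Λ / σ ^ (d + 2) * (M * ∫ z in S, posAbove ℓ (u z)))
      ≤ 2 * (Λ / σ ^ (d + 2) * (M * (Y / (ℓ - ℓ₀)))) := by gcongr
  refine (add_le_add c1 (hcross.trans (add_le_add c2 c3))).trans_eq ?_
  ring

end Step

lemma de_giorgi_step_bound {n : ℕ} (hn : 0 < n) {C C₂ L Λ R k Y : ℝ} (j : ℕ) (hC : 0 ≤ C)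
    (hC₂ : 0 ≤ C₂) (hL : 0 ≤ L) (hΛ : 0 ≤ Λ) (hR : 0 < R) (hk : 0 < k) (hY : 0 ≤ Y)
    {F σ ε : ℝ} (hσ : σ = R / 32 * (1 / 2) ^ j) (hε : ε = k / 4 * (1 / 2) ^ j)
    (hF : F = C₂ * (2 ^ (n + 1)) ^ j / σ ^ 2 * Y) :
    2 * C * n * (2 * F / ε ^ 2) ^ (1 / (n : ℝ)) * (√Y * (√(2 * Λ * F) + 2 * (L / σ) * √Y))
      ≤ ((64 * C * n * (√(2 * Λ * C₂) + 2 * L) + 1) / R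
          * (32768 * C₂ / (R * k) ^ 2) ^ (1 / (n : ℝ)))
        * (2 ^ (2 * n + 7)) ^ j * (Y * Y ^ (1 / (n : ℝ))) := by
  set β : ℝ := (2 ^ (n + 1)) ^ j with hβ
  have hβ1 : 1 ≤ β := one_le_pow₀ (one_le_pow₀ (by norm_num))
  have hx : (0 : ℝ) < (1 / 2) ^ j := by positivity
  have hx2 : ((1 : ℝ) / 2) ^ j * 2 ^ j = 1 := by rw [← mul_pow]; norm_num
  have hσ0 : 0 < σ := by rw [hσ]; positivity
  have hε0 : 0 < ε := by rw [hε]; positivity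
  have hσi : 1 / σ = 32 / R * 2 ^ j := by
    rw [hσ, div_eq_iff (by positivity)]
    field_simp
    linear_combination -hx2
  have hn1 : (1 : ℝ) / n ≤ 1 := by
    rw [div_le_one (by exact_mod_cast hn)]; exact_mod_cast hn
  have hn0 : (0 : ℝ) ≤ 1 / n := by positivity
  have e1 : 2 * F / ε ^ 2 = (β * 16 ^ j) * (32768 * C₂ / (R * k) ^ 2 * Y) := by
    have hei : 1 / ε = 4 / k * 2 ^ j := by
      rw [hε, div_eq_iff (by positivity)]
      field_simp
      linear_combination -hx2
    calc 2 * F / ε ^ 2 = 2 * C₂ * β * Y * (1 / σ) ^ 2 * (1 / ε) ^ 2 := by rw [hF]; ring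
      _ = 2 * C₂ * β * Y * (32 / R) ^ 2 * (4 / k) ^ 2 * (2 ^ j) ^ 4 := by rw [hσi, hei]; ring
      _ = _ := by
          rw [show ((2 : ℝ) ^ j) ^ 4 = 16 ^ j by rw [← pow_mul, mul_comm, pow_mul]; norm_num]
          field_simp
          ring
  have hb : (1 : ℝ) ≤ β * 16 ^ j :=
    one_le_mul_of_one_le_of_one_le hβ1 (one_le_pow₀ (by norm_num))
  have e2 : (2 * F / ε ^ 2) ^ (1 / (n : ℝ))
      ≤ (β * 16 ^ j) * ((32768 * C₂ / (R * k) ^ 2) ^ (1 / (n : ℝ)) * Y ^ (1 / (n : ℝ))) := by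
    rw [e1, Real.mul_rpow (by positivity) (by positivity),
      Real.mul_rpow (by positivity) hY]
    refine mul_le_mul_of_nonneg_right ?_ (by positivity)
    calc (β * 16 ^ j) ^ (1 / (n : ℝ)) ≤ (β * 16 ^ j) ^ (1 : ℝ) :=
          Real.rpow_le_rpow_of_exponent_le hb hn1
      _ = _ := Real.rpow_one _
  have e3 : √Y * (√(2 * Λ * F) + 2 * (L / σ) * √Y)
      ≤ Y * β * (32 / R * 2 ^ j) * (√(2 * Λ * C₂) + 2 * L) := by
    have s1 : √(2 * Λ * F) ≤ √(2 * Λ * C₂) * β * (1 / σ) * √Y := by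
      rw [hF, show 2 * Λ * (C₂ * β / σ ^ 2 * Y) = (2 * Λ * C₂) * β * (1 / σ) ^ 2 * Y by ring,
        Real.sqrt_mul (by positivity), Real.sqrt_mul (by positivity),
        Real.sqrt_sq (by positivity), Real.sqrt_mul (by positivity)]
      have : √β ≤ β := Real.sqrt_le_iff.2 ⟨by positivity, by nlinarith⟩
      gcongr
    have s2 : 2 * (L / σ) * √Y ≤ 2 * L * β * (1 / σ) * √Y := by
      have : 2 * (L / σ) * 1 ≤ 2 * (L / σ) * β := by gcongr
      calc _ = 2 * (L / σ) * 1 * √Y := by ring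
        _ ≤ 2 * (L / σ) * β * √Y := by gcongr
        _ = _ := by ring
    calc _ ≤ √Y * (√(2 * Λ * C₂) * β * (1 / σ) * √Y + 2 * L * β * (1 / σ) * √Y) := by gcongr
      _ = (√Y * √Y) * β * (1 / σ) * (√(2 * Λ * C₂) + 2 * L) := by ring
      _ = _ := by rw [Real.mul_self_sqrt hY, hσi]
  set X := (32768 * C₂ / (R * k) ^ 2) ^ (1 / (n : ℝ)) with hX
  have hX0 : 0 ≤ X := by positivity
  set Z := Y ^ (1 / (n : ℝ)) with hZ
  have hZ0 : 0 ≤ Z := by positivity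
  have e4 : (0 : ℝ) ≤ √Y * (√(2 * Λ * F) + 2 * (L / σ) * √Y) := by positivity
  calc _ ≤ 2 * C * n * ((β * 16 ^ j) * (X * Z))
        * (Y * β * (32 / R * 2 ^ j) * (√(2 * Λ * C₂) + 2 * L)) := by gcongr
    _ = (64 * C * n * (√(2 * Λ * C₂) + 2 * L)) / R * X * (β ^ 2 * (16 ^ j * 2 ^ j)) * (Y * Z) := by
        ring
    _ = (64 * C * n * (√(2 * Λ * C₂) + 2 * L)) / R * X * (2 ^ (2 * n + 7)) ^ j * (Y * Z) := by
        congr 2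
        rw [hβ, ← mul_pow, ← pow_mul, mul_comm j 2, pow_mul, ← mul_pow]
        congr 1
        rw [← pow_mul]; norm_num; ring
    _ ≤ _ := by
        gcongr
        linarith

/-- One step of the De Giorgi iteration between concentric cylinders. -/
lemma LocalisedEq.cylinder_step {d : ℕ} {s Λ t₁ t₂ ρ : ℝ} {x₀ : Ed d} {u f : ℝ × Ed d → ℝ}
    {Du a : ℝ × Ed d → Ed d} {κ : ℝ × Ed d → Ed d → ℝ} {C L : ℝ} (hC : SliceSobolev d C)
    (hL : 1 ≤ L) (h : LocalisedEq s Λ t₁ t₂ ρ x₀ u f Du a κ) {r σ ℓ ε M F : ℝ}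
    (hcut : ∃ η : ℝ × Ed d → ℝ, Cutoff (Ioo t₁ t₂ ×ˢ ball x₀ (7 / 8 * ρ))
      (Ici (t₂ - (r + σ + σ) ^ 2) ×ˢ closedBall x₀ (r + σ)) t₂ (L / σ ^ 2) (L / σ) η ∧
      ∀ z ∈ Ici (t₂ - r ^ 2) ×ˢ closedBall x₀ r, z.1 < t₂ → η z = 1)
    (hσ : 0 < σ) (hσ1 : σ ≤ 1) (hℓ : 0 ≤ ℓ) (hε : 0 < ε) (hM0 : 0 ≤ M)
    (hM : ∀ᵐ t : ℝ, ∫ x, (Ici (t₂ - (r + σ + σ) ^ 2) ×ˢ ball x₀ ρ).indicator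
      (fun z => posAbove 0 (u z)) (t, x) ≤ M)
    (hF : ((L + 2 * Λ ^ 3 * L ^ 2 + Λ * L ^ 2 *
            (∫ h : Ed d, ‖h‖ ^ (-((d : ℝ) + 2 * s)) * min (‖h‖ ^ 2) 1)) / σ ^ 2
          + 2 * Λ / σ ^ (d + 2) * (M / ε))
        * (∫ z in Ici (t₂ - (r + σ + σ) ^ 2) ×ˢ closedBall x₀ (r + σ + σ),
            posAbove ℓ (u z) ^ 2) ≤ F) :
    ∫ z in Ici (t₂ - r ^ 2) ×ˢ closedBall x₀ r, posAbove (ℓ + ε + ε) (u z) ^ 2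
      ≤ 2 * C * d * (2 * F / ε ^ 2) ^ (1 / (d : ℝ)) *
        (√(∫ z in Ici (t₂ - (r + σ + σ) ^ 2) ×ˢ closedBall x₀ (r + σ + σ),
            posAbove ℓ (u z) ^ 2) * (√(2 * Λ * F) + 2 * (L / σ) *
          √(∫ z in Ici (t₂ - (r + σ + σ) ^ 2) ×ˢ closedBall x₀ (r + σ + σ),
            posAbove ℓ (u z) ^ 2))) := by
  obtain ⟨η, hη, hη1⟩ := hcut
  have hcb := h.caccBound_le hℓ (by linarith : ℓ < ℓ + ε) hσ hσ1 hL hM0 hη hM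
  rw [add_sub_cancel_left] at hcb
  have i1 := (h.memLp_pos hℓ).integrable_sq
  have i2 := (h.memLp_pos (ℓ := ℓ + ε) (by linarith)).integrable_sq
  have hYS : ∫ z in Ici (t₂ - (r + σ + σ) ^ 2) ×ˢ closedBall x₀ (r + σ),
      posAbove (ℓ + ε) (u z) ^ 2
      ≤ ∫ z in Ici (t₂ - (r + σ + σ) ^ 2) ×ˢ closedBall x₀ (r + σ + σ), posAbove ℓ (u z) ^ 2 := by
    refine (setIntegral_mono_set (t := Ici (t₂ - (r + σ + σ) ^ 2) ×ˢ closedBall x₀ (r + σ + σ))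
      i2.integrableOn (ae_of_all _ fun z => sq_nonneg _) (Set.prod_mono le_rfl
        (closedBall_subset_closedBall (by linarith))).eventuallyLE).trans ?_
    exact integral_mono i2.integrableOn i1.integrableOn fun z => posAbove_sq_anti (by linarith)
  have key := h.setIntegral_pos_sq_le hC (ℓ := ℓ + ε) (ℓ₁ := ℓ + ε + ε) (by linarith)
    (by linarith) hη (by positivity) (hcb.trans hF) hYS
    (measurableSet_Ici.prod measurableSet_closedBall) hη1
  rwa [add_sub_cancel_left] at key

set_option maxHeartbeats 1000000 in
/-- Local boundedness: smallness of the energy and of the mean force a pointwise bound. -/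
lemma LocalisedEq.ae_le_of_small (d : ℕ) (hd : 2 ≤ d) (s Λ : ℝ) (hΛ : 1 ≤ Λ) :
    ∃ C : ℝ, 0 < C ∧ ∀ (x₀ : Ed d) (t₁ t₂ ρ R : ℝ) (u f : ℝ × Ed d → ℝ) (Du a : ℝ × Ed d → Ed d)
      (κ : ℝ × Ed d → Ed d → ℝ), LocalisedEq s Λ t₁ t₂ ρ x₀ u f Du a κ → 0 < R → R ≤ 1 →
      5 / 8 * R < 7 / 8 * ρ → t₁ < t₂ - (5 / 8 * R) ^ 2 → ∀ M k : ℝ, 0 ≤ M → 0 < k →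
      (∀ᵐ t : ℝ, ∫ x, (Ici (t₂ - (5 / 8 * R) ^ 2) ×ˢ ball x₀ ρ).indicator
        (fun z => posAbove 0 (u z)) (t, x) ≤ M) → M ≤ k * R ^ d →
      C * (∫ z in Ici (t₂ - (5 / 8 * R) ^ 2) ×ˢ closedBall x₀ (5 / 8 * R), posAbove 0 (u z) ^ 2)
        ≤ R ^ (d + 2) * k ^ 2 →
      ∀ᵐ z : ℝ × Ed d, z ∈ Ici (t₂ - (R / 2) ^ 2) ×ˢ closedBall x₀ (R / 2) → u z ≤ k := by
  obtain ⟨L, hL, hcut⟩ := exists_cylinder_cutoff d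
  obtain ⟨C, hC⟩ : ∃ C, SliceSobolev d C := exists_setIntegral_le_sum_fderiv hd
  have hC0 := hC.1
  have hd0 : 0 < d := by omega
  set I := ∫ h : Ed d, ‖h‖ ^ (-((d : ℝ) + 2 * s)) * min (‖h‖ ^ 2) 1 with hI
  have hI0 : 0 ≤ I := integral_nonneg fun h => by positivity
  set C₁ := L + 2 * Λ ^ 3 * L ^ 2 + Λ * L ^ 2 * I with hC₁
  have hC₁0 : 0 < C₁ := by positivity
  set C₂ := C₁ + 8 * Λ * 32 ^ d with hC₂
  have hC₂0 : 0 < C₂ := by positivity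
  set C₄ := 64 * C * d * (√(2 * Λ * C₂) + 2 * L) + 1 with hC₄
  have hC₄0 : 0 < C₄ := by positivity
  set b : ℝ := 2 ^ (2 * d + 7) with hb
  have hb1 : 1 < b := one_lt_pow₀ (by norm_num) (by omega)
  refine ⟨(C₄ * b ^ d) ^ d * (32768 * C₂), by positivity, ?_⟩
  intro x₀ t₁ t₂ ρ R u f Du a κ h hR hR1 hρ ht M k hM0 hk hM hMk hsmall
  set X : ℕ → ℝ := fun j => (1 / 2) ^ j with hX
  have hX0 : ∀ j, 0 < X j := fun j => by simp only [hX]; positivity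
  have hX1 : ∀ j, X j ≤ 1 := fun j => pow_le_one₀ (by norm_num) (by norm_num)
  have hXs : ∀ j, X (j + 1) = X j / 2 := fun j => by simp only [hX, pow_succ]; ring
  set r : ℕ → ℝ := fun j => R / 2 + R / 8 * X j with hr
  set lev : ℕ → ℝ := fun j => k * (1 - X j) with hlev
  have hlev0 : ∀ j, 0 ≤ lev j := fun j => mul_nonneg hk.le (by linarith [hX1 j])
  set W : ℕ → Set (ℝ × Ed d) := fun j => Ici (t₂ - r j ^ 2) ×ˢ closedBall x₀ (r j) with hW
  have hWm : ∀ j, MeasurableSet (W j) := fun j => measurableSet_Ici.prod measurableSet_closedBall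
  set Y : ℕ → ℝ := fun j => ∫ z in W j, posAbove (lev j) (u z) ^ 2 with hY
  have hY0 : ∀ j, 0 ≤ Y j := fun j => integral_nonneg fun z => sq_nonneg _
  have hr0 : r 0 = 5 / 8 * R := by simp only [hr, hX, pow_zero]; ring
  have hrlo : ∀ j, R / 2 ≤ r j := fun j => by
    have := mul_nonneg (by positivity : 0 ≤ R / 8) (hX0 j).le
    simp only [hr]; linarith
  have hrhi : ∀ j, r j ≤ 5 / 8 * R := fun j => by
    have := mul_le_mul_of_nonneg_left (hX1 j) (by positivity : 0 ≤ R / 8)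
    simp only [hr]; linarith
  have hstep : ∀ j, Y (j + 1) ≤ (C₄ / R * (32768 * C₂ / (R * k) ^ 2) ^ (1 / (d : ℝ))) * b ^ j
      * (Y j * Y j ^ (1 / (d : ℝ))) := fun j => by
    set σ := R / 32 * X j with hσ
    set ε := k / 4 * X j with hε
    have hσ0 : 0 < σ := mul_pos (by positivity) (hX0 j)
    have hε0 : 0 < ε := mul_pos (by positivity) (hX0 j)
    have hσ1 : σ ≤ 1 := by
      have := mul_le_mul_of_nonneg_left (hX1 j) (by positivity : 0 ≤ R / 32)
      linarith
    have hrs : r (j + 1) + σ + σ = r j := by simp only [hr, hXs, hσ]; ring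
    have hl1 : lev j + ε + ε = lev (j + 1) := by simp only [hlev, hXs, hε]; ring
    have hτ0 : t₂ - (5 / 8 * R) ^ 2 ≤ t₂ - r j ^ 2 := by
      have := hrhi j; have := hrlo j; nlinarith
    obtain ⟨η, hη1, hη2, hη3, hη4, hη5, hη6, hη7, hη8⟩ := hcut x₀ t₂ (t₂ - r j ^ 2) (σ ^ 2)
      (r (j + 1)) σ (by positivity) hσ0 (by linarith [hrlo (j + 1)])
    have hcutoff : ∃ η : ℝ × Ed d → ℝ, Cutoff (Ioo t₁ t₂ ×ˢ ball x₀ (7 / 8 * ρ))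
        (Ici (t₂ - (r (j + 1) + σ + σ) ^ 2) ×ˢ closedBall x₀ (r (j + 1) + σ)) t₂
          (L / σ ^ 2) (L / σ) η ∧
        ∀ z ∈ Ici (t₂ - r (j + 1) ^ 2) ×ˢ closedBall x₀ (r (j + 1)), z.1 < t₂ → η z = 1 := by
      rw [hrs]
      refine ⟨η, ⟨hη1, hη2, hη3, hη4, hη5, fun z hz hz2 => ?_,
        measurableSet_Ici.prod measurableSet_closedBall, hη7, hη8⟩,
        fun z hz hz2 => hη6 z (le_trans ?_ hz.1) hz2 hz.2⟩
      · obtain ⟨a1, a2⟩ := hη5 hz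
        refine ⟨⟨lt_of_lt_of_le ht (hτ0.trans a1), hz2⟩, closedBall_subset_ball ?_ a2⟩
        linarith [hrhi j]
      · have q1 : 0 < r (j + 1) := by linarith [hrlo (j + 1)]
        rw [← hrs]
        nlinarith [mul_pos q1 hσ0]
    have hMj : ∀ᵐ t : ℝ, ∫ x, (Ici (t₂ - r j ^ 2) ×ˢ ball x₀ ρ).indicator
        (fun z => posAbove 0 (u z)) (t, x) ≤ M := by
      have i1 := (h.integrable_pos le_rfl).indicator
        (measurableSet_Ici.prod measurableSet_ball : MeasurableSet
          (Ici (t₂ - (5 / 8 * R) ^ 2) ×ˢ ball x₀ ρ))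
      have i2 := (h.integrable_pos le_rfl).indicator
        (measurableSet_Ici.prod measurableSet_ball : MeasurableSet
          (Ici (t₂ - r j ^ 2) ×ˢ ball x₀ ρ))
      rw [Measure.volume_eq_prod] at i1 i2
      filter_upwards [hM, i1.prod_right_ae, i2.prod_right_ae] with t ht h1 h2
      refine (integral_mono h2 h1 fun x => ?_).trans ht
      exact indicator_le_indicator_of_subset (Set.prod_mono (Ici_subset_Ici.2 hτ0) le_rfl)
        (fun z => posAbove_nonneg _ _) _
    have hpw : X j * 2 ^ j = 1 := by simp only [hX]; rw [← mul_pow]; norm_num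
    have hFle : (C₁ / σ ^ 2 + 2 * Λ / σ ^ (d + 2) * (M / ε)) * Y j
        ≤ C₂ * (2 ^ (d + 1)) ^ j / σ ^ 2 * Y j := by
      refine mul_le_mul_of_nonneg_right ?_ (hY0 j)
      have m1 : M / ε ≤ 4 * 2 ^ j * R ^ d := by
        rw [div_le_iff₀ hε0]
        calc M ≤ k * R ^ d * (X j * 2 ^ j) := by rw [hpw, mul_one]; exact hMk
          _ = _ := by rw [hε]; ring
      have m2 : R = 32 * 2 ^ j * σ := by rw [hσ]; linear_combination -R * hpw
      have m3 : R ^ d = 32 ^ d * (2 ^ d) ^ j * σ ^ d := by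
        conv_lhs => rw [m2]
        rw [mul_pow, mul_pow, ← pow_mul, ← pow_mul, mul_comm j d]
      have hβ : (1 : ℝ) ≤ (2 ^ (d + 1)) ^ j := one_le_pow₀ (one_le_pow₀ (by norm_num))
      have m4 : 2 * Λ / σ ^ (d + 2) * (M / ε)
          ≤ 8 * Λ * 32 ^ d * (2 ^ (d + 1)) ^ j / σ ^ 2 := by
        calc _ ≤ 2 * Λ / σ ^ (d + 2) * (4 * 2 ^ j * R ^ d) := by gcongr
          _ = 8 * Λ * 32 ^ d * ((2 ^ d) ^ j * 2 ^ j) * (σ ^ d / σ ^ (d + 2)) := by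
              rw [m3]; ring
          _ = _ := by
              rw [← mul_pow, ← pow_succ, pow_add σ, ← div_div, div_self (by positivity)]
              ring
      have m5 : C₁ / σ ^ 2 ≤ C₁ * (2 ^ (d + 1)) ^ j / σ ^ 2 :=
        div_le_div_of_nonneg_right (le_mul_of_one_le_right hC₁0.le hβ) (by positivity)
      refine (add_le_add m5 m4).trans_eq ?_
      rw [hC₂]; ring
    have key := h.cylinder_step hC hL (r := r (j + 1)) (σ := σ) (ℓ := lev j) (ε := ε) (M := M)
      (F := C₂ * (2 ^ (d + 1)) ^ j / σ ^ 2 * Y j) hcutoff hσ0 hσ1 (hlev0 j) hε0 hM0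
      (by rw [hrs]; exact hMj) (by rw [hrs]; exact hFle)
    rw [hrs, hl1] at key
    exact key.trans (de_giorgi_step_bound hd0 j hC0 hC₂0.le (by linarith)
        (by linarith) hR hk (hY0 j) rfl rfl rfl)
  have hlim : Tendsto Y atTop (𝓝 0) := by
    refine tendsto_zero_of_superlinear hd0 (by positivity) hb1 hY0 hstep ?_
    have hY00 : Y 0 = ∫ z in Ici (t₂ - (5 / 8 * R) ^ 2) ×ˢ closedBall x₀ (5 / 8 * R),
        posAbove 0 (u z) ^ 2 := by
      simp only [hY, hW, hr0, hlev, hX, pow_zero, sub_self, mul_zero]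
    rw [← hY00] at hsmall
    have h1 : 32768 * C₂ / (R * k) ^ 2 * Y 0 ≤ (R / (C₄ * b ^ d)) ^ d := by
      rw [div_pow, div_mul_eq_mul_div, div_le_div_iff₀ (by positivity) (by positivity)]
      calc _ = (C₄ * b ^ d) ^ d * (32768 * C₂) * Y 0 := by ring
        _ ≤ R ^ (d + 2) * k ^ 2 := hsmall
        _ = _ := by ring
    have h2 : (32768 * C₂ / (R * k) ^ 2) ^ (1 / (d : ℝ)) * Y 0 ^ (1 / (d : ℝ))
        ≤ R / (C₄ * b ^ d) := by
      rw [← Real.mul_rpow (by positivity) (hY0 0)]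
      refine (Real.rpow_le_rpow (mul_nonneg (by positivity) (hY0 0)) h1 (by positivity)).trans_eq ?_
      rw [one_div, Real.pow_rpow_inv_natCast (by positivity) hd0.ne']
    calc _ = C₄ / R * b ^ d * ((32768 * C₂ / (R * k) ^ 2) ^ (1 / (d : ℝ)) * Y 0 ^ (1 / (d : ℝ))) := by
          ring
      _ ≤ C₄ / R * b ^ d * (R / (C₄ * b ^ d)) := by gcongr
      _ = 1 := by field_simp
  have hmem := (h.memLp_pos hk.le).integrable_sq
  have hle : ∀ j, ∫ z in Ici (t₂ - (R / 2) ^ 2) ×ˢ closedBall x₀ (R / 2), posAbove k (u z) ^ 2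
      ≤ Y j := fun j => by
    have i1 := (h.memLp_pos (hlev0 j)).integrable_sq
    have hs : Ici (t₂ - (R / 2) ^ 2) ×ˢ closedBall x₀ (R / 2) ⊆ W j := by
      refine Set.prod_mono (Ici_subset_Ici.2 ?_) (closedBall_subset_closedBall (hrlo j))
      have := hrlo j; nlinarith
    refine (setIntegral_mono_set hmem.integrableOn (ae_of_all _ fun z => sq_nonneg _)
      hs.eventuallyLE).trans ?_
    refine integral_mono hmem.integrableOn i1.integrableOn fun z => posAbove_sq_anti ?_
    have := mul_pos hk (hX0 j)
    simp only [hlev]; linarith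
  have hzero := ge_of_tendsto' hlim hle
  have h0 := le_antisymm hzero (integral_nonneg fun z => sq_nonneg _)
  rw [setIntegral_eq_zero_iff_of_nonneg_ae (ae_of_all _ fun z => sq_nonneg _)
    hmem.integrableOn] at h0
  rw [Filter.EventuallyEq, ae_restrict_iff' (measurableSet_Ici.prod measurableSet_closedBall)] at h0
  filter_upwards [h0] with z hz hz2
  have h3 : posAbove k (u z) = 0 := by simpa using hz hz2
  by_contra h4
  rw [posAbove_of_ge (not_le.1 h4).le] at h3
  exact h4 (by linarith)

lemma LocalSol.localisedEq {d : ℕ} {s Λ : ℝ} {A : ℝ → Ed d → Ed d → Ed d}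
    {K : ℝ → Ed d → Ed d → ℝ} {J : Set ℝ} {Ω : Set (Ed d)} {v : ℝ → Ed d → ℝ}
    {Dv : ℝ → Ed d → Ed d} {t₁ t₂ : ℝ} {x₀ : Ed d} {R ρ : ℝ}
    (h : LocalSol d s Λ A K J Ω v Dv t₁ t₂ x₀ R) (hρ : 0 < ρ) (hρR : ρ ≤ R) :
    LocalisedEq s Λ t₁ t₂ ρ x₀ (redU s Λ v t₁ t₂ x₀ R ρ) (redF s Λ K v t₁ t₂ x₀ ρ)
      (redDu s Λ v Dv t₁ t₂ x₀ R ρ) (redA A Dv t₁ t₂ x₀ R) (nearK K t₁ t₂ x₀ ρ) where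
  hd := h.hd
  hs := h.hs
  hΛ := h.hΛ
  hρ := hρ
  eq := h.weakEq hρ hρR
  ell := h.elliptic hρ hρR
  int := by
    have : IsFiniteMeasure ((volume : Measure (ℝ × Ed d)).restrict
        (Ioo t₁ t₂ ×ˢ closedBall x₀ (2 * R))) :=
      ⟨by rw [Measure.restrict_apply_univ]; exact volume_box_lt_top⟩
    have h1 : IntegrableOn (redU s Λ v t₁ t₂ x₀ R ρ) (Ioo t₁ t₂ ×ˢ closedBall x₀ (2 * R)) :=
      ((h.memLp_redU hρ).restrict _).integrable (by norm_num)
    refine (integrableOn_iff_integrable_of_support_subset fun z hz => ?_).1 h1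
    by_contra hc
    exact hz (indicator_of_notMem hc _)
  late z hz := indicator_of_notMem (fun hc => absurd hc.1.2 (not_lt.2 hz)) _
  late_grad z hz := indicator_of_notMem (fun hc => absurd hc.1.2 (not_lt.2 hz)) _
  near z k hk := by
    by_contra hc
    exact hk (indicator_of_notMem (fun hm => hc hm.2) _)

/-- Energy bound on time slices of the positive part. -/
lemma LocalisedEq.energy_sup (d : ℕ) (s Λ : ℝ) (hΛ : 1 ≤ Λ) :
    ∃ C : ℝ, 0 < C ∧ ∀ (x₀ : Ed d) (t₂ R : ℝ) (u f : ℝ × Ed d → ℝ) (Du a : ℝ × Ed d → Ed d)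
      (κ : ℝ × Ed d → Ed d → ℝ), LocalisedEq s Λ (t₂ - R ^ 2) t₂ R x₀ u f Du a κ → R ≤ 1 →
      ∀ᵐ t : ℝ, ∫ x, (Ici (t₂ - 3 / 4 * R ^ 2) ×ˢ ball x₀ (3 / 4 * R)).indicator
        (fun z => posAbove 0 (u z) ^ 2) (t, x)
        ≤ C / R ^ 2 * ∫ z in univ ×ˢ ball x₀ R, posAbove 0 (u z) ^ 2 := by
  obtain ⟨L, hL, hcut⟩ := exists_cylinder_cutoff d
  set I := ∫ h : Ed d, ‖h‖ ^ (-((d : ℝ) + 2 * s)) * min (‖h‖ ^ 2) 1 with hI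
  have hI0 : 0 ≤ I := integral_nonneg fun h => by positivity
  refine ⟨2 * (8 * L + 2 * Λ ^ 3 * 256 * L ^ 2 + Λ * 256 * L ^ 2 * I), by positivity, ?_⟩
  intro x₀ t₂ R u f Du a κ h hR1
  have hR : 0 < R := h.hρ
  obtain ⟨η, hη1, hη2, hη3, hη4, hη5, hη6, hη7, hη8⟩ := hcut x₀ t₂ (t₂ - 7 / 8 * R ^ 2)
    (R ^ 2 / 8) (3 / 4 * R) (R / 16) (by positivity) (by positivity) (by positivity)
  set S : Set (ℝ × Ed d) := Ici (t₂ - 7 / 8 * R ^ 2) ×ˢ closedBall x₀ (3 / 4 * R + R / 16) with hS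
  set W : Set (ℝ × Ed d) := univ ×ˢ ball x₀ R with hW
  have hWm : MeasurableSet W := MeasurableSet.univ.prod measurableSet_ball
  have hSW : S ⊆ W := Set.prod_mono (subset_univ _) (closedBall_subset_ball (by linarith))
  have hR2 : 0 < R ^ 2 := by positivity
  have hη : Cutoff (Ioo (t₂ - R ^ 2) t₂ ×ˢ ball x₀ (7 / 8 * R)) S t₂ (L / (R ^ 2 / 8))
      (L / (R / 16)) η := by
    refine ⟨hη1, hη2, hη3, hη4, hη5, fun z hz hz2 => ?_,
      measurableSet_Ici.prod measurableSet_closedBall, hη7, hη8⟩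
    obtain ⟨a1, a2⟩ := hη5 hz
    refine ⟨⟨lt_of_lt_of_le (by linarith) a1, hz2⟩, closedBall_subset_ball ?_ a2⟩
    linarith
  have i0 := (h.memLp_pos (le_refl (0 : ℝ))).integrable_sq
  set Y := ∫ z in W, posAbove 0 (u z) ^ 2 with hY
  have hSY : ∫ z in S, posAbove 0 (u z) ^ 2 ≤ Y :=
    setIntegral_mono_set i0.integrableOn (ae_of_all _ fun z => sq_nonneg _) hSW.eventuallyLE
  have hcross := crossForm_le h.hd h.hs.1 h.hs.2 (by linarith) h.eq.jump hη
    ((one_le_div (by positivity)).2 (by linarith)) (h.measurable_pos 0) (h.memLp_pos le_rfl)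
    (h.integrable_pos le_rfl) (fun z => posAbove_nonneg _ _) hWm MeasurableSet.empty hSW
    (G := 0) le_rfl (M := 0) (fun z h' hk => ?_) (ae_of_all _ fun t => by simp)
  swap
  · obtain ⟨n1, n2⟩ := h.near z h' hk
    exact ⟨fun _ hc => absurd ⟨mem_univ _, by simpa using n2⟩ hc,
      fun _ hc => absurd ⟨mem_univ _, n1⟩ hc⟩
  have hcb : 2 * caccBound Λ S κ η (fun z => posAbove 0 (u z)) (L / (R ^ 2 / 8)) (L / (R / 16))
      ≤ 2 * (8 * L + 2 * Λ ^ 3 * 256 * L ^ 2 + Λ * 256 * L ^ 2 * I) / R ^ 2 * Y := by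
    unfold caccBound
    have c1 : (L / (R ^ 2 / 8) + 2 * Λ ^ 3 * (L / (R / 16)) ^ 2)
        * (∫ z in S, posAbove 0 (u z) ^ 2)
        ≤ (L / (R ^ 2 / 8) + 2 * Λ ^ 3 * (L / (R / 16)) ^ 2) * Y := by gcongr
    refine (mul_le_mul_of_nonneg_left (add_le_add c1 hcross) (by norm_num)).trans_eq ?_
    rw [← hI, ← hY]
    field_simp
    ring
  have hintg : Integrable fun z => posAbove 0 (u z) ^ 2 * η z ^ 2 :=
    i0.mul_bdd (c := 1) (hη.smooth.continuous.pow 2).aestronglyMeasurable (ae_of_all _ fun z => by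
      rw [Real.norm_of_nonneg (sq_nonneg _)]
      exact pow_le_one₀ (hη.nonneg z) (hη.le_one z))
  have hintg2 := i0.indicator (measurableSet_Ici.prod measurableSet_ball : MeasurableSet
    (Ici (t₂ - 3 / 4 * R ^ 2) ×ˢ ball x₀ (3 / 4 * R)))
  rw [Measure.volume_eq_prod] at hintg hintg2
  filter_upwards [caccioppoli_sup h.hd h.hs.1 h.hs.2 (by linarith) h.eq h.ell
    LocalisedEq.isOpen le_rfl hη h.late_grad h.late, hintg.prod_right_ae, hintg2.prod_right_ae]
    with t ht h1 h2
  refine (integral_mono h2 h1 fun x => ?_).trans (ht.trans hcb)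
  refine indicator_le' (f := fun z => posAbove 0 (u z) ^ 2)
    (g := fun z => posAbove 0 (u z) ^ 2 * η z ^ 2) (fun z hz => ?_) (fun z _ => by positivity) (t, x)
  rcases lt_or_ge z.1 t₂ with hz2 | hz2
  · have := hη6 z (by linarith [mem_Ici.1 hz.1]) hz2 (ball_subset_closedBall hz.2)
    simp only [this, one_pow, mul_one, le_refl]
  · simp [h.late_pos le_rfl hz2]

section SupBound

variable {d : ℕ} {s Λ : ℝ} {A : ℝ → Ed d → Ed d → Ed d} {K : ℝ → Ed d → Ed d → ℝ}
    {J : Set ℝ} {Ω : Set (Ed d)} {v : ℝ → Ed d → ℝ} {Dv : ℝ → Ed d → Ed d}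
    {t₁ t₂ : ℝ} {x₀ : Ed d} {R ρ : ℝ}

lemma volume_real_ball_eq (hR : 0 < R) (x₀ : Ed d) :
    volume.real (ball x₀ R) = volume.real (ball (0 : Ed d) 1) * R ^ d := by
  rw [Measure.real, Measure.addHaar_ball_of_pos _ _ hR, ENNReal.toReal_mul,
    ENNReal.toReal_ofReal (by positivity), finrank_euclideanSpace_fin, mul_comm, Measure.real]

lemma volume_real_unit_ball_pos : 0 < volume.real (ball (0 : Ed d) 1) :=
  ENNReal.toReal_pos (measure_ball_pos _ _ one_pos).ne' measure_ball_lt_top.ne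

lemma LocalSol.corr_anti (h : LocalSol d s Λ A K J Ω v Dv t₁ t₂ x₀ R) {ρ' : ℝ} (hρ : 0 < ρ)
    (hρ' : ρ ≤ ρ') {t : ℝ} (ht : t₁ ≤ t) :
    corr s Λ v t₁ t₂ x₀ ρ' t ≤ corr s Λ v t₁ t₂ x₀ ρ t := by
  refine mul_le_mul_of_nonneg_left ?_ (tailConst_pos h.hΛ).le
  refine intervalIntegral.integral_mono_ae ht
    (h.integrable_farTail (hρ.trans_le hρ')).intervalIntegrable
    (h.integrable_farTail hρ).intervalIntegrable ?_
  filter_upwards [ae_integrableOn_farTail (x₀ := x₀) h.hs.1 hρ h.reg] with τ hτ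
  by_cases hm : τ ∈ Ioo t₁ t₂
  · rw [indicator_of_mem hm, indicator_of_mem hm]
    exact setIntegral_mono_set (hτ (h.hJ (Ioo_subset_Icc_self hm)))
      (ae_of_all _ fun y => by positivity)
      (compl_subset_compl.2 (ball_subset_ball hρ')).eventuallyLE
  · rw [indicator_of_notMem hm, indicator_of_notMem hm]

lemma LocalSol.redU_le (h : LocalSol d s Λ A K J Ω v Dv t₁ t₂ x₀ R) {ρ' : ℝ} (hρ : 0 < ρ)
    (hρ' : ρ ≤ ρ') (z : ℝ × Ed d) :
    redU s Λ v t₁ t₂ x₀ R ρ z ≤ redU s Λ v t₁ t₂ x₀ R ρ' z := by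
  unfold redU
  by_cases hz : z ∈ Ioo t₁ t₂ ×ˢ closedBall x₀ (2 * R)
  · rw [indicator_of_mem hz, indicator_of_mem hz]
    have := h.corr_anti hρ hρ' hz.1.1.le
    exact mul_le_mul_of_nonneg_left (by linarith) (spCut_nonneg _)
  · rw [indicator_of_notMem hz, indicator_of_notMem hz]

lemma posAbove_mono {ℓ a b : ℝ} (h : a ≤ b) : posAbove ℓ a ≤ posAbove ℓ b :=
  max_le_max (by linarith) le_rfl

lemma LocalSol.posAbove_redU_le (h : LocalSol d s Λ A K J Ω v Dv t₁ t₂ x₀ R) {z : ℝ × Ed d}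
    (hz : z ∈ Ioo t₁ t₂ ×ˢ ball x₀ R) :
    posAbove 0 (redU s Λ v t₁ t₂ x₀ R ρ z) ^ 2 ≤ v z.1 z.2 ^ 2 := by
  have hR := h.hR
  have hz2 : z ∈ Ioo t₁ t₂ ×ˢ closedBall x₀ (2 * R) :=
    ⟨hz.1, closedBall_subset_closedBall (by linarith) (ball_subset_closedBall hz.2)⟩
  have hc := h.corr_nonneg (ρ := ρ) hz.1.1.le
  rw [← sq_abs (v z.1 z.2)]
  refine pow_le_pow_left₀ (posAbove_nonneg _ _) ?_ 2
  unfold redU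
  rw [indicator_of_mem hz2, spCut_one hR (ball_subset_closedBall hz.2), one_mul]
  exact max_le (by linarith [le_abs_self (v z.1 z.2)]) (abs_nonneg _)

lemma LocalSol.integrableOn_sq (h : LocalSol d s Λ A K J Ω v Dv t₁ t₂ x₀ R) :
    IntegrableOn (fun z : ℝ × Ed d => v z.1 z.2 ^ 2) (Ioo t₁ t₂ ×ˢ ball x₀ R) := by
  have hR := h.hR
  have h1 := h.memLp_v
  rw [memLp_indicator_iff_restrict measurableSet_box] at h1
  exact IntegrableOn.mono_set h1.integrable_sq (Set.prod_mono le_rfl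
    (ball_subset_closedBall.trans (closedBall_subset_closedBall (by linarith))))

lemma LocalSol.setIntegral_posAbove_redU_le (h : LocalSol d s Λ A K J Ω v Dv t₁ t₂ x₀ R)
    (hρ : 0 < ρ) (hρR : ρ ≤ R) {W : Set (ℝ × Ed d)} (hW : MeasurableSet W)
    (hWR : W ⊆ univ ×ˢ ball x₀ R) :
    ∫ z in W, posAbove 0 (redU s Λ v t₁ t₂ x₀ R ρ z) ^ 2
      ≤ ∫ z in Ioo t₁ t₂ ×ˢ ball x₀ R, v z.1 z.2 ^ 2 := by
  have hQ : MeasurableSet (Ioo t₁ t₂ ×ˢ ball x₀ R) := measurableSet_Ioo.prod measurableSet_ball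
  rw [← integral_indicator hW, ← integral_indicator hQ]
  refine integral_mono (((h.localisedEq hρ hρR).memLp_pos le_rfl).integrable_sq.indicator hW)
    (h.integrableOn_sq.integrable_indicator hQ) fun z => ?_
  by_cases hz : z ∈ W
  · rw [indicator_of_mem hz]
    by_cases hz2 : z ∈ Ioo t₁ t₂ ×ˢ ball x₀ R
    · rw [indicator_of_mem hz2]; exact h.posAbove_redU_le hz2
    · have : redU s Λ v t₁ t₂ x₀ R ρ z = 0 :=
        indicator_of_notMem (fun hc => hz2 ⟨hc.1, (hWR hz).2⟩) _
      rw [indicator_of_notMem hz2, this, posAbove_of_le le_rfl]; simp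
  · rw [indicator_of_notMem hz]
    exact indicator_nonneg (fun z _ => sq_nonneg _) z

/-- Local upper bound for the corrected solution. -/
lemma LocalSol.redU_le_of_energy (d : ℕ) (hd : 2 ≤ d) (s Λ : ℝ) (hΛ : 1 ≤ Λ) :
    ∃ C : ℝ, 0 < C ∧ ∀ (A : ℝ → Ed d → Ed d → Ed d) (K : ℝ → Ed d → Ed d → ℝ)
      (J : Set ℝ) (Ω : Set (Ed d)) (v : ℝ → Ed d → ℝ) (Dv : ℝ → Ed d → Ed d)
      (t₂ : ℝ) (x₀ : Ed d) (R : ℝ), LocalSol d s Λ A K J Ω v Dv (t₂ - R ^ 2) t₂ x₀ R → R ≤ 1 →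
      ∀ k : ℝ, 0 < k →
      C * (∫ z in Ioo (t₂ - R ^ 2) t₂ ×ˢ ball x₀ R, v z.1 z.2 ^ 2) ≤ R ^ (d + 2) * k ^ 2 →
      ∀ᵐ z : ℝ × Ed d, z ∈ Ici (t₂ - (R / 2) ^ 2) ×ˢ closedBall x₀ (R / 2) →
        redU s Λ v (t₂ - R ^ 2) t₂ x₀ R (3 / 4 * R) z ≤ k := by
  obtain ⟨C₁, hC₁, H₁⟩ := LocalisedEq.energy_sup d s Λ hΛ
  obtain ⟨C₂, hC₂, H₂⟩ := LocalisedEq.ae_le_of_small d hd s Λ hΛ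
  set ω := volume.real (ball (0 : Ed d) 1) with hω
  have hω0 : 0 < ω := volume_real_unit_ball_pos
  refine ⟨ω * C₁ + C₂, by positivity, ?_⟩
  intro A K J Ω v Dv t₂ x₀ R h hR1 k hk hE
  have hR := h.hR
  have hρ : 0 < 3 / 4 * R := by positivity
  set E := ∫ z in Ioo (t₂ - R ^ 2) t₂ ×ˢ ball x₀ R, v z.1 z.2 ^ 2 with hEd
  have hE0 : 0 ≤ E := integral_nonneg fun z => sq_nonneg _
  have hR2 : 0 < R ^ 2 := by positivity
  have L₁ := h.localisedEq hR le_rfl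
  have L₂ := h.localisedEq hρ (by linarith)
  set u₁ := redU s Λ v (t₂ - R ^ 2) t₂ x₀ R R with hu₁
  set u₂ := redU s Λ v (t₂ - R ^ 2) t₂ x₀ R (3 / 4 * R) with hu₂
  have he₁ : ∫ z in univ ×ˢ ball x₀ R, posAbove 0 (u₁ z) ^ 2 ≤ E :=
    h.setIntegral_posAbove_redU_le hR le_rfl (MeasurableSet.univ.prod measurableSet_ball) le_rfl
  refine H₂ x₀ (t₂ - R ^ 2) t₂ (3 / 4 * R) R u₂ _ _ _ _ L₂ hR hR1 (by linarith)
    (by nlinarith) (k * R ^ d) k (by positivity) hk ?_ le_rfl ?_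
  · have B : MeasurableSet (Ici (t₂ - 3 / 4 * R ^ 2) ×ˢ ball x₀ (3 / 4 * R)) :=
      measurableSet_Ici.prod measurableSet_ball
    have i1 := ((L₂.integrable_pos le_rfl).indicator (measurableSet_Ici.prod measurableSet_ball :
      MeasurableSet (Ici (t₂ - (5 / 8 * R) ^ 2) ×ˢ ball x₀ (3 / 4 * R))))
    have i2 := (L₁.memLp_pos le_rfl).integrable_sq.indicator B
    rw [Measure.volume_eq_prod] at i1 i2
    filter_upwards [H₁ x₀ t₂ R u₁ _ _ _ _ L₁ hR1, i1.prod_right_ae, i2.prod_right_ae]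
      with t ht j1 j2
    have j3 : Integrable ((ball x₀ (3 / 4 * R)).indicator fun _ : Ed d => k / ω) :=
      (integrable_indicator_iff measurableSet_ball).2
        (integrableOn_const measure_ball_lt_top.ne)
    have hpt : ∀ x, (Ici (t₂ - (5 / 8 * R) ^ 2) ×ˢ ball x₀ (3 / 4 * R)).indicator
        (fun z => posAbove 0 (u₂ z)) (t, x)
        ≤ 1 / 2 * (ball x₀ (3 / 4 * R)).indicator (fun _ => k / ω) x
          + 1 / 2 * (ω / k) * (Ici (t₂ - 3 / 4 * R ^ 2) ×ˢ ball x₀ (3 / 4 * R)).indicator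
            (fun z => posAbove 0 (u₁ z) ^ 2) (t, x) := fun x => by
      by_cases hx : (t, x) ∈ Ici (t₂ - (5 / 8 * R) ^ 2) ×ˢ ball x₀ (3 / 4 * R)
      · have hx1 : (t, x) ∈ Ici (t₂ - 3 / 4 * R ^ 2) ×ˢ ball x₀ (3 / 4 * R) :=
          ⟨le_trans (by ring_nf; linarith : t₂ - 3 / 4 * R ^ 2 ≤ t₂ - (5 / 8 * R) ^ 2) hx.1, hx.2⟩
        rw [indicator_of_mem hx, indicator_of_mem hx1, indicator_of_mem (show x ∈ _ from hx.2)]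
        refine (posAbove_mono (h.redU_le (ρ' := R) hρ (by linarith) (t, x))).trans ?_
        rw [← hu₁]
        set p := posAbove 0 (u₁ (t, x))
        have : 0 ≤ (ω / k) * (p - k / ω) ^ 2 := by positivity
        have e : (ω / k) * (p - k / ω) ^ 2 = (ω / k) * p ^ 2 - 2 * p + k / ω := by
          field_simp
          ring
        linarith
      · rw [indicator_of_notMem hx]
        have a1 : 0 ≤ (ball x₀ (3 / 4 * R)).indicator (fun _ => k / ω) x :=
          indicator_nonneg (fun _ _ => by positivity) _
        have a2 : 0 ≤ (Ici (t₂ - 3 / 4 * R ^ 2) ×ˢ ball x₀ (3 / 4 * R)).indicator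
            (fun z => posAbove 0 (u₁ z) ^ 2) (t, x) :=
          indicator_nonneg (fun _ _ => by positivity) _
        positivity
    refine (integral_mono j1 ((j3.const_mul _).add (j2.const_mul _)) hpt).trans ?_
    rw [integral_add' (j3.const_mul _) (j2.const_mul _), integral_const_mul, integral_const_mul,
      integral_indicator measurableSet_ball, setIntegral_const, volume_real_ball_eq hρ, smul_eq_mul]
    have b1 : ω * (3 / 4 * R) ^ d * (k / ω) ≤ k * R ^ d := by
      rw [mul_pow]
      have : ((3 : ℝ) / 4) ^ d ≤ 1 := pow_le_one₀ (by norm_num) (by norm_num)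
      calc _ = (3 / 4) ^ d * (k * R ^ d) := by field_simp
        _ ≤ 1 * (k * R ^ d) := by gcongr
        _ = _ := one_mul _
    have b2 : ω / k * (C₁ / R ^ 2 * E) ≤ k * R ^ d := by
      have : ω * C₁ * E ≤ R ^ (d + 2) * k ^ 2 := by
        have := mul_nonneg hC₂.le hE0
        linarith
      calc _ = ω * C₁ * E / (k * R ^ 2) := by field_simp
        _ ≤ R ^ (d + 2) * k ^ 2 / (k * R ^ 2) := by gcongr
        _ = _ := by field_simp; ring
    have b3 : ω / k * (∫ x, (Ici (t₂ - 3 / 4 * R ^ 2) ×ˢ ball x₀ (3 / 4 * R)).indicator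
        (fun z => posAbove 0 (u₁ z) ^ 2) (t, x)) ≤ k * R ^ d := by
      refine (mul_le_mul_of_nonneg_left (ht.trans ?_) (by positivity)).trans b2
      exact mul_le_mul_of_nonneg_left he₁ (by positivity)
    linarith
  · have he₂ : ∫ z in Ici (t₂ - (5 / 8 * R) ^ 2) ×ˢ closedBall x₀ (5 / 8 * R),
        posAbove 0 (u₂ z) ^ 2 ≤ E :=
      h.setIntegral_posAbove_redU_le hρ (by linarith)
        (measurableSet_Ici.prod measurableSet_closedBall)
        (Set.prod_mono (subset_univ _) (closedBall_subset_ball (by linarith)))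
    have := mul_nonneg (mul_nonneg hω0.le hC₁.le) hE0
    have := mul_le_mul_of_nonneg_left he₂ hC₂.le
    linarith

end SupBound

lemma setIntegral_abs_le_sqrt_average {α : Type*} [MeasurableSpace α] {μ : Measure α} {S : Set α}
    {f : α → ℝ} (h0 : 0 < μ.real S) (hf : IntegrableOn f S μ)
    (hf2 : IntegrableOn (fun x => f x ^ 2) S μ) :
    ∫ x in S, |f x| ∂μ ≤ μ.real S * √(⨍ x in S, |f x| ^ 2 ∂μ) := by
  set V := μ.real S with hV
  set I := ∫ x in S, |f x| ∂μ with hI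
  have hV' : μ S ≠ ⊤ := fun hc => by simp [hV, Measure.real, hc] at h0
  have : IsFiniteMeasure (μ.restrict S) :=
    ⟨by rw [Measure.restrict_apply_univ]; exact hV'.lt_top⟩
  rw [setAverage_eq, smul_eq_mul, ← hV]
  simp only [sq_abs]
  set E := ∫ x in S, f x ^ 2 ∂μ with hE
  have key : 0 ≤ ∫ x in S, (f x ^ 2 - 2 * (I / V) * |f x|) + (I / V) ^ 2 ∂μ := by
    refine integral_nonneg fun x => ?_
    simp only [Pi.zero_apply]
    nlinarith [sq_nonneg (|f x| - I / V), sq_abs (f x)]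
  have i1 : Integrable (fun x => f x ^ 2 - 2 * (I / V) * |f x|) (μ.restrict S) :=
    hf2.sub (hf.abs.const_mul _)
  rw [integral_add i1 (integrable_const _),
    integral_sub hf2 (hf.abs.const_mul _), integral_const_mul, setIntegral_const, ← hV, ← hE, ← hI,
    smul_eq_mul] at key
  have h1 : (I / V) ^ 2 ≤ V⁻¹ * E := by
    rw [inv_mul_eq_div, le_div_iff₀ h0]
    have : I / V * I = V * (I / V) ^ 2 := by field_simp
    linarith
  have h2 : I / V ≤ √(V⁻¹ * E) := Real.le_sqrt_of_sq_le h1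
  rwa [div_le_iff₀' h0] at h2

section Final

variable {d : ℕ} {s Λ : ℝ} {A : ℝ → Ed d → Ed d → Ed d} {K : ℝ → Ed d → Ed d → ℝ}
    {J : Set ℝ} {Ω : Set (Ed d)} {v : ℝ → Ed d → ℝ} {Dv : ℝ → Ed d → Ed d}
    {t₁ t₂ : ℝ} {x₀ : Ed d} {R ρ : ℝ}

lemma volume_real_pCyl (hR : 0 < R) (t₀ : ℝ) (x₀ : Ed d) :
    volume.real (pCyl t₀ x₀ R) = volume.real (ball (0 : Ed d) 1) * R ^ (d + 2) := by
  rw [pCyl, Iminus, Measure.volume_eq_prod, measureReal_prod_prod, volume_real_ball_eq hR,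
    Real.volume_real_Ioo_of_le (by nlinarith [sq_nonneg R])]
  ring

lemma LocalSol.integrableOn (h : LocalSol d s Λ A K J Ω v Dv t₁ t₂ x₀ R) :
    IntegrableOn (fun z : ℝ × Ed d => v z.1 z.2) (Ioo t₁ t₂ ×ˢ ball x₀ R) := by
  have hR := h.hR
  have h1 := h.memLp_v
  rw [memLp_indicator_iff_restrict measurableSet_box] at h1
  have : IsFiniteMeasure ((volume : Measure (ℝ × Ed d)).restrict
      (Ioo t₁ t₂ ×ˢ closedBall x₀ (2 * R))) :=
    ⟨by rw [Measure.restrict_apply_univ]; exact volume_box_lt_top⟩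
  exact IntegrableOn.mono_set (h1.integrable (by norm_num)) (Set.prod_mono le_rfl
    (ball_subset_closedBall.trans (closedBall_subset_closedBall (by linarith))))

lemma farTail_le_add (hs : s ∈ Ioo (0 : ℝ) 1) (hρ : 0 < ρ) (hρ1 : ρ ≤ 1) (hρR : ρ ≤ R) {t : ℝ}
    (ht : IntegrableOn (fun y => |v t y| / ‖x₀ - y‖ ^ ((d : ℝ) + 2 * s)) (ball x₀ ρ)ᶜ)
    (hv : IntegrableOn (fun y => |v t y|) (ball x₀ R)) :
    farTail s v x₀ ρ t ≤ farTail s v x₀ R t + 1 / ρ ^ (d + 2) * ∫ y in ball x₀ R, |v t y| := by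
  have hsub : (ball x₀ R)ᶜ ⊆ (ball x₀ ρ)ᶜ := compl_subset_compl.2 (ball_subset_ball hρR)
  have hun : (ball x₀ ρ)ᶜ = (ball x₀ R)ᶜ ∪ ball x₀ R \ ball x₀ ρ := by
    ext y
    have := @ball_subset_ball _ _ x₀ _ _ hρR y
    simp only [mem_union, mem_compl_iff, Set.mem_sdiff]
    tauto
  have hd2 : ball x₀ R \ ball x₀ ρ ⊆ (ball x₀ ρ)ᶜ := fun y hy => hy.2
  have hm : MeasurableSet (ball x₀ R \ ball x₀ ρ) := measurableSet_ball.diff measurableSet_ball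
  have hdj : Disjoint (ball x₀ R)ᶜ (ball x₀ R \ ball x₀ ρ) :=
    Set.disjoint_left.2 fun y hy hy2 => hy hy2.1
  unfold farTail
  rw [hun, setIntegral_union hdj hm
    (ht.mono_set hsub) (ht.mono_set hd2)]
  refine add_le_add_right ?_ _
  rw [← integral_const_mul]
  refine (setIntegral_mono_on (ht.mono_set hd2)
    (IntegrableOn.mono_set (hv.const_mul _) Set.sdiff_subset) hm
    fun y hy => ?_).trans (setIntegral_mono_set (hv.const_mul _)
      (ae_of_all _ fun y => by positivity)
      (Set.sdiff_subset (s := ball x₀ R) (t := ball x₀ ρ)).eventuallyLE)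
  have hr : ρ ≤ ‖x₀ - y‖ := by
    have := hy.2
    rwa [mem_ball, not_lt, dist_comm, dist_eq_norm] at this
  have h1 : ρ ^ (d + 2) ≤ ‖x₀ - y‖ ^ ((d : ℝ) + 2 * s) := by
    calc ρ ^ (d + 2) = ρ ^ ((d : ℝ) + 2) := by rw [← Real.rpow_natCast]; push_cast; rfl
      _ ≤ ρ ^ ((d : ℝ) + 2 * s) :=
          Real.rpow_le_rpow_of_exponent_ge hρ hρ1 (by linarith [hs.2])
      _ ≤ _ := Real.rpow_le_rpow hρ.le hr (by have := hs.1; positivity)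
  rw [one_div, inv_mul_eq_div]
  exact div_le_div_of_nonneg_left (abs_nonneg _) (by positivity) h1

lemma LocalSol.setIntegral_farTail_le (h : LocalSol d s Λ A K J Ω v Dv (t₂ - R ^ 2) t₂ x₀ R)
    (hR1 : R ≤ 1) :
    ∫ τ in Ioo (t₂ - R ^ 2) t₂, farTail s v x₀ (3 / 4 * R) τ
      ≤ (⨍ t in Iminus t₂ R, Tail s (v t) x₀ R)
        + volume.real (ball (0 : Ed d) 1) * (4 / 3) ^ (d + 2)
          * √(⨍ z in pCyl t₂ x₀ R, |v z.1 z.2| ^ 2) := by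
  have hR := h.hR
  have hρ : 0 < 3 / 4 * R := by positivity
  have hi := h.integrableOn
  have hi' : IntegrableOn (fun z : ℝ × Ed d => |v z.1 z.2|)
      (Ioo (t₂ - R ^ 2) t₂ ×ˢ ball x₀ R) (volume.prod volume) := hi.abs
  have hi2 := hi'
  rw [IntegrableOn, ← Measure.prod_restrict] at hi2
  have j0 := h.integrable_farTail hρ
  have j1 := h.integrable_farTail hR
  rw [integrable_indicator_iff measurableSet_Ioo] at j0 j1
  have j2 := hi2.integral_prod_left
  have h1 : ∫ τ in Ioo (t₂ - R ^ 2) t₂, farTail s v x₀ (3 / 4 * R) τ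
      ≤ ∫ τ in Ioo (t₂ - R ^ 2) t₂, (farTail s v x₀ R τ
        + 1 / (3 / 4 * R) ^ (d + 2) * ∫ y in ball x₀ R, |v τ y|) := by
    refine integral_mono_ae j0 (j1.add (j2.const_mul _)) ?_
    filter_upwards [ae_restrict_of_ae (ae_integrableOn_farTail (x₀ := x₀) h.hs.1 hρ h.reg),
      hi2.prod_right_ae, ae_restrict_mem measurableSet_Ioo] with τ a1 a2 a3
    exact farTail_le_add h.hs hρ (by linarith) (by linarith)
      (a1 (h.hJ (Ioo_subset_Icc_self a3))) a2
  refine h1.trans ?_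
  rw [integral_add j1 (j2.const_mul _), integral_const_mul]
  refine add_le_add (le_of_eq ?_) ?_
  · rw [setAverage_eq]
    simp only [Tail]
    rw [integral_const_mul, Iminus, Real.volume_real_Ioo_of_le (by nlinarith [sq_nonneg R]),
      smul_eq_mul, sub_sub_cancel, inv_mul_cancel_left₀ (by positivity)]
    rfl
  · have h2 := setIntegral_prod _ hi'
    rw [← Measure.volume_eq_prod] at h2
    rw [← h2]
    have h3 : volume.real (pCyl t₂ x₀ R) = _ := volume_real_pCyl hR t₂ x₀
    have h4 := setIntegral_abs_le_sqrt_average (S := pCyl t₂ x₀ R) (μ := volume)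
      (by rw [h3]; have := volume_real_unit_ball_pos (d := d); positivity) hi h.integrableOn_sq
    refine (mul_le_mul_of_nonneg_left h4 (by positivity)).trans_eq ?_
    rw [h3, mul_pow, div_pow, div_pow]
    field_simp

lemma LocalSol.ae_le (d : ℕ) (hd : 2 ≤ d) (s Λ : ℝ) (hΛ : 1 ≤ Λ) :
    ∃ C : ℝ, 0 < C ∧ ∀ (A : ℝ → Ed d → Ed d → Ed d) (K : ℝ → Ed d → Ed d → ℝ)
      (J : Set ℝ) (Ω : Set (Ed d)) (v : ℝ → Ed d → ℝ) (Dv : ℝ → Ed d → Ed d)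
      (t₂ : ℝ) (x₀ : Ed d) (R : ℝ), LocalSol d s Λ A K J Ω v Dv (t₂ - R ^ 2) t₂ x₀ R → R ≤ 1 →
      ∀ᵐ z : ℝ × Ed d, z ∈ pCyl t₂ x₀ (R / 2) →
        v z.1 z.2 ≤ C * √(⨍ z in pCyl t₂ x₀ R, |v z.1 z.2| ^ 2)
          + C * ⨍ t in Iminus t₂ R, Tail s (v t) x₀ R := by
  obtain ⟨C₀, hC₀, H⟩ := LocalSol.redU_le_of_energy d hd s Λ hΛ
  set ω := volume.real (ball (0 : Ed d) 1) with hω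
  have hω0 : 0 < ω := volume_real_unit_ball_pos
  have hT := tailConst_pos (d := d) hΛ
  set D := tailConst d Λ with hD
  refine ⟨√(C₀ * ω) + D * (1 + ω * (4 / 3) ^ (d + 2)), by positivity, ?_⟩
  intro A K J Ω v Dv t₂ x₀ R h hR1
  have hR := h.hR
  set m := ⨍ z in pCyl t₂ x₀ R, |v z.1 z.2| ^ 2 with hm
  have hmE : ∫ z in Ioo (t₂ - R ^ 2) t₂ ×ˢ ball x₀ R, v z.1 z.2 ^ 2 = ω * R ^ (d + 2) * m := by
    rw [hm, setAverage_eq, volume_real_pCyl hR, smul_eq_mul, mul_inv_cancel_left₀ (by positivity)]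
    simp only [sq_abs]
    rfl
  have hm0 : 0 ≤ m := by
    rw [hm, setAverage_eq]
    exact smul_nonneg (by positivity) (integral_nonneg fun z => by positivity)
  set k := √(C₀ * ω * m) with hk
  have hk0 : 0 ≤ k := Real.sqrt_nonneg _
  have hbd : ∀ n : ℕ, ∀ᵐ z : ℝ × Ed d, z ∈ Ici (t₂ - (R / 2) ^ 2) ×ˢ closedBall x₀ (R / 2) →
      redU s Λ v (t₂ - R ^ 2) t₂ x₀ R (3 / 4 * R) z ≤ k + 1 / ((n : ℝ) + 1) := fun n => by
    have hn : 0 < 1 / ((n : ℝ) + 1) := by positivity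
    refine H A K J Ω v Dv t₂ x₀ R h hR1 _ (by positivity) ?_
    rw [hmE]
    calc C₀ * (ω * R ^ (d + 2) * m) = R ^ (d + 2) * k ^ 2 := by
          rw [hk, Real.sq_sqrt (by positivity)]; ring
      _ ≤ _ := by gcongr; linarith
  filter_upwards [ae_all_iff.2 hbd] with z hz hzQ
  have hz1 : z ∈ Ici (t₂ - (R / 2) ^ 2) ×ˢ closedBall x₀ (R / 2) :=
    ⟨hzQ.1.1.le, ball_subset_closedBall hzQ.2⟩
  have h1 : redU s Λ v (t₂ - R ^ 2) t₂ x₀ R (3 / 4 * R) z ≤ k := by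
    refine le_of_forall_pos_le_add fun ε hε => ?_
    obtain ⟨n, hn⟩ := exists_nat_one_div_lt hε
    exact (hz n hz1).trans (by linarith)
  have hzt : z.1 ∈ Ioo (t₂ - R ^ 2) t₂ := ⟨lt_of_le_of_lt (by nlinarith) hzQ.1.1, hzQ.1.2⟩
  have hzb : z ∈ Ioo (t₂ - R ^ 2) t₂ ×ˢ closedBall x₀ (2 * R) :=
    ⟨hzt, closedBall_subset_closedBall (by linarith) hz1.2⟩
  unfold redU at h1
  rw [indicator_of_mem hzb, spCut_one hR (closedBall_subset_closedBall (by linarith) hz1.2),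
    one_mul] at h1
  have h2 := h.corr_le (ρ := 3 / 4 * R) (by positivity) hzt.1.le
  have h3 := mul_le_mul_of_nonneg_left (h.setIntegral_farTail_le hR1) hT.le
  rw [← hm, ← hω] at h3
  set T := ⨍ t in Iminus t₂ R, Tail s (v t) x₀ R with hTd
  have hT0 : 0 ≤ T := by
    rw [hTd, setAverage_eq]
    refine smul_nonneg (by positivity) (integral_nonneg fun t => ?_)
    exact mul_nonneg (by positivity) (farTail_nonneg (v := v) t)
  have h4 : k = √(C₀ * ω) * √m := by rw [hk, Real.sqrt_mul (by positivity)]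
  have h5 : 0 ≤ D * √m := by positivity
  have h6 : 0 ≤ (√(C₀ * ω) + D * (ω * (4 / 3) ^ (d + 2))) * T := by positivity
  calc v z.1 z.2 ≤ k + D * (T + ω * (4 / 3) ^ (d + 2) * √m) := by linarith
    _ ≤ _ := by rw [h4]; linarith

lemma LocalSol.neg (h : LocalSol d s Λ A K J Ω v Dv t₁ t₂ x₀ R) :
    LocalSol d s Λ (fun t x ξ => -A t x (-ξ)) K J Ω (fun t x => -v t x) (fun t x => -Dv t x)
      t₁ t₂ x₀ R where
  hd := h.hd
  hs := h.hs
  hΛ := h.hΛ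
  hA := by
    refine ⟨fun ξ => (h.hA.meas (-ξ)).neg, fun t x => ((h.hA.cont t x).comp continuous_neg).neg,
      fun t x ξ => ?_, fun t x ξ η => ?_⟩
    · simpa using h.hA.growth t x (-ξ)
    · have := h.hA.monotone t x (-η) (-ξ)
      rw [show -ξ - -η = η - ξ by abel] at this
      rwa [show -A t x (-η) - -A t x (-ξ) = A t x (-ξ) - A t x (-η) by abel]
  hK := h.hK
  reg := by
    have r := h.reg
    refine ⟨r.meas.neg, r.measD.neg, fun t ht φ h1 h2 h3 e => ?_, ?_, ?_, ?_, ?_⟩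
    · have := r.grad t ht φ h1 h2 h3 e
      simp only [neg_mul, inner_neg_left, mul_neg, integral_neg, this]
    · simpa only [neg_sq, norm_neg] using r.l2w12
    · simpa only [neg_sq] using r.linfl2
    · simpa only [abs_neg] using r.tail_ae
    · simpa only [abs_neg] using r.tail_l2
  sol := by
    intro a b hab hJ φ hφ
    have := h.sol a b hab hJ φ hφ
    unfold mixedLHS at this ⊢
    have e : ∀ t x y, (-v t x - -v t y) * (φ t x - φ t y) * K t x y
        = -((v t x - v t y) * (φ t x - φ t y) * K t x y) := fun t x y => by ring
    simp only [neg_mul, neg_neg, inner_neg_left, integral_neg, e]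
    linarith
  lt := h.lt
  hJ := h.hJ
  hR := h.hR
  hΩ := h.hΩ

end Final

/-- **Claim (3.8) in the proof of Lemma 3.2: interpolated `L²`-sup bound with `L¹` tail.** -/
theorem interpolated_sup_bound_with_L1_tail
    (d : ℕ) (hd : 2 ≤ d) (s Λ : ℝ) (hs : s ∈ Set.Ioo (0 : ℝ) 1) (hΛ : 1 ≤ Λ) :
    ∃ C : ℝ, 0 < C ∧
      ∀ (T : ℝ), 0 < T → ∀ (Ω : Set (Ed d)), IsOpen Ω → Bornology.IsBounded Ω →
      ∀ (A : ℝ → Ed d → Ed d → Ed d), VectorFieldHyp d Λ A →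
      ∀ (K : ℝ → Ed d → Ed d → ℝ), KernelHyp d s Λ K →
      ∀ (v : ℝ → Ed d → ℝ) (Dv : ℝ → Ed d → Ed d),
        LocalWeakReg d s (Set.Ioo 0 T) Ω v Dv →
        IsLocalWeakSolutionHom A K (Set.Ioo 0 T) Ω v Dv →
        ∀ R ∈ Set.Ioc (0 : ℝ) 1, ∀ (t₀ : ℝ) (x₀ : Ed d),
          closure ((Iminus t₀ (2 * R)) ×ˢ Metric.ball x₀ (2 * R)) ⊆ (Set.Ioo 0 T) ×ˢ Ω →
          ∀ δ ∈ Set.Ioc (0 : ℝ) 1,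
            ∀ᵐ p ∂(volume : Measure (ℝ × Ed d)),
              p ∈ pCyl t₀ x₀ (R / 2) →
              |v p.1 p.2| ≤
                C * δ ^ (-(((d : ℝ) + 2) / 4)) *
                    Real.sqrt (⨍ z in pCyl t₀ x₀ R, |v z.1 z.2| ^ 2)
                  + C * ⨍ t in Iminus t₀ R, Tail s (v t) x₀ R := by
  obtain ⟨C, hC, H⟩ := LocalSol.ae_le d hd s Λ hΛ
  refine ⟨C, hC, ?_⟩
  intro T _ Ω _ _ A hA K hK v Dv hreg hsol R hR t₀ x₀ hcl δ hδ
  have hR0 := hR.1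
  rw [closure_prod_eq, Iminus, closure_Ioo (by nlinarith), closure_ball _ (by positivity)] at hcl
  have hx : x₀ ∈ closedBall x₀ (2 * R) := mem_closedBall_self (by positivity)
  have ht : t₀ ∈ Icc (t₀ - (2 * R) ^ 2) t₀ := ⟨by nlinarith, le_rfl⟩
  have h : LocalSol d s Λ A K (Set.Ioo 0 T) Ω v Dv (t₀ - R ^ 2) t₀ x₀ R :=
    ⟨hd, hs, hΛ, hA, hK, hreg, hsol, by nlinarith,
      fun t h1 => (hcl (mk_mem_prod (Icc_subset_Icc_left (by nlinarith) h1) hx)).1, hR0,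
      fun x h1 => (hcl (mk_mem_prod ht h1)).2⟩
  have hδ1 : 1 ≤ δ ^ (-(((d : ℝ) + 2) / 4)) :=
    Real.one_le_rpow_of_pos_of_le_one_of_nonpos hδ.1 hδ.2 (by
      have : (0 : ℝ) ≤ d := d.cast_nonneg
      linarith)
  have hneg := H _ _ _ _ _ _ t₀ x₀ R h.neg hR.2
  simp only [Tail, abs_neg] at hneg
  filter_upwards [H _ _ _ _ _ _ t₀ x₀ R h hR.2, hneg] with z h1 h2 hz
  have h3 : C * √(⨍ z in pCyl t₀ x₀ R, |v z.1 z.2| ^ 2)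
      ≤ C * δ ^ (-(((d : ℝ) + 2) / 4)) * √(⨍ z in pCyl t₀ x₀ R, |v z.1 z.2| ^ 2) := by
    refine mul_le_mul_of_nonneg_right ?_ (Real.sqrt_nonneg _)
    exact le_mul_of_one_le_right hC.le hδ1
  refine (abs_le'.2 ⟨h1 hz, h2 hz⟩).trans ?_
  exact add_le_add_left h3 _
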